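/- Let S ⊆ Γ = SL₂(ℤ)×SL₂(ℤ)×SL₂(ℤ) be a finite symmetric set generating a group Zariski-dense in SL₂×SL₂×SL₂, and let ε > 0. There exist a constant c > 0 depending only on S and ε, and for each δ > 0 constants ρ = ρ(δ) > 0 and C = C(δ) ∈ ℤ₊ with ρ(δ) → 0 as δ → 0, such that the following holds for all sufficiently large q. Write q = ∏ p^{n_p}, let L > 18/δ, q_s = ∏_{n_p ≤ L} p^{n_p}, q_l = q/q_s, and assume q_l > q^{ε/2}. Suppose A ⊆ Γ is symmetric and there is an integer l > δ^{−1} log q with χ_S^{(l)}(A) > q^{−δ}, |π_q(A)| < |Γ_q|^{1−ε}, and |π_q(A·A·A)| ≤ |π_q(A)|^{1+δ}. Set q₀ = ∏_{p | q_l} p and A₀ = (A·A) ∩ Γ(q₀), where Γ(q₀) is the kernel of π_{q₀}: Γ → Γ_{q₀}. Then there exists an exact divisor q′ ∥ q_l with q′ ≥ q_l^c such that for each i ∈ {1,2,3}, the C-fold product set of π_{q′}(ℙᵢ(A₀)) contains the kernel of the reduction map SL₂(ℤ/q′ℤ) → SL₂(ℤ/(q′)^{{ρ}}ℤ), where ℙᵢ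 is the projection of Γ onto its i-th SL₂(ℤ) factor. -/

import Mathlib

open Matrix Pointwise

abbrev SL2Z := Matrix.SpecialLinearGroup (Fin 2) ℤ
abbrev SL2C := Matrix.SpecialLinearGroup (Fin 2) ℂ
abbrev GammaSL : Type := SL2Z × SL2Z × SL2Z
abbrev GammaC : Type := SL2C × SL2C × SL2C

def entryZ (g : GammaSL) : Fin 3 × Fin 2 × Fin 2 → ℤ :=
  fun x => ![(g.1 : Matrix (Fin 2) (Fin 2) ℤ), (g.2.1 : Matrix (Fin 2) (Fin 2) ℤ),
    (g.2.2 : Matrix (Fin 2) (Fin 2) ℤ)] x.1 x.2.1 x.2.2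

noncomputable def entryC (g : GammaC) : Fin 3 × Fin 2 × Fin 2 → ℂ :=
  fun x => ![(g.1 : Matrix (Fin 2) (Fin 2) ℂ), (g.2.1 : Matrix (Fin 2) (Fin 2) ℂ),
    (g.2.2 : Matrix (Fin 2) (Fin 2) ℂ)] x.1 x.2.1 x.2.2

/-- Zariski density of a subgroup of `SL₂(ℤ)³` in `SL₂ × SL₂ × SL₂`. -/
def ZariskiDense (G : Subgroup GammaSL) : Prop :=
  ∀ P : MvPolynomial (Fin 3 × Fin 2 × Fin 2) ℚ,
    (∀ g ∈ G, (MvPolynomial.aeval (fun x => (entryZ g x : ℂ))) P = 0) →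
    ∀ h : GammaC, (MvPolynomial.aeval (entryC h)) P = 0

/-- Entrywise reduction mod `q` on `SL₂(ℤ)`. -/
def redSL (q : ℕ) : SL2Z →* Matrix.SpecialLinearGroup (Fin 2) (ZMod q) :=
  Matrix.SpecialLinearGroup.map (Int.castRingHom (ZMod q))

abbrev GammaMod (q : ℕ) : Type :=
  Matrix.SpecialLinearGroup (Fin 2) (ZMod q) × Matrix.SpecialLinearGroup (Fin 2) (ZMod q) ×
    Matrix.SpecialLinearGroup (Fin 2) (ZMod q)

/-- Entrywise reduction mod `q` on `Γ = SL₂(ℤ)³`. -/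
def piq (q : ℕ) : GammaSL →* GammaMod q :=
  (redSL q).prodMap ((redSL q).prodMap (redSL q))

/-- convolution on Γ -/
noncomputable def convG (f g : GammaSL → ℝ) : GammaSL → ℝ := fun x => ∑ᶠ y, f y * g (x * y⁻¹)

/-- normalized counting measure on S -/
noncomputable def chiS (S : Set GammaSL) : GammaSL → ℝ := S.indicator fun _ => (S.ncard : ℝ)⁻¹

/-- l-fold convolution of χ_S with itself -/
noncomputable def chiIter (S : Set GammaSL) : ℕ → GammaSL → ℝ
  | 0 => fun x => open Classical in if x = 1 then 1 else 0
  | n + 1 => convG (chiS S) (chiIter S n)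

/-- `q' ∥ q`: `q'` is an exact divisor of `q`. -/
def ExactDivisor (q' q : ℕ) : Prop :=
  ∀ p n : ℕ, p.Prime → 1 ≤ n → p ^ n ∣ q' → ¬ p ^ (n + 1) ∣ q' →
    (p ^ n ∣ q ∧ ¬ p ^ (n + 1) ∣ q)

/-- For `q = ∏ pᵢ^{nᵢ}` and `α > 0`, `q^{{α}} = ∏ pᵢ^{⌊nᵢα⌋}`. -/
noncomputable def floorPow (q : ℕ) (α : ℝ) : ℕ :=
  ∏ p ∈ q.primeFactors, p ^ (⌊(q.factorization p : ℝ) * α⌋₊)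

/-- `q_s`: the product of the exact prime power divisors of `q` with exponent at most `L`. -/
def smallPart (q L : ℕ) : ℕ :=
  ∏ p ∈ q.primeFactors, if q.factorization p ≤ L then p ^ q.factorization p else 1

/-- The radical `∏_{p ∣ q} p` of `q`. -/
def radical (q : ℕ) : ℕ := ∏ p ∈ q.primeFactors, p

/-- The subset of `SL₂(ℤ/q'ℤ)` of matrices congruent to the identity mod `(q')^{{ρ}}`,
i.e. the kernel of the reduction map `SL₂(ℤ/q'ℤ) → SL₂(ℤ/(q')^{{ρ}}ℤ)`. -/
noncomputable def kerFloorPow (q' : ℕ) (ρ : ℝ) :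
    Set (Matrix.SpecialLinearGroup (Fin 2) (ZMod q')) :=
  {g | ∀ i j, ((floorPow q' ρ : ℕ) : ZMod q') ∣
    ((g : Matrix (Fin 2) (Fin 2) (ZMod q')) i j - (1 : Matrix (Fin 2) (Fin 2) (ZMod q')) i j)}

/-- Ring elements built from `W` by at most `k` rounds of additions, subtractions, products. -/
def ringGen {R : Type*} [Ring R] (W : Set R) : ℕ → Set R
  | 0 => W
  | k + 1 => {x | ∃ y ∈ ringGen W k, ∃ z ∈ ringGen W k, x = y ∨ x = y + z ∨ x = y - z ∨ x = y * z}

namespace ringGen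
variable {R : Type*} [Ring R] {W : Set R}

lemma subset_succ (k : ℕ) : ringGen W k ⊆ ringGen W (k + 1) :=
  fun x hx => ⟨x, hx, x, hx, Or.inl rfl⟩

lemma mono {k l : ℕ} (h : k ≤ l) : ringGen W k ⊆ ringGen W l :=
  monotone_nat_of_le_succ (fun k => subset_succ (W := W) k) h

lemma base_mem {x : R} (hx : x ∈ W) (k : ℕ) : x ∈ ringGen W k := mono (Nat.zero_le k) hx

lemma add_mem {k : ℕ} {x y : R} (hx : x ∈ ringGen W k) (hy : y ∈ ringGen W k) :
    x + y ∈ ringGen W (k + 1) := ⟨x, hx, y, hy, by simp⟩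

lemma sub_mem {k : ℕ} {x y : R} (hx : x ∈ ringGen W k) (hy : y ∈ ringGen W k) :
    x - y ∈ ringGen W (k + 1) := ⟨x, hx, y, hy, by simp⟩

lemma mul_mem {k : ℕ} {x y : R} (hx : x ∈ ringGen W k) (hy : y ∈ ringGen W k) :
    x * y ∈ ringGen W (k + 1) := ⟨x, hx, y, hy, by simp⟩

lemma pow_mem (h1 : (1 : R) ∈ W) {k : ℕ} {x : R} (hx : x ∈ ringGen W k) (n : ℕ) :
    x ^ n ∈ ringGen W (k + n) := by
  induction n with
  | zero => simpa using base_mem h1 k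
  | succ n ih =>
    rw [pow_succ]
    exact mul_mem ih (mono (Nat.le_add_right k n) hx)

lemma sum_mem (h0 : (0 : R) ∈ W) {k : ℕ} {ι : Type*} (s : Finset ι) (f : ι → R)
    (hf : ∀ i ∈ s, f i ∈ ringGen W k) : ∑ i ∈ s, f i ∈ ringGen W (k + s.card) := by
  classical
  induction s using Finset.induction_on with
  | empty => simpa using base_mem h0 k
  | insert a s ha ih =>
    rw [Finset.sum_insert ha, Finset.card_insert_of_notMem ha]
    exact add_mem (mono (Nat.le_add_right k _) (hf a (by simp)))
      (ih fun i hi => hf i (by simp [hi]))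

end ringGen

/-- Sums `v₀ + D v₁ + ⋯ + D ^ (k - 1) v_{k-1}` with digits in `V`. -/
def digitSet (V : Finset ℤ) (D : ℤ) : ℕ → Finset ℤ
  | 0 => {0}
  | k + 1 => (V ×ˢ digitSet V D k).image fun p => p.1 + D * p.2

namespace digitSet
variable {V : Finset ℤ} {D : ℤ}

lemma subset_ringGen {𝒲 : Set ℤ} (h0 : (0 : ℤ) ∈ 𝒲) {K : ℕ} (hV : ∀ v ∈ V, v ∈ ringGen 𝒲 K)
    (hD : D ∈ ringGen 𝒲 K) (k : ℕ) : ∀ b ∈ digitSet V D k, b ∈ ringGen 𝒲 (K + 2 * k) := by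
  induction k with
  | zero =>
    intro b hb
    simp only [digitSet, Finset.mem_singleton] at hb
    exact hb ▸ ringGen.base_mem h0 _
  | succ k ih =>
    intro b hb
    simp only [digitSet, Finset.mem_image, Finset.mem_product] at hb
    obtain ⟨p, ⟨h1, h2⟩, rfl⟩ := hb
    have hm := ringGen.mul_mem (ringGen.mono (by omega : K ≤ K + 2 * k) hD) (ih _ h2)
    exact ringGen.add_mem (ringGen.mono (by omega : K ≤ K + 2 * k + 1) (hV _ h1)) hm

lemma abs_le {N : ℝ} (hN : ∀ v ∈ V, |(v : ℝ)| ≤ N) (hN0 : 0 ≤ N) (hD : 2 ≤ D) (k : ℕ) :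
    ∀ b ∈ digitSet V D k, |(b : ℝ)| ≤ N * ((D : ℝ) ^ k - 1) := by
  have hD' : (2 : ℝ) ≤ D := by exact_mod_cast hD
  induction k with
  | zero =>
    intro b hb
    simp only [digitSet, Finset.mem_singleton] at hb
    simp [hb]
  | succ k ih =>
    intro b hb
    simp only [digitSet, Finset.mem_image, Finset.mem_product] at hb
    obtain ⟨p, ⟨h1, h2⟩, rfl⟩ := hb
    push_cast
    calc |(p.1 : ℝ) + D * p.2| ≤ |(p.1 : ℝ)| + |(D : ℝ) * p.2| := abs_add_le _ _
      _ = |(p.1 : ℝ)| + D * |(p.2 : ℝ)| := by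
        rw [abs_mul, abs_of_nonneg (by linarith : (0 : ℝ) ≤ D)]
      _ ≤ N + D * (N * ((D : ℝ) ^ k - 1)) := by
        gcongr
        · exact hN _ h1
        · exact ih _ h2
      _ ≤ N * ((D : ℝ) ^ (k + 1) - 1) := by
        rw [pow_succ]
        nlinarith

lemma card_sep {N μ : ℝ} (hN : ∀ v ∈ V, |(v : ℝ)| ≤ N) (hμ : 0 < μ)
    (sep : ∀ v ∈ V, ∀ v' ∈ V, v ≠ v' → μ ≤ |(v : ℝ) - v'|) (hD : 2 * N + μ ≤ D * μ) (k : ℕ) :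
    (digitSet V D k).card = V.card ^ k ∧
      ∀ v ∈ digitSet V D k, ∀ v' ∈ digitSet V D k, v ≠ v' → μ ≤ |(v : ℝ) - v'| := by
  induction k with
  | zero => simp [digitSet]
  | succ k ih =>
    obtain ⟨ih1, ih2⟩ := ih
    have key : ∀ p ∈ V ×ˢ digitSet V D k, ∀ p' ∈ V ×ˢ digitSet V D k, p ≠ p' →
        μ ≤ |((p.1 + D * p.2 : ℤ) : ℝ) - ((p'.1 + D * p'.2 : ℤ) : ℝ)| := by
      rintro ⟨v, b⟩ hp ⟨v', b'⟩ hp' hne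
      simp only [Finset.mem_product] at hp hp'
      push_cast
      by_cases hb : b = b'
      · subst hb
        have : v ≠ v' := fun h => hne (by rw [h])
        simpa using sep _ hp.1 _ hp'.1 this
      · have h1 := ih2 _ hp.2 _ hp'.2 hb
        have hv := hN _ hp.1
        have hv' := hN _ hp'.1
        have hN0 : 0 ≤ N := (abs_nonneg _).trans hv
        have hD0 : (0 : ℝ) ≤ D := by
          by_contra h
          push Not at h
          nlinarith
        have h2 : (D : ℝ) * μ ≤ |(D : ℝ) * (b - b')| := by
          rw [abs_mul, abs_of_nonneg hD0]
          gcongr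
        have h3 : |(D : ℝ) * (b - b')| ≤
            |((v : ℝ) + D * b) - (v' + D * b')| + |(v : ℝ)| + |(v' : ℝ)| := by
          have := abs_add_three (((v : ℝ) + D * b) - (v' + D * b')) (-(v : ℝ)) (v' : ℝ)
          rw [abs_neg] at this
          refine le_trans (le_of_eq ?_) this
          congr 1; ring
        linarith
    have hinj : Set.InjOn (fun p : ℤ × ℤ => p.1 + D * p.2) (V ×ˢ digitSet V D k : Finset _) := by
      intro p hp p' hp' h
      by_contra hne
      have := key p hp p' hp' hne
      simp only at h
      rw [h] at this
      simp at this
      linarith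
    refine ⟨?_, ?_⟩
    · rw [digitSet, Finset.card_image_of_injOn hinj, Finset.card_product, ih1, pow_succ, mul_comm]
    · intro x hx y hy hne
      rw [digitSet, Finset.mem_image] at hx hy
      obtain ⟨p, hp, rfl⟩ := hx
      obtain ⟨p', hp', rfl⟩ := hy
      exact key p hp p' hp' fun h => hne (by rw [h])

end digitSet

/-- `ξ ∈ [0,1]` is a quotient of two differences of elements of `W`. -/
def IsQuot (W : Finset ℤ) (ξ : ℝ) : Prop :=
  ∃ w₁ ∈ W, ∃ w₂ ∈ W, ∃ w₃ ∈ W, ∃ w₄ ∈ W, w₃ ≠ w₄ ∧ ξ = ((w₁ : ℝ) - w₂) / ((w₃ : ℝ) - w₄)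

lemma isQuot_clamp {W : Finset ℤ} (hW : 2 ≤ W.card) {x ξ θ : ℝ} (hx0 : 0 ≤ x) (hx1 : x ≤ 1)
    (hξ : IsQuot W ξ) (h : |ξ - x| ≤ θ) : ∃ ξ', IsQuot W ξ' ∧ 0 ≤ ξ' ∧ ξ' ≤ 1 ∧ |ξ' - x| ≤ θ := by
  obtain ⟨a, ha, b, hb, hab⟩ := Finset.one_lt_card.mp (by omega : 1 < W.card)
  have hab' : (a : ℝ) - b ≠ 0 := sub_ne_zero.mpr (by exact_mod_cast hab)
  rw [abs_le] at h
  by_cases h0 : ξ < 0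
  · refine ⟨0, ⟨a, ha, a, ha, a, ha, b, hb, hab, by simp⟩, le_rfl, zero_le_one, ?_⟩
    rw [abs_le]; constructor <;> linarith
  by_cases h1 : 1 < ξ
  · refine ⟨1, ⟨a, ha, b, hb, a, ha, b, hb, hab, by rw [div_self hab']⟩, zero_le_one, le_rfl, ?_⟩
    rw [abs_le]; constructor <;> linarith
  · exact ⟨ξ, hξ, by linarith, by linarith, abs_le.mpr h⟩

lemma isQuot_dense {W : Finset ℤ} (hW : 2 ≤ W.card) {θ : ℝ} (hθ : 0 < θ)
    (H : ∀ ξ, IsQuot W ξ → 0 ≤ ξ → ξ ≤ 1 →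
      (∃ ξ', IsQuot W ξ' ∧ |ξ' - ξ / 2| ≤ θ) ∧ ∃ ξ', IsQuot W ξ' ∧ |ξ' - (ξ + 1) / 2| ≤ θ)
    {t : ℝ} (ht0 : 0 ≤ t) (ht1 : t ≤ 1) : ∃ ξ, IsQuot W ξ ∧ |ξ - t| ≤ 3 * θ := by
  have claim : ∀ n : ℕ, ∀ t : ℝ, 0 ≤ t → t ≤ 1 →
      ∃ ξ, IsQuot W ξ ∧ 0 ≤ ξ ∧ ξ ≤ 1 ∧ |ξ - t| ≤ 2 * θ + (1 / 2) ^ n := by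
    intro n
    induction n with
    | zero =>
      intro t h0 h1
      obtain ⟨a, ha, b, hb, hab⟩ := Finset.one_lt_card.mp (by omega : 1 < W.card)
      refine ⟨0, ⟨a, ha, a, ha, a, ha, b, hb, hab, by simp⟩, le_rfl, zero_le_one, ?_⟩
      rw [abs_le]; constructor <;> simp <;> linarith
    | succ n ih =>
      intro t h0 h1
      rw [pow_succ]
      by_cases ht : t ≤ 1 / 2
      · obtain ⟨ξ, hξ, hξ0, hξ1, hd⟩ := ih (2 * t) (by linarith) (by linarith)
        obtain ⟨ξ', hξ', hd'⟩ := (H ξ hξ hξ0 hξ1).1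
        obtain ⟨ξ'', h1', h2', h3', h4'⟩ :=
          isQuot_clamp hW (by linarith) (by linarith) hξ' hd'
        refine ⟨ξ'', h1', h2', h3', ?_⟩
        rw [abs_le] at *
        constructor <;> linarith
      · obtain ⟨ξ, hξ, hξ0, hξ1, hd⟩ := ih (2 * t - 1) (by linarith) (by linarith)
        obtain ⟨ξ', hξ', hd'⟩ := (H ξ hξ hξ0 hξ1).2
        obtain ⟨ξ'', h1', h2', h3', h4'⟩ :=
          isQuot_clamp hW (by linarith) (by linarith) hξ' hd'
        refine ⟨ξ'', h1', h2', h3', ?_⟩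
        rw [abs_le] at *
        constructor <;> linarith
  obtain ⟨n, hn⟩ := exists_pow_lt_of_lt_one hθ (by norm_num : (1 / 2 : ℝ) < 1)
  obtain ⟨ξ, h1, -, -, h2⟩ := claim n t ht0 ht1
  exact ⟨ξ, h1, by linarith⟩

/-- Either some linear form `R x + P y` separates the pairs of `W × W`, or the quotient set of `W`
is dense in `[0,1]`. -/
lemma gap_or_dense {𝒲 : Set ℤ} {K : ℕ} {W : Finset ℤ} (hWK : ∀ w ∈ W, w ∈ ringGen 𝒲 K)
    {X : ℝ} (hX : ∀ w ∈ W, |(w : ℝ)| ≤ X) (hW : 2 ≤ W.card) {θ : ℝ} (hθ : 0 < θ) (hθ1 : θ ≤ 1) :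
    (∃ P R : ℤ, P ∈ ringGen 𝒲 (K + 2) ∧ R ∈ ringGen 𝒲 (K + 2) ∧ R ≠ 0 ∧ |(R : ℝ)| ≤ 4 * X ∧
      |(P : ℝ)| ≤ |(R : ℝ)| ∧
      ∀ x ∈ W, ∀ y ∈ W, ∀ x' ∈ W, ∀ y' ∈ W, (x, y) ≠ (x', y') →
        θ * |(R : ℝ)| ≤ |(R : ℝ) * (x - x') + P * (y - y')|) ∨
    (∀ t : ℝ, 0 ≤ t → t ≤ 1 → ∃ ξ, IsQuot W ξ ∧ |ξ - t| ≤ 3 * θ) := by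
  by_cases H : ∀ ξ, IsQuot W ξ → 0 ≤ ξ → ξ ≤ 1 →
      (∃ ξ', IsQuot W ξ' ∧ |ξ' - ξ / 2| ≤ θ) ∧ ∃ ξ', IsQuot W ξ' ∧ |ξ' - (ξ + 1) / 2| ≤ θ
  · exact Or.inr fun t h0 h1 => isQuot_dense hW hθ H h0 h1
  · left
    push Not at H
    obtain ⟨ξ, hξ, hξ0, hξ1, H⟩ := H
    have main : ∀ P R : ℤ, P ∈ ringGen 𝒲 (K + 2) → R ∈ ringGen 𝒲 (K + 2) → R ≠ 0 →
        |(R : ℝ)| ≤ 4 * X → 0 ≤ (P / R : ℝ) → (P / R : ℝ) ≤ 1 →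
        (∀ ξ', IsQuot W ξ' → θ < |ξ' - P / R|) →
        ∃ P R : ℤ, P ∈ ringGen 𝒲 (K + 2) ∧ R ∈ ringGen 𝒲 (K + 2) ∧ R ≠ 0 ∧ |(R : ℝ)| ≤ 4 * X ∧
          |(P : ℝ)| ≤ |(R : ℝ)| ∧
          ∀ x ∈ W, ∀ y ∈ W, ∀ x' ∈ W, ∀ y' ∈ W, (x, y) ≠ (x', y') →
            θ * |(R : ℝ)| ≤ |(R : ℝ) * (x - x') + P * (y - y')| := by
      intro P R hP hR hR0 hRX h0 h1 hfar
      have hRr : (R : ℝ) ≠ 0 := by exact_mod_cast hR0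
      have hRpos : 0 < |(R : ℝ)| := abs_pos.mpr hRr
      refine ⟨P, R, hP, hR, hR0, hRX, ?_, ?_⟩
      · have : |(P / R : ℝ)| ≤ 1 := by rw [abs_of_nonneg h0]; exact h1
        rwa [abs_div, div_le_one hRpos] at this
      · intro x hx y hy x' hx' y' hy' hne
        by_cases hyy : y = y'
        · subst hyy
          have hxx : x ≠ x' := fun h => hne (by rw [h])
          have : (1 : ℝ) ≤ |(x : ℝ) - x'| := by
            have : (1 : ℤ) ≤ |x - x'| := Int.one_le_abs (sub_ne_zero.mpr hxx)
            exact_mod_cast this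
          simp only [sub_self, mul_zero, add_zero, abs_mul]
          nlinarith
        · have hyr : (y : ℝ) - y' ≠ 0 := sub_ne_zero.mpr (by exact_mod_cast hyy)
          have h1y : (1 : ℝ) ≤ |(y : ℝ) - y'| := by
            have : (1 : ℤ) ≤ |y - y'| := Int.one_le_abs (sub_ne_zero.mpr hyy)
            exact_mod_cast this
          have hf := hfar (((x' : ℝ) - x) / ((y : ℝ) - y'))
            ⟨x', hx', x, hx, y, hy, y', hy', hyy, rfl⟩
          have e : (R : ℝ) * (x - x') + P * (y - y') =
              -(R * (y - y') * (((x' : ℝ) - x) / ((y : ℝ) - y') - P / R)) := by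
            field_simp
            ring
          rw [e, abs_neg, abs_mul, abs_mul]
          have hm : |(R : ℝ)| * 1 ≤ |(R : ℝ)| * |(y : ℝ) - y'| := by gcongr
          nlinarith [abs_nonneg ((R : ℝ))]
    obtain ⟨w₁, h1, w₂, h2, w₃, h3, w₄, h4, h34, rfl⟩ := hξ
    have h34r : (w₃ : ℝ) - w₄ ≠ 0 := sub_ne_zero.mpr (by exact_mod_cast h34)
    have hβ := ringGen.sub_mem (hWK _ h1) (hWK _ h2)
    have hβ' := ringGen.sub_mem (hWK _ h3) (hWK _ h4)
    have hR : (w₃ - w₄) + (w₃ - w₄) ∈ ringGen 𝒲 (K + 2) := ringGen.add_mem hβ' hβ'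
    have hR0 : (w₃ - w₄) + (w₃ - w₄) ≠ 0 := by omega
    have hRX : |(((w₃ - w₄) + (w₃ - w₄) : ℤ) : ℝ)| ≤ 4 * X := by
      have := hX _ h3
      have := hX _ h4
      push_cast
      rw [abs_le] at *
      constructor <;> linarith
    by_cases hA : ∃ ξ', IsQuot W ξ' ∧ |ξ' - (((w₁ : ℝ) - w₂) / ((w₃ : ℝ) - w₄)) / 2| ≤ θ
    · have e : (((w₁ - w₂) + (w₃ - w₄) : ℤ) / ((w₃ - w₄) + (w₃ - w₄) : ℤ) : ℝ) =
          ((((w₁ : ℝ) - w₂) / ((w₃ : ℝ) - w₄)) + 1) / 2 := by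
        push_cast
        rw [← two_mul ((w₃ : ℝ) - w₄)]
        field_simp
      refine main ((w₁ - w₂) + (w₃ - w₄)) _ (ringGen.add_mem hβ hβ') hR hR0 hRX ?_ ?_ ?_
      · rw [e]; linarith
      · rw [e]; linarith
      · rw [e]; exact H hA
    · push Not at hA
      have e : (((w₁ - w₂) : ℤ) / ((w₃ - w₄) + (w₃ - w₄) : ℤ) : ℝ) =
          (((w₁ : ℝ) - w₂) / ((w₃ : ℝ) - w₄)) / 2 := by
        push_cast
        rw [← two_mul ((w₃ : ℝ) - w₄)]
        field_simp
      refine main (w₁ - w₂) _ (ringGen.subset_succ _ hβ) hR hR0 hRX ?_ ?_ ?_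
      · rw [e]; linarith
      · rw [e]; linarith
      · rw [e]; exact hA

lemma exists_two_separated (I : Finset ℤ) :
    ∃ J ⊆ I, I.card ≤ 2 * J.card ∧ ∀ c ∈ J, ∀ c' ∈ J, c ≠ c' → 2 ≤ |c - c'| := by
  have hadd := Finset.card_filter_add_card_filter_not (s := I) (fun c => c % 2 = 0)
  by_cases h : I.card ≤ 2 * (I.filter fun c => c % 2 = 0).card
  · refine ⟨_, Finset.filter_subset _ _, h, ?_⟩
    intro c hc c' hc' hne
    have h1 := (Finset.mem_filter.mp hc).2
    have h2 := (Finset.mem_filter.mp hc').2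
    rw [le_abs]; omega
  · refine ⟨I.filter fun c => ¬ c % 2 = 0, Finset.filter_subset _ _, by omega, ?_⟩
    intro c hc c' hc' hne
    have h1 := (Finset.mem_filter.mp hc).2
    have h2 := (Finset.mem_filter.mp hc').2
    rw [le_abs]; omega

lemma exists_separated_subset {α : Type*} [DecidableEq α] (s : Finset α) (φ : α → ℝ) :
    ∃ P ⊆ s, (s.card : ℝ) ^ 2 ≤
      2 * (((s ×ˢ s).filter fun p => |φ p.1 - φ p.2| < 1).card : ℝ) * P.card ∧
      ∀ p ∈ P, ∀ p' ∈ P, p ≠ p' → 1 ≤ |φ p - φ p'| := by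
  classical
  rcases s.eq_empty_or_nonempty with rfl | hs
  · exact ⟨∅, by simp⟩
  obtain ⟨I, hI⟩ : ∃ I, I = s.image fun p => ⌊φ p⌋ := ⟨_, rfl⟩
  have hsum : s.card = ∑ c ∈ I, (s.filter fun p => ⌊φ p⌋ = c).card := hI ▸
    Finset.card_eq_sum_card_image _ _
  have hsum' : (s.card : ℝ) = ∑ c ∈ I, ((s.filter fun p => ⌊φ p⌋ = c).card : ℝ) := by
    exact_mod_cast hsum
  have hcs : (s.card : ℝ) ^ 2 ≤ I.card * ∑ c ∈ I, ((s.filter fun p => ⌊φ p⌋ = c).card : ℝ) ^ 2 := by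
    rw [hsum']
    exact sq_sum_le_card_mul_sum_sq
  have hE : ∑ c ∈ I, ((s.filter fun p => ⌊φ p⌋ = c).card : ℝ) ^ 2 ≤
      (((s ×ˢ s).filter fun p => |φ p.1 - φ p.2| < 1).card : ℝ) := by
    have h1 : ∀ c ∈ I, ((s.filter fun p => ⌊φ p⌋ = c).card) ^ 2 =
        ((s.filter fun p => ⌊φ p⌋ = c) ×ˢ (s.filter fun p => ⌊φ p⌋ = c)).card := by
      intro c _
      rw [Finset.card_product, sq]
    have h2 : ∑ c ∈ I, ((s.filter fun p => ⌊φ p⌋ = c).card) ^ 2 ≤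
        ((s ×ˢ s).filter fun p => |φ p.1 - φ p.2| < 1).card := by
      rw [Finset.sum_congr rfl h1, ← Finset.card_biUnion]
      · apply Finset.card_le_card
        intro p hp
        simp only [Finset.mem_biUnion, Finset.mem_product, Finset.mem_filter] at hp ⊢
        obtain ⟨c, -, ⟨h1, h2⟩, h3, h4⟩ := hp
        refine ⟨⟨h1, h3⟩, Int.abs_sub_lt_one_of_floor_eq_floor (h2.trans h4.symm)⟩
      · intro c _ c' _ hne
        rw [Function.onFun, Finset.disjoint_left]
        intro p hp hp'
        simp only [Finset.mem_product, Finset.mem_filter] at hp hp'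
        exact hne (hp.1.2.symm.trans hp'.1.2)
    exact_mod_cast h2
  have key : ∀ J ⊆ I, (∀ c ∈ J, ∀ c' ∈ J, c ≠ c' → 2 ≤ |c - c'|) → ∃ P ⊆ s, P.card = J.card ∧
      ∀ p ∈ P, ∀ p' ∈ P, p ≠ p' → 1 ≤ |φ p - φ p'| := by
    intro J hJ hsep
    have hch : ∀ c : ℤ, ∃ p, c ∈ J → p ∈ s ∧ ⌊φ p⌋ = c := by
      intro c
      by_cases hc : c ∈ J
      · obtain ⟨p, hp, h⟩ := Finset.mem_image.mp (hI ▸ hJ hc)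
        exact ⟨p, fun _ => ⟨hp, h⟩⟩
      · exact ⟨hs.choose, fun h => absurd h hc⟩
    choose r hr using hch
    refine ⟨J.image r, ?_, ?_, ?_⟩
    · intro p hp
      obtain ⟨c, hc, rfl⟩ := Finset.mem_image.mp hp
      exact (hr c hc).1
    · apply Finset.card_image_of_injOn
      intro c hc c' hc' h
      rw [← (hr c hc).2, ← (hr c' hc').2, h]
    · intro p hp p' hp' hne
      obtain ⟨c, hc, rfl⟩ := Finset.mem_image.mp hp
      obtain ⟨c', hc', rfl⟩ := Finset.mem_image.mp hp'
      have h2 := hsep c hc c' hc' fun h => hne (by rw [h])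
      by_contra hlt
      push Not at hlt
      have h3 := (hr c hc).2
      have h4 := (hr c' hc').2
      rw [Int.floor_eq_iff] at h3 h4
      have h5 : |((c - c' : ℤ) : ℝ)| < 2 := by
        push_cast
        rw [abs_lt] at hlt ⊢
        constructor <;> linarith
      have h6 : (2 : ℝ) ≤ |((c - c' : ℤ) : ℝ)| := by exact_mod_cast h2
      linarith
  obtain ⟨J, hJ, hJc, hJs⟩ := exists_two_separated I
  obtain ⟨P, hP, hPc, hPs⟩ := key J hJ hJs
  refine ⟨P, hP, ?_, hPs⟩
  have hIc : (I.card : ℝ) ≤ 2 * P.card := by rw [hPc]; exact_mod_cast hJc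
  calc (s.card : ℝ) ^ 2 ≤ _ := hcs
    _ ≤ (2 * P.card) * (((s ×ˢ s).filter fun p => |φ p.1 - φ p.2| < 1).card : ℝ) :=
      mul_le_mul hIc hE (Finset.sum_nonneg fun _ _ => sq_nonneg _) (by positivity)
    _ = _ := by ring

lemma card_le_of_diam (s : Finset ℕ) (L : ℝ) (hL : 0 ≤ L)
    (h : ∀ i ∈ s, ∀ j ∈ s, |(i : ℝ) - j| ≤ L) : (s.card : ℝ) ≤ L + 1 := by
  rcases s.eq_empty_or_nonempty with rfl | hs
  · simp; linarith
  · have hsub : s ⊆ Finset.Icc (s.min' hs) (s.max' hs) := fun i hi =>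
      Finset.mem_Icc.mpr ⟨s.min'_le i hi, s.le_max' i hi⟩
    have h1 := Finset.card_le_card hsub
    rw [Nat.card_Icc] at h1
    have h2 := h _ (s.max'_mem hs) _ (s.min'_mem hs)
    have h3 : s.min' hs ≤ s.max' hs := s.min'_le _ (s.max'_mem hs)
    have h4 : (s.card : ℝ) ≤ (s.max' hs : ℝ) - s.min' hs + 1 := by
      have : s.card + s.min' hs ≤ s.max' hs + 1 := by omega
      have : (s.card : ℝ) + s.min' hs ≤ s.max' hs + 1 := by exact_mod_cast this
      linarith
    linarith [le_abs_self ((s.max' hs : ℝ) - s.min' hs)]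

/-- For few sample points `t = i / H` is `a + t c` small. -/
lemma card_near_zero (H : ℕ) (hH : 0 < H) (a c : ℝ) (hc : c ≠ 0) (hcH : |c| ≤ 2 * H) :
    (((Finset.range (H + 1)).filter fun i : ℕ => |a + (i / H : ℝ) * c| < 1).card : ℝ) ≤
      if |a| ≤ |c| + 1 then 4 * H * (1 / |c|) else 0 := by
  have hH' : (0 : ℝ) < H := by exact_mod_cast hH
  have hc' : 0 < |c| := abs_pos.mpr hc
  split_ifs with ha
  · have h1 : ((2 * H / |c| : ℝ)) + 1 ≤ 4 * H * (1 / |c|) := by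
      rw [div_add_one hc'.ne', mul_one_div]
      gcongr
      linarith
    refine le_trans (card_le_of_diam _ (2 * H / |c|) (by positivity) ?_) h1
    intro i hi j hj
    simp only [Finset.mem_filter] at hi hj
    have hi2 := abs_lt.mp hi.2
    have hj2 := abs_lt.mp hj.2
    have : |((i : ℝ) - j) / H * c| ≤ 2 := by
      have e : ((i : ℝ) - j) / H * c = (a + (i / H : ℝ) * c) - (a + (j / H : ℝ) * c) := by ring
      rw [e, abs_le]; constructor <;> linarith
    rw [abs_mul, abs_div, abs_of_pos hH', div_mul_eq_mul_div, div_le_iff₀ hH'] at this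
    rw [le_div_iff₀ hc']
    exact this
  · have : ((Finset.range (H + 1)).filter fun i : ℕ => |a + (i / H : ℝ) * c| < 1) = ∅ := by
      rw [Finset.filter_eq_empty_iff]
      intro i hi h
      apply ha
      have hi' : (i : ℝ) / H ≤ 1 := by
        rw [div_le_one hH']
        have := Finset.mem_range.mp hi
        exact_mod_cast (by omega : i ≤ H)
      have hi0 : (0 : ℝ) ≤ (i : ℝ) / H := by positivity
      have h1 : |a| ≤ |a + (i / H : ℝ) * c| + |(i / H : ℝ) * c| := by
        have := abs_sub (a + (i / H : ℝ) * c) ((i / H : ℝ) * c)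
        simpa using this
      have h2 : |(i / H : ℝ) * c| ≤ |c| := by
        rw [abs_mul, abs_of_nonneg hi0]
        exact mul_le_of_le_one_left hc'.le hi'
      linarith
    rw [this]
    simp

/-- The weight `1 / |c|`, restricted to `|a| ≤ |c| + 1` and `c ≠ 0`. -/
noncomputable def quadTerm (a c : ℤ) : ℝ := if c ≠ 0 ∧ |a| ≤ |c| + 1 then 1 / |(c : ℝ)| else 0

lemma quadTerm_nonneg (a c : ℤ) : 0 ≤ quadTerm a c := by
  unfold quadTerm; split_ifs <;> positivity

lemma quadTerm_digit {N : ℝ} (hN1 : 1 ≤ N) {D : ℤ} (hD : 16 * N ≤ D) {v₁ v₂ v₃ v₄ : ℤ}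
    (h₁ : |(v₁ : ℝ)| ≤ N) (h₂ : |(v₂ : ℝ)| ≤ N) (h₃ : |(v₃ : ℝ)| ≤ N) (h₄ : |(v₄ : ℝ)| ≤ N)
    (b₁ b₂ b₃ b₄ : ℤ) :
    quadTerm (v₁ + D * b₁ - (v₂ + D * b₂)) (v₃ + D * b₃ - (v₄ + D * b₄)) ≤
      (2 / D) * quadTerm (b₁ - b₂) (b₃ - b₄) +
        (if b₁ = b₂ then 1 else 0) * (if b₃ = b₄ then 1 else 0) := by
  have hD0 : (0 : ℝ) < D := by linarith
  have hq := quadTerm_nonneg (b₁ - b₂) (b₃ - b₄)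
  have hq' : 0 ≤ (2 / D) * quadTerm (b₁ - b₂) (b₃ - b₄) := by positivity
  by_cases hc : (v₃ + D * b₃ - (v₄ + D * b₄)) ≠ 0 ∧
      |v₁ + D * b₁ - (v₂ + D * b₂)| ≤ |v₃ + D * b₃ - (v₄ + D * b₄)| + 1
  swap
  · rw [quadTerm, if_neg hc]
    have : (0 : ℝ) ≤ (if b₁ = b₂ then 1 else 0) * (if b₃ = b₄ then 1 else 0) := by
      split_ifs <;> norm_num
    linarith
  obtain ⟨hc0, hc1⟩ := hc
  have hc1r : |(v₁ + D * b₁ - (v₂ + D * b₂) : ℝ)| ≤ |(v₃ + D * b₃ - (v₄ + D * b₄) : ℝ)| + 1 := by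
    exact_mod_cast hc1
  have ha : (D : ℝ) * |(b₁ - b₂ : ℝ)| ≤ |(v₁ + D * b₁ - (v₂ + D * b₂) : ℝ)| + 2 * N := by
    rw [← abs_of_pos hD0, ← abs_mul, abs_of_pos hD0]
    have := abs_add_three (v₁ + D * b₁ - (v₂ + D * b₂) : ℝ) (-v₁ : ℝ) (v₂ : ℝ)
    rw [abs_neg] at this
    have e : (v₁ + D * b₁ - (v₂ + D * b₂) : ℝ) + (-v₁) + v₂ = D * (b₁ - b₂) := by ring
    rw [e] at this
    linarith
  have hcl : (D : ℝ) * |(b₃ - b₄ : ℝ)| ≤ |(v₃ + D * b₃ - (v₄ + D * b₄) : ℝ)| + 2 * N := by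
    rw [← abs_of_pos hD0, ← abs_mul, abs_of_pos hD0]
    have := abs_add_three (v₃ + D * b₃ - (v₄ + D * b₄) : ℝ) (-v₃ : ℝ) (v₄ : ℝ)
    rw [abs_neg] at this
    have e : (v₃ + D * b₃ - (v₄ + D * b₄) : ℝ) + (-v₃) + v₄ = D * (b₃ - b₄) := by ring
    rw [e] at this
    linarith
  have hcu : |(v₃ + D * b₃ - (v₄ + D * b₄) : ℝ)| ≤ D * |(b₃ - b₄ : ℝ)| + 2 * N := by
    rw [← abs_of_pos hD0, ← abs_mul, abs_of_pos hD0]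
    have := abs_add_three (D * (b₃ - b₄) : ℝ) (v₃ : ℝ) (-v₄ : ℝ)
    rw [abs_neg] at this
    have e : (D * (b₃ - b₄) : ℝ) + v₃ + (-v₄) = (v₃ + D * b₃ - (v₄ + D * b₄) : ℝ) := by ring
    rw [e] at this
    linarith
  have hterm : quadTerm (v₁ + D * b₁ - (v₂ + D * b₂)) (v₃ + D * b₃ - (v₄ + D * b₄)) =
      1 / |(v₃ + D * b₃ - (v₄ + D * b₄) : ℝ)| := by
    rw [quadTerm, if_pos ⟨hc0, hc1⟩]; push_cast; rfl
  have hge1 : (1 : ℝ) ≤ |(v₃ + D * b₃ - (v₄ + D * b₄) : ℝ)| := by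
    have := Int.one_le_abs hc0
    exact_mod_cast this
  rw [hterm]
  by_cases hb : b₃ = b₄
  · have hb12 : b₁ = b₂ := by
      by_contra hne
      have h1 : (1 : ℝ) ≤ |(b₁ - b₂ : ℝ)| := by
        have := Int.one_le_abs (sub_ne_zero.mpr hne)
        exact_mod_cast this
      have h2 : |(b₃ - b₄ : ℝ)| = 0 := by rw [hb]; simp
      rw [h2] at hcu
      nlinarith
    rw [if_pos hb, if_pos hb12]
    have : 1 / |(v₃ + D * b₃ - (v₄ + D * b₄) : ℝ)| ≤ 1 := by
      rw [div_le_one (by linarith)]; exact hge1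
    linarith
  · have h1 : (1 : ℝ) ≤ |(b₃ - b₄ : ℝ)| := by
      have := Int.one_le_abs (sub_ne_zero.mpr hb)
      exact_mod_cast this
    have hlt : |(b₁ - b₂ : ℝ)| < |(b₃ - b₄ : ℝ)| + 2 := by
      by_contra hcon
      push Not at hcon
      nlinarith
    have hle : |b₁ - b₂| ≤ |b₃ - b₄| + 1 := by
      have : |b₁ - b₂| < |b₃ - b₄| + 2 := by exact_mod_cast hlt
      omega
    rw [if_neg hb, mul_zero, add_zero, quadTerm, if_pos ⟨sub_ne_zero.mpr hb, hle⟩]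
    push_cast
    have h2 : (D : ℝ) / 2 * |(b₃ - b₄ : ℝ)| ≤ |(v₃ + D * b₃ - (v₄ + D * b₄) : ℝ)| := by
      nlinarith
    calc 1 / |(v₃ + D * b₃ - (v₄ + D * b₄) : ℝ)| ≤ 1 / ((D : ℝ) / 2 * |(b₃ - b₄ : ℝ)|) := by
          apply one_div_le_one_div_of_le _ h2
          positivity
      _ = 2 / D * (1 / |(b₃ - b₄ : ℝ)|) := by
          field_simp

/-- A logarithmic energy of a finite set of integers. -/
noncomputable def logEnergy (B : Finset ℤ) : ℝ :=
  ∑ w₁ ∈ B, ∑ w₂ ∈ B, ∑ w₃ ∈ B, ∑ w₄ ∈ B, quadTerm (w₁ - w₂) (w₃ - w₄)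

lemma digitSet_sep_one {V : Finset ℤ} {D : ℤ} {N : ℝ} (hN : ∀ v ∈ V, |(v : ℝ)| ≤ N)
    (hD : 2 * N + 1 ≤ D) (k : ℕ) : (digitSet V D k).card = V.card ^ k :=
  (digitSet.card_sep hN one_pos (fun v _ v' _ h => by
    have := Int.one_le_abs (sub_ne_zero.mpr h)
    exact_mod_cast this) (by linarith) k).1

lemma sum_digitSet_succ {V : Finset ℤ} {D : ℤ} {N : ℝ} (hN : ∀ v ∈ V, |(v : ℝ)| ≤ N)
    (hD : 2 * N + 1 ≤ D) (k : ℕ) (f : ℤ → ℝ) :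
    ∑ w ∈ digitSet V D (k + 1), f w = ∑ v ∈ V, ∑ b ∈ digitSet V D k, f (v + D * b) := by
  have hcard := digitSet_sep_one hN hD (k + 1)
  have hinj : Set.InjOn (fun p : ℤ × ℤ => p.1 + D * p.2) (V ×ˢ digitSet V D k : Finset _) := by
    rw [← Finset.card_image_iff]
    rw [digitSet] at hcard
    rw [hcard, Finset.card_product, digitSet_sep_one hN hD k, pow_succ, mul_comm]
  rw [digitSet, Finset.sum_image hinj, Finset.sum_product]

lemma logEnergy_digitSet {V : Finset ℤ} {D : ℤ} {N : ℝ} (hN : ∀ v ∈ V, |(v : ℝ)| ≤ N)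
    (hN1 : 1 ≤ N) (hD : 16 * N ≤ D) (hVD : 4 * (V.card : ℝ) ^ 2 ≤ D) (k : ℕ) :
    logEnergy (digitSet V D k) ≤ 2 * (V.card : ℝ) ^ (2 * k + 2) := by
  have hD0 : (0 : ℝ) < D := by linarith
  induction k with
  | zero => simp [logEnergy, digitSet, quadTerm]
  | succ k ih =>
    have hD' : 2 * N + 1 ≤ D := by linarith
    set B := digitSet V D k with hB
    have h1 : logEnergy (digitSet V D (k + 1)) ≤
        ∑ v₁ ∈ V, ∑ b₁ ∈ B, ∑ v₂ ∈ V, ∑ b₂ ∈ B, ∑ v₃ ∈ V, ∑ b₃ ∈ B, ∑ v₄ ∈ V, ∑ b₄ ∈ B,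
          ((2 / D) * quadTerm (b₁ - b₂) (b₃ - b₄) +
          (if b₁ = b₂ then 1 else 0) * (if b₃ = b₄ then 1 else 0)) := by
      unfold logEnergy
      simp only [sum_digitSet_succ hN hD']
      refine Finset.sum_le_sum fun v₁ h₁ => Finset.sum_le_sum fun b₁ _ => ?_
      refine Finset.sum_le_sum fun v₂ h₂ => Finset.sum_le_sum fun b₂ _ => ?_
      refine Finset.sum_le_sum fun v₃ h₃ => Finset.sum_le_sum fun b₃ _ => ?_
      refine Finset.sum_le_sum fun v₄ h₄ => Finset.sum_le_sum fun b₄ _ => ?_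
      exact quadTerm_digit hN1 hD (hN _ h₁) (hN _ h₂) (hN _ h₃) (hN _ h₄) _ _ _ _
    have h2 : ∑ v₁ ∈ V, ∑ b₁ ∈ B, ∑ v₂ ∈ V, ∑ b₂ ∈ B, ∑ v₃ ∈ V, ∑ b₃ ∈ B, ∑ v₄ ∈ V, ∑ b₄ ∈ B,
          ((2 / (D : ℝ)) * quadTerm (b₁ - b₂) (b₃ - b₄) +
          (if b₁ = b₂ then 1 else 0) * (if b₃ = b₄ then 1 else 0)) =
        (V.card : ℝ) ^ 4 * ((2 / D) * logEnergy B + (B.card : ℝ) ^ 2) := by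
      have e1 : ∑ b₁ ∈ B, ∑ b₂ ∈ B, ∑ b₃ ∈ B, ∑ b₄ ∈ B,
          ((if b₁ = b₂ then 1 else 0) * (if b₃ = b₄ then 1 else 0) : ℝ) = (B.card : ℝ) ^ 2 := by
        simp [sq]
      rw [← e1, logEnergy]
      simp only [Finset.sum_const, nsmul_eq_mul, ← Finset.mul_sum, Finset.sum_add_distrib]
      ring
    have hBc : (B.card : ℝ) = (V.card : ℝ) ^ k := by
      rw [hB, digitSet_sep_one hN hD' k]; push_cast; rfl
    rw [h2, hBc] at h1
    refine h1.trans ?_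
    have h3 : 2 / D * logEnergy B ≤ (V.card : ℝ) ^ (2 * k) := by
      have h4 : 2 / (D : ℝ) * logEnergy B ≤ 2 / D * (2 * (V.card : ℝ) ^ (2 * k + 2)) := by gcongr
      refine h4.trans ?_
      rw [div_mul_eq_mul_div, div_le_iff₀ hD0]
      have h5 : (0 : ℝ) ≤ (V.card : ℝ) ^ (2 * k) := by positivity
      have e : (V.card : ℝ) ^ (2 * k + 2) = (V.card : ℝ) ^ (2 * k) * (V.card : ℝ) ^ 2 := by ring
      rw [e]
      nlinarith
    have e : (V.card : ℝ) ^ (2 * (k + 1) + 2) = (V.card : ℝ) ^ 4 * (V.card : ℝ) ^ (2 * k) := by ring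
    have e' : ((V.card : ℝ) ^ k) ^ 2 = (V.card : ℝ) ^ (2 * k) := by ring
    rw [e, e']
    have h6 : (0 : ℝ) ≤ (V.card : ℝ) ^ 4 := by positivity
    nlinarith

/-- For some `t ∈ [0,1]` the linear form `x + t y` has many `1`-separated values on `B × B`. -/
lemma exists_good_slope (B : Finset ℤ) {N : ℝ} (hB : ∀ b ∈ B, |(b : ℝ)| ≤ N) {E : ℝ}
    (hE : logEnergy B ≤ E) (hcE : (B.card : ℝ) ^ 2 ≤ E) :
    ∃ t : ℝ, 0 ≤ t ∧ t ≤ 1 ∧ ∃ P ⊆ B ×ˢ B, (B.card : ℝ) ^ 4 ≤ 10 * E * P.card ∧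
      ∀ p ∈ P, ∀ p' ∈ P, p ≠ p' → 1 ≤ |((p.1 : ℝ) + t * p.2) - (p'.1 + t * p'.2)| := by
  classical
  obtain ⟨H, hH⟩ := exists_nat_ge (max N 1)
  have hHN : N ≤ H := (le_max_left _ _).trans hH
  have hH1 : (1 : ℝ) ≤ H := (le_max_right _ _).trans hH
  have hH0 : 0 < H := by exact_mod_cast lt_of_lt_of_le one_pos hH1
  set F : ℕ → ℝ := fun i => ∑ w₁ ∈ B, ∑ w₂ ∈ B, ∑ w₃ ∈ B, ∑ w₄ ∈ B,
    (if |((w₁ : ℝ) - w₂) + (i / H : ℝ) * (w₃ - w₄)| < 1 then (1 : ℝ) else 0) with hF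
  have hFle : ∑ i ∈ Finset.range (H + 1), F i ≤ ∑ i ∈ Finset.range (H + 1), 5 * E := by
    have h1 : ∑ i ∈ Finset.range (H + 1), F i = ∑ w₁ ∈ B, ∑ w₂ ∈ B, ∑ w₃ ∈ B, ∑ w₄ ∈ B,
        ∑ i ∈ Finset.range (H + 1),
          (if |((w₁ : ℝ) - w₂) + (i / H : ℝ) * (w₃ - w₄)| < 1 then (1 : ℝ) else 0) := by
      simp only [hF]
      rw [Finset.sum_comm]
      refine Finset.sum_congr rfl fun w₁ _ => ?_
      rw [Finset.sum_comm]
      refine Finset.sum_congr rfl fun w₂ _ => ?_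
      rw [Finset.sum_comm]
      refine Finset.sum_congr rfl fun w₃ _ => ?_
      rw [Finset.sum_comm]
    rw [h1]
    have h2 : ∀ w₁ ∈ B, ∀ w₂ ∈ B, ∀ w₃ ∈ B, ∀ w₄ ∈ B, ∑ i ∈ Finset.range (H + 1),
          (if |((w₁ : ℝ) - w₂) + (i / H : ℝ) * (w₃ - w₄)| < 1 then (1 : ℝ) else 0) ≤
        4 * H * quadTerm (w₁ - w₂) (w₃ - w₄) +
          (H + 1) * ((if w₁ = w₂ then 1 else 0) * (if w₃ = w₄ then 1 else 0)) := by
      intro w₁ _ w₂ _ w₃ h3 w₄ h4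
      rw [Finset.sum_boole]
      by_cases h34 : w₃ = w₄
      · subst h34
        simp only [sub_self, mul_zero, add_zero]
        by_cases h12 : w₁ = w₂
        · simp [h12, quadTerm]
        · have : ¬ |(w₁ : ℝ) - w₂| < 1 := by
            have := Int.one_le_abs (sub_ne_zero.mpr h12)
            rw [not_lt]
            exact_mod_cast this
          simp [h12, quadTerm, this]
      · have hc0 : (w₃ : ℝ) - w₄ ≠ 0 := sub_ne_zero.mpr (by exact_mod_cast h34)
        have hcH : |(w₃ : ℝ) - w₄| ≤ 2 * H := by
          have := hB _ h3
          have := hB _ h4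
          rw [abs_le] at *
          constructor <;> linarith
        refine (card_near_zero H hH0 _ _ hc0 hcH).trans ?_
        have hcond : (|(w₁ : ℝ) - w₂| ≤ |(w₃ : ℝ) - w₄| + 1) ↔ (|w₁ - w₂| ≤ |w₃ - w₄| + 1) := by
          exact_mod_cast Iff.rfl
        rw [quadTerm, if_neg h34, mul_zero, mul_zero, add_zero]
        by_cases hh : |w₁ - w₂| ≤ |w₃ - w₄| + 1
        · rw [if_pos (hcond.mpr hh), if_pos ⟨sub_ne_zero.mpr h34, hh⟩]
          push_cast
          exact le_rfl
        · rw [if_neg (fun h => hh (hcond.mp h)), if_neg (fun h => hh h.2)]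
          simp
    calc _ ≤ ∑ w₁ ∈ B, ∑ w₂ ∈ B, ∑ w₃ ∈ B, ∑ w₄ ∈ B, (4 * H * quadTerm (w₁ - w₂) (w₃ - w₄) +
          ((H : ℝ) + 1) * ((if w₁ = w₂ then 1 else 0) * (if w₃ = w₄ then 1 else 0))) :=
          Finset.sum_le_sum fun w₁ h₁ => Finset.sum_le_sum fun w₂ h₂ =>
            Finset.sum_le_sum fun w₃ h₃ => Finset.sum_le_sum fun w₄ h₄ => h2 _ h₁ _ h₂ _ h₃ _ h₄
      _ = 4 * H * logEnergy B + ((H : ℝ) + 1) * (B.card : ℝ) ^ 2 := by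
          have e1 : ∑ b₁ ∈ B, ∑ b₂ ∈ B, ∑ b₃ ∈ B, ∑ b₄ ∈ B,
              ((if b₁ = b₂ then 1 else 0) * (if b₃ = b₄ then 1 else 0) : ℝ) =
              (B.card : ℝ) ^ 2 := by
            simp [sq]
          rw [← e1, logEnergy]
          simp only [← Finset.mul_sum, Finset.sum_add_distrib]
      _ ≤ _ := by
          rw [Finset.sum_const, Finset.card_range, nsmul_eq_mul]
          push_cast
          have hE0 : 0 ≤ E := (sq_nonneg _).trans hcE
          nlinarith
  obtain ⟨i, hi, hFi⟩ := Finset.exists_le_of_sum_le (by simp) hFle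
  have hi' : (i : ℝ) / H ≤ 1 := by
    rw [div_le_one (by linarith)]
    have := Finset.mem_range.mp hi
    exact_mod_cast (by omega : i ≤ H)
  refine ⟨i / H, by positivity, hi', ?_⟩
  obtain ⟨P, hP, hPc, hPs⟩ := exists_separated_subset (B ×ˢ B)
    (fun p : ℤ × ℤ => (p.1 : ℝ) + (i / H : ℝ) * p.2)
  refine ⟨P, hP, ?_, hPs⟩
  have hcount : ((((B ×ˢ B) ×ˢ (B ×ˢ B)).filter fun p : (ℤ × ℤ) × (ℤ × ℤ) =>
      |((p.1.1 : ℝ) + (i / H : ℝ) * p.1.2) - (p.2.1 + (i / H : ℝ) * p.2.2)| < 1).card : ℝ) =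
      F i := by
    rw [← Finset.sum_boole, Finset.sum_product, Finset.sum_product]
    simp only [Finset.sum_product, hF]
    refine Finset.sum_congr rfl fun w₁ _ => ?_
    rw [Finset.sum_comm]
    refine Finset.sum_congr rfl fun w₂ _ => ?_
    refine Finset.sum_congr rfl fun w₃ _ => ?_
    refine Finset.sum_congr rfl fun w₄ _ => ?_
    have : ((w₁ : ℝ) + (i / H : ℝ) * w₃) - (w₂ + (i / H : ℝ) * w₄) =
      ((w₁ : ℝ) - w₂) + (i / H : ℝ) * (w₃ - w₄) := by ring
    rw [this]
  rw [hcount, Finset.card_product] at hPc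
  calc (B.card : ℝ) ^ 4 = ((B.card * B.card : ℕ) : ℝ) ^ 2 := by push_cast; ring
    _ ≤ 2 * F i * P.card := hPc
    _ ≤ 2 * (5 * E) * P.card := by gcongr
    _ = _ := by ring

/-- At the logarithmic scale `t` there is a subset of `ringGen 𝒲 k` of dimension at least `σ`. -/
def RichAt (𝒲 : Set ℤ) (σ M : ℝ) (k : ℕ) (t : ℝ) : Prop :=
  ∃ x, t ≤ x ∧ x ≤ M * t ∧ ∃ W : Finset ℤ, (∀ w ∈ W, w ∈ ringGen 𝒲 k) ∧
    (∀ w ∈ W, |(w : ℝ)| ≤ Real.exp x) ∧ Real.exp (σ * x) ≤ W.card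

lemma exists_large_elt (W : Finset ℤ) {u : ℝ} (hu : 3 ≤ u) (h : u ^ 2 ≤ W.card) :
    ∃ d ∈ W, u ≤ |(d : ℝ)| := by
  by_contra hcon
  push Not at hcon
  have hsub : W ⊆ Finset.Icc (-(⌊u⌋)) ⌊u⌋ := by
    intro w hw
    have := (hcon w hw).le
    rw [abs_le] at this
    rw [Finset.mem_Icc]
    refine ⟨?_, Int.le_floor.mpr this.2⟩
    have : -w ≤ ⌊u⌋ := Int.le_floor.mpr (by push_cast; linarith)
    omega
  have h1 := Finset.card_le_card hsub
  rw [Int.card_Icc] at h1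
  have h0 : 0 ≤ ⌊u⌋ := Int.floor_nonneg.mpr (by linarith)
  have h2 : (W.card : ℤ) ≤ 2 * ⌊u⌋ + 1 := by omega
  have h3 : (W.card : ℝ) ≤ 2 * ⌊u⌋ + 1 := by exact_mod_cast h2
  have h4 := Int.floor_le u
  nlinarith

lemma exists_base {𝒲 : Set ℤ} (h1 : (1 : ℤ) ∈ 𝒲) {σ M t : ℝ} {k : ℕ} (hσ : 0 < σ)
    (hR : RichAt 𝒲 σ M k t) (hσt : 4 ≤ σ * t) {y : ℝ} (hy : 0 ≤ y) (J : ℕ)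
    (hJ : 2 * (y / (σ * t) + 1) ≤ J) :
    ∃ D : ℤ, D ∈ ringGen 𝒲 (k + J) ∧ Real.exp y ≤ D ∧ (D : ℝ) ≤ Real.exp (y + 2 * (M * t)) := by
  obtain ⟨x, hx1, hx2, W, hW, hWx, hWc⟩ := hR
  have hu : (3 : ℝ) ≤ Real.exp (σ * t / 2) := by
    have := Real.add_one_le_exp (σ * t / 2)
    linarith
  have hu2 : (Real.exp (σ * t / 2)) ^ 2 ≤ W.card := by
    rw [← Real.exp_nat_mul]
    refine le_trans (Real.exp_le_exp.mpr ?_) hWc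
    push_cast
    nlinarith
  obtain ⟨d, hd, hdu⟩ := exists_large_elt W hu hu2
  have hd0 : 0 < |(d : ℝ)| := by linarith
  set lg := Real.log |(d : ℝ)| with hlg
  have hlg1 : σ * t / 2 ≤ lg := by
    rw [hlg, Real.le_log_iff_exp_le hd0]; exact hdu
  have hlg2 : lg ≤ M * t := by
    rw [hlg, Real.log_le_iff_le_exp hd0]
    exact (hWx d hd).trans (Real.exp_le_exp.mpr hx2)
  have hlgpos : 0 < lg := by linarith
  have hexp : |(d : ℝ)| = Real.exp lg := (Real.exp_log hd0).symm
  set j := ⌈y / (2 * lg)⌉₊ with hj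
  have hj1 : y / (2 * lg) ≤ j := Nat.le_ceil _
  have hj2 : (j : ℝ) < y / (2 * lg) + 1 := Nat.ceil_lt_add_one (by positivity)
  have hDe : (((d ^ 2) ^ j : ℤ) : ℝ) = Real.exp (2 * j * lg) := by
    push_cast
    rw [← sq_abs, hexp, ← Real.exp_nat_mul, ← Real.exp_nat_mul]
    congr 1; push_cast; ring
  refine ⟨(d ^ 2) ^ j, ?_, ?_, ?_⟩
  · rw [← pow_mul]
    refine ringGen.mono ?_ (ringGen.pow_mem h1 (hW d hd) (2 * j))
    have h3 : y / (2 * lg) ≤ y / (σ * t) := by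
      apply div_le_div_of_nonneg_left hy (by linarith) (by linarith)
    have h4 : (2 * j : ℝ) ≤ J := by linarith
    have : 2 * j ≤ J := by exact_mod_cast h4
    omega
  · rw [hDe]
    apply Real.exp_le_exp.mpr
    rw [div_le_iff₀ (by positivity)] at hj1
    linarith
  · rw [hDe]
    apply Real.exp_le_exp.mpr
    have : (j : ℝ) * (2 * lg) ≤ (y / (2 * lg) + 1) * (2 * lg) := by gcongr
    rw [add_mul, div_mul_cancel₀ _ (by positivity)] at this
    linarith

/-- Digit expansions in a separated set. -/
lemma digits_of_separated {𝒲 : Set ℤ} (h0 : (0 : ℤ) ∈ 𝒲) {K k : ℕ} {V : Finset ℤ} {D : ℤ}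
    (hV : ∀ v ∈ V, v ∈ ringGen 𝒲 K) (hDK : D ∈ ringGen 𝒲 K) {N μ x y : ℝ}
    (hN : ∀ v ∈ V, |(v : ℝ)| ≤ N) (hN0 : 0 ≤ N) (hμ : 0 < μ)
    (sep : ∀ v ∈ V, ∀ v' ∈ V, v ≠ v' → μ ≤ |(v : ℝ) - v'|) (hD : 2 * N + μ ≤ D * μ)
    (hD2 : 2 ≤ D) (hNx : N ≤ Real.exp x) (hDy : (D : ℝ) ≤ Real.exp y) :
    ∃ B : Finset ℤ, (∀ b ∈ B, b ∈ ringGen 𝒲 (K + 2 * k)) ∧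
      (∀ b ∈ B, |(b : ℝ)| ≤ Real.exp (x + k * y)) ∧ B.card = V.card ^ k := by
  refine ⟨digitSet V D k, digitSet.subset_ringGen h0 hV hDK k, ?_,
    (digitSet.card_sep hN hμ sep hD k).1⟩
  intro b hb
  refine (digitSet.abs_le hN hN0 hD2 k b hb).trans ?_
  have hD0 : (0 : ℝ) ≤ D := by exact_mod_cast (by omega : (0 : ℤ) ≤ D)
  rw [Real.exp_add, Real.exp_nat_mul]
  have h1 : (D : ℝ) ^ k - 1 ≤ Real.exp y ^ k := by
    have := pow_le_pow_left₀ hD0 hDy k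
    linarith
  calc N * ((D : ℝ) ^ k - 1) ≤ N * Real.exp y ^ k := by gcongr
    _ ≤ _ := by gcongr

/-- The case of the doubling step in which a linear form separates pairs. -/
lemma doubling_gap {𝒲 : Set ℤ} (h0 : (0 : ℤ) ∈ 𝒲) {K k : ℕ} {W : Finset ℤ} {P R D : ℤ}
    (hW : ∀ w ∈ W, w ∈ ringGen 𝒲 K) (hP : P ∈ ringGen 𝒲 K) (hR : R ∈ ringGen 𝒲 K)
    (hD : D ∈ ringGen 𝒲 K) {x s : ℝ} (hx : 0 ≤ x) (hs : 0 ≤ s)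
    (hX : ∀ w ∈ W, |(w : ℝ)| ≤ Real.exp x)
    (hR0 : R ≠ 0) (hR4 : |(R : ℝ)| ≤ 4 * Real.exp x) (hPR : |(P : ℝ)| ≤ |(R : ℝ)|)
    (hsep : ∀ x' ∈ W, ∀ y ∈ W, ∀ x'' ∈ W, ∀ y' ∈ W, (x', y) ≠ (x'', y') →
        Real.exp (-(s * x)) * |(R : ℝ)| ≤ |(R : ℝ) * (x' - x'') + P * (y - y')|)
    (hD1 : Real.exp ((1 + s) * x + 2) ≤ D) (hD2 : (D : ℝ) ≤ Real.exp ((1 + 2 * s) * x + 2)) :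
    ∃ B : Finset ℤ, (∀ b ∈ B, b ∈ ringGen 𝒲 (K + 2 + 2 * k)) ∧
      (∀ b ∈ B, |(b : ℝ)| ≤ Real.exp (2 * x + 3 + k * ((1 + 2 * s) * x + 2))) ∧
      B.card = (W.card ^ 2) ^ k := by
  classical
  set V := (W ×ˢ W).image fun p => R * p.1 + P * p.2 with hV
  have hRpos : 0 < |(R : ℝ)| := abs_pos.mpr (by exact_mod_cast hR0)
  set θ := Real.exp (-(s * x)) with hθ
  have hθ0 : 0 < θ := Real.exp_pos _
  have hθ1 : θ ≤ 1 := by rw [hθ, Real.exp_le_one_iff]; nlinarith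
  have hinj : Set.InjOn (fun p : ℤ × ℤ => R * p.1 + P * p.2) (W ×ˢ W : Finset _) := by
    rintro ⟨a, b⟩ hp ⟨c, d⟩ hp' h
    simp only [Finset.coe_product, Set.mem_prod, Finset.mem_coe] at hp hp'
    by_contra hne
    have h1 := hsep a hp.1 b hp.2 c hp'.1 d hp'.2 hne
    have h2 : (R : ℝ) * (a - c) + P * (b - d) = 0 := by
      have : R * a + P * b = R * c + P * d := h
      have : (R : ℝ) * a + P * b = R * c + P * d := by exact_mod_cast this
      linarith
    rw [h2, abs_zero] at h1
    nlinarith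
  have hVc : V.card = W.card ^ 2 := by
    rw [hV, Finset.card_image_of_injOn hinj, Finset.card_product, sq]
  rw [← hVc]
  have hex : 1 ≤ Real.exp x := Real.one_le_exp hx
  have he2 : (7 : ℝ) ≤ Real.exp 2 := by
    have := Real.exp_one_gt_d9
    have e : Real.exp 2 = Real.exp 1 * Real.exp 1 := by rw [← Real.exp_add]; norm_num
    nlinarith
  have he3 : (8 : ℝ) ≤ Real.exp 3 := by
    have := Real.exp_one_gt_d9
    have e : Real.exp 3 = Real.exp 2 * Real.exp 1 := by rw [← Real.exp_add]; norm_num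
    nlinarith
  have hDθ : 7 * Real.exp x ≤ D * θ := by
    calc 7 * Real.exp x ≤ Real.exp 2 * Real.exp x := by gcongr
      _ = Real.exp ((1 + s) * x + 2) * θ := by
        rw [hθ, ← Real.exp_add, ← Real.exp_add]; congr 1; ring
      _ ≤ _ := by gcongr
  have hD2' : (2 : ℝ) ≤ D := by nlinarith
  refine digits_of_separated h0 (K := K + 2) (N := 2 * Real.exp x * |(R : ℝ)|)
    (μ := θ * |(R : ℝ)|) (D := D) ?_ (ringGen.mono (by omega) hD) ?_ (by positivity)
    (by positivity) ?_ ?_ (by exact_mod_cast hD2') ?_ hD2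
  · intro v hv
    obtain ⟨p, hp, rfl⟩ := Finset.mem_image.mp hv
    rw [Finset.mem_product] at hp
    exact ringGen.add_mem (ringGen.mul_mem hR (hW _ hp.1)) (ringGen.mul_mem hP (hW _ hp.2))
  · intro v hv
    obtain ⟨p, hp, rfl⟩ := Finset.mem_image.mp hv
    rw [Finset.mem_product] at hp
    push_cast
    calc |(R : ℝ) * p.1 + P * p.2| ≤ |(R : ℝ)| * |(p.1 : ℝ)| + |(P : ℝ)| * |(p.2 : ℝ)| := by
          rw [← abs_mul, ← abs_mul]; exact abs_add_le _ _
      _ ≤ |(R : ℝ)| * Real.exp x + |(R : ℝ)| * Real.exp x := by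
          gcongr
          · exact hX _ hp.1
          · exact hX _ hp.2
      _ = _ := by ring
  · intro v hv v' hv' hne
    obtain ⟨p, hp, rfl⟩ := Finset.mem_image.mp hv
    obtain ⟨p', hp', rfl⟩ := Finset.mem_image.mp hv'
    rw [Finset.mem_product] at hp hp'
    have := hsep p.1 hp.1 p.2 hp.2 p'.1 hp'.1 p'.2 hp'.2 fun h => hne (by
      rw [Prod.mk.injEq] at h; rw [h.1, h.2])
    refine this.trans (le_of_eq ?_)
    congr 1; push_cast; ring
  · nlinarith
  · calc 2 * Real.exp x * |(R : ℝ)| ≤ 2 * Real.exp x * (4 * Real.exp x) := by gcongr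
      _ = 8 * (Real.exp x * Real.exp x) := by ring
      _ ≤ Real.exp 3 * (Real.exp x * Real.exp x) := by gcongr
      _ = _ := by rw [← Real.exp_add, ← Real.exp_add]; congr 1; ring

lemma exp_three_bound : (16 : ℝ) ≤ Real.exp 3 ∧ (54 : ℝ) ≤ Real.exp 4 ∧ (20 : ℝ) ≤ Real.exp 3 := by
  have := Real.exp_one_gt_d9
  have e2 : Real.exp 2 = Real.exp 1 * Real.exp 1 := by rw [← Real.exp_add]; norm_num
  have e3 : Real.exp 3 = Real.exp 2 * Real.exp 1 := by rw [← Real.exp_add]; norm_num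
  have e4 : Real.exp 4 = Real.exp 3 * Real.exp 1 := by rw [← Real.exp_add]; norm_num
  have h2 : (7.38 : ℝ) ≤ Real.exp 2 := by rw [e2]; nlinarith
  have h3 : (20.05 : ℝ) ≤ Real.exp 3 := by rw [e3]; nlinarith
  refine ⟨by linarith, by rw [e4]; nlinarith, by linarith⟩

lemma exists_good_pairs {𝒲 : Set ℤ} (h0 : (0 : ℤ) ∈ 𝒲) {K k₂ : ℕ} (hk₂ : 1 ≤ k₂) {V₀ : Finset ℤ}
    {D₂ : ℤ} (hV₀ : ∀ w ∈ V₀, w ∈ ringGen 𝒲 K) (hD₂ : D₂ ∈ ringGen 𝒲 K)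
    {σ x₁ x₂ y₂ : ℝ} (hσ : 0 < σ) (hσ2 : σ ≤ 1 / 2) (hx₂ : 0 ≤ x₂)
    (hV₀X : ∀ w ∈ V₀, |(w : ℝ)| ≤ Real.exp x₂)
    (hV₀c : Real.exp (σ * x₂) ≤ V₀.card)
    (hD₂l : Real.exp (x₂ + 3) ≤ D₂) (hD₂u : (D₂ : ℝ) ≤ Real.exp y₂)
    (hx₁ : x₁ = x₂ + k₂ * y₂) :
    ∃ t : ℝ, 0 ≤ t ∧ t ≤ 1 ∧ ∃ P : Finset (ℤ × ℤ),
      (∀ p ∈ P, p.1 ∈ ringGen 𝒲 (K + 2 * k₂) ∧ p.2 ∈ ringGen 𝒲 (K + 2 * k₂) ∧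
        |(p.1 : ℝ)| ≤ Real.exp x₁ ∧ |(p.2 : ℝ)| ≤ Real.exp x₁) ∧
      Real.exp (σ * x₂ * (2 * k₂ - 2) - 3) ≤ P.card ∧
      ∀ p ∈ P, ∀ p' ∈ P, p ≠ p' →
        1 ≤ |((p.1 : ℝ) + t * p.2) - (p'.1 + t * p'.2)| := by
  classical
  obtain ⟨he16, he54, he20⟩ := exp_three_bound
  have hceil : ⌈Real.exp (σ * x₂)⌉₊ ≤ V₀.card := Nat.ceil_le.mpr hV₀c
  obtain ⟨V, hVV, hVc⟩ := Finset.exists_subset_card_eq hceil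
  have hVl : Real.exp (σ * x₂) ≤ V.card := by rw [hVc]; exact Nat.le_ceil _
  have hVu : (V.card : ℝ) ≤ 2 * Real.exp (x₂ / 2) := by
    rw [hVc]
    have h1 := (Nat.ceil_lt_add_one (Real.exp_pos (σ * x₂)).le).le
    have h2 : Real.exp (σ * x₂) ≤ Real.exp (x₂ / 2) := Real.exp_le_exp.mpr (by nlinarith)
    have h3 : 1 ≤ Real.exp (x₂ / 2) := Real.one_le_exp (by linarith)
    linarith
  have hV1 : (1 : ℝ) ≤ V.card := (Real.one_le_exp (by positivity)).trans hVl
  have hVX : ∀ v ∈ V, |(v : ℝ)| ≤ Real.exp x₂ := fun v hv => hV₀X v (hVV hv)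
  have hex₂ : 1 ≤ Real.exp x₂ := Real.one_le_exp hx₂
  have hD16 : 16 * Real.exp x₂ ≤ D₂ := by
    refine le_trans ?_ hD₂l
    rw [Real.exp_add, mul_comm]
    gcongr
  have hVD : 4 * (V.card : ℝ) ^ 2 ≤ D₂ := by
    refine le_trans ?_ hD16
    have : (V.card : ℝ) ^ 2 ≤ (2 * Real.exp (x₂ / 2)) ^ 2 := by gcongr
    have e : (2 * Real.exp (x₂ / 2)) ^ 2 = 4 * Real.exp x₂ := by
      rw [mul_pow, ← Real.exp_nat_mul]
      congr 1
      · norm_num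
      · congr 1; push_cast; ring
    linarith
  have hD₂2 : (2 : ℤ) ≤ D₂ := by
    have : (2 : ℝ) ≤ D₂ := by linarith
    exact_mod_cast this
  set B₁ := digitSet V D₂ k₂ with hB₁
  have hB₁K : ∀ b ∈ B₁, b ∈ ringGen 𝒲 (K + 2 * k₂) :=
    digitSet.subset_ringGen h0 (fun v hv => hV₀ v (hVV hv)) hD₂ k₂
  have hB₁X : ∀ b ∈ B₁, |(b : ℝ)| ≤ Real.exp x₁ := by
    intro b hb
    refine (digitSet.abs_le hVX (by positivity) hD₂2 k₂ b hb).trans ?_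
    have hD0 : (0 : ℝ) ≤ D₂ := by linarith
    have := pow_le_pow_left₀ hD0 hD₂u k₂
    rw [hx₁, Real.exp_add, Real.exp_nat_mul]
    gcongr
    linarith
  have hB₁c : (B₁.card : ℝ) = (V.card : ℝ) ^ k₂ := by
    rw [hB₁, digitSet_sep_one hVX (by linarith) k₂]; push_cast; rfl
  have hlogE := logEnergy_digitSet hVX hex₂ hD16 hVD k₂
  obtain ⟨t, ht0, ht1, P, hPB, hPc, hPs⟩ := exists_good_slope B₁ hB₁X hlogE (by
    rw [hB₁c, ← pow_mul]
    have : (V.card : ℝ) ^ (k₂ * 2) ≤ (V.card : ℝ) ^ (2 * k₂ + 2) :=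
      pow_le_pow_right₀ hV1 (by omega)
    have h0 : (0 : ℝ) ≤ (V.card : ℝ) ^ (2 * k₂ + 2) := by positivity
    linarith)
  have hPcard : Real.exp (σ * x₂ * (2 * k₂ - 2) - 3) ≤ P.card := by
    rw [hB₁c] at hPc
    have h2 : (V.card : ℝ) ^ (2 * k₂ + 2) * (V.card : ℝ) ^ (2 * k₂ - 2) ≤
        (V.card : ℝ) ^ (2 * k₂ + 2) * (20 * P.card) := by
      rw [← pow_add]
      refine le_trans (le_of_eq ?_) (hPc.trans (le_of_eq (by ring)))
      rw [← pow_mul]; congr 1; omega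
    have h3 := le_of_mul_le_mul_left h2 (by positivity)
    have h4 : Real.exp (σ * x₂ * (2 * k₂ - 2)) ≤ (V.card : ℝ) ^ (2 * k₂ - 2) := by
      have := pow_le_pow_left₀ (Real.exp_pos _).le hVl (2 * k₂ - 2)
      rw [← Real.exp_nat_mul] at this
      refine le_trans (le_of_eq ?_) this
      congr 1
      rw [Nat.cast_sub (by omega)]; push_cast; ring
    rw [Real.exp_sub, div_le_iff₀ (Real.exp_pos _)]
    have : (0 : ℝ) ≤ P.card := by positivity
    nlinarith
  exact ⟨t, ht0, ht1, P, fun p hp =>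
    have hp' := Finset.mem_product.mp (hPB hp)
    ⟨hB₁K _ hp'.1, hB₁K _ hp'.2, hB₁X _ hp'.1, hB₁X _ hp'.2⟩, hPcard, hPs⟩

lemma sep_of_approx {P : Finset (ℤ × ℤ)} {X t θ : ℝ} {β β' : ℤ} (ht0 : 0 ≤ t) (ht1 : t ≤ 1)
    (hβ'0 : β' ≠ 0) (hX : 1 ≤ X) (hθ0 : 0 < θ) (hθ : 12 * (θ * X) ≤ 1)
    (hP : ∀ p ∈ P, |(p.1 : ℝ)| ≤ X ∧ |(p.2 : ℝ)| ≤ X)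
    (hPs : ∀ p ∈ P, ∀ p' ∈ P, p ≠ p' → 1 ≤ |((p.1 : ℝ) + t * p.2) - (p'.1 + t * p'.2)|)
    (hξt : |(β / β' : ℝ) - t| ≤ 3 * θ) :
    |(β : ℝ)| ≤ 2 * |(β' : ℝ)| ∧ ∀ p ∈ P, ∀ p' ∈ P, p ≠ p' →
      |(β' : ℝ)| / 2 ≤ |((β' * p.1 + β * p.2 : ℤ) : ℝ) - ((β' * p'.1 + β * p'.2 : ℤ) : ℝ)| := by
  have hβ'r : (β' : ℝ) ≠ 0 := by exact_mod_cast hβ'0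
  have hβ'pos : 0 < |(β' : ℝ)| := abs_pos.mpr hβ'r
  have hθ' : 12 * θ ≤ 1 := by nlinarith
  obtain ⟨r, hr⟩ : ∃ r : ℝ, r = β / β' := ⟨_, rfl⟩
  have hβr : (β : ℝ) = β' * r := by rw [hr]; field_simp
  rw [← hr] at hξt
  constructor
  · have h5 : |r| ≤ 2 := by
      rw [abs_le] at hξt ⊢
      constructor <;> linarith
    rw [hβr, abs_mul]
    nlinarith
  · intro p hp p' hp' hne
    have h5 := hPs p hp p' hp' hne
    have hp2 := (hP p hp).2
    have hp2' := (hP p' hp').2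
    have h6 : |(r - t) * ((p.2 : ℝ) - p'.2)| ≤ 1 / 2 := by
      rw [abs_mul]
      have h7 : |(p.2 : ℝ) - p'.2| ≤ 2 * X := by
        have := abs_sub (p.2 : ℝ) p'.2
        linarith
      have := mul_le_mul hξt h7 (abs_nonneg _) (by positivity)
      linarith
    have e : ((β' * p.1 + β * p.2 : ℤ) : ℝ) - ((β' * p'.1 + β * p'.2 : ℤ) : ℝ) =
        β' * ((((p.1 : ℝ) + t * p.2) - (p'.1 + t * p'.2)) + (r - t) * ((p.2 : ℝ) - p'.2)) := by
      push_cast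
      rw [hβr]
      ring
    rw [e, abs_mul]
    have h8 : (1 : ℝ) / 2 ≤ |(((p.1 : ℝ) + t * p.2) - (p'.1 + t * p'.2)) +
        (r - t) * ((p.2 : ℝ) - p'.2)| := by
      have h9 := abs_sub_abs_le_abs_sub (((p.1 : ℝ) + t * p.2) - (p'.1 + t * p'.2))
        (-((r - t) * ((p.2 : ℝ) - p'.2)))
      rw [abs_neg, sub_neg_eq_add] at h9
      linarith
    nlinarith

/-- The case of the doubling step in which the quotient set of `W` is dense. -/
lemma doubling_dense {𝒲 : Set ℤ} (h0 : (0 : ℤ) ∈ 𝒲) {K k k₂ : ℕ} (hk₂ : 1 ≤ k₂) {W V₀ : Finset ℤ}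
    {D₁ D₂ : ℤ}
    (hW : ∀ w ∈ W, w ∈ ringGen 𝒲 K) (hV₀ : ∀ w ∈ V₀, w ∈ ringGen 𝒲 K)
    (hD₁ : D₁ ∈ ringGen 𝒲 K) (hD₂ : D₂ ∈ ringGen 𝒲 K)
    {σ x x₁ x₂ s y₁ y₂ : ℝ} (hσ : 0 < σ) (hσ2 : σ ≤ 1 / 2) (hx₂ : 0 ≤ x₂)
    (hWX : ∀ w ∈ W, |(w : ℝ)| ≤ Real.exp x) (hV₀X : ∀ w ∈ V₀, |(w : ℝ)| ≤ Real.exp x₂)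
    (hV₀c : Real.exp (σ * x₂) ≤ V₀.card)
    (hdense : ∀ t : ℝ, 0 ≤ t → t ≤ 1 → ∃ ξ, IsQuot W ξ ∧ |ξ - t| ≤ 3 * Real.exp (-(s * x)))
    (hD₂l : Real.exp (x₂ + 3) ≤ D₂) (hD₂u : (D₂ : ℝ) ≤ Real.exp y₂)
    (hx₁ : x₁ = x₂ + k₂ * y₂) (hx₁s : x₁ + 3 ≤ s * x)
    (hD₁l : Real.exp (x₁ + 4) ≤ D₁) (hD₁u : (D₁ : ℝ) ≤ Real.exp y₁) :
    ∃ B : Finset ℤ, (∀ b ∈ B, b ∈ ringGen 𝒲 (K + 2 * k₂ + 3 + 2 * k)) ∧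
      (∀ b ∈ B, |(b : ℝ)| ≤ Real.exp (x₁ + x + 3 + k * y₁)) ∧
      Real.exp (k * (σ * x₂ * (2 * k₂ - 2) - 3)) ≤ B.card := by
  classical
  obtain ⟨he16, he54, he20⟩ := exp_three_bound
  obtain ⟨t, ht0, ht1, P, hPK, hPcard, hPs⟩ := exists_good_pairs h0 hk₂ hV₀ hD₂ hσ hσ2 hx₂ hV₀X
    hV₀c hD₂l hD₂u hx₁
  obtain ⟨ξ, ⟨w₁, h1, w₂, h2, w₃, h3, w₄, h4, h34, rfl⟩, hξt⟩ := hdense t ht0 ht1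
  obtain ⟨β, hβ⟩ : ∃ β, β = w₁ - w₂ := ⟨_, rfl⟩
  obtain ⟨β', hβ'⟩ : ∃ β', β' = w₃ - w₄ := ⟨_, rfl⟩
  have hβ'0 : β' ≠ 0 := hβ' ▸ sub_ne_zero.mpr h34
  have hβ'r : (β' : ℝ) ≠ 0 := by exact_mod_cast hβ'0
  have hβ'pos : 0 < |(β' : ℝ)| := abs_pos.mpr hβ'r
  have eβ : (w₁ : ℝ) - w₂ = β := by rw [hβ]; push_cast; rfl
  have eβ' : (w₃ : ℝ) - w₄ = β' := by rw [hβ']; push_cast; rfl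
  rw [eβ, eβ'] at hξt
  have hex₁ : 1 ≤ Real.exp x₁ := by
    apply Real.one_le_exp
    have hy₂ : 0 ≤ y₂ := by
      have h5 : Real.exp (x₂ + 3) ≤ Real.exp y₂ := hD₂l.trans hD₂u
      have := Real.exp_le_exp.mp h5
      linarith
    rw [hx₁]; positivity
  have hθ : 12 * (Real.exp (-(s * x)) * Real.exp x₁) ≤ 1 := by
    have : Real.exp 3 * (Real.exp (-(s * x)) * Real.exp x₁) ≤ 1 := by
      rw [← Real.exp_add, ← Real.exp_add, Real.exp_le_one_iff]; linarith
    have h0 : 0 ≤ Real.exp (-(s * x)) * Real.exp x₁ := by positivity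
    nlinarith
  obtain ⟨hβle, hsep⟩ := sep_of_approx ht0 ht1 hβ'0 hex₁ (Real.exp_pos _) hθ
    (fun p hp => (hPK p hp).2.2) hPs hξt
  obtain ⟨V', hV'⟩ : ∃ V', V' = P.image fun p => β' * p.1 + β * p.2 := ⟨_, rfl⟩
  have hV'c : V'.card = P.card := by
    rw [hV']
    apply Finset.card_image_of_injOn
    intro p hp p' hp' h
    by_contra hne
    have h5 := hsep p hp p' hp' hne
    simp only at h
    rw [h, sub_self, abs_zero] at h5
    linarith
  have hD₁54 : 54 * Real.exp x₁ ≤ D₁ := by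
    refine le_trans ?_ hD₁l
    rw [Real.exp_add, mul_comm]
    gcongr
  obtain ⟨B, hB1, hB2, hB3⟩ := digits_of_separated h0 (K := K + 2 * k₂ + 3) (k := k) (V := V')
    (D := D₁) (N := 3 * Real.exp x₁ * |(β' : ℝ)|) (μ := |(β' : ℝ)| / 2) (x := x₁ + x + 3) (y := y₁)
    (by
      intro v hv
      rw [hV'] at hv
      obtain ⟨p, hp, rfl⟩ := Finset.mem_image.mp hv
      have hp' := hPK p hp
      have m1 : β ∈ ringGen 𝒲 (K + 2 * k₂ + 1) :=
        hβ ▸ ringGen.mono (by omega) (ringGen.sub_mem (hW _ h1) (hW _ h2))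
      have m2 : β' ∈ ringGen 𝒲 (K + 2 * k₂ + 1) :=
        hβ' ▸ ringGen.mono (by omega) (ringGen.sub_mem (hW _ h3) (hW _ h4))
      exact ringGen.add_mem (ringGen.mul_mem m2 (ringGen.subset_succ _ hp'.1))
        (ringGen.mul_mem m1 (ringGen.subset_succ _ hp'.2.1)))
    (ringGen.mono (by omega) hD₁)
    (by
      intro v hv
      rw [hV'] at hv
      obtain ⟨p, hp, rfl⟩ := Finset.mem_image.mp hv
      have hp' := hPK p hp
      push_cast
      calc |(β' : ℝ) * p.1 + β * p.2| ≤ |(β' : ℝ)| * |(p.1 : ℝ)| + |(β : ℝ)| * |(p.2 : ℝ)| := by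
            rw [← abs_mul, ← abs_mul]; exact abs_add_le _ _
        _ ≤ |(β' : ℝ)| * Real.exp x₁ + 2 * |(β' : ℝ)| * Real.exp x₁ := by
            gcongr
            · exact hp'.2.2.1
            · exact hp'.2.2.2
        _ = _ := by ring)
    (by positivity) (by positivity)
    (by
      intro v hv v' hv' hne
      rw [hV'] at hv
      obtain ⟨p, hp, rfl⟩ := Finset.mem_image.mp hv
      rw [hV'] at hv'
      obtain ⟨p', hp', rfl⟩ := Finset.mem_image.mp hv'
      exact hsep p hp p' hp' fun h => hne (by rw [h]))
    (by nlinarith)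
    (by
      have : (2 : ℝ) ≤ D₁ := by linarith
      exact_mod_cast this)
    (by
      have hβ'u : |(β' : ℝ)| ≤ 2 * Real.exp x := by
        have := hWX _ h3
        have := hWX _ h4
        rw [← eβ']
        rw [abs_le] at *
        constructor <;> linarith
      calc 3 * Real.exp x₁ * |(β' : ℝ)| ≤ 3 * Real.exp x₁ * (2 * Real.exp x) := by gcongr
        _ = 6 * (Real.exp x₁ * Real.exp x) := by ring
        _ ≤ Real.exp 3 * (Real.exp x₁ * Real.exp x) := by gcongr; linarith
        _ = _ := by rw [← Real.exp_add, ← Real.exp_add]; congr 1; ring)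
    hD₁u
  refine ⟨B, hB1, hB2, ?_⟩
  rw [hB3, hV'c, Real.exp_nat_mul]
  push_cast
  gcongr

lemma gap_numerics {s x σ k₁ : ℝ} (hs : 0 < s) (hs1 : s ≤ 1) (hσ : 0 < σ) (hx : 9 ≤ s * x)
    (hk₁ : 10 ≤ s * k₁) :
    2 * σ * (1 - s) * (2 * x + 3 + k₁ * ((1 + 2 * (s / 10)) * x + 2)) ≤ k₁ * (2 * (σ * x)) := by
  have hx0 : 0 < x := by nlinarith
  have hk0 : 0 < k₁ := by nlinarith
  have h : (1 - s) * (2 * x + 3 + k₁ * ((1 + 2 * (s / 10)) * x + 2)) ≤ k₁ * x := by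
    have h1 : 2 * x ≤ s / 5 * k₁ * x := by nlinarith
    have h2 : 2 * k₁ + 3 ≤ 3 / 5 * (s * x) * k₁ := by nlinarith
    have h3 : (1 - s) * (2 * x + 3 + 2 * k₁) ≤ 2 * x + 3 + 2 * k₁ := by nlinarith
    have h4 : (1 - s) * (1 + 2 * (s / 10)) ≤ 1 - 4 / 5 * s := by nlinarith
    have h5 : (1 - s) * (1 + 2 * (s / 10)) * (k₁ * x) ≤ (1 - 4 / 5 * s) * (k₁ * x) := by gcongr
    nlinarith
  nlinarith

lemma dense_numerics {s x x₁ x₂ y₁ σ k₁ k₂ : ℝ} (hs : 0 < s) (hs1 : s ≤ 1) (hσ : 0 < σ)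
    (hk₁ : 0 ≤ k₁) (hk₂ : 10 ≤ s * k₂) (hx₂ : 6 * k₂ + 4 + 3 / (2 * σ) ≤ 3 * x₂)
    (hx : x₁ + x + 3 ≤ k₁ * x₂) (hx₁ : x₁ = x₂ + k₂ * ((1 + s / 10) * x₂ + 3))
    (hy₁ : y₁ = (1 + s / 10) * x₁ + 4) :
    2 * σ * (1 - s) * (x₁ + x + 3 + k₁ * y₁) ≤ k₁ * (σ * x₂ * (2 * k₂ - 2) - 3) := by
  have hk0 : 0 < k₂ := by nlinarith
  have hd : 0 < 3 / (2 * σ) := by positivity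
  have hx0 : 0 < x₂ := by nlinarith
  have key : (1 - s) * (x₂ + y₁) ≤ (k₂ - 1) * x₂ - 3 / (2 * σ) := by
    have h1 : y₁ ≤ 2 * x₂ + k₂ * (1 + 3 * (s / 10)) * x₂ + 6 * k₂ + 4 := by
      rw [hy₁, hx₁]
      have : (1 + s / 10) * (1 + s / 10) ≤ 1 + 3 * (s / 10) := by nlinarith
      have h2 : (1 + s / 10) * (1 + s / 10) * (k₂ * x₂) ≤ (1 + 3 * (s / 10)) * (k₂ * x₂) := by
        gcongr
      nlinarith
    have h2 : (1 - s) * (x₂ + y₁) ≤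
        (1 - s) * (3 * x₂ + k₂ * (1 + 3 * (s / 10)) * x₂ + 6 * k₂ + 4) := by
      apply mul_le_mul_of_nonneg_left _ (by linarith)
      linarith
    have h3 : (1 - s) * (3 * x₂ + 6 * k₂ + 4) ≤ 3 * x₂ + 6 * k₂ + 4 := by nlinarith
    have h4 : (1 - s) * (1 + 3 * (s / 10)) * (k₂ * x₂) ≤ (1 - 7 / 10 * s) * (k₂ * x₂) := by
      apply mul_le_mul_of_nonneg_right _ (by positivity)
      nlinarith
    have h5 : 7 * x₂ ≤ 7 / 10 * s * (k₂ * x₂) := by nlinarith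
    nlinarith
  have h6 : (1 - s) * (x₁ + x + 3 + k₁ * y₁) ≤ k₁ * ((k₂ - 1) * x₂ - 3 / (2 * σ)) := by
    calc (1 - s) * (x₁ + x + 3 + k₁ * y₁) ≤ (1 - s) * (k₁ * (x₂ + y₁)) := by
          apply mul_le_mul_of_nonneg_left _ (by linarith)
          linarith
      _ = k₁ * ((1 - s) * (x₂ + y₁)) := by ring
      _ ≤ _ := by gcongr
  have h7 : 2 * σ * (k₁ * ((k₂ - 1) * x₂ - 3 / (2 * σ))) =
      k₁ * (σ * x₂ * (2 * k₂ - 2) - 3) := by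
    field_simp
  calc 2 * σ * (1 - s) * (x₁ + x + 3 + k₁ * y₁) = 2 * σ * ((1 - s) * (x₁ + x + 3 + k₁ * y₁)) := by
        ring
    _ ≤ 2 * σ * (k₁ * ((k₂ - 1) * x₂ - 3 / (2 * σ))) := by gcongr
    _ = _ := h7

set_option maxHeartbeats 1000000 in
lemma richAt_double_of_scales {𝒲 : Set ℤ} (h0 : (0 : ℤ) ∈ 𝒲) (h1 : (1 : ℤ) ∈ 𝒲) {σ s M : ℝ}
    {k k₁ k₂ J : ℕ} (hσ : 0 < σ) (hσ2 : σ ≤ 1 / 2) (hs : 0 < s) (hs1 : s ≤ 1) (hM : 1 ≤ M)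
    {t t₂ tb : ℝ} (ht₂ : 2 * M * (1 + 2 * k₂) * t₂ = s / 10 * t) (htb : 2 * M * tb = s / 10 * t₂)
    (hk₂ : 10 ≤ s * k₂) (hk₁ : 10 ≤ s * k₁) (hk₁' : 2 * M * t ≤ k₁ * t₂)
    (hJ : 2 * (4 * M * t / (σ * tb) + 1) ≤ J)
    (hbig : 6 * k₂ + 4 + 3 / (2 * σ) ≤ tb) (hbig2 : 9 ≤ s * tb) (hbig3 : 4 ≤ σ * tb)
    (hRt : RichAt 𝒲 σ M k t) (hRt₂ : RichAt 𝒲 σ M k t₂) (hRb : RichAt 𝒲 σ M k tb) :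
    RichAt 𝒲 (2 * σ * (1 - s)) ((5 + 5 * k₁) * M) (k + J + 2 * k₂ + 2 * k₁ + 4) t := by
  have hk₂0 : (0 : ℝ) ≤ k₂ := by positivity
  have hd : 0 < 3 / (2 * σ) := by positivity
  have htb9 : 9 ≤ tb := by nlinarith only [hbig2, hs, hs1]
  have ht₂9 : tb ≤ t₂ := by nlinarith only [htb, htb9, hs, hs1, hM]
  have ht9 : t₂ ≤ t := by
    have : t₂ ≤ 2 * M * (1 + 2 * k₂) * t₂ := by
      have : 1 ≤ M * (1 + 2 * k₂) := by nlinarith only [hM, hk₂0]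
      nlinarith only [this, ht₂9, htb9]
    nlinarith only [this, ht₂, hs, hs1, ht₂9, htb9]
  have hbase := fun y : ℝ => fun (hy0 : 0 ≤ y) (hy : y ≤ 4 * M * t) =>
    exists_base h1 hσ hRb hbig3 hy0 J (le_trans (by gcongr) hJ)
  obtain ⟨x, htx, hxM, W, hWk, hWx, hWc⟩ := hRt
  obtain ⟨x₂, htx₂, hxM₂, V₀, hVk, hVx, hVc⟩ := hRt₂
  have hx0 : 0 < x := by linarith
  have hx₂0 : 0 < x₂ := by linarith
  have hst : s / 10 * t ≤ s / 10 * x := by gcongr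
  have hst' : s / 10 * t₂ ≤ s / 10 * t := by gcongr
  have hsx : s / 10 * x ≤ x / 10 := by nlinarith only [hs1, hx0]
  have hsxb : s * tb ≤ s * x := mul_le_mul_of_nonneg_left (by linarith) hs.le
  have hMt : t ≤ M * t := by nlinarith only [hM, ht9, ht₂9, htb9]
  have hW2 : 2 ≤ W.card := by
    have h2 : (2 : ℝ) ≤ Real.exp (σ * x) := by
      have := Real.add_one_le_exp (σ * x)
      have : σ * tb ≤ σ * x := mul_le_mul_of_nonneg_left (by linarith) hσ.le
      linarith
    exact_mod_cast h2.trans hWc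
  rcases gap_or_dense (K := k + J) (fun w hw => ringGen.mono (by omega) (hWk w hw)) hWx hW2
      (θ := Real.exp (-(s / 10 * x))) (Real.exp_pos _)
      (by rw [Real.exp_le_one_iff, neg_nonpos]; positivity) with
    ⟨P, R, hP, hR, hR0, hR4, hPR, hsep⟩ | hdense
  · obtain ⟨D, hDk, hD1, hD2⟩ := hbase ((1 + s / 10) * x + 2) (by positivity) (by linarith)
    obtain ⟨B, hB1, hB2, hB3⟩ := doubling_gap h0 (k := k₁)
      (fun w hw => ringGen.mono (Nat.le_add_right k (J + 2)) (hWk w hw)) hP hR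
      (ringGen.mono (Nat.le_add_right (k + J) 2) hDk) hx0.le (by positivity : 0 ≤ s / 10) hWx hR0
      hR4 hPR hsep hD1 (hD2.trans (Real.exp_le_exp.mpr (by linarith)))
    refine ⟨_, ?_, ?_, B, fun b hb => ringGen.mono (by omega) (hB1 b hb), hB2, ?_⟩
    · have : 0 ≤ (k₁ : ℝ) * ((1 + 2 * (s / 10)) * x + 2) := by positivity
      linarith
    · have hk0 : (0 : ℝ) ≤ k₁ := by positivity
      have e1 : (1 + 2 * (s / 10)) * x + 2 ≤ 5 * x := by linarith
      have e2 : (k₁ : ℝ) * ((1 + 2 * (s / 10)) * x + 2) ≤ k₁ * (5 * x) := by gcongr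
      calc _ ≤ (5 + 5 * k₁) * x := by linarith
        _ ≤ (5 + 5 * k₁) * (M * t) := by gcongr
        _ = _ := by ring
    · rw [hB3]
      push_cast
      calc _ ≤ Real.exp (k₁ * (2 * (σ * x))) :=
            Real.exp_le_exp.mpr (gap_numerics hs hs1 hσ (by linarith) hk₁)
        _ = ((Real.exp (σ * x)) ^ 2) ^ k₁ := by
            rw [Real.exp_nat_mul, ← Real.exp_nat_mul (σ * x) 2]; norm_num
        _ ≤ _ := by gcongr
  · have hk₂1 : 1 ≤ k₂ := by
      have : 0 < (k₂ : ℝ) := by nlinarith only [hk₂, hs, hk₂0]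
      exact_mod_cast this
    have hsx₂ : s / 10 * x₂ ≤ x₂ / 10 := by nlinarith only [hs1, hx₂0]
    have hst₂ : s / 10 * t₂ ≤ s / 10 * x₂ := by gcongr
    have hxx : (1 + 2 * k₂) * x₂ ≤ s / 10 * x / 2 := by
      have : (1 + 2 * k₂) * x₂ ≤ (1 + 2 * k₂) * (M * t₂) := by gcongr
      linarith
    obtain ⟨x₁, hx₁⟩ : ∃ x₁, x₁ = x₂ + k₂ * ((1 + s / 10) * x₂ + 3) := ⟨_, rfl⟩
    have hx₁0 : x₂ ≤ x₁ := by
      have : 0 ≤ (k₂ : ℝ) * ((1 + s / 10) * x₂ + 3) := by positivity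
      linarith
    have hx₁s : x₁ + 3 ≤ s / 10 * x := by
      have e1 : (k₂ : ℝ) * ((1 + s / 10) * x₂ + 3) ≤ k₂ * (2 * x₂ + 3) := by
        gcongr; linarith
      linarith
    have hx₂x : x₂ + 3 ≤ 4 * M * t := by
      have : 0 ≤ (k₂ : ℝ) * x₂ := by positivity
      linarith
    have hsx₁ : s / 10 * x₂ ≤ s / 10 * x₁ := by gcongr
    obtain ⟨D₂, hD₂k, hD₂1, hD₂2⟩ := hbase (x₂ + 3) (by positivity) hx₂x
    obtain ⟨D₁, hD₁k, hD₁1, hD₁2⟩ := hbase (x₁ + 4) (by linarith) (by linarith)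
    obtain ⟨B, hB1, hB2, hB3⟩ := doubling_dense h0 (k := k₁) (K := k + J) hk₂1
      (y₂ := (1 + s / 10) * x₂ + 3) (y₁ := (1 + s / 10) * x₁ + 4)
      (fun w hw => ringGen.mono (by omega) (hWk w hw))
      (fun w hw => ringGen.mono (by omega) (hVk w hw)) hD₁k hD₂k hσ hσ2 hx₂0.le hWx hVx hVc hdense
      hD₂1 (hD₂2.trans (Real.exp_le_exp.mpr (by linarith))) hx₁ hx₁s hD₁1
      (hD₁2.trans (Real.exp_le_exp.mpr (by linarith)))
    have hk0 : (0 : ℝ) ≤ k₁ := by positivity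
    refine ⟨_, ?_, ?_, B, fun b hb => ringGen.mono (by omega) (hB1 b hb), hB2, ?_⟩
    · have : 0 ≤ (k₁ : ℝ) * ((1 + s / 10) * x₁ + 4) := by
        have : 0 ≤ x₁ := by linarith
        positivity
      linarith
    · have e0 : s / 10 * x₁ ≤ x₁ / 10 := by nlinarith only [hs1, hx₁0, hx₂0]
      have e1 : (1 + s / 10) * x₁ + 4 ≤ 5 * x := by linarith
      have e2 : (k₁ : ℝ) * ((1 + s / 10) * x₁ + 4) ≤ k₁ * (5 * x) := by gcongr
      calc _ ≤ (5 + 5 * k₁) * x := by linarith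
        _ ≤ (5 + 5 * k₁) * (M * t) := by gcongr
        _ = _ := by ring
    · refine le_trans (Real.exp_le_exp.mpr ?_) hB3
      refine dense_numerics hs hs1 hσ hk0 hk₂ (by linarith) ?_ hx₁ rfl
      have : (k₁ : ℝ) * t₂ ≤ k₁ * x₂ := by gcongr
      linarith

lemma richAt_double {σ s M : ℝ} (k : ℕ) (hσ : 0 < σ) (hσ2 : σ ≤ 1 / 2) (hs : 0 < s) (hs1 : s ≤ 1)
    (hM : 1 ≤ M) : ∃ (k' : ℕ) (M' c t₀ : ℝ), 1 ≤ M' ∧ 1 ≤ c ∧ 0 < t₀ ∧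
      ∀ 𝒲 : Set ℤ, (0 : ℤ) ∈ 𝒲 → (1 : ℤ) ∈ 𝒲 → ∀ t, t₀ ≤ t →
        (∀ t', t / c ≤ t' → t' ≤ t → RichAt 𝒲 σ M k t') →
        RichAt 𝒲 (2 * σ * (1 - s)) M' k' t := by
  obtain ⟨k₂, hk₂⟩ := exists_nat_ge (10 / s)
  rw [div_le_iff₀' hs] at hk₂
  have hk₂0 : (0 : ℝ) ≤ k₂ := by positivity
  obtain ⟨a, ha⟩ : ∃ a : ℝ, a = 2 * M * (1 + 2 * k₂) * (10 / s) := ⟨_, rfl⟩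
  obtain ⟨b, hb⟩ : ∃ b : ℝ, b = 2 * M * (10 / s) := ⟨_, rfl⟩
  have hs10 : 1 ≤ 10 / s := by rw [le_div_iff₀ hs]; linarith
  have hb1 : 1 ≤ b := by rw [hb]; nlinarith only [hM, hs10]
  have ha1 : 1 ≤ a := by
    have : a = b * (1 + 2 * k₂) := by rw [ha, hb]; ring
    rw [this]; nlinarith only [hb1, hk₂0]
  obtain ⟨k₁, hk₁⟩ := exists_nat_ge (10 / s + 2 * M * a)
  have hk₁a : 10 ≤ s * k₁ := by
    rw [← div_le_iff₀' hs]
    have : 0 ≤ 2 * M * a := by positivity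
    linarith
  have hk₁b : 2 * M * a ≤ k₁ := by
    have : 0 ≤ 10 / s := by positivity
    linarith
  obtain ⟨J, hJ⟩ := exists_nat_ge (2 * (4 * M * (a * b) / σ + 1))
  have hd : 0 < 3 / (2 * σ) := by positivity
  obtain ⟨Z, hZ⟩ : ∃ Z : ℝ, Z = 6 * k₂ + 4 + 3 / (2 * σ) + 9 / s + 4 / σ := ⟨_, rfl⟩
  have hZ0 : 0 < Z := by rw [hZ]; positivity
  refine ⟨k + J + 2 * k₂ + 2 * k₁ + 4, (5 + 5 * k₁) * M, a * b, a * b * Z, ?_, ?_, by positivity,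
    fun 𝒲 h0 h1 t ht H => ?_⟩
  · have : (0 : ℝ) ≤ k₁ := by positivity
    nlinarith only [this, hM]
  · nlinarith only [ha1, hb1]
  have ha0 : 0 < a := by linarith
  have hb0 : 0 < b := by linarith
  have htb : Z ≤ t / (a * b) := by rw [le_div_iff₀ (by positivity)]; linarith
  have ht0 : 0 < t := lt_of_lt_of_le (by positivity) ht
  have hab : t / (a * b) ≤ t / a := by
    apply div_le_div_of_nonneg_left ht0.le ha0; nlinarith only [ha0, hb1]
  have hat : t / a ≤ t := div_le_self ht0.le ha1
  have p1 : 0 < 9 / s := by positivity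
  have p2 : 0 < 4 / σ := by positivity
  refine richAt_double_of_scales h0 h1 hσ hσ2 hs hs1 hM (t₂ := t / a) (tb := t / (a * b))
    ?_ ?_ hk₂ hk₁a
    ?_ ?_ ?_ ?_ ?_ (H _ (hab.trans hat) le_rfl) (H _ hab hat) (H _ le_rfl (hab.trans hat))
  · rw [ha]; field_simp
  · rw [hb]; field_simp
  · rw [← mul_div_assoc, le_div_iff₀ ha0]
    nlinarith only [hk₁b, ht0]
  · refine le_trans (le_of_eq ?_) hJ
    field_simp
  · linarith
  · rw [← div_le_iff₀' hs]; linarith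
  · rw [← div_le_iff₀' hσ]; linarith

/-- Iterating the doubling step from density `2⁻ʰ (1 - s)ʰ`-ish up to density close to one. -/
lemma richAt_iterate {s : ℝ} (hs : 0 < s) (hs1 : s < 1) (h : ℕ) {M : ℝ} (k : ℕ) (hM : 1 ≤ M)
    {σ : ℝ} (hσ : 0 < σ) (hσh : 2 ^ h * σ ≤ 1) : ∃ (k' : ℕ) (M' c t₀ : ℝ), 1 ≤ M' ∧ 1 ≤ c ∧ 0 < t₀ ∧
      ∀ 𝒲 : Set ℤ, (0 : ℤ) ∈ 𝒲 → (1 : ℤ) ∈ 𝒲 → ∀ t, t₀ ≤ t →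
        (∀ t', t / c ≤ t' → t' ≤ t → RichAt 𝒲 σ M k t') →
        RichAt 𝒲 ((2 * (1 - s)) ^ h * σ) M' k' t := by
  induction h with
  | zero =>
    refine ⟨k, M, 1, 1, hM, le_rfl, one_pos, fun 𝒲 _ _ t _ H => ?_⟩
    simpa using H t (by simp) le_rfl
  | succ h ih =>
    have hσh' : 2 ^ h * σ ≤ 1 / 2 := by rw [pow_succ] at hσh; linarith
    obtain ⟨k₁, M₁, c₁, t₁, hM₁, hc₁, ht₁, H₁⟩ := ih (by linarith)
    have hs0 : 0 < 1 - s := by linarith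
    have hσ' : (2 * (1 - s)) ^ h * σ ≤ 1 / 2 := by
      refine le_trans ?_ hσh'
      gcongr
      linarith
    obtain ⟨k₂, M₂, c₂, t₂, hM₂, hc₂, ht₂, H₂⟩ := richAt_double (M := M₁) k₁
      (by positivity : 0 < (2 * (1 - s)) ^ h * σ) hσ' hs hs1.le hM₁
    refine ⟨k₂, M₂, c₁ * c₂, t₂ + c₂ * t₁, hM₂, by nlinarith only [hc₁, hc₂], by positivity,
      fun 𝒲 h0 h1 t ht H => ?_⟩
    have hc₁0 : 0 < c₁ := by linarith
    have hc₂0 : 0 < c₂ := by linarith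
    have ht0 : c₂ * t₁ ≤ t := by linarith
    have e : (2 * (1 - s)) ^ (h + 1) * σ = 2 * ((2 * (1 - s)) ^ h * σ) * (1 - s) := by
      rw [pow_succ]; ring
    rw [e]
    refine H₂ 𝒲 h0 h1 t (le_trans (by nlinarith) ht) fun t' h1' h2' => ?_
    have ht' : t ≤ t' * c₂ := by rwa [div_le_iff₀ hc₂0] at h1'
    refine H₁ 𝒲 h0 h1 t' (by nlinarith only [ht', ht0, hc₂0]) fun t'' h1'' h2'' =>
      H t'' ?_ (h2''.trans h2')
    rw [div_le_iff₀ (by positivity)]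
    rw [div_le_iff₀ hc₁0] at h1''
    nlinarith only [ht', h1'', hc₂0]

lemma RichAt.mono {𝒲 : Set ℤ} {σ σ' M : ℝ} {k : ℕ} {t : ℝ} (hσ : σ' ≤ σ) (ht : 0 ≤ t)
    (h : RichAt 𝒲 σ M k t) : RichAt 𝒲 σ' M k t := by
  obtain ⟨x, htx, hxM, W, h1, h2, h3⟩ := h
  exact ⟨x, htx, hxM, W, h1, h2, (Real.exp_le_exp.mpr (by nlinarith)).trans h3⟩

/-- Archimedean sum-product theorem: polynomially rich sets of integers at all scales generate, in
boundedly many ring operations, sets of density exponent arbitrarily close to one. -/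
theorem richAt_near_one {σ τ M : ℝ} (k : ℕ) (hσ : 0 < σ) (hτ : 0 < τ) (hM : 1 ≤ M) :
    ∃ (k' : ℕ) (M' c t₀ : ℝ), 1 ≤ M' ∧ 1 ≤ c ∧ 0 < t₀ ∧
      ∀ 𝒲 : Set ℤ, (0 : ℤ) ∈ 𝒲 → (1 : ℤ) ∈ 𝒲 → ∀ t, t₀ ≤ t →
        (∀ t', t / c ≤ t' → t' ≤ t → RichAt 𝒲 σ M k t') → RichAt 𝒲 (1 - τ) M' k' t := by
  obtain ⟨h, hh⟩ := exists_pow_lt_of_lt_one hσ (by norm_num : (1 / 2 : ℝ) < 1)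
  obtain ⟨s, hs0, hs1, hs⟩ : ∃ s : ℝ, 0 < s ∧ s < 1 ∧ 1 - τ ≤ (1 - s) ^ h := by
    refine ⟨min (1 / 2) (τ / (h + 1)), by positivity, by
      exact lt_of_le_of_lt (min_le_left _ _) (by norm_num), ?_⟩
    have h1 := one_add_mul_le_pow (a := -min (1 / 2) (τ / (h + 1)))
      (by linarith [min_le_left (1 / 2 : ℝ) (τ / (h + 1))]) h
    rw [← sub_eq_add_neg] at h1
    refine le_trans ?_ h1
    have h2 : min (1 / 2) (τ / (h + 1)) ≤ τ / (h + 1) := min_le_right _ _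
    have h3 : (h : ℝ) * min (1 / 2) (τ / (h + 1)) ≤ h * (τ / (h + 1)) := by gcongr
    have h4 : (h : ℝ) * (τ / (h + 1)) ≤ τ := by
      rw [← mul_div_assoc, div_le_iff₀ (by positivity)]; nlinarith
    linarith
  have e0 : (2 : ℝ) ^ h * (1 / 2) ^ h = 1 := by rw [← mul_pow]; norm_num
  obtain ⟨k', M', c, t₀, h1, h2, h3, H⟩ := richAt_iterate hs0 hs1 h k hM
    (by positivity : (0 : ℝ) < (1 / 2) ^ h) e0.le
  refine ⟨k', M', c, t₀, h1, h2, h3, fun 𝒲 z o t ht Hr => ?_⟩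
  refine (H 𝒲 z o t ht fun t' a b => (Hr t' a b).mono hh.le ?_).mono ?_ (by linarith)
  · exact le_trans (by have : 0 < t := by linarith
                       positivity) a
  · rw [mul_pow, mul_right_comm, e0, one_mul]; exact hs

section ExponentialSums

variable {N : ℕ} [NeZero N]

local notation "ψ" => (ZMod.stdAddChar (N := N))

lemma sum_orbit_char (B : Finset ℤ) (ξ : ZMod N) {μ : ℕ}
    (hμ : ∀ u : ZMod N, (B.filter fun x : ℤ => (x : ZMod N) * ξ = u).card ≤ μ) :
    ∑ j ∈ Finset.range (addOrderOf ξ), ‖∑ y ∈ B, ψ ((j : ZMod N) * ξ * (y : ZMod N))‖ ^ 2 ≤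
      addOrderOf ξ * (B.card * μ : ℝ) := by
  have key : ((∑ j ∈ Finset.range (addOrderOf ξ),
      ‖∑ y ∈ B, ψ ((j : ZMod N) * ξ * (y : ZMod N))‖ ^ 2 : ℝ) : ℂ) =
      ∑ y ∈ B, ∑ y' ∈ B, if (y' : ZMod N) * ξ = y * ξ then (addOrderOf ξ : ℂ) else 0 := by
    push_cast
    have h1 : ∀ j ∈ Finset.range (addOrderOf ξ),
        ((‖∑ y ∈ B, ψ ((j : ZMod N) * ξ * (y : ZMod N))‖ : ℂ)) ^ 2 =
        ∑ y ∈ B, ∑ y' ∈ B, (ψ (ξ * (y - y'))) ^ j := by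
      intro j _
      rw [← Complex.mul_conj', map_sum, Finset.sum_mul_sum]
      refine Finset.sum_congr rfl fun y _ => Finset.sum_congr rfl fun y' _ => ?_
      rw [← AddChar.map_neg_eq_conj, ← AddChar.map_add_eq_mul, ← AddChar.map_nsmul_eq_pow]
      congr 1
      rw [nsmul_eq_mul]; ring
    rw [Finset.sum_congr rfl h1, Finset.sum_comm]
    refine Finset.sum_congr rfl fun y _ => ?_
    rw [Finset.sum_comm]
    refine Finset.sum_congr rfl fun y' _ => ?_
    split_ifs with h
    · have : ξ * ((y : ZMod N) - y') = 0 := by rw [mul_sub, mul_comm, ← h]; ring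
      rw [this]
      simp
    · have h2 : ψ (ξ * ((y : ZMod N) - y')) ≠ 1 := by
        intro h3
        have := ZMod.injective_stdAddChar (h3.trans (AddChar.map_zero_eq_one ψ).symm)
        apply h
        rw [mul_sub, sub_eq_zero] at this
        rw [mul_comm, ← this, mul_comm]
      have h3 : (ψ (ξ * ((y : ZMod N) - y'))) ^ addOrderOf ξ = 1 := by
        rw [← AddChar.map_nsmul_eq_pow, ← smul_mul_assoc, addOrderOf_nsmul_eq_zero, zero_mul,
          AddChar.map_zero_eq_one]
      rw [geom_sum_eq h2, h3, sub_self, zero_div]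
  have key2 : (∑ j ∈ Finset.range (addOrderOf ξ),
      ‖∑ y ∈ B, ψ ((j : ZMod N) * ξ * (y : ZMod N))‖ ^ 2 : ℝ) =
      ∑ y ∈ B, ∑ y' ∈ B, if (y' : ZMod N) * ξ = y * ξ then (addOrderOf ξ : ℝ) else 0 := by
    have := congrArg Complex.re key
    rw [Complex.ofReal_re] at this
    rw [this, Complex.re_sum]
    refine Finset.sum_congr rfl fun y _ => ?_
    rw [Complex.re_sum]
    refine Finset.sum_congr rfl fun y' _ => ?_
    split_ifs <;> simp
  rw [key2]
  calc _ ≤ ∑ y ∈ B, (addOrderOf ξ * μ : ℝ) := by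
        refine Finset.sum_le_sum fun y _ => ?_
        rw [← Finset.sum_filter, Finset.sum_const, nsmul_eq_mul, mul_comm]
        have : ((B.filter fun x : ℤ => (x : ZMod N) * ξ = y * ξ).card : ℝ) ≤ μ := by
          exact_mod_cast hμ _
        exact mul_le_mul_of_nonneg_left this (by positivity)
    _ = _ := by rw [Finset.sum_const, nsmul_eq_mul]; ring

lemma bilinear_char_sum_sq (B : Finset ℤ) (ξ : ZMod N) {μ : ℕ}
    (hμ : ∀ u : ZMod N, (B.filter fun x : ℤ => (x : ZMod N) * ξ = u).card ≤ μ) :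
    ‖∑ x ∈ B, ∑ y ∈ B, ψ ((x : ZMod N) * ξ * (y : ZMod N))‖ ^ 2 ≤
      (B.card : ℝ) ^ 2 * μ ^ 2 * addOrderOf ξ := by
  have hm : 0 < addOrderOf ξ := addOrderOf_pos ξ
  have hm' : (addOrderOf ξ : ℤ) ≠ 0 := by exact_mod_cast hm.ne'
  have h1 : ‖∑ x ∈ B, ∑ y ∈ B, ψ ((x : ZMod N) * ξ * (y : ZMod N))‖ ^ 2 ≤
      B.card * ∑ x ∈ B, ‖∑ y ∈ B, ψ ((x : ZMod N) * ξ * (y : ZMod N))‖ ^ 2 := by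
    refine le_trans ?_ sq_sum_le_card_mul_sum_sq
    exact pow_le_pow_left₀ (norm_nonneg _) (norm_sum_le _ _) 2
  have h2 : ∑ x ∈ B, ‖∑ y ∈ B, ψ ((x : ZMod N) * ξ * (y : ZMod N))‖ ^ 2 ≤
      ∑ j ∈ Finset.range (addOrderOf ξ),
        μ * ‖∑ y ∈ B, ψ ((j : ZMod N) * ξ * (y : ZMod N))‖ ^ 2 := by
    have hmap : ∀ x ∈ B, (x % (addOrderOf ξ : ℤ)).toNat ∈ Finset.range (addOrderOf ξ) := by
      intro x _
      rw [Finset.mem_range]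
      have := Int.emod_lt_of_pos x (by exact_mod_cast hm : (0 : ℤ) < addOrderOf ξ)
      have := Int.emod_nonneg x hm'
      omega
    have hval : ∀ x : ℤ,
        (((x % (addOrderOf ξ : ℤ)).toNat : ℕ) : ZMod N) * ξ = (x : ZMod N) * ξ := by
      intro x
      have h3 : (((x % (addOrderOf ξ : ℤ)).toNat : ℤ)) = x - addOrderOf ξ * (x / addOrderOf ξ) := by
        rw [Int.toNat_of_nonneg (Int.emod_nonneg x hm'), Int.emod_def]
      have h4 : (((x % (addOrderOf ξ : ℤ)).toNat : ℕ) : ZMod N) =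
          ((x - addOrderOf ξ * (x / addOrderOf ξ) : ℤ) : ZMod N) := by
        rw [← h3, Int.cast_natCast]
      have h5 : (addOrderOf ξ : ZMod N) * ξ = 0 := by
        rw [← nsmul_eq_mul, addOrderOf_nsmul_eq_zero]
      rw [h4]
      push_cast
      linear_combination -((x / addOrderOf ξ : ℤ) : ZMod N) * h5
    rw [← Finset.sum_fiberwise_of_maps_to hmap]
    refine Finset.sum_le_sum fun j _ => ?_
    calc _ = ∑ x ∈ B with (x % (addOrderOf ξ : ℤ)).toNat = j,
          ‖∑ y ∈ B, ψ ((j : ZMod N) * ξ * (y : ZMod N))‖ ^ 2 := by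
          refine Finset.sum_congr rfl fun x hx => ?_
          rw [← (Finset.mem_filter.mp hx).2, hval]
      _ = (B.filter fun x => (x % (addOrderOf ξ : ℤ)).toNat = j).card *
          ‖∑ y ∈ B, ψ ((j : ZMod N) * ξ * (y : ZMod N))‖ ^ 2 := by
          rw [Finset.sum_const, nsmul_eq_mul]
      _ ≤ _ := by
          apply mul_le_mul_of_nonneg_right _ (by positivity)
          have : (B.filter fun x => (x % (addOrderOf ξ : ℤ)).toNat = j).card ≤ μ := by
            refine le_trans (Finset.card_le_card ?_) (hμ (j * ξ))
            intro x hx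
            rw [Finset.mem_filter] at hx ⊢
            exact ⟨hx.1, by rw [← hx.2, hval]⟩
          exact_mod_cast this
  rw [← Finset.mul_sum] at h2
  have h3 := sum_orbit_char B ξ hμ
  calc _ ≤ B.card * (μ * (addOrderOf ξ * (B.card * μ : ℝ))) := by
        refine h1.trans (mul_le_mul_of_nonneg_left (h2.trans ?_) (by positivity))
        exact mul_le_mul_of_nonneg_left h3 (by positivity)
    _ = _ := by ring

lemma bilinear_char_sum_pow (B : Finset ℤ) (ξ : ZMod N)
    (hB : ∀ u : ZMod N, (B.filter fun x : ℤ => (x : ZMod N) * ξ = u).card ^ 4 * addOrderOf ξ ^ 3 ≤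
      B.card ^ 4) :
    ‖∑ x ∈ B, ∑ y ∈ B, ψ ((x : ZMod N) * ξ * (y : ZMod N))‖ ^ 16 * (addOrderOf ξ : ℝ) ^ 4 ≤
      (B.card : ℝ) ^ 32 := by
  obtain ⟨u, -, hu⟩ := Finset.exists_max_image Finset.univ
    (fun u : ZMod N => (B.filter fun x : ℤ => (x : ZMod N) * ξ = u).card) Finset.univ_nonempty
  have h1 := bilinear_char_sum_sq B ξ fun v => hu v (Finset.mem_univ _)
  have h2 : ((B.filter fun x : ℤ => (x : ZMod N) * ξ = u).card : ℝ) ^ 4 * (addOrderOf ξ : ℝ) ^ 3 ≤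
      (B.card : ℝ) ^ 4 := by exact_mod_cast hB u
  have hm0 : (0 : ℝ) ≤ addOrderOf ξ := by positivity
  generalize ‖∑ x ∈ B, ∑ y ∈ B, ψ ((x : ZMod N) * ξ * (y : ZMod N))‖ = s at *
  generalize ((B.filter fun x : ℤ => (x : ZMod N) * ξ = u).card : ℝ) = μ at *
  generalize (addOrderOf ξ : ℝ) = m at *
  generalize (B.card : ℝ) = n at *
  calc s ^ 16 * m ^ 4 = (s ^ 2) ^ 8 * m ^ 4 := by ring
    _ ≤ (n ^ 2 * μ ^ 2 * m) ^ 8 * m ^ 4 := by gcongr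
    _ = n ^ 16 * (μ ^ 4 * m ^ 3) ^ 4 := by ring
    _ ≤ n ^ 16 * (n ^ 4) ^ 4 := by gcongr
    _ = n ^ 32 := by ring

lemma sum_addOrderOf_lt : ∑ ξ ∈ (Finset.univ : Finset (ZMod N)).erase 0,
    ((addOrderOf ξ : ℝ) ^ 4)⁻¹ < 1 := by
  classical
  have hmap : ∀ ξ ∈ (Finset.univ : Finset (ZMod N)).erase 0,
      addOrderOf ξ ∈ Finset.Ico 2 (N + 1) := by
    intro ξ hξ
    have h0 := (Finset.mem_erase.mp hξ).1
    have h1 : addOrderOf ξ ≠ 1 := by rwa [Ne, AddMonoid.addOrderOf_eq_one_iff]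
    have h2 := addOrderOf_pos ξ
    have h3 : addOrderOf ξ ≤ N := by
      have := addOrderOf_le_card_univ (x := ξ)
      rwa [ZMod.card] at this
    rw [Finset.mem_Ico]; omega
  rw [← Finset.sum_fiberwise_of_maps_to hmap]
  have h1 : ∀ m ∈ Finset.Ico 2 (N + 1), ∑ ξ ∈ (Finset.univ : Finset (ZMod N)).erase 0 with
      addOrderOf ξ = m, ((addOrderOf ξ : ℝ) ^ 4)⁻¹ ≤ 1 / 2 * (1 / ((m : ℝ) - 1) - 1 / m) := by
    intro m hm
    rw [Finset.mem_Ico] at hm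
    have hm2 : (2 : ℝ) ≤ m := by exact_mod_cast hm.1
    have hc : ((Finset.univ : Finset (ZMod N)).erase 0 |>.filter fun ξ => addOrderOf ξ = m).card ≤
        m := by
      refine le_trans (Finset.card_le_card ?_) (IsAddCyclic.card_nsmul_eq_zero_le (α := ZMod N)
        (by omega : 0 < m))
      intro ξ hξ
      rw [Finset.mem_filter] at hξ ⊢
      exact ⟨Finset.mem_univ _, by rw [← hξ.2]; exact addOrderOf_nsmul_eq_zero ξ⟩
    calc _ = ∑ ξ ∈ (Finset.univ : Finset (ZMod N)).erase 0 with addOrderOf ξ = m,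
          ((m : ℝ) ^ 4)⁻¹ := by
          refine Finset.sum_congr rfl fun ξ hξ => ?_
          rw [(Finset.mem_filter.mp hξ).2]
      _ ≤ m * ((m : ℝ) ^ 4)⁻¹ := by
          rw [Finset.sum_const, nsmul_eq_mul]
          gcongr
      _ ≤ _ := by
          rw [div_sub_div _ _ (by linarith) (by linarith), ← div_eq_mul_inv, ← mul_div_assoc,
            div_le_div_iff₀ (by positivity) (by nlinarith)]
          have : (0 : ℝ) < m := by linarith
          nlinarith [pow_pos this 2, pow_pos this 3,
            mul_le_mul_of_nonneg_left hm2 (pow_pos this 3).le]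
  have h2 : ∀ n : ℕ, 1 ≤ n → ∑ m ∈ Finset.Ico 2 (n + 1), (1 / 2 : ℝ) * (1 / ((m : ℝ) - 1) - 1 / m) =
      1 / 2 * (1 - 1 / n) := by
    intro n hn
    induction n, hn using Nat.le_induction with
    | base => simp
    | succ n hn ih =>
      rw [Finset.sum_Ico_succ_top (by omega), ih]
      push_cast
      ring
  have hN : 1 ≤ N := Nat.one_le_iff_ne_zero.mpr (NeZero.ne N)
  calc _ ≤ ∑ m ∈ Finset.Ico 2 (N + 1), (1 / 2 : ℝ) * (1 / ((m : ℝ) - 1) - 1 / m) :=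
        Finset.sum_le_sum h1
    _ = 1 / 2 * (1 - 1 / N) := h2 N hN
    _ < 1 := by
        have : (0 : ℝ) ≤ 1 / N := by positivity
        linarith

lemma char_sum {ι : Type*} (s : Finset ι) (f : ι → ZMod N) :
    ψ (∑ i ∈ s, f i) = ∏ i ∈ s, ψ (f i) := by
  classical
  induction s using Finset.induction_on with
  | empty => simp
  | insert a s ha ih => rw [Finset.sum_insert ha, Finset.prod_insert ha, AddChar.map_add_eq_mul, ih]

/-- If `B` is well distributed in residue classes, then sixteen-fold sums of products of two
elements of `B` cover all residues. -/
lemma exists_sum_mul_eq {B : Finset ℤ} (hB0 : B.Nonempty)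
    (hB : ∀ ξ : ZMod N, ξ ≠ 0 → ∀ u : ZMod N,
      (B.filter fun x : ℤ => (x : ZMod N) * ξ = u).card ^ 4 * addOrderOf ξ ^ 3 ≤ B.card ^ 4)
    (z : ZMod N) : ∃ x y : Fin 16 → ℤ, (∀ i, x i ∈ B) ∧ (∀ i, y i ∈ B) ∧
      ∑ i, (x i : ZMod N) * (y i : ZMod N) = z := by
  classical
  by_contra hcon
  push Not at hcon
  obtain ⟨S, hS⟩ : ∃ S : ZMod N → ℂ, S = fun ξ =>
    ∑ x ∈ B, ∑ y ∈ B, ψ ((x : ZMod N) * ξ * (y : ZMod N)) := ⟨_, rfl⟩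
  have h1 : ∑ ξ : ZMod N, ψ (-(ξ * z)) * S ξ ^ 16 = 0 := by
    have e : ∀ ξ : ZMod N, ψ (-(ξ * z)) * S ξ ^ 16 =
        ∑ F ∈ Fintype.piFinset (fun _ : Fin 16 => B ×ˢ B),
          ψ (ξ * (∑ i, ((F i).1 : ZMod N) * ((F i).2 : ZMod N) - z)) := by
      intro ξ
      rw [hS]
      simp only
      rw [← Finset.sum_product', Finset.sum_pow', Finset.mul_sum]
      refine Finset.sum_congr rfl fun F _ => ?_
      have hprod : ∏ i, ψ (((F i).1 : ZMod N) * ξ * ((F i).2 : ZMod N)) =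
          ψ (∑ i, ((F i).1 : ZMod N) * ξ * ((F i).2 : ZMod N)) :=
        (char_sum _ _).symm
      rw [hprod, ← AddChar.map_add_eq_mul]
      congr 1
      rw [mul_sub, Finset.mul_sum, neg_add_eq_sub]
      congr 1
      exact Finset.sum_congr rfl fun i _ => by ring
    rw [Finset.sum_congr rfl fun ξ _ => e ξ, Finset.sum_comm]
    refine Finset.sum_eq_zero fun F hF => ?_
    rw [AddChar.sum_mulShift _ (ZMod.isPrimitive_stdAddChar N), if_neg, Nat.cast_zero]
    rw [sub_eq_zero]
    rw [Fintype.mem_piFinset] at hF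
    exact hcon (fun i => (F i).1) (fun i => (F i).2) (fun i => (Finset.mem_product.mp (hF i)).1)
      (fun i => (Finset.mem_product.mp (hF i)).2)
  rw [← Finset.add_sum_erase _ _ (Finset.mem_univ (0 : ZMod N))] at h1
  have hS0 : S 0 = (B.card : ℂ) ^ 2 := by
    rw [hS]; simp [pow_two]
  have h2 : ‖∑ ξ ∈ (Finset.univ : Finset (ZMod N)).erase 0, ψ (-(ξ * z)) * S ξ ^ 16‖ =
      (B.card : ℝ) ^ 32 := by
    have : ∑ ξ ∈ (Finset.univ : Finset (ZMod N)).erase 0, ψ (-(ξ * z)) * S ξ ^ 16 =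
        -(B.card : ℂ) ^ 32 := by
      rw [hS0] at h1
      simp only [zero_mul, neg_zero, AddChar.map_zero_eq_one, one_mul] at h1
      rw [← pow_mul] at h1
      linear_combination h1
    rw [this]
    simp
  have hc : (0 : ℝ) < (B.card : ℝ) ^ 32 := by
    have : 0 < B.card := hB0.card_pos
    positivity
  have h3 : ‖∑ ξ ∈ (Finset.univ : Finset (ZMod N)).erase 0, ψ (-(ξ * z)) * S ξ ^ 16‖ <
      (B.card : ℝ) ^ 32 := by
    calc _ ≤ ∑ ξ ∈ (Finset.univ : Finset (ZMod N)).erase 0,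
          (B.card : ℝ) ^ 32 * ((addOrderOf ξ : ℝ) ^ 4)⁻¹ := by
          refine norm_sum_le_of_le _ fun ξ hξ => ?_
          have hm : (0 : ℝ) < addOrderOf ξ := by exact_mod_cast addOrderOf_pos ξ
          rw [norm_mul, AddChar.norm_apply, one_mul, norm_pow, ← div_eq_mul_inv,
            le_div_iff₀ (by positivity), hS]
          exact bilinear_char_sum_pow B ξ (hB ξ (Finset.mem_erase.mp hξ).1)
      _ = (B.card : ℝ) ^ 32 * ∑ ξ ∈ (Finset.univ : Finset (ZMod N)).erase 0,
          ((addOrderOf ξ : ℝ) ^ 4)⁻¹ := by rw [Finset.mul_sum]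
      _ < (B.card : ℝ) ^ 32 * 1 := by
          exact mul_lt_mul_of_pos_left sum_addOrderOf_lt hc
      _ = _ := mul_one _
  exact absurd h2 h3.ne

end ExponentialSums

open Classical in
/-- A dense set of integers represents, through sixteen-fold sums of products of differences, all
multiples of a small square modulo any moderately sized integer. -/
theorem exists_dense_residues {B : Finset ℤ} (hB0 : B.Nonempty) {Y : ℕ} (hY : 1 ≤ Y)
    (hBY : ∀ b ∈ B, |b| ≤ Y) :
    ∃ m₀ : ℕ, 1 ≤ m₀ ∧ m₀ ≤ Y ∧ m₀ * B.card ^ 4 ≤ (5 * Y) ^ 4 ∧ ∃ b₀ ∈ B, ∀ R : ℕ, 1 ≤ R →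
      m₀ * R ≤ Y → ∀ z : ℤ, ∃ x y : Fin 16 → ℤ, (∀ i, x i ∈ B) ∧ (∀ i, y i ∈ B) ∧
        (R : ℤ) ∣ m₀ ^ 2 * z - ∑ i, (x i - b₀) * (y i - b₀) := by
  obtain ⟨Q, hQ⟩ : ∃ Q : ℕ → Prop, Q = fun m : ℕ => 1 ≤ m ∧ ∃ r : ℤ,
    B.card ^ 4 ≤ (B.filter fun b => (m : ℤ) ∣ b - r).card ^ 4 * m ^ 3 := ⟨_, rfl⟩
  have hQ1 : Q 1 := by
    rw [hQ]
    refine ⟨le_rfl, 0, ?_⟩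
    simp
  obtain ⟨m₀, hm₀⟩ : ∃ m, m = Nat.findGreatest Q Y := ⟨_, rfl⟩
  have hQm : Q m₀ := hm₀ ▸ Nat.findGreatest_spec hY hQ1
  have hm₀Y : m₀ ≤ Y := hm₀ ▸ Nat.findGreatest_le Y
  have hmax : ∀ n, m₀ < n → n ≤ Y → ¬ Q n := fun n h1 h2 =>
    Nat.findGreatest_is_greatest (hm₀ ▸ h1) h2
  rw [hQ] at hQm
  obtain ⟨hm1, r, hr⟩ := hQm
  have hm0' : (m₀ : ℤ) ≠ 0 := by exact_mod_cast (by omega : m₀ ≠ 0)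
  obtain ⟨B', hB'⟩ : ∃ B', B' = B.filter fun b => (m₀ : ℤ) ∣ b - r := ⟨_, rfl⟩
  rw [← hB'] at hr
  have hB'0 : B'.Nonempty := by
    rw [Finset.nonempty_iff_ne_empty]
    intro h
    rw [h] at hr
    have : 0 < B.card ^ 4 := by have := hB0.card_pos; positivity
    simp at hr
    simp [hr] at hB0
  obtain ⟨b₀, hb₀⟩ := hB'0
  have hb₀' := hb₀
  rw [hB', Finset.mem_filter] at hb₀'
  have hdvd : ∀ b ∈ B', (m₀ : ℤ) ∣ b - b₀ := by
    intro b hb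
    rw [hB', Finset.mem_filter] at hb
    have := dvd_sub hb.2 hb₀'.2
    rwa [sub_sub_sub_cancel_right] at this
  have hdiv : ∀ b ∈ B', m₀ * ((b - b₀) / m₀) = b - b₀ := fun b hb =>
    Int.mul_ediv_cancel' (hdvd b hb)
  obtain ⟨B'', hB''⟩ : ∃ B'', B'' = B'.image fun b => (b - b₀) / m₀ := ⟨_, rfl⟩
  have hcard : B''.card = B'.card := by
    rw [hB'']
    apply Finset.card_image_of_injOn
    intro b hb b' hb' h
    have h1 := hdiv b hb
    have h2 := hdiv b' hb'
    simp only at h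
    rw [h, h2] at h1
    linarith
  have hB''0 : B''.Nonempty := by rw [hB'']; exact ⟨_, Finset.mem_image_of_mem _ hb₀⟩
  refine ⟨m₀, hm1, hm₀Y, ?_, b₀, hb₀'.1, fun R hR hmR z => ?_⟩
  · have h1 : B''.card * m₀ ≤ 5 * Y := by
      have hsub : B'' ⊆ Finset.Icc (-((2 * Y / m₀ : ℕ) : ℤ)) ((2 * Y / m₀ : ℕ) : ℤ) := by
        intro x hx
        rw [hB'', Finset.mem_image] at hx
        obtain ⟨b, hb, rfl⟩ := hx
        have h1 := hBY b ((by rw [hB'] at hb; exact (Finset.mem_filter.mp hb).1))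
        have h2 := hBY b₀ hb₀'.1
        have h3 := hdiv b hb
        generalize (b - b₀) / (m₀ : ℤ) = x at *
        have h4 : |(m₀ : ℤ) * x| ≤ 2 * Y := by
          rw [h3, abs_le]; rw [abs_le] at h1 h2; constructor <;> linarith
        rw [Finset.mem_Icc, ← abs_le, Int.abs_eq_natAbs]
        have h5 : x.natAbs ≤ 2 * Y / m₀ := by
          rw [Nat.le_div_iff_mul_le (by omega), mul_comm]
          rw [Int.abs_eq_natAbs, Int.natAbs_mul, Int.natAbs_natCast] at h4
          exact_mod_cast h4
        exact_mod_cast h5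
      have h2 := Finset.card_le_card hsub
      rw [Int.card_Icc] at h2
      have h3 := Nat.div_mul_le_self (2 * Y) m₀
      have h4 : B''.card ≤ 2 * (2 * Y / m₀) + 1 := by omega
      nlinarith
    rw [hcard] at h1
    calc m₀ * B.card ^ 4 ≤ m₀ * (B'.card ^ 4 * m₀ ^ 3) := Nat.mul_le_mul_left _ hr
      _ = (B'.card * m₀) ^ 4 := by ring
      _ ≤ _ := Nat.pow_le_pow_left h1 4
  · have : NeZero R := ⟨by omega⟩
    obtain ⟨x, y, hx, hy, hxy⟩ := exists_sum_mul_eq (N := R) hB''0 (by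
      intro ξ hξ u
      obtain ⟨m, hm⟩ : ∃ m, m = addOrderOf ξ := ⟨_, rfl⟩
      rw [← hm]
      have hmpos : 0 < m := hm ▸ addOrderOf_pos ξ
      have hm2 : 2 ≤ m := by
        have : m ≠ 1 := by rw [hm, Ne, AddMonoid.addOrderOf_eq_one_iff]; exact hξ
        omega
      have hmR' : m ≤ R := by
        have := addOrderOf_le_card_univ (x := ξ)
        rwa [ZMod.card, ← hm] at this
      by_cases hne : (B''.filter fun x : ℤ => (x : ZMod R) * ξ = u) = ∅
      · rw [hne]; simp
      obtain ⟨x₀, hx₀⟩ := Finset.nonempty_iff_ne_empty.mpr hne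
      rw [Finset.mem_filter] at hx₀
      have hcls : (B''.filter fun x : ℤ => (x : ZMod R) * ξ = u).card ≤
          (B.filter fun b => ((m₀ * m : ℕ) : ℤ) ∣ b - (b₀ + m₀ * x₀)).card := by
        refine Finset.card_le_card_of_injOn (fun x => b₀ + m₀ * x) ?_ ?_
        · intro x hx
          rw [Finset.mem_coe, Finset.mem_filter] at hx
          obtain ⟨hxB, hxu⟩ := hx
          rw [hB'', Finset.mem_image] at hxB
          obtain ⟨b, hb, hbx⟩ := hxB
          have h1 : b₀ + m₀ * x = b := by rw [← hbx, hdiv b hb]; ring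
          rw [Finset.mem_coe, Finset.mem_filter]
          refine ⟨?_, ?_⟩
          · simp only [h1]; rw [hB'] at hb; exact (Finset.mem_filter.mp hb).1
          · have h2 : (m : ℤ) ∣ x - x₀ := by
              rw [hm, addOrderOf_dvd_iff_zsmul_eq_zero, zsmul_eq_mul]
              push_cast
              rw [sub_mul, hxu, hx₀.2, sub_self]
            simp only [add_sub_add_left_eq_sub, ← mul_sub]
            push_cast
            exact mul_dvd_mul_left _ h2
        · intro x _ x' _ h
          simp only [add_right_inj] at h
          exact mul_left_cancel₀ hm0' h
      have hnot := hmax (m₀ * m) (by nlinarith)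
        ((Nat.mul_le_mul_left _ hmR').trans hmR)
      rw [hQ] at hnot
      push Not at hnot
      have h3 := hnot (Nat.mul_pos (by omega) hmpos) (b₀ + m₀ * x₀)
      have h4 := (Nat.mul_le_mul_right ((m₀ * m) ^ 3) (Nat.pow_le_pow_left hcls 4)).trans
        (h3.le.trans hr)
      rw [← hcard, mul_pow, mul_comm (m₀ ^ 3), ← mul_assoc] at h4
      exact Nat.le_of_mul_le_mul_right h4 (by positivity)) (z : ZMod R)
    have hlift : ∀ w : ℤ, w ∈ B'' → b₀ + m₀ * w ∈ B := by
      intro w hw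
      rw [hB'', Finset.mem_image] at hw
      obtain ⟨b, hb, hbx⟩ := hw
      rw [← hbx, hdiv b hb, add_sub_cancel]
      rw [hB'] at hb
      exact (Finset.mem_filter.mp hb).1
    refine ⟨fun i => b₀ + m₀ * x i, fun i => b₀ + m₀ * y i, fun i => hlift _ (hx i),
      fun i => hlift _ (hy i), ?_⟩
    have h1 : (R : ℤ) ∣ z - ∑ i, x i * y i := by
      rw [← ZMod.intCast_zmod_eq_zero_iff_dvd]
      push_cast
      rw [hxy, sub_self]
    have h2 : (m₀ : ℤ) ^ 2 * z - ∑ i, (b₀ + m₀ * x i - b₀) * (b₀ + m₀ * y i - b₀) =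
        m₀ ^ 2 * (z - ∑ i, x i * y i) := by
      rw [mul_sub, Finset.mul_sum]
      congr 1
      exact Finset.sum_congr rfl fun i _ => by ring
    rw [h2]
    exact Dvd.dvd.mul_left h1 _

/-- Conjugation by `g` as an endomorphism of the integral `2 × 2` matrices. -/
def adEnd : SL2Z →* Module.End ℤ (Matrix (Fin 2) (Fin 2) ℤ) where
  toFun g :=
    { toFun := fun x => (g : Matrix (Fin 2) (Fin 2) ℤ) * x *
        ((g⁻¹ : SL2Z) : Matrix (Fin 2) (Fin 2) ℤ)
      map_add' := fun x y => by rw [mul_add, add_mul]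
      map_smul' := fun c x => by rw [mul_smul_comm, smul_mul_assoc, RingHom.id_apply] }
  map_one' := by
    apply LinearMap.ext
    intro x
    simp
  map_mul' g h := by
    apply LinearMap.ext
    intro x
    change ((g * h : SL2Z) : Matrix (Fin 2) (Fin 2) ℤ) * x * (((g * h)⁻¹ : SL2Z) :
      Matrix (Fin 2) (Fin 2) ℤ) = (g : Matrix (Fin 2) (Fin 2) ℤ) * (h * x *
        ((h⁻¹ : SL2Z) : Matrix (Fin 2) (Fin 2) ℤ)) * ((g⁻¹ : SL2Z) : Matrix (Fin 2) (Fin 2) ℤ)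
    rw [_root_.mul_inv_rev, Matrix.SpecialLinearGroup.coe_mul, Matrix.SpecialLinearGroup.coe_mul]
    simp only [mul_assoc]

lemma adEnd_apply (g : SL2Z) (x : Matrix (Fin 2) (Fin 2) ℤ) :
    adEnd g x = (g : Matrix (Fin 2) (Fin 2) ℤ) * x *
      ((g⁻¹ : SL2Z) : Matrix (Fin 2) (Fin 2) ℤ) := rfl

/-- The conjugations by elements of `T`, together with zero. -/
def adSet (T : Set SL2Z) : Set (Module.End ℤ (Matrix (Fin 2) (Fin 2) ℤ)) := adEnd '' T ∪ {0}

/-- Some element of `T ^ K` has the form `1 + Q y` modulo `Q R`. -/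
def Reach (T : Set SL2Z) (K : ℕ) (Q R : ℤ) (y : Matrix (Fin 2) (Fin 2) ℤ) : Prop :=
  ∃ g ∈ T ^ K, ∃ e : Matrix (Fin 2) (Fin 2) ℤ,
    (g : Matrix (Fin 2) (Fin 2) ℤ) = 1 + Q • y + (Q * R) • e

namespace Reach
variable {T : Set SL2Z} {K K' : ℕ} {Q R : ℤ} {y y' : Matrix (Fin 2) (Fin 2) ℤ}

lemma mono (h1 : (1 : SL2Z) ∈ T) (h : K ≤ K') (hy : Reach T K Q R y) : Reach T K' Q R y := by
  obtain ⟨g, hg, e, he⟩ := hy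
  exact ⟨g, Set.pow_subset_pow_right h1 h hg, e, he⟩

lemma zero (h1 : (1 : SL2Z) ∈ T) : Reach T K Q R 0 :=
  ⟨1, Set.one_mem_pow h1, 0, by simp⟩

lemma add (hR : R ∣ Q) (hy : Reach T K Q R y) (hy' : Reach T K' Q R y') :
    Reach T (K + K') Q R (y + y') := by
  obtain ⟨g, hg, e, he⟩ := hy
  obtain ⟨g', hg', e', he'⟩ := hy'
  obtain ⟨c, rfl⟩ := hR
  refine ⟨g * g', by rw [pow_add]; exact Set.mul_mem_mul hg hg',
    e + e' + c • ((y + R • e) * (y' + R • e')), ?_⟩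
  rw [Matrix.SpecialLinearGroup.coe_mul, he, he']
  simp only [mul_add, add_mul, smul_add, smul_mul_assoc, mul_smul_comm, smul_smul, one_mul, mul_one]
  module

lemma neg (hT : T⁻¹ = T) (hR : R ∣ Q) (hy : Reach T K Q R y) : Reach T K Q R (-y) := by
  obtain ⟨g, hg, e, he⟩ := hy
  obtain ⟨c, rfl⟩ := hR
  refine ⟨g⁻¹, by rw [← hT, inv_pow]; exact Set.inv_mem_inv.2 hg,
    - e + c • (((g⁻¹ : SL2Z) : Matrix (Fin 2) (Fin 2) ℤ) * ((y + R • e) * (y + R • e))), ?_⟩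
  have h : ((g⁻¹ : SL2Z) : Matrix (Fin 2) (Fin 2) ℤ) * (g : Matrix (Fin 2) (Fin 2) ℤ) = 1 := by
    rw [← Matrix.SpecialLinearGroup.coe_mul, inv_mul_cancel, Matrix.SpecialLinearGroup.coe_one]
  obtain ⟨i, hi⟩ : ∃ i, i = ((g⁻¹ : SL2Z) : Matrix (Fin 2) (Fin 2) ℤ) := ⟨_, rfl⟩
  obtain ⟨w, hw⟩ : ∃ w, w = y + R • e := ⟨_, rfl⟩
  rw [← hi] at h ⊢
  have he2 : (g : Matrix (Fin 2) (Fin 2) ℤ) = 1 + (R * c) • w := by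
    rw [he, hw]; module
  rw [he2] at h
  have h2 : i = 1 - (R * c) • (i * w) := by
    rw [mul_add, mul_one, mul_smul_comm] at h
    rw [← h]; abel
  have h3 : i * w = w - (R * c) • (i * (w * w)) := by
    conv_lhs => rw [h2]
    rw [sub_mul, one_mul, smul_mul_assoc, mul_assoc]
  obtain ⟨z, hz⟩ : ∃ z, z = i * (w * w) := ⟨_, rfl⟩
  rw [← hw, ← hz, h2, h3, ← hz, hw]
  module

lemma conj (hT : T⁻¹ = T) {w : SL2Z} (hw : w ∈ T) (hy : Reach T K Q R y) :
    Reach T (K + 2) Q R (adEnd w y) := by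
  obtain ⟨g, hg, e, he⟩ := hy
  refine ⟨w * g * w⁻¹, ?_, adEnd w e, ?_⟩
  · rw [show K + 2 = 1 + K + 1 by ring, pow_add, pow_add, pow_one]
    exact Set.mul_mem_mul (Set.mul_mem_mul hw hg) (by rw [← hT]; exact Set.inv_mem_inv.2 hw)
  · rw [Matrix.SpecialLinearGroup.coe_mul, Matrix.SpecialLinearGroup.coe_mul, he, ← adEnd_apply]
    simp only [map_add, map_smul]
    congr 2
    rw [adEnd_apply, mul_one, ← Matrix.SpecialLinearGroup.coe_mul, mul_inv_cancel,
      Matrix.SpecialLinearGroup.coe_one]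

end Reach

lemma Reach.of_ringGen (k K : ℕ) : ∃ K', ∀ T : Set SL2Z, T⁻¹ = T → (1 : SL2Z) ∈ T →
    ∀ Q R : ℤ, R ∣ Q → ∀ F ∈ ringGen (adSet T) k, ∀ y, Reach T K Q R y →
      Reach T K' Q R (F y) := by
  induction k generalizing K with
  | zero =>
    refine ⟨K + 2, fun T hT h1 Q R hR F hF y hy => ?_⟩
    rcases hF with ⟨w, hw, rfl⟩ | hF
    · exact hy.conj hT hw
    · rw [Set.mem_singleton_iff] at hF
      subst hF
      exact Reach.zero h1
  | succ k ih =>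
    obtain ⟨K₁, h₁⟩ := ih K
    obtain ⟨K₂, h₂⟩ := ih K₁
    refine ⟨K₁ + K₁ + K₂, fun T hT h1 Q R hR F hF y hy => ?_⟩
    obtain ⟨G, hG, H, hH, rfl | rfl | rfl | rfl⟩ := hF
    · exact (h₁ T hT h1 Q R hR F hG y hy).mono h1 (by omega)
    · exact ((h₁ T hT h1 Q R hR G hG y hy).add hR (h₁ T hT h1 Q R hR H hH y hy)).mono h1 (by omega)
    · rw [LinearMap.sub_apply, sub_eq_add_neg]
      exact ((h₁ T hT h1 Q R hR G hG y hy).add hR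
        ((h₁ T hT h1 Q R hR H hH y hy).neg hT hR)).mono h1 (by omega)
    · exact (h₂ T hT h1 Q R hR G hG _ (h₁ T hT h1 Q R hR H hH y hy)).mono h1 (by omega)

/-- The difference of the conjugations by `a` and by `a⁻¹`. -/
def dEnd (a : SL2Z) : Module.End ℤ (Matrix (Fin 2) (Fin 2) ℤ) := adEnd a - adEnd a⁻¹

/-- The scalar with which `dEnd a * dEnd w` acts on the image of `dEnd a`. -/
def dScalar (a w : SL2Z) : ℤ :=
  (a : Matrix (Fin 2) (Fin 2) ℤ).trace * (w : Matrix (Fin 2) (Fin 2) ℤ).trace *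
    (2 * ((a : Matrix (Fin 2) (Fin 2) ℤ) * w).trace -
      (a : Matrix (Fin 2) (Fin 2) ℤ).trace * (w : Matrix (Fin 2) (Fin 2) ℤ).trace)

lemma coe_inv_eq_trace_sub (a : SL2Z) : ((a⁻¹ : SL2Z) : Matrix (Fin 2) (Fin 2) ℤ) =
    (a : Matrix (Fin 2) (Fin 2) ℤ).trace • (1 : Matrix (Fin 2) (Fin 2) ℤ) -
      (a : Matrix (Fin 2) (Fin 2) ℤ) := by
  rw [Matrix.SpecialLinearGroup.coe_inv, Matrix.adjugate_fin_two, Matrix.trace_fin_two]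
  ext i j
  rw [Matrix.sub_apply, Matrix.smul_apply]
  fin_cases i <;> fin_cases j <;> simp

lemma dEnd_apply (a : SL2Z) (y : Matrix (Fin 2) (Fin 2) ℤ) :
    dEnd a y = (a : Matrix (Fin 2) (Fin 2) ℤ).trace •
      ((a : Matrix (Fin 2) (Fin 2) ℤ) * y - y * (a : Matrix (Fin 2) (Fin 2) ℤ)) := by
  rw [dEnd, LinearMap.sub_apply, adEnd_apply, adEnd_apply, inv_inv, coe_inv_eq_trace_sub]
  simp only [mul_sub, sub_mul, mul_smul_comm, smul_mul_assoc, mul_one, one_mul, smul_sub, mul_assoc]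
  abel

lemma comm_comm_comm {R : Type*} [CommRing R] (a w y : Matrix (Fin 2) (Fin 2) R) :
    a * (w * (a * y - y * a) - (a * y - y * a) * w) -
      (w * (a * y - y * a) - (a * y - y * a) * w) * a
      = (2 * (a * w).trace - a.trace * w.trace) • (a * y - y * a) := by
  ext i j
  fin_cases i <;> fin_cases j <;>
    simp [Matrix.mul_apply, Fin.sum_univ_two, Matrix.trace_fin_two] <;> ring

lemma dEnd_mul_mul (a w : SL2Z) : dEnd a * dEnd w * dEnd a = dScalar a w • dEnd a := by
  apply LinearMap.ext
  intro y
  have h := comm_comm_comm (a : Matrix (Fin 2) (Fin 2) ℤ) w y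
  obtain ⟨t, ht⟩ : ∃ t, t = (a : Matrix (Fin 2) (Fin 2) ℤ).trace := ⟨_, rfl⟩
  obtain ⟨s, hs⟩ : ∃ s, s = (w : Matrix (Fin 2) (Fin 2) ℤ).trace := ⟨_, rfl⟩
  simp only [Module.End.mul_apply, LinearMap.smul_apply, dEnd_apply, dScalar, ← ht, ← hs] at h ⊢
  simp only [mul_smul_comm, smul_mul_assoc, ← smul_sub]
  rw [h]
  module

lemma dEnd_conj (a b : SL2Z) : dEnd (b * a * b⁻¹) = adEnd b * dEnd a * adEnd b⁻¹ := by
  simp only [dEnd, mul_sub, sub_mul, ← map_mul]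
  congr 2
  group

lemma dEnd_mem {T : Set SL2Z} (hT : T⁻¹ = T) {a : SL2Z} (ha : a ∈ T) :
    dEnd a ∈ ringGen (adSet T) 1 :=
  ringGen.sub_mem (k := 0) (Or.inl ⟨a, ha, rfl⟩)
    (Or.inl ⟨a⁻¹, by rw [← hT]; exact Set.inv_mem_inv.2 ha, rfl⟩)

lemma adEnd_mem {T : Set SL2Z} {b : SL2Z} (hb : b ∈ T * T) : adEnd b ∈ ringGen (adSet T) 1 := by
  obtain ⟨x, hx, y, hy, rfl⟩ := hb
  simp only [map_mul]
  exact ringGen.mul_mem (k := 0) (Or.inl ⟨x, hx, rfl⟩) (Or.inl ⟨y, hy, rfl⟩)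

lemma inv_mem_mul_self {T : Set SL2Z} (hT : T⁻¹ = T) {b : SL2Z} (hb : b ∈ T * T) :
    b⁻¹ ∈ T * T := by
  rw [← hT, ← _root_.mul_inv_rev]
  exact Set.inv_mem_inv.2 hb

/-- The scalars obtained from the elements of `T` through three conjugates of `a`. -/
def scalarSet (T : Set SL2Z) (a : SL2Z) (b : Fin 3 → SL2Z) : Set ℤ :=
  {z | ∃ i, ∃ w ∈ T, z = dScalar a (b i * w * (b i)⁻¹)} ∪ {0, 1}

lemma exists_scalar {T : Set SL2Z} (hT : T⁻¹ = T) (h1 : (1 : SL2Z) ∈ T) {a : SL2Z} (ha : a ∈ T)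
    {b : Fin 3 → SL2Z} (hb : ∀ i, b i ∈ T * T) (k : ℕ) :
    ∀ z ∈ ringGen (scalarSet T a b) k,
      ∃ F ∈ ringGen (adSet T) (k + 4), F * dEnd a = z • dEnd a := by
  induction k with
  | zero =>
    rintro z (⟨i, w, hw, rfl⟩ | rfl | rfl)
    · refine ⟨dEnd a * dEnd (b i * w * (b i)⁻¹), ?_, dEnd_mul_mul _ _⟩
      rw [dEnd_conj]
      refine ringGen.mul_mem (k := 3) (ringGen.mono (by omega) (dEnd_mem hT ha)) ?_
      refine ringGen.mul_mem (k := 2) (ringGen.mul_mem (k := 1) (adEnd_mem (hb i)) (dEnd_mem hT hw))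
        (ringGen.mono (by omega) (adEnd_mem (inv_mem_mul_self hT (hb i))))
    · exact ⟨0, ringGen.base_mem (W := adSet T) (Or.inr rfl) _, by simp⟩
    · exact ⟨1, ringGen.base_mem (W := adSet T) (Or.inl ⟨1, h1, map_one _⟩) _, by simp⟩
  | succ k ih =>
    rintro z ⟨x, hx, y, hy, h⟩
    obtain ⟨F, hF, hFx⟩ := ih x hx
    obtain ⟨G, hG, hGy⟩ := ih y hy
    rcases h with rfl | rfl | rfl | rfl
    · exact ⟨F, ringGen.mono (by omega) hF, hFx⟩
    · exact ⟨F + G, by simpa [add_right_comm] using ringGen.add_mem hF hG,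
        by rw [add_mul, hFx, hGy, add_smul]⟩
    · exact ⟨F - G, by simpa [add_right_comm] using ringGen.sub_mem hF hG,
        by rw [sub_mul, hFx, hGy, sub_smul]⟩
    · exact ⟨F * G, by simpa [add_right_comm] using ringGen.mul_mem hF hG,
        by rw [mul_assoc, hGy, mul_smul_comm, hFx, smul_smul, mul_comm]⟩

lemma exists_scalar_conj {T : Set SL2Z} (hT : T⁻¹ = T) (h1 : (1 : SL2Z) ∈ T) {a : SL2Z} (ha : a ∈ T)
    {b : Fin 3 → SL2Z} (hb : ∀ i, b i ∈ T * T) (k : ℕ) {z : ℤ}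
    (hz : z ∈ ringGen (scalarSet T a b) k) (i : Fin 3) :
      ∃ F ∈ ringGen (adSet T) (k + 6),
        F * dEnd ((b i)⁻¹ * a * b i) = z • dEnd ((b i)⁻¹ * a * b i) := by
  obtain ⟨F, hF, h⟩ := exists_scalar hT h1 ha hb k z hz
  refine ⟨adEnd (b i)⁻¹ * F * adEnd (b i), ?_, ?_⟩
  · exact ringGen.mul_mem (k := k + 5) (ringGen.mul_mem (k := k + 4)
      (ringGen.mono (by omega) (adEnd_mem (inv_mem_mul_self hT (hb i)))) hF)
      (ringGen.mono (by omega) (adEnd_mem (hb i)))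
  · have := dEnd_conj a (b i)⁻¹
    rw [inv_inv] at this
    rw [this]
    have h2 : adEnd (b i) * adEnd (b i)⁻¹ = 1 := by rw [← map_mul, mul_inv_cancel, map_one]
    calc _ = adEnd (b i)⁻¹ * F * (adEnd (b i) * adEnd (b i)⁻¹) * dEnd a * adEnd (b i) := by
          simp only [mul_assoc]
      _ = adEnd (b i)⁻¹ * (F * dEnd a) * adEnd (b i) := by rw [h2]; simp only [mul_assoc, mul_one]
      _ = _ := by rw [h, mul_smul_comm, smul_mul_assoc]

lemma dEnd_conj_mem {T : Set SL2Z} (hT : T⁻¹ = T) {a : SL2Z} (ha : a ∈ T)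
    {b : SL2Z} (hb : b ∈ T * T) : dEnd (b⁻¹ * a * b) ∈ ringGen (adSet T) 3 := by
  have := dEnd_conj a b⁻¹
  rw [inv_inv] at this
  rw [this]
  exact ringGen.mul_mem (k := 2) (ringGen.mul_mem (k := 1) (adEnd_mem (inv_mem_mul_self hT hb))
    (dEnd_mem hT ha)) (ringGen.mono (by omega) (adEnd_mem hb))

/-- The commutators of a triple of matrices, in cyclic order. -/
def sl2Dual (u : Fin 3 → Matrix (Fin 2) (Fin 2) ℤ) : Fin 3 → Matrix (Fin 2) (Fin 2) ℤ :=
  ![u 1 * u 2 - u 2 * u 1, u 2 * u 0 - u 0 * u 2, u 0 * u 1 - u 1 * u 0]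

/-- The volume `tr (u₀ [u₁, u₂])` of a triple of matrices. -/
def sl2Vol (u : Fin 3 → Matrix (Fin 2) (Fin 2) ℤ) : ℤ :=
  (u 0 * (u 1 * u 2 - u 2 * u 1)).trace

lemma exists_traceless (x : Matrix (Fin 2) (Fin 2) ℤ) (h : x.trace = 0) :
    ∃ p q r, x = !![p, q; r, -p] := by
  refine ⟨x 0 0, x 0 1, x 1 0, ?_⟩
  rw [Matrix.trace_fin_two] at h
  ext i j
  fin_cases i <;> fin_cases j <;> simp
  omega

lemma sl2Dual_identities (u : Fin 3 → Matrix (Fin 2) (Fin 2) ℤ) (hu : ∀ i, (u i).trace = 0) :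
    (∀ w, w.trace = 0 → ∑ i, (sl2Dual u i * w).trace • u i = sl2Vol u • w) ∧
    (∀ w, w.trace = 0 → ∑ i, (u i * w).trace • sl2Dual u i = sl2Vol u • w) ∧
    ∑ i, (sl2Dual u i * u i).trace = 3 * sl2Vol u := by
  obtain ⟨p₀, q₀, r₀, h₀⟩ := exists_traceless _ (hu 0)
  obtain ⟨p₁, q₁, r₁, h₁⟩ := exists_traceless _ (hu 1)
  obtain ⟨p₂, q₂, r₂, h₂⟩ := exists_traceless _ (hu 2)
  refine ⟨fun w hw => ?_, fun w hw => ?_, ?_⟩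
  · obtain ⟨p, q, r, rfl⟩ := exists_traceless w hw
    simp only [Fin.sum_univ_three, sl2Dual, sl2Vol, h₀, h₁, h₂, Matrix.cons_val]
    ext i j
    fin_cases i <;> fin_cases j <;>
      simp [Matrix.trace_fin_two] <;> ring
  · obtain ⟨p, q, r, rfl⟩ := exists_traceless w hw
    simp only [Fin.sum_univ_three, sl2Dual, sl2Vol, h₀, h₁, h₂, Matrix.cons_val]
    ext i j
    fin_cases i <;> fin_cases j <;>
      simp [Matrix.trace_fin_two] <;> ring
  · simp only [Fin.sum_univ_three, sl2Dual, sl2Vol, h₀, h₁, h₂, Matrix.cons_val]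
    simp [Matrix.trace_fin_two]
    ring

lemma trace_sl2Dual (u : Fin 3 → Matrix (Fin 2) (Fin 2) ℤ) (i : Fin 3) :
    (sl2Dual u i).trace = 0 := by
  fin_cases i <;> simp [sl2Dual, Matrix.trace_sub] <;> rw [Matrix.trace_mul_comm, sub_self]

lemma comm_comm_traceless {u v x : Matrix (Fin 2) (Fin 2) ℤ} (hu : u.trace = 0) (hv : v.trace = 0)
    (hx : x.trace = 0) : u * (v * x - x * v) - (v * x - x * v) * u =
      (2 * (u * v).trace) • x - (2 * (u * x).trace) • v := by
  obtain ⟨p, q, r, rfl⟩ := exists_traceless u hu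
  obtain ⟨p₁, q₁, r₁, rfl⟩ := exists_traceless v hv
  obtain ⟨p₂, q₂, r₂, rfl⟩ := exists_traceless x hx
  ext i j
  fin_cases i <;> fin_cases j <;> simp [Matrix.trace_fin_two] <;> ring

lemma sum_comm_comm {u us : Fin 3 → Matrix (Fin 2) (Fin 2) ℤ} {d : ℤ}
    (hu : ∀ i, (u i).trace = 0) (hus : ∀ i, (us i).trace = 0)
    (h1 : ∀ w : Matrix (Fin 2) (Fin 2) ℤ, w.trace = 0 → ∑ i, (us i * w).trace • u i = d • w)
    (h2 : ∀ w : Matrix (Fin 2) (Fin 2) ℤ, w.trace = 0 → ∑ i, (u i * w).trace • us i = d • w)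
    (h3 : ∑ i, (us i * u i).trace = 3 * d) {x y z : Matrix (Fin 2) (Fin 2) ℤ} (hx : x.trace = 0)
    (hy : y.trace = 0) (hz : z.trace = 0) :
    ∑ i, ∑ j, ((z * y).trace * (us i * us j).trace - 2 * (us i * z).trace * (us j * y).trace) •
      (u i * (u j * x - x * u j) - (u j * x - x * u j) * u i) =
        (4 * d ^ 2 * (z * x).trace) • y := by
  have tr : ∀ (A : Matrix (Fin 2) (Fin 2) ℤ) (c : Fin 3 → ℤ) (B : Fin 3 → Matrix (Fin 2) (Fin 2) ℤ),
      ∑ j, c j * (A * B j).trace = (A * ∑ j, c j • B j).trace := by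
    intro A c B
    simp only [Fin.sum_univ_three, mul_add, Matrix.trace_add, mul_smul_comm, Matrix.trace_smul,
      smul_eq_mul]
  have e1 : ∑ i, ∑ j, (us i * us j).trace * (u i * u j).trace = 3 * d ^ 2 := by
    calc _ = ∑ i, ∑ j, (u i * u j).trace * (us i * us j).trace :=
          Finset.sum_congr rfl fun i _ => Finset.sum_congr rfl fun j _ => mul_comm _ _
      _ = ∑ i, (us i * (d • u i)).trace := Finset.sum_congr rfl fun i _ => by
          rw [tr, ← h2 (u i) (hu i)]
          simp only [Matrix.trace_mul_comm (u i)]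
      _ = d * ∑ i, (us i * u i).trace := by
          simp only [mul_smul_comm, Matrix.trace_smul, smul_eq_mul, Finset.mul_sum]
      _ = _ := by rw [h3]; ring
  have e2 : ∑ i, ∑ j, (us i * z).trace * (us j * y).trace * (u i * u j).trace
      = d ^ 2 * (z * y).trace := by
    calc _ = ∑ i, (us i * z).trace * (u i * (d • y)).trace := Finset.sum_congr rfl fun i _ => by
          rw [← h1 y hy, ← tr, Finset.mul_sum]
          exact Finset.sum_congr rfl fun j _ => by ring
      _ = ∑ i, (us i * z).trace * ((d • y) * u i).trace := Finset.sum_congr rfl fun i _ => by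
          rw [Matrix.trace_mul_comm (u i)]
      _ = ((d • y) * (d • z)).trace := by rw [tr, h1 z hz]
      _ = _ := by
          rw [smul_mul_smul_comm, Matrix.trace_smul, Matrix.trace_mul_comm, smul_eq_mul]; ring
  have e3 : ∑ i, ∑ j, ((us i * us j).trace * (u i * x).trace) • u j = d ^ 2 • x := by
    calc _ = ∑ i, (u i * x).trace • (d • us i) := Finset.sum_congr rfl fun i _ => by
          rw [← h1 (us i) (hus i), Finset.smul_sum]
          exact Finset.sum_congr rfl fun j _ => by
            rw [smul_smul, Matrix.trace_mul_comm (us i), mul_comm]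
      _ = d • ∑ i, (u i * x).trace • us i := by
          rw [Finset.smul_sum]
          exact Finset.sum_congr rfl fun i _ => by rw [smul_comm]
      _ = _ := by rw [h2 x hx, smul_smul, sq]
  have e4 : ∑ i, ∑ j, ((us i * z).trace * (us j * y).trace * (u i * x).trace) • u j
      = (d ^ 2 * (z * x).trace) • y := by
    calc _ = ∑ i, ((us i * z).trace * (x * u i).trace) • (d • y) :=
          Finset.sum_congr rfl fun i _ => by
            rw [← h1 y hy, Finset.smul_sum]
            exact Finset.sum_congr rfl fun j _ => by
              rw [smul_smul, Matrix.trace_mul_comm x]; congr 1; ring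
      _ = (∑ i, (us i * z).trace * (x * u i).trace) • (d • y) := by rw [Finset.sum_smul]
      _ = _ := by
          rw [tr, h1 z hz, mul_smul_comm, Matrix.trace_smul, smul_smul, smul_eq_mul,
            Matrix.trace_mul_comm]
          congr 1; ring
  calc _ = ∑ i, ∑ j, ((2 * (z * y).trace * ((us i * us j).trace * (u i * u j).trace)
          - 4 * ((us i * z).trace * (us j * y).trace * (u i * u j).trace)) • x
        - (2 * (z * y).trace) • (((us i * us j).trace * (u i * x).trace) • u j)
        + (4 : ℤ) • (((us i * z).trace * (us j * y).trace * (u i * x).trace) • u j)) := by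
        refine Finset.sum_congr rfl fun i _ => Finset.sum_congr rfl fun j _ => ?_
        rw [comm_comm_traceless (hu i) (hu j) hx]
        module
    _ = (2 * (z * y).trace * (3 * d ^ 2) - 4 * (d ^ 2 * (z * y).trace)) • x
        - (2 * (z * y).trace) • (d ^ 2 • x) + (4 : ℤ) • ((d ^ 2 * (z * x).trace) • y) := by
        simp only [Finset.sum_add_distrib, Finset.sum_sub_distrib, ← Finset.smul_sum,
          ← Finset.sum_smul, ← Finset.mul_sum, e1, e2, e3, e4]
    _ = _ := by module

/-- The traceless part `2 a - tr a` of the conjugates of `a` by the `b i`. -/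
def axisOf (a : SL2Z) (b : Fin 3 → SL2Z) (i : Fin 3) : Matrix (Fin 2) (Fin 2) ℤ :=
  2 • (((b i)⁻¹ * a * b i : SL2Z) : Matrix (Fin 2) (Fin 2) ℤ) -
    (a : Matrix (Fin 2) (Fin 2) ℤ).trace • (1 : Matrix (Fin 2) (Fin 2) ℤ)

lemma trace_conj_eq (a b : SL2Z) : ((b⁻¹ * a * b : SL2Z) : Matrix (Fin 2) (Fin 2) ℤ).trace =
    (a : Matrix (Fin 2) (Fin 2) ℤ).trace := by
  rw [Matrix.SpecialLinearGroup.coe_mul, Matrix.trace_mul_comm, ← Matrix.SpecialLinearGroup.coe_mul,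
    ← mul_assoc, mul_inv_cancel, one_mul]

lemma trace_axisOf (a : SL2Z) (b : Fin 3 → SL2Z) (i : Fin 3) : (axisOf a b i).trace = 0 := by
  rw [axisOf, Matrix.trace_sub, Matrix.trace_smul, Matrix.trace_smul, trace_conj_eq,
    Matrix.trace_one, Fintype.card_fin, smul_eq_mul, nsmul_eq_mul]
  push_cast; ring

lemma dEnd_dEnd_conj (a : SL2Z) (b : Fin 3 → SL2Z) (i j : Fin 3) (x : Matrix (Fin 2) (Fin 2) ℤ) :
    (4 : ℤ) • dEnd ((b i)⁻¹ * a * b i) (dEnd ((b j)⁻¹ * a * b j) x) =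
      ((a : Matrix (Fin 2) (Fin 2) ℤ).trace ^ 2) •
        (axisOf a b i * (axisOf a b j * x - x * axisOf a b j) -
        (axisOf a b j * x - x * axisOf a b j) * axisOf a b i) := by
  simp only [dEnd_apply, trace_conj_eq, axisOf]
  obtain ⟨t, ht⟩ : ∃ t, t = (a : Matrix (Fin 2) (Fin 2) ℤ).trace := ⟨_, rfl⟩
  obtain ⟨A, hA⟩ : ∃ A, A = (((b i)⁻¹ * a * b i : SL2Z) : Matrix (Fin 2) (Fin 2) ℤ) := ⟨_, rfl⟩
  obtain ⟨B, hB⟩ : ∃ B, B = (((b j)⁻¹ * a * b j : SL2Z) : Matrix (Fin 2) (Fin 2) ℤ) := ⟨_, rfl⟩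
  rw [← ht, ← hA, ← hB]
  have h : ∀ C : Matrix (Fin 2) (Fin 2) ℤ, (2 • B - t • (1 : Matrix (Fin 2) (Fin 2) ℤ)) * C -
      C * (2 • B - t • (1 : Matrix (Fin 2) (Fin 2) ℤ)) = (2 : ℤ) • (B * C - C * B) := by
    intro C
    simp only [sub_mul, mul_sub, smul_mul_assoc, mul_smul_comm, one_mul, mul_one]
    module
  have h' : ∀ C : Matrix (Fin 2) (Fin 2) ℤ, (2 • A - t • (1 : Matrix (Fin 2) (Fin 2) ℤ)) * C -
      C * (2 • A - t • (1 : Matrix (Fin 2) (Fin 2) ℤ)) = (2 : ℤ) • (A * C - C * A) := by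
    intro C
    simp only [sub_mul, mul_sub, smul_mul_assoc, mul_smul_comm, one_mul, mul_one]
    module
  rw [h', h]
  simp only [smul_mul_assoc, mul_smul_comm, ← smul_sub, smul_smul]
  module

/-- Reduction to a traceless matrix, modulo `R`. -/
lemma exists_traceless_congr {R : ℤ} {x : Matrix (Fin 2) (Fin 2) ℤ} (h : R ∣ x.trace) :
    ∃ x' e : Matrix (Fin 2) (Fin 2) ℤ, x'.trace = 0 ∧ x = x' + R • e ∧
      x' 0 0 = x 0 0 ∧ x' 0 1 = x 0 1 ∧ x' 1 0 = x 1 0 := by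
  obtain ⟨c, hc⟩ := h
  refine ⟨!![x 0 0, x 0 1; x 1 0, - x 0 0], !![0, 0; 0, c], by simp [Matrix.trace_fin_two], ?_,
    by simp⟩
  rw [Matrix.trace_fin_two] at hc
  ext i j
  fin_cases i <;> fin_cases j <;> simp
  omega

/-- If every integer is congruent modulo `R` to `m₀ ^ 2` times a generated scalar, then the
conjugations by `T` move any primitive traceless matrix to any multiple of
`m₀ ^ 2 * (2 t ^ 2 d ^ 2)` modulo `R`. -/
lemma exists_moving (k : ℕ) : ∃ k', ∀ T : Set SL2Z, T⁻¹ = T → (1 : SL2Z) ∈ T → ∀ a ∈ T,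
    ∀ b : Fin 3 → SL2Z, (∀ i, b i ∈ T * T) → ∀ R m₀ : ℤ,
    (∀ z, ∃ β ∈ ringGen (scalarSet T a b) k, R ∣ m₀ ^ 2 * z - β) →
    ∀ x : Matrix (Fin 2) (Fin 2) ℤ, R ∣ x.trace →
    (∃ α β γ, R ∣ α * x 0 0 + β * x 0 1 + γ * x 1 0 - 1) →
    ∀ y : Matrix (Fin 2) (Fin 2) ℤ, R ∣ y.trace →
    ∃ F ∈ ringGen (adSet T) k', ∃ e, F x = (m₀ ^ 2 *
      (2 * (a : Matrix (Fin 2) (Fin 2) ℤ).trace ^ 2 * sl2Vol (axisOf a b) ^ 2)) • y + R • e := by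
  refine ⟨k + 20, fun T hT h1 a ha b hb R m₀ hβ x hx hprim y hy => ?_⟩
  obtain ⟨x', e₁, hx', hxe, hx00, hx01, hx10⟩ := exists_traceless_congr hx
  obtain ⟨y', e₂, hy', hye, -⟩ := exists_traceless_congr hy
  obtain ⟨α, β, γ, ⟨κ, hκ⟩⟩ := hprim
  obtain ⟨z, hz⟩ : ∃ z, z = !![α, 2 * γ; 2 * β, - α] := ⟨_, rfl⟩
  have hz0 : z.trace = 0 := by simp [hz, Matrix.trace_fin_two]
  have hzx : (z * x').trace = 2 * (1 + R * κ) := by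
    have h11 : x' 1 1 = - x' 0 0 := by rw [Matrix.trace_fin_two] at hx'; linarith
    rw [← hκ, hz, ← hx00, ← hx01, ← hx10]
    rw [Matrix.trace_fin_two, Matrix.mul_apply, Matrix.mul_apply, Fin.sum_univ_two,
      Fin.sum_univ_two, h11]
    simp
    ring
  obtain ⟨u, hu⟩ : ∃ u, u = axisOf a b := ⟨_, rfl⟩
  obtain ⟨g1, g2, g3⟩ := sl2Dual_identities u (by rw [hu]; exact trace_axisOf a b)
  have hsum := sum_comm_comm (by rw [hu]; exact trace_axisOf a b) (trace_sl2Dual u) g1 g2 g3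
    hx' hy' hz0
  choose β hβm hβR using fun i j => hβ ((z * y').trace * (sl2Dual u i * sl2Dual u j).trace -
    2 * (sl2Dual u i * z).trace * (sl2Dual u j * y').trace)
  choose c hc using hβR
  choose F hF hFD using fun i j => exists_scalar_conj hT h1 ha hb k (hβm i j) i
  obtain ⟨D, hD⟩ : ∃ D : Fin 3 → Module.End ℤ (Matrix (Fin 2) (Fin 2) ℤ),
    D = fun i => dEnd ((b i)⁻¹ * a * b i) := ⟨_, rfl⟩
  have hDm : ∀ i, D i ∈ ringGen (adSet T) 3 := fun i => by
    rw [hD]; exact dEnd_conj_mem hT ha (hb i)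
  have hFD' : ∀ i j, F i j * D i = β i j • D i := by rw [hD]; exact hFD
  have hDD : ∀ i j, (4 : ℤ) • D i (D j x') = ((a : Matrix (Fin 2) (Fin 2) ℤ).trace ^ 2) •
      (u i * (u j * x' - x' * u j) - (u j * x' - x' * u j) * u i) := by
    rw [hD, hu]; exact fun i j => dEnd_dEnd_conj a b i j x'
  have hadd0 : (0 : Module.End ℤ (Matrix (Fin 2) (Fin 2) ℤ)) ∈ adSet T := Or.inr rfl
  obtain ⟨t, ht⟩ : ∃ t, t = (a : Matrix (Fin 2) (Fin 2) ℤ).trace := ⟨_, rfl⟩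
  obtain ⟨d, hd⟩ : ∃ d, d = sl2Vol u := ⟨_, rfl⟩
  rw [← hu, ← ht, ← hd]
  rw [← hd] at hsum
  rw [← ht] at hDD
  refine ⟨∑ i, ∑ j, F i j * D i * D j, ?_, ?_⟩
  · have : ∀ i j, F i j * D i * D j ∈ ringGen (adSet T) (k + 8) := fun i j =>
      ringGen.mul_mem (k := k + 7) (ringGen.mul_mem (k := k + 6) (hF i j)
        (ringGen.mono (by omega) (hDm i))) (ringGen.mono (by omega) (hDm j))
    have h := ringGen.sum_mem hadd0 Finset.univ (fun i => ∑ j, F i j * D i * D j)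
      (k := k + 8 + 3) fun i _ => by
        simpa using ringGen.sum_mem hadd0 Finset.univ (fun j => F i j * D i * D j)
          (k := k + 8) fun j _ => this i j
    exact ringGen.mono (by simp) h
  · obtain ⟨G, hG⟩ : ∃ G : Module.End ℤ (Matrix (Fin 2) (Fin 2) ℤ),
      G = ∑ i, ∑ j, F i j * D i * D j := ⟨_, rfl⟩
    obtain ⟨E, hE⟩ : ∃ E : Matrix (Fin 2) (Fin 2) ℤ, E = ∑ i, ∑ j, c i j • D i (D j x') := ⟨_, rfl⟩
    have hGx : G x' = (m₀ ^ 2 * (2 * t ^ 2 * d ^ 2 * (1 + R * κ))) • y' - R • E := by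
      have h4 : (4 : ℤ) • G x' = (4 : ℤ) •
          ((m₀ ^ 2 * (2 * t ^ 2 * d ^ 2 * (1 + R * κ))) • y' - R • E) := by
        calc (4 : ℤ) • G x' = ∑ i, ∑ j, β i j • ((4 : ℤ) • D i (D j x')) := by
              rw [hG]
              simp only [LinearMap.sum_apply, hFD', Module.End.mul_apply, LinearMap.smul_apply,
                Finset.smul_sum]
              exact Finset.sum_congr rfl fun i _ => Finset.sum_congr rfl fun j _ => smul_comm _ _ _
          _ = ∑ i, ∑ j, ((m₀ ^ 2 * t ^ 2) • (((z * y').trace * (sl2Dual u i * sl2Dual u j).trace -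
                2 * (sl2Dual u i * z).trace * (sl2Dual u j * y').trace) •
                (u i * (u j * x' - x' * u j) - (u j * x' - x' * u j) * u i)) -
                (4 * R) • (c i j • D i (D j x'))) := by
              refine Finset.sum_congr rfl fun i _ => Finset.sum_congr rfl fun j _ => ?_
              have hb : β i j = m₀ ^ 2 * ((z * y').trace * (sl2Dual u i * sl2Dual u j).trace -
                2 * (sl2Dual u i * z).trace * (sl2Dual u j * y').trace) - R * c i j := by
                rw [← hc i j]; ring
              rw [hb, sub_smul, hDD, smul_smul, ← smul_smul (R) (c i j), ← hDD]
              module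
          _ = (m₀ ^ 2 * t ^ 2) • ((4 * d ^ 2 * (z * x').trace) • y') - (4 * R) • E := by
              simp only [Finset.sum_sub_distrib, ← Finset.smul_sum, hsum, hE]
          _ = _ := by rw [hzx]; module
      exact smul_right_injective _ (by norm_num : (4 : ℤ) ≠ 0) h4
    refine ⟨G e₁ - E + (m₀ ^ 2 * (2 * t ^ 2 * d ^ 2)) • (κ • y' - e₂), ?_⟩
    rw [← hG, hxe, map_add, map_smul, hGx, hye]
    module

lemma dScalar_conj (a w : SL2Z) (b : Fin 3 → SL2Z) (i : Fin 3) :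
    dScalar a (b i * w * (b i)⁻¹) = (a : Matrix (Fin 2) (Fin 2) ℤ).trace *
      ((w : Matrix (Fin 2) (Fin 2) ℤ).trace *
        (axisOf a b i * (w : Matrix (Fin 2) (Fin 2) ℤ)).trace) := by
  have h1 : ((b i * w * (b i)⁻¹ : SL2Z) : Matrix (Fin 2) (Fin 2) ℤ).trace =
      (w : Matrix (Fin 2) (Fin 2) ℤ).trace := by
    simpa using trace_conj_eq w (b i)⁻¹
  have h2 : ((a : Matrix (Fin 2) (Fin 2) ℤ) *
      ((b i * w * (b i)⁻¹ : SL2Z) : Matrix (Fin 2) (Fin 2) ℤ)).trace =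
      ((((b i)⁻¹ * a * b i : SL2Z) : Matrix (Fin 2) (Fin 2) ℤ) * w).trace := by
    have := trace_conj_eq (a * (b i * w * (b i)⁻¹)) (b i)
    rw [show (b i)⁻¹ * (a * (b i * w * (b i)⁻¹)) * b i = (b i)⁻¹ * a * b i * w by group] at this
    rw [← Matrix.SpecialLinearGroup.coe_mul, ← this, Matrix.SpecialLinearGroup.coe_mul]
  rw [dScalar, h1, h2, axisOf, sub_mul, smul_mul_assoc, smul_mul_assoc, one_mul, Matrix.trace_sub,
    Matrix.trace_smul, Matrix.trace_smul, smul_eq_mul, nsmul_eq_mul]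
  push_cast
  ring

lemma eq_or_eq_neg_of_trace_smul {w w' : SL2Z} (hw : (w : Matrix (Fin 2) (Fin 2) ℤ).trace ≠ 0)
    (hw' : (w' : Matrix (Fin 2) (Fin 2) ℤ).trace ≠ 0)
    (h : (w : Matrix (Fin 2) (Fin 2) ℤ).trace • ((2 : ℤ) • (w : Matrix (Fin 2) (Fin 2) ℤ) -
        (w : Matrix (Fin 2) (Fin 2) ℤ).trace • (1 : Matrix (Fin 2) (Fin 2) ℤ)) =
      (w' : Matrix (Fin 2) (Fin 2) ℤ).trace • ((2 : ℤ) • (w' : Matrix (Fin 2) (Fin 2) ℤ) -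
        (w' : Matrix (Fin 2) (Fin 2) ℤ).trace • (1 : Matrix (Fin 2) (Fin 2) ℤ))) :
    w' = w ∨ w' = -w := by
  have hd := w.det_coe
  have hd' := w'.det_coe
  rw [Matrix.det_fin_two] at hd hd'
  have h00 := congrFun (congrFun h 0) 0
  have h01 := congrFun (congrFun h 0) 1
  have h10 := congrFun (congrFun h 1) 0
  have h11 := congrFun (congrFun h 1) 1
  have ht : (w : Matrix (Fin 2) (Fin 2) ℤ).trace = w 0 0 + w 1 1 := Matrix.trace_fin_two _
  have ht' : (w' : Matrix (Fin 2) (Fin 2) ℤ).trace = w' 0 0 + w' 1 1 := Matrix.trace_fin_two _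
  obtain ⟨t, htt⟩ : ∃ t, t = (w : Matrix (Fin 2) (Fin 2) ℤ).trace := ⟨_, rfl⟩
  obtain ⟨s, hss⟩ : ∃ s, s = (w' : Matrix (Fin 2) (Fin 2) ℤ).trace := ⟨_, rfl⟩
  rw [← htt] at ht hw h00 h01 h10 h11
  rw [← hss] at ht' hw' h00 h01 h10 h11
  simp only [Matrix.smul_apply, Matrix.sub_apply, smul_eq_mul, Matrix.one_apply_eq, mul_one,
    ne_eq, zero_ne_one, one_ne_zero, not_false_eq_true, Matrix.one_apply_ne, mul_zero, sub_zero]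
    at h00 h01 h10 h11
  have key : (t ^ 2 - s ^ 2) * (4 - t ^ 2 - s ^ 2) = 0 := by
    have e1 : t ^ 2 * (4 - t ^ 2) = (t * (2 * w 0 0 - t)) * (t * (2 * w 1 1 - t)) -
        (t * (2 * w 0 1)) * (t * (2 * w 1 0)) := by
      rw [ht] at *; linear_combination (-4 * (w 0 0 + w 1 1) ^ 2) * hd
    have e2 : s ^ 2 * (4 - s ^ 2) = (s * (2 * w' 0 0 - s)) * (s * (2 * w' 1 1 - s)) -
        (s * (2 * w' 0 1)) * (s * (2 * w' 1 0)) := by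
      rw [ht'] at *; linear_combination (-4 * (w' 0 0 + w' 1 1) ^ 2) * hd'
    rw [h00, h01, h10, h11, ← e2] at e1
    linear_combination e1
  have hcases : s = t ∨ s = -t := by
    rcases mul_eq_zero.1 key with h | h
    · have : (s - t) * (s + t) = 0 := by linear_combination -h
      rcases mul_eq_zero.1 this with h | h
      · left; omega
      · right; omega
    · exfalso
      have h1 : t ^ 2 ≤ 4 := by nlinarith only [h, sq_nonneg s]
      have h2 : s ^ 2 ≤ 4 := by nlinarith only [h, sq_nonneg t]
      have t1 : t ≤ 2 := by nlinarith only [h1]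
      have t2 : -2 ≤ t := by nlinarith only [h1]
      have s1 : s ≤ 2 := by nlinarith only [h2]
      have s2 : -2 ≤ s := by nlinarith only [h2]
      clear * - h t1 t2 s1 s2 hw hw'
      interval_cases t <;> interval_cases s <;> simp_all
  rcases hcases with rfl | rfl
  · left
    have c00 := mul_left_cancel₀ hw h00
    have c01 := mul_left_cancel₀ hw h01
    have c10 := mul_left_cancel₀ hw h10
    have c11 := mul_left_cancel₀ hw h11
    ext i j
    fin_cases i <;> fin_cases j <;> simp <;> omega
  · right
    rw [neg_mul, ← mul_neg] at h00 h01 h10 h11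
    have c00 := mul_left_cancel₀ hw h00
    have c01 := mul_left_cancel₀ hw h01
    have c10 := mul_left_cancel₀ hw h10
    have c11 := mul_left_cancel₀ hw h11
    ext i j
    fin_cases i <;> fin_cases j <;> simp <;> omega

/-- One of the three families of scalars takes many values. -/
lemma exists_card_image_dScalar {a : SL2Z} {b : Fin 3 → SL2Z}
    (ha : (a : Matrix (Fin 2) (Fin 2) ℤ).trace ≠ 0) (hd : sl2Vol (axisOf a b) ≠ 0)
    (V : Finset SL2Z) (hV : ∀ w ∈ V, (w : Matrix (Fin 2) (Fin 2) ℤ).trace ≠ 0) :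
    ∃ i, V.card ≤ 2 * (V.image fun w => dScalar a (b i * w * (b i)⁻¹)).card ^ 3 := by
  classical
  obtain ⟨lam, hlam⟩ : ∃ lam : Fin 3 → SL2Z → ℤ,
    lam = fun i w => dScalar a (b i * w * (b i)⁻¹) := ⟨_, rfl⟩
  have hinj : ∀ w ∈ V, ∀ w' ∈ V, (∀ i, lam i w = lam i w') → w' = w ∨ w' = -w := by
    intro w hw w' hw' h
    refine eq_or_eq_neg_of_trace_smul (hV w hw) (hV w' hw') ?_
    obtain ⟨g1, g2, g3⟩ := sl2Dual_identities (axisOf a b) (trace_axisOf a b)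
    have tr0 : ∀ w : SL2Z, ((w : Matrix (Fin 2) (Fin 2) ℤ).trace •
        ((2 : ℤ) • (w : Matrix (Fin 2) (Fin 2) ℤ) -
        (w : Matrix (Fin 2) (Fin 2) ℤ).trace • (1 : Matrix (Fin 2) (Fin 2) ℤ))).trace = 0 := by
      intro w
      rw [Matrix.trace_smul, Matrix.trace_sub, Matrix.trace_smul, Matrix.trace_smul,
        Matrix.trace_one, Fintype.card_fin, smul_eq_mul, smul_eq_mul, smul_eq_mul]
      push_cast; ring
    have hpair : ∀ (w : SL2Z) i, (axisOf a b i * ((w : Matrix (Fin 2) (Fin 2) ℤ).trace •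
        ((2 : ℤ) • (w : Matrix (Fin 2) (Fin 2) ℤ) -
        (w : Matrix (Fin 2) (Fin 2) ℤ).trace • (1 : Matrix (Fin 2) (Fin 2) ℤ)))).trace =
        2 * ((w : Matrix (Fin 2) (Fin 2) ℤ).trace *
          (axisOf a b i * (w : Matrix (Fin 2) (Fin 2) ℤ)).trace) := by
      intro w i
      rw [mul_smul_comm, mul_sub, mul_smul_comm, mul_smul_comm, mul_one, Matrix.trace_smul,
        Matrix.trace_sub, Matrix.trace_smul, Matrix.trace_smul, trace_axisOf, smul_eq_mul,
        smul_eq_mul, smul_eq_mul]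
      ring
    apply smul_right_injective _ hd
    simp only
    rw [← g2 _ (tr0 w), ← g2 _ (tr0 w')]
    refine Finset.sum_congr rfl fun i _ => ?_
    rw [hpair, hpair]
    have := h i
    rw [hlam] at this
    simp only [dScalar_conj] at this
    rw [mul_left_cancel₀ ha this]
  obtain ⟨f, hf⟩ : ∃ f : SL2Z → ℤ × ℤ × ℤ, f = fun w => (lam 0 w, lam 1 w, lam 2 w) := ⟨_, rfl⟩
  have h1 : V.card ≤ 2 * (V.image f).card := by
    refine Finset.card_le_mul_card_image V 2 fun z hz => ?_
    obtain ⟨w, hw, rfl⟩ := Finset.mem_image.1 hz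
    refine (Finset.card_le_card (t := {w, -w}) ?_).trans Finset.card_le_two
    intro w' hw'
    rw [Finset.mem_filter] at hw'
    rw [Finset.mem_insert, Finset.mem_singleton]
    refine hinj w hw w' hw'.1 fun i => ?_
    have := hw'.2.symm
    rw [hf] at this
    simp only [Prod.mk.injEq] at this
    fin_cases i
    · exact this.1
    · exact this.2.1
    · exact this.2.2
  have h2 : (V.image f).card ≤ ∏ i, (V.image (lam i)).card := by
    have : V.image f ⊆ V.image (lam 0) ×ˢ (V.image (lam 1) ×ˢ V.image (lam 2)) := by
      intro z hz
      obtain ⟨w, hw, rfl⟩ := Finset.mem_image.1 hz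
      rw [hf]
      simp only [Finset.mem_product]
      exact ⟨Finset.mem_image_of_mem _ hw, Finset.mem_image_of_mem _ hw,
        Finset.mem_image_of_mem _ hw⟩
    refine (Finset.card_le_card this).trans ?_
    rw [Finset.card_product, Finset.card_product, Fin.prod_univ_three, mul_assoc]
  obtain ⟨i, -, hi⟩ := Finset.exists_max_image Finset.univ (fun i => (V.image (lam i)).card)
    ⟨0, Finset.mem_univ _⟩
  refine ⟨i, h1.trans (Nat.mul_le_mul_left 2 (h2.trans ?_))⟩
  refine (Finset.prod_le_pow_card _ _ _ fun j hj => hi j hj).trans ?_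
  rw [hlam]; simp

lemma trace_ne_zero_of_dvd {w : SL2Z} {N : ℤ} (hN : 2 ≤ N)
    (h : ∀ i j, N ∣ w i j - (1 : Matrix (Fin 2) (Fin 2) ℤ) i j) :
    (w : Matrix (Fin 2) (Fin 2) ℤ).trace ≠ 0 := by
  have hd := w.det_coe
  rw [Matrix.det_fin_two] at hd
  rw [Matrix.trace_fin_two]
  obtain ⟨p, hp⟩ := h 0 0
  obtain ⟨q, hq⟩ := h 0 1
  obtain ⟨r, hr⟩ := h 1 0
  obtain ⟨s, hs⟩ := h 1 1
  simp only [Matrix.one_apply_eq, ne_eq, zero_ne_one, one_ne_zero, not_false_eq_true,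
    Matrix.one_apply_ne, sub_zero] at hp hq hr hs
  have h00 : w 0 0 = 1 + N * p := by linarith
  have h11 : w 1 1 = 1 + N * s := by linarith
  rw [h00, h11, hq, hr] at hd
  intro h0
  rw [h00, h11] at h0
  have h1 : N * (p + s) = -2 := by linarith
  have h2 : N * N * (p * s - q * r) = 2 := by linear_combination hd - h1
  have h4 : N * N ∣ 2 := ⟨_, h2.symm⟩
  have := Int.le_of_dvd (by norm_num) h4
  nlinarith

lemma dvd_trace_of_eq {g : SL2Z} {Q R : ℤ} (hQ : Q ≠ 0) (hR : R ∣ Q) {x : Matrix (Fin 2) (Fin 2) ℤ}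
    (h : (g : Matrix (Fin 2) (Fin 2) ℤ) = 1 + Q • x) : R ∣ x.trace := by
  have hd := g.det_coe
  rw [h, Matrix.det_fin_two] at hd
  simp only [Matrix.add_apply, Matrix.smul_apply, smul_eq_mul, Matrix.one_apply_eq, ne_eq,
    zero_ne_one, one_ne_zero, not_false_eq_true, Matrix.one_apply_ne, zero_add] at hd
  rw [Matrix.trace_fin_two]
  have h1 : Q * (x 0 0 + x 1 1 + Q * (x 0 0 * x 1 1 - x 0 1 * x 1 0)) = 0 := by
    linear_combination hd
  have h2 := (mul_eq_zero.1 h1).resolve_left hQ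
  have h3 : x 0 0 + x 1 1 = Q * -(x 0 0 * x 1 1 - x 0 1 * x 1 0) := by linarith
  rw [h3]
  exact hR.mul_right _

/-- The data with which elements of `T` close to `1` are moved around: every integer is
`m₀ ^ 2` times a generated scalar modulo `R`, and `m' = gcd` part of `m₀ ^ 2 (2 t ^ 2 d ^ 2)`. -/
structure Mover (k : ℕ) (T : Set SL2Z) (R m' N D P : ℤ) : Prop where
  exists_data : ∃ a ∈ T, ∃ b : Fin 3 → SL2Z, (∀ i, b i ∈ T * T) ∧ ∃ m₀ u : ℤ,
    (∀ z, ∃ β ∈ ringGen (scalarSet T a b) k, R ∣ m₀ ^ 2 * z - β) ∧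
    m₀ ^ 2 * (2 * (a : Matrix (Fin 2) (Fin 2) ℤ).trace ^ 2 * sl2Vol (axisOf a b) ^ 2) = m' * u ∧
    IsCoprime u P
  inv_eq : T⁻¹ = T
  one_mem : (1 : SL2Z) ∈ T
  dvd_pow : ∃ s : ℕ, R ∣ P ^ s
  eq_mul : R = N * D * m'
  dvd_P : P ∣ D
  dvd_D : m' ∣ D

/-- A matrix that is nonzero modulo every prime divisor of `R`, witnessed by a Bézout relation. -/
def PrimitiveMod (R : ℤ) (x : Matrix (Fin 2) (Fin 2) ℤ) : Prop :=
  ∃ α β γ, R ∣ α * x 0 0 + β * x 0 1 + γ * x 1 0 - 1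

/-- Starting from `1 + Q x` one reaches `1 + Q m' y` modulo `Q R`. -/
lemma Mover.exists_move (k K : ℕ) : ∃ K', ∀ (T : Set SL2Z) (R m' N D P : ℤ),
    Mover k T R m' N D P → ∀ Q : ℤ, Q ≠ 0 → R ∣ Q → ∀ g ∈ T ^ K, ∀ x : Matrix (Fin 2) (Fin 2) ℤ,
    (g : Matrix (Fin 2) (Fin 2) ℤ) = 1 + Q • x → PrimitiveMod R x →
    ∀ y : Matrix (Fin 2) (Fin 2) ℤ, R ∣ y.trace → Reach T K' Q R (m' • y) := by
  obtain ⟨k', hk'⟩ := exists_moving k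
  obtain ⟨K', hK'⟩ := Reach.of_ringGen k' K
  refine ⟨K', fun T R m' N D P hM Q hQ hRQ g hg x hgx hx y hy => ?_⟩
  obtain ⟨a, ha, b, hb, m₀, u, hβ, hmu, huP⟩ := hM.exists_data
  obtain ⟨s, hs⟩ := hM.dvd_pow
  have huR : IsCoprime u R := (huP.pow_right (n := s)).of_isCoprime_of_dvd_right hs
  obtain ⟨v, c, hvc⟩ := huR
  obtain ⟨F, hF, e, hFe⟩ := hk' T hM.inv_eq hM.one_mem a ha b hb R m₀ hβ x
    (dvd_trace_of_eq hQ hRQ hgx) hx (v • y) (by rw [Matrix.trace_smul]; exact hy.mul_left _)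
  rw [hmu] at hFe
  obtain ⟨g', hg', e', he'⟩ := hK' T hM.inv_eq hM.one_mem Q R hRQ F hF x
    ⟨g, hg, 0, by rw [hgx, smul_zero, add_zero]⟩
  refine ⟨g', hg', e' + e - (m' * c) • y, ?_⟩
  rw [he', hFe, smul_smul, show m' * u * v = m' - m' * c * R by linear_combination m' * hvc]
  module

/-- Elements of bounded powers of `T` at every depth. -/
lemma Mover.exists_deep (k K j : ℕ) : ∃ K', ∀ (T : Set SL2Z) (R m' N D P : ℤ),
    Mover k T R m' N D P → R ≠ 0 → ∀ Q : ℤ, Q ≠ 0 → R ∣ Q → ∀ g ∈ T ^ K,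
    ∀ x : Matrix (Fin 2) (Fin 2) ℤ,
    (g : Matrix (Fin 2) (Fin 2) ℤ) = 1 + Q • x → PrimitiveMod R x →
    ∃ g' ∈ T ^ K', ∃ x' : Matrix (Fin 2) (Fin 2) ℤ,
      (g' : Matrix (Fin 2) (Fin 2) ℤ) = 1 + (Q * (N * m') ^ j) • x' ∧ PrimitiveMod R x' := by
  induction j with
  | zero => exact ⟨K, fun T R m' N D P hM hR Q hQ hRQ g hg x hgx hx =>
      ⟨g, hg, x, by rw [pow_zero, mul_one, hgx], hx⟩⟩
  | succ j ih =>
    obtain ⟨K₁, h₁⟩ := ih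
    obtain ⟨k', hk'⟩ := exists_moving k
    obtain ⟨K', hK'⟩ := Reach.of_ringGen k' K₁
    refine ⟨K', fun T R m' N D P hM hR Q hQ hRQ g hg x hgx hx => ?_⟩
    obtain ⟨g₁, hg₁, x₁, hx₁, hp₁⟩ := h₁ T R m' N D P hM hR Q hQ hRQ g hg x hgx hx
    obtain ⟨Q₁, hQ₁⟩ : ∃ Q₁, Q₁ = Q * (N * m') ^ j := ⟨_, rfl⟩
    rw [← hQ₁] at hx₁
    have hNm : N * m' ≠ 0 := by
      intro h0
      apply hR
      rw [hM.eq_mul]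
      linear_combination D * h0
    have hQ₁0 : Q₁ ≠ 0 := by rw [hQ₁]; exact mul_ne_zero hQ (pow_ne_zero _ hNm)
    have hRQ₁ : R ∣ Q₁ := by rw [hQ₁]; exact hRQ.mul_right _
    obtain ⟨a, ha, b, hb, m₀, u, hβ, hmu, huP⟩ := hM.exists_data
    obtain ⟨s, hs⟩ := hM.dvd_pow
    obtain ⟨F, hF, e, hFe⟩ := hk' T hM.inv_eq hM.one_mem a ha b hb R m₀ hβ x₁
      (dvd_trace_of_eq hQ₁0 hRQ₁ hx₁) hp₁ (N • !![0, 1; 0, 0]) (by simp [Matrix.trace_fin_two])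
    rw [hmu] at hFe
    obtain ⟨g', hg', e', he'⟩ := hK' T hM.inv_eq hM.one_mem Q₁ R hRQ₁ F hF x₁
      ⟨g₁, hg₁, 0, by rw [hx₁, smul_zero, add_zero]⟩
    refine ⟨g', hg', u • !![0, 1; 0, 0] + D • (e' + e), ?_, ?_⟩
    · rw [he', hFe, pow_succ, ← mul_assoc, ← hQ₁]
      have := hM.eq_mul
      obtain ⟨f, hf⟩ : ∃ f : Matrix (Fin 2) (Fin 2) ℤ, f = !![0, 1; 0, 0] := ⟨_, rfl⟩
      rw [← hf, this]
      module
    · have hcop : IsCoprime (u + D * (e' + e) 0 1) P := by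
        obtain ⟨c, hc⟩ := hM.dvd_P
        rw [hc, mul_assoc]
        exact huP.add_mul_left_left _
      have hcR : IsCoprime (u + D * (e' + e) 0 1) R :=
        (hcop.pow_right (n := s)).of_isCoprime_of_dvd_right hs
      obtain ⟨v, c, hvc⟩ := hcR
      refine ⟨0, v, 0, -c, ?_⟩
      simp only [Matrix.add_apply, Matrix.smul_apply, smul_eq_mul, Matrix.of_apply,
        Matrix.cons_val', Matrix.cons_val_zero, Matrix.cons_val_one, zero_mul, mul_one, zero_add,
        add_zero] at hvc ⊢
      linear_combination hvc

/-- Bounded powers of `T` fill the congruence subgroup of level `m' Q`, to every depth. -/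
theorem Mover.exists_approx (k K j : ℕ) : ∃ K', ∀ (T : Set SL2Z) (R m' N D P : ℤ),
    Mover k T R m' N D P → R ≠ 0 → ∀ Q : ℤ, Q ≠ 0 → R ∣ Q → ∀ g ∈ T ^ K,
    ∀ x : Matrix (Fin 2) (Fin 2) ℤ,
    (g : Matrix (Fin 2) (Fin 2) ℤ) = 1 + Q • x → PrimitiveMod R x →
    ∀ h : SL2Z, (∃ y, (h : Matrix (Fin 2) (Fin 2) ℤ) = 1 + (m' * Q) • y) →
    ∃ f ∈ T ^ K', ∃ y, ((h * f⁻¹ : SL2Z) : Matrix (Fin 2) (Fin 2) ℤ) =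
      1 + (m' * (Q * (N * m') ^ j)) • y := by
  induction j with
  | zero =>
    refine ⟨0, fun T R m' N D P hM hR Q hQ hRQ g hg x hgx hx h hh => ?_⟩
    obtain ⟨y, hy⟩ := hh
    exact ⟨1, by simp, y, by rw [inv_one, mul_one, pow_zero, mul_one, hy]⟩
  | succ j ih =>
    obtain ⟨K₁, h₁⟩ := ih
    obtain ⟨K₂, h₂⟩ := Mover.exists_deep k K j
    obtain ⟨K₃, h₃⟩ := Mover.exists_move k K₂
    refine ⟨K₃ + K₁, fun T R m' N D P hM hR Q hQ hRQ g hg x hgx hx h hh => ?_⟩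
    obtain ⟨f, hf, y, hy⟩ := h₁ T R m' N D P hM hR Q hQ hRQ g hg x hgx hx h hh
    obtain ⟨g', hg', x', hgx', hx'⟩ := h₂ T R m' N D P hM hR Q hQ hRQ g hg x hgx hx
    have hm : m' ≠ 0 := by
      rintro rfl
      exact hR (by rw [hM.eq_mul, mul_zero])
    have hNm : N * m' ≠ 0 := by
      intro h0
      apply hR
      rw [hM.eq_mul]
      linear_combination D * h0
    obtain ⟨Q₁, hQ₁⟩ : ∃ Q₁, Q₁ = Q * (N * m') ^ j := ⟨_, rfl⟩
    rw [pow_succ, ← mul_assoc Q, ← hQ₁]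
    rw [← hQ₁] at hy hgx'
    have hQ₁0 : Q₁ ≠ 0 := by rw [hQ₁]; exact mul_ne_zero hQ (pow_ne_zero _ hNm)
    have hRQ₁ : R ∣ Q₁ := by rw [hQ₁]; exact hRQ.mul_right _
    obtain ⟨f', hf', e, he⟩ := h₃ T R m' N D P hM Q₁ hQ₁0 hRQ₁ g' hg' x' hgx' hx' y
      (dvd_trace_of_eq (mul_ne_zero hm hQ₁0) (hRQ₁.mul_left _) hy)
    refine ⟨f' * f, by rw [pow_add]; exact Set.mul_mem_mul hf' hf, ?_⟩
    obtain ⟨c, hc⟩ := hM.dvd_D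
    refine ⟨(-c) • (e * ((f'⁻¹ : SL2Z) : Matrix (Fin 2) (Fin 2) ℤ)), ?_⟩
    have h1 : ((h * f⁻¹ : SL2Z) : Matrix (Fin 2) (Fin 2) ℤ) =
        (f' : Matrix (Fin 2) (Fin 2) ℤ) - (Q₁ * R) • e := by
      rw [hy, he]; module
    have h2 : (f' : Matrix (Fin 2) (Fin 2) ℤ) * ((f'⁻¹ : SL2Z) : Matrix (Fin 2) (Fin 2) ℤ) = 1 := by
      rw [← Matrix.SpecialLinearGroup.coe_mul, mul_inv_cancel, Matrix.SpecialLinearGroup.coe_one]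
    rw [_root_.mul_inv_rev, ← mul_assoc, Matrix.SpecialLinearGroup.coe_mul, h1, sub_mul, h2,
      smul_mul_assoc, hM.eq_mul, hc, smul_smul, sub_eq_add_neg, ← neg_smul]
    congr 2
    ring

lemma exists_add_mul_isCoprime {c d : ℤ} {N : ℕ} (hN : N ≠ 0) (hc : c ≠ 0)
    (h : ∀ p : ℤ, Prime p → p ∣ c → p ∣ d → ¬ p ∣ (N : ℤ)) : ∃ k : ℤ, IsCoprime c (d + k * N) := by
  have hN' : (N : ℤ) ≠ 0 := by exact_mod_cast hN
  obtain ⟨e, he⟩ : ∃ e : ℕ, e = Int.gcd d N := ⟨_, rfl⟩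
  have he0 : e ≠ 0 := by rw [he]; exact Int.gcd_ne_zero_right hN'
  have he0' : (e : ℤ) ≠ 0 := by exact_mod_cast he0
  obtain ⟨d₁, hd₁⟩ : (e : ℤ) ∣ d := by rw [he]; exact Int.gcd_dvd_left ..
  obtain ⟨N₁, hN₁⟩ : (e : ℤ) ∣ N := by rw [he]; exact Int.gcd_dvd_right ..
  have hcop : IsCoprime d₁ N₁ := by
    have := Int.gcd_eq_gcd_ab d N
    rw [← he] at this
    refine ⟨Int.gcdA d N, Int.gcdB d N, ?_⟩
    apply mul_left_cancel₀ he0'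
    linear_combination -this - Int.gcdA d N * hd₁ - Int.gcdB d N * hN₁
  have hN₁0 : N₁.natAbs ≠ 0 := by
    rw [Int.natAbs_ne_zero]
    rintro rfl
    exact hN' (by rw [hN₁, mul_zero])
  have hdvd : N₁.natAbs ∣ N₁.natAbs * c.natAbs := dvd_mul_right _ _
  have : NeZero (N₁.natAbs * c.natAbs) := ⟨mul_ne_zero hN₁0 (Int.natAbs_ne_zero.2 hc)⟩
  have hu : IsUnit ((d₁ : ℤ) : ZMod N₁.natAbs) := by
    rw [ZMod.coe_int_isUnit_iff_isCoprime]
    exact (Int.isCoprime_iff_gcd_eq_one.2 (by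
      rw [Int.gcd, Int.natAbs_natCast]
      exact Int.isCoprime_iff_gcd_eq_one.1 hcop.symm))
  obtain ⟨w, hw⟩ := ZMod.unitsMap_surjective hdvd hu.unit
  obtain ⟨z, hz⟩ := ZMod.intCast_surjective (w : ZMod (N₁.natAbs * c.natAbs))
  have hzu : IsCoprime ((N₁.natAbs * c.natAbs : ℕ) : ℤ) z := by
    rw [← ZMod.coe_int_isUnit_iff_isCoprime, hz]
    exact w.isUnit
  have hzd : ((z : ℤ) : ZMod N₁.natAbs) = (d₁ : ℤ) := by
    have := congrArg Units.val hw
    rw [ZMod.unitsMap_val, ← hz] at this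
    simpa using this
  rw [ZMod.intCast_eq_intCast_iff_dvd_sub, Int.natAbs_dvd] at hzd
  obtain ⟨k, hk⟩ := hzd
  refine ⟨-k, ?_⟩
  have : d + -k * N = e * z := by rw [hd₁, hN₁]; linear_combination (e : ℤ) * hk
  rw [this]
  refine IsCoprime.mul_right ?_ ?_
  · rw [Int.isCoprime_iff_gcd_eq_one]
    by_contra hne
    obtain ⟨p, hp, hpd⟩ := Nat.exists_prime_and_dvd hne
    have h1 : (p : ℤ) ∣ c := (Int.natCast_dvd_natCast.2 hpd).trans (Int.gcd_dvd_left ..)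
    have h2 : (p : ℤ) ∣ e := (Int.natCast_dvd_natCast.2 hpd).trans (Int.gcd_dvd_right ..)
    exact h p (Nat.prime_iff_prime_int.1 hp) h1 (hd₁ ▸ h2.mul_right _) (hN₁ ▸ h2.mul_right _)
  · rw [Nat.cast_mul] at hzu
    have h1 : IsCoprime ((c.natAbs : ℕ) : ℤ) z := hzu.of_mul_left_right
    rw [Int.isCoprime_iff_gcd_eq_one] at h1 ⊢
    rwa [Int.gcd, Int.natAbs_natCast] at h1

lemma redSL_apply (N : ℕ) (g : SL2Z) (i j : Fin 2) :
    (redSL N g : Matrix (Fin 2) (Fin 2) (ZMod N)) i j = ((g i j : ℤ) : ZMod N) := rfl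

theorem redSL_surjective {N : ℕ} (hN : N ≠ 0) : Function.Surjective (redSL N) := by
  intro g
  have hg := g.det_coe
  rw [Matrix.det_fin_two] at hg
  obtain ⟨b, hb⟩ := ZMod.intCast_surjective (g 0 1)
  obtain ⟨a, ha⟩ := ZMod.intCast_surjective (g 0 0)
  obtain ⟨d, hd⟩ := ZMod.intCast_surjective (g 1 1)
  obtain ⟨c, hc, hc0⟩ : ∃ c : ℤ, (c : ZMod N) = g 1 0 ∧ c ≠ 0 := by
    obtain ⟨c, hc⟩ := ZMod.intCast_surjective (g 1 0)
    by_cases h : c = 0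
    · exact ⟨N, by rw [← hc, h]; simp, by exact_mod_cast hN⟩
    · exact ⟨c, hc, h⟩
  have hdet : ((a * d - b * c : ℤ) : ZMod N) = ((1 : ℤ) : ZMod N) := by
    push_cast; rw [ha, hb, hc, hd]; exact hg
  rw [ZMod.intCast_eq_intCast_iff_dvd_sub] at hdet
  obtain ⟨k, hk⟩ := exists_add_mul_isCoprime (d := d) hN hc0 fun p hp h1 h2 h3 =>
    hp.not_isUnit <| by
    have h4 : p ∣ 1 - (a * d - b * c) := h3.trans hdet
    have h5 : p ∣ (a * d - b * c) := (h2.mul_left a).sub (h1.mul_left b)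
    have := h4.add h5
    rw [sub_add_cancel] at this
    exact isUnit_of_dvd_one this
  obtain ⟨d', hd'⟩ : ∃ d', d' = d + k * N := ⟨_, rfl⟩
  rw [← hd'] at hk
  have hdd : ((d' : ℤ) : ZMod N) = g 1 1 := by rw [hd', ← hd]; simp
  obtain ⟨s, t, hst⟩ := hk
  obtain ⟨x, hx⟩ : ∃ x, x = t * b + a * s := ⟨_, rfl⟩
  have hgd : (a : ZMod N) * d' - b * c = 1 := by rw [ha, hb, hc, hdd]; exact hg
  have hst' : (s : ZMod N) * c + t * d' = 1 := by
    exact_mod_cast congrArg (Int.cast (R := ZMod N)) hst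
  refine ⟨⟨!![t + x * c, -s + x * d'; c, d'], ?_⟩, ?_⟩
  · rw [Matrix.det_fin_two_of]; linear_combination hst
  · ext i j
    change ((!![t + x * c, -s + x * d'; c, d'] i j : ℤ) : ZMod N) = g i j
    fin_cases i <;> fin_cases j
    · simp only [Fin.zero_eta, Matrix.of_apply, Matrix.cons_val', Matrix.cons_val_zero]
      rw [← ha, hx]; push_cast
      linear_combination (-t : ZMod N) * hgd + (a : ZMod N) * hst'
    · simp only [Fin.zero_eta, Fin.mk_one, Matrix.of_apply, Matrix.cons_val', Matrix.cons_val_zero,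
        Matrix.cons_val_one]
      rw [← hb, hx]; push_cast
      linear_combination (s : ZMod N) * hgd + (b : ZMod N) * hst'
    · exact hc
    · exact hdd

/-- The greatest common divisor of the entries of `g - 1`. -/
def depth (g : SL2Z) : ℕ :=
  Nat.gcd (Nat.gcd (g 0 0 - 1).natAbs (g 0 1).natAbs) (Nat.gcd (g 1 0).natAbs (g 1 1 - 1).natAbs)

lemma dvd_depth_iff {g : SL2Z} {d : ℕ} : d ∣ depth g ↔
    ∀ i j, (d : ℤ) ∣ g i j - (1 : Matrix (Fin 2) (Fin 2) ℤ) i j := by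
  simp [depth, Nat.dvd_gcd_iff, Int.natCast_dvd, Fin.forall_fin_two, Matrix.one_apply, and_assoc]

lemma depth_ne_zero {g : SL2Z} (hg : g ≠ 1) : depth g ≠ 0 := by
  intro h
  apply hg
  have h0 : (0 : ℕ) ∣ depth g := by rw [h]
  rw [dvd_depth_iff] at h0
  ext i j
  have := h0 i j
  rw [Nat.cast_zero, zero_dvd_iff, sub_eq_zero] at this
  rw [this]; rfl

lemma prod_pow_dvd_of_forall {G : Finset ℕ} (hG : ∀ p ∈ G, p.Prime) {e : ℕ → ℕ} {z : ℕ}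
    (h : ∀ p ∈ G, p ^ e p ∣ z) : ∏ p ∈ G, p ^ e p ∣ z := by
  refine Finset.prod_dvd_of_isRelPrime (fun p hp q hq hpq => ?_) h
  exact Nat.Coprime.pow _ _ ((Nat.coprime_primes (hG p hp) (hG q hq)).2 hpq) |>
    Nat.coprime_iff_isRelPrime.1

lemma factorization_prod_pow {G : Finset ℕ} (hG : ∀ p ∈ G, p.Prime) (e : ℕ → ℕ) {q : ℕ}
    (hq : q ∈ G) : (∏ p ∈ G, p ^ e p).factorization q = e q := by
  rw [Nat.factorization_prod fun p hp => pow_ne_zero _ (hG p hp).ne_zero, Finset.sum_apply']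
  rw [Finset.sum_eq_single q]
  · rw [(hG q hq).factorization_pow, Finsupp.single_eq_same]
  · intro p hp hpq
    rw [(hG p hp).factorization_pow, Finsupp.single_eq_of_ne hpq.symm]
  · exact fun h => (h hq).elim

lemma primeFactors_prod_pow {G : Finset ℕ} (hG : ∀ p ∈ G, p.Prime) {e : ℕ → ℕ}
    (he : ∀ p ∈ G, 1 ≤ e p) : (∏ p ∈ G, p ^ e p).primeFactors = G := by
  ext q
  have h0 : ∏ p ∈ G, p ^ e p ≠ 0 :=
    Finset.prod_ne_zero_iff.2 fun p hp => pow_ne_zero _ (hG p hp).ne_zero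
  rw [Nat.mem_primeFactors_of_ne_zero h0]
  constructor
  · rintro ⟨hq, hd⟩
    obtain ⟨p, hp, hqp⟩ := (hq.prime.dvd_finsetProd_iff _).1 hd
    rwa [(Nat.prime_dvd_prime_iff_eq hq (hG p hp)).1 (hq.dvd_of_dvd_pow hqp)]
  · intro hq
    exact ⟨hG q hq, (dvd_pow_self q (by have := he q hq; omega)).trans
      (Finset.dvd_prod_of_mem _ hq)⟩

lemma floorPow_prod_pow {G : Finset ℕ} (hG : ∀ p ∈ G, p.Prime) {n : ℕ → ℕ}
    (hn : ∀ p ∈ G, 1 ≤ n p) (ρ : ℝ) :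
    floorPow (∏ p ∈ G, p ^ n p) ρ = ∏ p ∈ G, p ^ ⌊(n p : ℝ) * ρ⌋₊ := by
  rw [floorPow, primeFactors_prod_pow hG hn]
  exact Finset.prod_congr rfl fun p hp => by rw [factorization_prod_pow hG n hp]

/-- The quotient of `g - 1` by the part of its depth supported on `G` is primitive. -/
lemma exists_primitive {G : Finset ℕ} (hG : ∀ p ∈ G, p.Prime) {r : ℕ → ℕ} {g : SL2Z} (hg : g ≠ 1)
    (hr1 : ∀ p ∈ G, 1 ≤ r p)
    (hr : ∏ p ∈ G, p ^ r p ∣ depth g) : ∃ x : Matrix (Fin 2) (Fin 2) ℤ,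
    (g : Matrix (Fin 2) (Fin 2) ℤ) =
      1 + ((∏ p ∈ G, p ^ (depth g).factorization p : ℕ) : ℤ) • x ∧
    PrimitiveMod ((∏ p ∈ G, p ^ r p : ℕ) : ℤ) x ∧
    ∏ p ∈ G, p ^ r p ∣ ∏ p ∈ G, p ^ (depth g).factorization p := by
  obtain ⟨Q, hQ⟩ : ∃ Q, Q = ∏ p ∈ G, p ^ (depth g).factorization p := ⟨_, rfl⟩
  obtain ⟨R, hR⟩ : ∃ R, R = ∏ p ∈ G, p ^ r p := ⟨_, rfl⟩
  rw [← hQ, ← hR]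
  rw [← hR] at hr
  have hQd : Q ∣ depth g := by
    rw [hQ]; exact prod_pow_dvd_of_forall hG fun p hp => Nat.ordProj_dvd _ _
  have hQ0 : Q ≠ 0 := ne_zero_of_dvd_ne_zero (depth_ne_zero hg) hQd
  have hRQ : R ∣ Q := by
    rw [hR, hQ]
    refine Finset.prod_dvd_prod_of_dvd _ _ fun p hp => pow_dvd_pow p ?_
    rw [← (hG p hp).pow_dvd_iff_le_factorization (depth_ne_zero hg)]
    exact ((Finset.dvd_prod_of_mem (fun p => p ^ r p) hp)).trans (hR ▸ hr)
  choose x hx using dvd_depth_iff.1 hQd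
  have hgx : (g : Matrix (Fin 2) (Fin 2) ℤ) = 1 + (Q : ℤ) • Matrix.of x := by
    ext i j
    rw [Matrix.add_apply, Matrix.smul_apply, Matrix.of_apply, smul_eq_mul, ← hx]
    ring
  refine ⟨Matrix.of x, hgx, ?_, hRQ⟩
  have htr := dvd_trace_of_eq (by exact_mod_cast hQ0) (Int.natCast_dvd_natCast.2 hRQ) hgx
  obtain ⟨c, hc⟩ : ∃ c : ℕ, c = Int.gcd (x 0 0) (Int.gcd (x 0 1) (x 1 0)) := ⟨_, rfl⟩
  have hcop : IsCoprime (c : ℤ) R := by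
    rw [hR, Nat.cast_prod]
    refine IsCoprime.prod_right fun p hp => ?_
    rw [Nat.cast_pow]
    refine IsCoprime.pow_right ?_
    rw [Nat.isCoprime_iff_coprime, Nat.coprime_comm, (hG p hp).coprime_iff_not_dvd]
    intro hpc
    have hpc' : (p : ℤ) ∣ c := Int.natCast_dvd_natCast.2 hpc
    rw [hc, Int.dvd_coe_gcd_iff, Int.dvd_coe_gcd_iff] at hpc'
    have hpR : (p : ℤ) ∣ R := by
      rw [Int.natCast_dvd_natCast, hR]
      exact (dvd_pow_self p (by have := hr1 p hp; omega)).trans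
        (Finset.dvd_prod_of_mem (fun p => p ^ r p) hp)
    have h11 : (p : ℤ) ∣ x 1 1 := by
      have := hpR.trans htr
      rw [Matrix.trace_fin_two] at this
      exact (dvd_add_right hpc'.1).1 this
    have hall : ∀ i j, (p : ℤ) ∣ x i j := by
      intro i j
      fin_cases i <;> fin_cases j
      exacts [hpc'.1, hpc'.2.1, hpc'.2.2, h11]
    have hdd : Q * p ∣ depth g := by
      rw [dvd_depth_iff]
      intro i j
      rw [hx i j, Nat.cast_mul]
      exact mul_dvd_mul_left _ (hall i j)
    have hpQ : p ^ (depth g).factorization p ∣ Q := by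
      rw [hQ]; exact Finset.dvd_prod_of_mem (fun p => p ^ (depth g).factorization p) hp
    refine Nat.pow_succ_factorization_not_dvd (depth_ne_zero hg) (hG p hp) ?_
    rw [pow_succ]
    exact (mul_dvd_mul_right hpQ p).trans hdd
  obtain ⟨v, w, hvw⟩ := hcop
  have e1 := Int.gcd_eq_gcd_ab (x 0 0) (Int.gcd (x 0 1) (x 1 0))
  have e2 := Int.gcd_eq_gcd_ab (x 0 1) (x 1 0)
  rw [← hc] at e1
  obtain ⟨A, hA⟩ : ∃ A, A = Int.gcdA (x 0 0) (Int.gcd (x 0 1) (x 1 0)) := ⟨_, rfl⟩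
  obtain ⟨B, hB⟩ : ∃ B, B = Int.gcdB (x 0 0) (Int.gcd (x 0 1) (x 1 0)) := ⟨_, rfl⟩
  rw [← hA, ← hB] at e1
  refine ⟨v * A, v * B * Int.gcdA (x 0 1) (x 1 0), v * B * Int.gcdB (x 0 1) (x 1 0), -w, ?_⟩
  simp only [Matrix.of_apply]
  linear_combination hvw - v * e1 - v * B * e2

/-- The integer by which the moving operators multiply. -/
def moveFactor (a : SL2Z) (b : Fin 3 → SL2Z) (m₀ : ℤ) : ℤ :=
  m₀ ^ 2 * (2 * (a : Matrix (Fin 2) (Fin 2) ℤ).trace ^ 2 * sl2Vol (axisOf a b) ^ 2)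

lemma Mover.of_primes {k : ℕ} {T : Set SL2Z} (hT : T⁻¹ = T) (h1 : (1 : SL2Z) ∈ T) {a : SL2Z}
    (ha : a ∈ T) {b : Fin 3 → SL2Z} (hb : ∀ i, b i ∈ T * T) {G : Finset ℕ}
    (hG : ∀ p ∈ G, p.Prime) {r : ℕ → ℕ} {m₀ : ℤ}
    (hβ : ∀ z, ∃ β ∈ ringGen (scalarSet T a b) k, ((∏ p ∈ G, p ^ r p : ℕ) : ℤ) ∣ m₀ ^ 2 * z - β)
    (hm : moveFactor a b m₀ ≠ 0)
    (hr : ∀ p ∈ G, 4 * ((moveFactor a b m₀).natAbs.factorization p + 1) ≤ r p) :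
    Mover k T ((∏ p ∈ G, p ^ r p : ℕ) : ℤ)
      ((∏ p ∈ G, p ^ (moveFactor a b m₀).natAbs.factorization p : ℕ) : ℤ)
      ((∏ p ∈ G, p ^ (r p - 2 * (moveFactor a b m₀).natAbs.factorization p - 2) : ℕ) : ℤ)
      ((∏ p ∈ G, p ^ ((moveFactor a b m₀).natAbs.factorization p + 2) : ℕ) : ℤ)
      ((∏ p ∈ G, p : ℕ) : ℤ) := by
  obtain ⟨m, hmm⟩ : ∃ m, m = moveFactor a b m₀ := ⟨_, rfl⟩
  rw [← hmm] at hm hr ⊢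
  obtain ⟨v, hv⟩ : ∃ v : ℕ → ℕ, v = fun p => m.natAbs.factorization p := ⟨_, rfl⟩
  have hm0 : m.natAbs ≠ 0 := Int.natAbs_ne_zero.2 hm
  have hmd : ((∏ p ∈ G, p ^ m.natAbs.factorization p : ℕ) : ℤ) ∣ m := by
    rw [Int.natCast_dvd]
    exact prod_pow_dvd_of_forall hG fun p hp => Nat.ordProj_dvd _ _
  obtain ⟨u, hu⟩ := hmd
  refine ⟨⟨a, ha, b, hb, m₀, u, hβ, ?_, ?_⟩, hT, h1, ⟨∑ p ∈ G, r p, ?_⟩, ?_, ?_, ?_⟩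
  · rw [← hu, hmm]; rfl
  · rw [Nat.cast_prod]
    refine IsCoprime.prod_right fun p hp => ?_
    rw [Int.isCoprime_iff_gcd_eq_one, Int.gcd_comm, ← Int.isCoprime_iff_gcd_eq_one]
    rw [Prime.coprime_iff_not_dvd (Nat.prime_iff_prime_int.1 (hG p hp))]
    intro hpu
    refine Nat.pow_succ_factorization_not_dvd hm0 (hG p hp) ?_
    rw [← Int.natCast_dvd, pow_succ, Nat.cast_mul]
    exact (mul_dvd_mul (Int.natCast_dvd_natCast.2
      (Finset.dvd_prod_of_mem (fun p => p ^ m.natAbs.factorization p) hp)) hpu).trans hu.symm.dvd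
  · rw [← Nat.cast_pow, Int.natCast_dvd_natCast, ← Finset.prod_pow_eq_pow_sum]
    exact Finset.prod_dvd_prod_of_dvd _ _ fun p hp =>
      pow_dvd_pow_of_dvd (Finset.dvd_prod_of_mem (fun p => p) hp) _
  · rw [← Nat.cast_mul, ← Nat.cast_mul, ← Finset.prod_mul_distrib, ← Finset.prod_mul_distrib]
    congr 1
    refine Finset.prod_congr rfl fun p hp => ?_
    rw [← pow_add, ← pow_add]
    congr 1
    have := hr p hp
    omega
  · rw [Int.natCast_dvd_natCast]
    exact Finset.prod_dvd_prod_of_dvd _ _ fun p hp => dvd_pow_self p (by omega)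
  · rw [Int.natCast_dvd_natCast]
    exact Finset.prod_dvd_prod_of_dvd _ _ fun p hp => pow_dvd_pow p (by omega)

lemma intCast_dvd_intCast_zmod {f N : ℕ} (h : f ∣ N) {z : ℤ} (hz : (f : ZMod N) ∣ (z : ZMod N)) :
    (f : ℤ) ∣ z := by
  obtain ⟨c, hc⟩ := hz
  obtain ⟨c, rfl⟩ := ZMod.intCast_surjective c
  have h1 : ((z : ℤ) : ZMod N) = ((f * c : ℤ) : ZMod N) := by rw [hc]; push_cast; rfl
  rw [ZMod.intCast_eq_intCast_iff_dvd_sub] at h1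
  have h2 : (f : ℤ) ∣ f * c - z := (Int.natCast_dvd_natCast.2 h).trans h1
  exact (dvd_sub_right (dvd_mul_right _ _)).1 h2

lemma redSL_eq_of_eq_one_add {N : ℕ} {h f : SL2Z} {y : Matrix (Fin 2) (Fin 2) ℤ} {z : ℤ}
    (hz : (N : ℤ) ∣ z)
    (hy : ((h * f⁻¹ : SL2Z) : Matrix (Fin 2) (Fin 2) ℤ) = 1 + z • y) : redSL N h = redSL N f := by
  rw [← mul_inv_eq_one, ← map_inv, ← map_mul]
  ext i j
  rw [redSL_apply, hy, Matrix.add_apply, Matrix.smul_apply, smul_eq_mul]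
  push_cast
  rw [(ZMod.intCast_zmod_eq_zero_iff_dvd z N).2 hz, zero_mul, add_zero,
    Matrix.SpecialLinearGroup.coe_one]
  simp [Matrix.one_apply]

/-- Bounded powers of `T` cover a principal congruence subgroup. -/
theorem exists_kernel_cover (k K j : ℕ) : ∃ K', ∀ T : Set SL2Z, T⁻¹ = T → (1 : SL2Z) ∈ T →
    ∀ a ∈ T, ∀ b : Fin 3 → SL2Z, (∀ i, b i ∈ T * T) → ∀ G : Finset ℕ, (∀ p ∈ G, p.Prime) →
    ∀ (r n : ℕ → ℕ) (m₀ : ℤ) (ρ : ℝ), ρ ≤ 1 →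
    (∀ z, ∃ β ∈ ringGen (scalarSet T a b) k, ((∏ p ∈ G, p ^ r p : ℕ) : ℤ) ∣ m₀ ^ 2 * z - β) →
    moveFactor a b m₀ ≠ 0 →
    (∀ p ∈ G, 4 * ((moveFactor a b m₀).natAbs.factorization p + 1) ≤ r p) →
    (∀ p ∈ G, 1 ≤ n p) →
    ∀ g ∈ T ^ K, g ≠ 1 → ∏ p ∈ G, p ^ r p ∣ depth g →
    (∀ p ∈ G, (moveFactor a b m₀).natAbs.factorization p + (depth g).factorization p ≤
      ⌊(n p : ℝ) * ρ⌋₊) →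
    (∀ p ∈ G, 2 * n p ≤ j * r p) →
    kerFloorPow (∏ p ∈ G, p ^ n p) ρ ⊆ (redSL (∏ p ∈ G, p ^ n p) '' T) ^ K' := by
  obtain ⟨K', hK'⟩ := Mover.exists_approx k K j
  refine ⟨K', fun T hT h1 a ha b hb G hG r n m₀ ρ hρ hβ hm hr hn g hg hg1 hgr hρn hj x hx => ?_⟩
  have hM := Mover.of_primes hT h1 ha hb hG hβ hm hr
  obtain ⟨m, hmm⟩ : ∃ m, m = moveFactor a b m₀ := ⟨_, rfl⟩
  rw [← hmm] at hm hr hρn hM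
  obtain ⟨y, hgy, hy, hRQ⟩ := exists_primitive hG hg1 (fun p hp => by have := hr p hp; omega) hgr
  have hR0 : ∏ p ∈ G, p ^ r p ≠ 0 :=
    Finset.prod_ne_zero_iff.2 fun p hp => pow_ne_zero _ (hG p hp).ne_zero
  have hQ0 : ∏ p ∈ G, p ^ (depth g).factorization p ≠ 0 :=
    Finset.prod_ne_zero_iff.2 fun p hp => pow_ne_zero _ (hG p hp).ne_zero
  have hq0 : ∏ p ∈ G, p ^ n p ≠ 0 :=
    Finset.prod_ne_zero_iff.2 fun p hp => pow_ne_zero _ (hG p hp).ne_zero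
  obtain ⟨h, rfl⟩ := redSL_surjective hq0 x
  have hfd : floorPow (∏ p ∈ G, p ^ n p) ρ ∣ ∏ p ∈ G, p ^ n p := by
    rw [floorPow_prod_pow hG hn]
    refine Finset.prod_dvd_prod_of_dvd _ _ fun p hp => pow_dvd_pow p ?_
    refine Nat.floor_le_of_le ?_
    exact mul_le_of_le_one_right (Nat.cast_nonneg _) hρ
  have hmQ : (∏ p ∈ G, p ^ m.natAbs.factorization p) * ∏ p ∈ G, p ^ (depth g).factorization p ∣
      floorPow (∏ p ∈ G, p ^ n p) ρ := by
    rw [floorPow_prod_pow hG hn, ← Finset.prod_mul_distrib]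
    refine Finset.prod_dvd_prod_of_dvd _ _ fun p hp => ?_
    rw [← pow_add]
    exact pow_dvd_pow p (hρn p hp)
  have hh : ∀ i l, ((∏ p ∈ G, p ^ m.natAbs.factorization p : ℕ) : ℤ) *
      ((∏ p ∈ G, p ^ (depth g).factorization p : ℕ) : ℤ) ∣
        h i l - (1 : Matrix (Fin 2) (Fin 2) ℤ) i l := by
    intro i l
    rw [← Nat.cast_mul]
    refine (Int.natCast_dvd_natCast.2 hmQ).trans (intCast_dvd_intCast_zmod hfd ?_)
    have := hx i l
    rw [redSL_apply] at this
    convert this using 1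
    push_cast
    simp [Matrix.one_apply]
  choose w hw using hh
  obtain ⟨f, hf, z, hz⟩ := hK' T _ _ _ _ _ hM (by exact_mod_cast hR0) _ (by exact_mod_cast hQ0)
    (by exact_mod_cast hRQ) g hg y hgy hy h ⟨Matrix.of w, by
      ext i l
      rw [Matrix.add_apply, Matrix.smul_apply, Matrix.of_apply, smul_eq_mul, ← hw]
      ring⟩
  rw [redSL_eq_of_eq_one_add (N := ∏ p ∈ G, p ^ n p) _ hz]
  · rw [← Set.image_pow]
    exact Set.mem_image_of_mem _ hf
  · refine Dvd.dvd.mul_left (Dvd.dvd.mul_left ?_ _) _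
    rw [← Nat.cast_mul, ← Nat.cast_pow, Int.natCast_dvd_natCast, ← Finset.prod_mul_distrib,
      ← Finset.prod_pow]
    refine Finset.prod_dvd_prod_of_dvd _ _ fun p hp => ?_
    rw [← pow_add, ← pow_mul]
    refine pow_dvd_pow p ?_
    have h4 := hr p hp
    have h5 := hj p hp
    obtain ⟨s, hs⟩ : ∃ s, s = r p - 2 * m.natAbs.factorization p - 2 + m.natAbs.factorization p :=
      ⟨_, rfl⟩
    have h6 : r p ≤ 2 * s := by omega
    rw [← hs]
    nlinarith only [h5, h6, Nat.mul_le_mul_left j h6]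

open scoped ENNReal

section Words

variable {G H X : Type*}

/-- The multiset of products of `n` elements of `S`. -/
def words [Monoid G] (S : Multiset G) : ℕ → Multiset G
  | 0 => {1}
  | n + 1 => S.bind fun s => (words S n).map (· * s)

lemma card_words [Monoid G] (S : Multiset G) (n : ℕ) : (words S n).card = S.card ^ n := by
  induction n with
  | zero => rfl
  | succ n ih => simp [words, ih, pow_succ, mul_comm]

lemma words_map [Monoid G] [Monoid H] (φ : G →* H) (S : Multiset G) (n : ℕ) :
    words (S.map φ) n = (words S n).map φ := by
  induction n with
  | zero => simp [words]
  | succ n ih => simp [words, ih, Multiset.map_bind, Multiset.bind_map]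

lemma words_add [Monoid G] (S : Multiset G) (n m : ℕ) :
    words S (n + m) = (words S m).bind fun u => (words S n).map (· * u) := by
  induction m with
  | zero => simp [words]
  | succ m ih =>
    rw [← add_assoc]
    simp only [words, ih, Multiset.map_bind, Multiset.bind_assoc, Multiset.bind_map,
      Multiset.map_map, Function.comp_def, mul_assoc]

lemma mul_mem_words [Monoid G] {S : Multiset G} {n m : ℕ} {v w : G} (hv : v ∈ words S n)
    (hw : w ∈ words S m) : v * w ∈ words S (n + m) := by
  rw [words_add, Multiset.mem_bind]
  exact ⟨w, hw, Multiset.mem_map_of_mem _ hv⟩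

lemma mem_words_one [Monoid G] {S : Multiset G} {s : G} (hs : s ∈ S) : s ∈ words S 1 := by
  simpa [words] using hs

/-- The sum of the translates of `f` by the elements of a multiset. -/
noncomputable def wordSum [SMul G X] (W : Multiset G) (f : X → ℝ≥0∞) (x : X) : ℝ≥0∞ :=
  (W.map fun w => f (w • x)).sum

/-- The sum of the squares of the values of `f`. -/
noncomputable def sqSum (f : X → ℝ≥0∞) : ℝ≥0∞ := ∑' x, f x ^ 2

lemma wordSum_words_add [Monoid G] [MulAction G X] (S : Multiset G) (n m : ℕ) (f : X → ℝ≥0∞) :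
    wordSum (words S (n + m)) f = wordSum (words S m) (wordSum (words S n) f) := by
  funext x
  simp only [wordSum, words_add, Multiset.map_bind, Multiset.sum_bind, Multiset.map_map,
    Function.comp_def, mul_smul]

lemma add_sq_le_succ_mul {x y z : ℝ≥0∞} {n : ℕ} (h : y ^ 2 ≤ n * z) :
    (x + y) ^ 2 ≤ (n + 1) * (x ^ 2 + z) := by
  rcases eq_or_ne x ⊤ with rfl | hx
  · simp
  rcases eq_or_ne z ⊤ with rfl | hz
  · simp
  have hy : y ≠ ⊤ := by
    rintro rfl
    have h2 : (n : ℝ≥0∞) * z ≠ ⊤ := ENNReal.mul_ne_top (by simp) hz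
    exact h2 (top_le_iff.1 (by simpa using h))
  lift x to NNReal using hx
  lift y to NNReal using hy
  lift z to NNReal using hz
  norm_cast at h ⊢
  rw [← NNReal.coe_le_coe] at h ⊢
  push_cast at h ⊢
  rcases Nat.eq_zero_or_pos n with rfl | hn
  · have hy : (y : ℝ) = 0 := by
      have : (y : ℝ) ^ 2 ≤ 0 := by simpa using h
      nlinarith [y.coe_nonneg]
    simp [hy]
  · have hn' : (0 : ℝ) < n := by exact_mod_cast hn
    have key : 0 ≤ (n : ℝ) * ((n + 1) * ((x : ℝ) ^ 2 + z) - (x + y) ^ 2) := by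
      have : (n : ℝ) * ((n + 1) * ((x : ℝ) ^ 2 + z) - (x + y) ^ 2) =
        (n * x - y) ^ 2 + (n + 1) * (n * z - y ^ 2) := by ring
      rw [this]
      exact add_nonneg (sq_nonneg _) (mul_nonneg (by positivity) (by linarith))
    exact sub_nonneg.1 (nonneg_of_mul_nonneg_right key hn')

lemma sq_multiset_sum_le (W : Multiset ℝ≥0∞) : W.sum ^ 2 ≤ W.card * (W.map (· ^ 2)).sum := by
  induction W using Multiset.induction_on with
  | empty => simp
  | cons a W ih =>
    rw [Multiset.sum_cons, Multiset.map_cons, Multiset.sum_cons, Multiset.card_cons, Nat.cast_succ]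
    exact add_sq_le_succ_mul ih

lemma sq_wordSum_le [SMul G X] (W : Multiset G) (f : X → ℝ≥0∞) (x : X) :
    wordSum W f x ^ 2 ≤ W.card * wordSum W (fun y => f y ^ 2) x := by
  have := sq_multiset_sum_le (W.map fun w => f (w • x))
  rwa [Multiset.card_map, Multiset.map_map] at this

lemma tsum_wordSum [Group G] [MulAction G X] (W : Multiset G) (f : X → ℝ≥0∞) :
    ∑' x, wordSum W f x = W.card * ∑' x, f x := by
  unfold wordSum
  induction W using Multiset.induction_on with
  | empty => simp
  | cons a W ih =>
    simp only [Multiset.map_cons, Multiset.sum_cons, Multiset.card_cons, Nat.cast_succ]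
    rw [ENNReal.tsum_add, ih, add_mul, one_mul, add_comm]
    congr 1
    exact (MulAction.toPerm a).tsum_eq f

lemma sqSum_wordSum_le [Group G] [MulAction G X] (W : Multiset G) (f : X → ℝ≥0∞) :
    sqSum (wordSum W f) ≤ W.card ^ 2 * sqSum f := by
  calc sqSum (wordSum W f) ≤ ∑' x, (W.card : ℝ≥0∞) * wordSum W (fun y => f y ^ 2) x :=
        ENNReal.tsum_le_tsum fun x => sq_wordSum_le W f x
    _ = W.card ^ 2 * sqSum f := by
        rw [ENNReal.tsum_mul_left, tsum_wordSum, sqSum, sq, mul_assoc]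

lemma five_mul_sq_add_le (a b c d : ℝ≥0∞) :
    5 * (a + b + c + d) ^ 2 ≤ 35 * a ^ 2 + 14 * b ^ 2 + 14 * c ^ 2 + 35 * d ^ 2 := by
  rcases eq_or_ne a ⊤ with rfl | ha
  · simp
  rcases eq_or_ne b ⊤ with rfl | hb
  · simp
  rcases eq_or_ne c ⊤ with rfl | hc
  · simp
  rcases eq_or_ne d ⊤ with rfl | hd
  · simp
  lift a to NNReal using ha
  lift b to NNReal using hb
  lift c to NNReal using hc
  lift d to NNReal using hd
  norm_cast
  rw [← NNReal.coe_le_coe]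
  push_cast
  nlinarith [sq_nonneg ((a : ℝ) - d), sq_nonneg ((b : ℝ) - c), sq_nonneg (5 * (a : ℝ) - 2 * b),
    sq_nonneg (5 * (a : ℝ) - 2 * c), sq_nonneg (5 * (d : ℝ) - 2 * b),
    sq_nonneg (5 * (d : ℝ) - 2 * c)]

lemma wordSum_sq_of_disjoint [SMul G X] {a : Fin 6 → G} {E : Set X}
    (ha : ∀ i j, i ≠ j → ∀ x, a i • x ∈ E → a j • x ∉ E) (f : X → ℝ≥0∞) (x : X) :
    (∑ i, E.indicator f (a i • x)) ^ 2 = ∑ i, E.indicator f (a i • x) ^ 2 := by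
  by_cases h : ∃ i, a i • x ∈ E
  · obtain ⟨i, hi⟩ := h
    have h0 : ∀ j ∈ Finset.univ, j ≠ i → E.indicator f (a j • x) = 0 := fun j _ hj =>
      Set.indicator_of_notMem (ha i j (Ne.symm hj) x hi) f
    rw [Finset.sum_eq_single i h0 (by simp),
      Finset.sum_eq_single i (fun j hj hji => by rw [h0 j hj hji]; simp) (by simp)]
  · push Not at h
    rw [Finset.sum_eq_zero fun i _ => Set.indicator_of_notMem (h i) f,
      Finset.sum_eq_zero fun i _ => by rw [Set.indicator_of_notMem (h i) f]; simp]
    simp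

lemma sq_sum_fin_six_le (y : Fin 6 → ℝ≥0∞) : (∑ i, y i) ^ 2 ≤ 6 * ∑ i, y i ^ 2 := by
  have := sq_multiset_sum_le (Finset.univ.val.map y)
  rw [Multiset.card_map, Multiset.map_map] at this
  exact this

lemma wordSum_univ [SMul G X] (c : Fin 6 → G) (f : X → ℝ≥0∞) (x : X) :
    wordSum (Finset.univ.val.map c) f x = ∑ i, f (c i • x) := by
  rw [wordSum, Multiset.map_map]
  rfl

lemma sqSum_pingpong [Group G] [MulAction G X] {a b : Fin 6 → G} {E : Set X}
    (ha : ∀ i j, i ≠ j → ∀ x, a i • x ∈ E → a j • x ∉ E)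
    (hb : ∀ i j, i ≠ j → ∀ x, b i • x ∉ E → b j • x ∈ E) (f : X → ℝ≥0∞) :
    5 * sqSum (wordSum (Finset.univ.val.map a + Finset.univ.val.map b) f) ≤ 714 * sqSum f := by
  have hb' : ∀ i j, i ≠ j → ∀ x, b i • x ∈ Eᶜ → b j • x ∉ Eᶜ := fun i j hij x h =>
    not_not.2 (hb i j hij x h)
  have hsplit : ∀ y, f y = E.indicator f y + Eᶜ.indicator f y := fun y => by
    rw [← Pi.add_apply, Set.indicator_self_add_compl]
  have hsplit2 : sqSum f = sqSum (E.indicator f) + sqSum (Eᶜ.indicator f) := by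
    rw [sqSum, sqSum, sqSum, ← ENNReal.tsum_add]
    refine tsum_congr fun y => ?_
    by_cases hy : y ∈ E
    · simp [hy]
    · simp [hy]
  have hpt : ∀ x, 5 * wordSum (Finset.univ.val.map a + Finset.univ.val.map b) f x ^ 2 ≤
      35 * (∑ i, E.indicator f (a i • x) ^ 2) + 84 * (∑ i, Eᶜ.indicator f (a i • x) ^ 2) +
      84 * (∑ i, E.indicator f (b i • x) ^ 2) + 35 * (∑ i, Eᶜ.indicator f (b i • x) ^ 2) := by
    intro x
    have h1 : wordSum (Finset.univ.val.map a + Finset.univ.val.map b) f x =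
        (∑ i, E.indicator f (a i • x)) + (∑ i, Eᶜ.indicator f (a i • x)) +
        (∑ i, E.indicator f (b i • x)) + (∑ i, Eᶜ.indicator f (b i • x)) := by
      have : wordSum (Finset.univ.val.map a + Finset.univ.val.map b) f x =
        (∑ i, f (a i • x)) + ∑ i, f (b i • x) := by
        rw [← wordSum_univ, ← wordSum_univ, wordSum, Multiset.map_add, Multiset.sum_add]
        rfl
      rw [this, add_assoc (_ + _)]
      refine congrArg₂ (· + ·) ?_ ?_
      · rw [← Finset.sum_add_distrib]
        exact Finset.sum_congr rfl fun i _ => hsplit _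
      · rw [← Finset.sum_add_distrib]
        exact Finset.sum_congr rfl fun i _ => hsplit _
    rw [h1]
    refine (five_mul_sq_add_le _ _ _ _).trans ?_
    rw [wordSum_sq_of_disjoint ha, wordSum_sq_of_disjoint hb']
    have e : (84 : ℝ≥0∞) = 14 * 6 := by norm_num
    rw [e, mul_assoc, mul_assoc]
    gcongr
    · exact sq_sum_fin_six_le _
    · exact sq_sum_fin_six_le _
  have htr : ∀ (c : Fin 6 → G) (h : X → ℝ≥0∞), ∑' x, ∑ i, h (c i • x) ^ 2 = 6 * sqSum h := by
    intro c h
    have := tsum_wordSum (Finset.univ.val.map c) (fun y => h y ^ 2)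
    rw [Multiset.card_map] at this
    simp only [wordSum_univ] at this
    exact this
  calc 5 * sqSum (wordSum (Finset.univ.val.map a + Finset.univ.val.map b) f)
      = ∑' x, 5 * wordSum (Finset.univ.val.map a + Finset.univ.val.map b) f x ^ 2 := by
        rw [sqSum, ENNReal.tsum_mul_left]
    _ ≤ _ := ENNReal.tsum_le_tsum hpt
    _ = 714 * sqSum f := by
        rw [ENNReal.tsum_add, ENNReal.tsum_add, ENNReal.tsum_add, ENNReal.tsum_mul_left,
          ENNReal.tsum_mul_left, ENNReal.tsum_mul_left, ENNReal.tsum_mul_left, htr, htr, htr, htr,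
          hsplit2]
        ring

lemma sqSum_wordSum_gap [Group G] [MulAction G X] {a b : Fin 6 → G} {E : Set X}
    (ha : ∀ i j, i ≠ j → ∀ x, a i • x ∈ E → a j • x ∉ E)
    (hb : ∀ i j, i ≠ j → ∀ x, b i • x ∉ E → b j • x ∈ E) {W : Multiset G}
    (haW : ∀ i, a i ∈ W) (hbW : ∀ i, b i ∈ W) {M : ℕ} (hM : W.card = M + 1) (f : X → ℝ≥0∞) :
    720 * sqSum (wordSum W f) ≤ (M + 1) * ((714 + 720 * M) * sqSum f) := by
  classical
  obtain ⟨Q, hQ⟩ : ∃ Q : Multiset G, Q = Finset.univ.val.map a + Finset.univ.val.map b := ⟨_, rfl⟩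
  have hQc : Q.card = 12 := by simp [hQ]
  have hQW : Q ≤ 12 • W := by
    rw [Multiset.le_iff_count]
    intro g
    rw [Multiset.count_nsmul]
    by_cases hg : g ∈ Q
    · have hgW : g ∈ W := by
        rw [hQ, Multiset.mem_add, Multiset.mem_map, Multiset.mem_map] at hg
        rcases hg with ⟨i, -, rfl⟩ | ⟨i, -, rfl⟩
        exacts [haW i, hbW i]
      have h1 := Multiset.one_le_count_iff_mem.2 hgW
      have h2 := Multiset.count_le_card g Q
      omega
    · rw [Multiset.count_eq_zero_of_notMem hg]
      exact Nat.zero_le _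
  obtain ⟨R, hR⟩ := Multiset.le_iff_exists_add.1 hQW
  have hRc : R.card = M * 12 := by
    have := congrArg Multiset.card hR
    rw [Multiset.card_nsmul, Multiset.card_add, hQc, hM] at this
    omega
  have hpt : ∀ x, 144 * wordSum W f x ^ 2 ≤
      (M + 1) * (wordSum Q f x ^ 2 + 12 * wordSum R (fun y => f y ^ 2) x) := by
    intro x
    have h1 : 12 * wordSum W f x = wordSum Q f x + wordSum R f x := by
      have : wordSum (12 • W) f x = wordSum (Q + R) f x := by rw [hR]
      simpa [wordSum, Multiset.map_nsmul, Multiset.sum_nsmul] using this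
    have h2 : 144 * wordSum W f x ^ 2 = (12 * wordSum W f x) ^ 2 := by rw [mul_pow]; norm_num
    rw [h2, h1]
    refine add_sq_le_succ_mul ?_
    refine (sq_wordSum_le R f x).trans ?_
    rw [hRc]
    push_cast
    rw [mul_assoc]
  have h3 : 144 * sqSum (wordSum W f) ≤
      (M + 1) * (sqSum (wordSum Q f) + 12 * (M * 12 * sqSum f)) := by
    calc 144 * sqSum (wordSum W f) = ∑' x, 144 * wordSum W f x ^ 2 := by
          rw [sqSum, ENNReal.tsum_mul_left]
      _ ≤ _ := ENNReal.tsum_le_tsum hpt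
      _ = _ := by
          rw [ENNReal.tsum_mul_left, ENNReal.tsum_add, ENNReal.tsum_mul_left, tsum_wordSum, hRc]
          push_cast
          rfl
  have h4 := sqSum_pingpong ha hb f
  rw [← hQ] at h4
  calc 720 * sqSum (wordSum W f) = 5 * (144 * sqSum (wordSum W f)) := by
        rw [← mul_assoc]; norm_num
    _ ≤ 5 * ((M + 1) * (sqSum (wordSum Q f) + 12 * (M * 12 * sqSum f))) := by gcongr
    _ = (M + 1) * (5 * sqSum (wordSum Q f) + 720 * M * sqSum f) := by ring
    _ ≤ (M + 1) * (714 * sqSum f + 720 * M * sqSum f) := by gcongr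
    _ = _ := by rw [← add_mul]

end Words

section Words

variable {G X : Type*}

lemma wordSum_indicator [SMul G X] (W : Multiset G) (x y : X)
    [DecidablePred fun w : G => w • x = y] :
    wordSum W (Set.indicator {y} 1) x = (W.countP fun w => w • x = y : ℕ) := by
  induction W using Multiset.induction_on with
  | empty => simp [wordSum]
  | cons a W ih =>
    rw [wordSum] at ih ⊢
    rw [Multiset.map_cons, Multiset.sum_cons, ih, Multiset.countP_cons]
    by_cases h : a • x = y
    · simp [h, add_comm]
    · simp [h]

/-- A ping-pong pair of families of words forces a spectral gap. -/
theorem exists_word_gap [Group G] [MulAction G X] {S : Multiset G} {a b : Fin 6 → G} {E : Set X}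
    (ha : ∀ i j, i ≠ j → ∀ x, a i • x ∈ E → a j • x ∉ E)
    (hb : ∀ i j, i ≠ j → ∀ x, b i • x ∉ E → b j • x ∈ E) {l : ℕ}
    (haW : ∀ i, a i ∈ words S l) (hbW : ∀ i, b i ∈ words S l) :
    ∃ θ : ℝ, 0 < θ ∧ θ < 1 ∧ ∀ (n : ℕ) (x y : X) [DecidablePred fun w : G => w • x = y],
      ((words S n).countP (fun w => w • x = y) : ℝ) ^ 2 ≤ θ ^ (n / l) * (S.card : ℝ) ^ (2 * n) := by
  have hpos : 0 < (words S l).card := Multiset.card_pos_iff_exists_mem.2 ⟨_, haW 0⟩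
  obtain ⟨M, hM⟩ : ∃ M, (words S l).card = M + 1 := ⟨_, (Nat.succ_pred_eq_of_pos hpos).symm⟩
  obtain ⟨θ, hθ⟩ : ∃ θ : ℝ, θ = (714 + 720 * M) / (720 * (M + 1)) := ⟨_, rfl⟩
  have hM1 : (0 : ℝ) < M + 1 := by positivity
  have hθ0 : 0 < θ := by rw [hθ]; positivity
  have hθ1 : θ < 1 := by
    rw [hθ, div_lt_one (by positivity)]
    linarith
  have hstep : ∀ f : X → ℝ≥0∞, sqSum (wordSum (words S l) f) ≤
      ENNReal.ofReal (θ * (S.card : ℝ) ^ (2 * l)) * sqSum f := by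
    intro f
    have h := sqSum_wordSum_gap ha hb haW hbW hM f
    have e : ENNReal.ofReal (θ * (S.card : ℝ) ^ (2 * l)) * 720 = (M + 1) * (714 + 720 * M) := by
      have h1 : (S.card : ℝ) ^ (2 * l) = (M + 1) ^ 2 := by
        rw [mul_comm, pow_mul, ← Nat.cast_pow, ← card_words, hM]
        push_cast
        rfl
      have h2 : θ * (S.card : ℝ) ^ (2 * l) * 720 = (M + 1) * (714 + 720 * M) := by
        rw [h1, hθ]
        field_simp
      have h3 : (720 : ℝ≥0∞) = ENNReal.ofReal 720 := by simp
      rw [h3, ← ENNReal.ofReal_mul (by positivity), h2]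
      have h4 : ((M : ℝ) + 1) * (714 + 720 * M) = (((M + 1) * (714 + 720 * M) : ℕ) : ℝ) := by
        push_cast
        rfl
      rw [h4, ENNReal.ofReal_natCast]
      push_cast
      simp
    have h5 : 720 * sqSum (wordSum (words S l) f) ≤
        720 * (ENNReal.ofReal (θ * (S.card : ℝ) ^ (2 * l)) * sqSum f) := by
      rw [← mul_assoc, mul_comm 720 (ENNReal.ofReal _), e, mul_assoc]
      exact h
    exact (ENNReal.mul_le_mul_iff_right (by simp) (by simp)).1 h5
  have hiter : ∀ (k : ℕ) (f : X → ℝ≥0∞), sqSum (wordSum (words S (l * k)) f) ≤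
      ENNReal.ofReal (θ * (S.card : ℝ) ^ (2 * l)) ^ k * sqSum f := by
    intro k f
    induction k with
    | zero =>
      have : wordSum ({1} : Multiset G) f = f := by funext x; simp [wordSum]
      simp [words, this]
    | succ k ih =>
      rw [Nat.mul_succ, wordSum_words_add, pow_succ', mul_assoc]
      exact (hstep _).trans (by gcongr)
  refine ⟨θ, hθ0, hθ1, fun n x y _ => ?_⟩
  have hn : l * (n / l) + n % l = n := Nat.div_add_mod n l
  have h1 : sqSum (Set.indicator {y} (1 : X → ℝ≥0∞)) = 1 := by
    rw [sqSum, tsum_eq_single y]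
    · simp
    · intro z hz
      simp [hz]
  have h2 : ((words S n).countP (fun w => w • x = y) : ℝ≥0∞) ^ 2 ≤
      (S.card ^ (n % l) : ℕ) ^ 2 * (ENNReal.ofReal (θ * (S.card : ℝ) ^ (2 * l)) ^ (n / l)) := by
    rw [← wordSum_indicator]
    calc wordSum (words S n) (Set.indicator {y} 1) x ^ 2
        ≤ sqSum (wordSum (words S n) (Set.indicator {y} 1)) := ENNReal.le_tsum (f := fun x =>
          wordSum (words S n) (Set.indicator {y} 1) x ^ 2) x
      _ = sqSum (wordSum (words S (n % l)) (wordSum (words S (l * (n / l)))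
            (Set.indicator {y} 1))) := by
          rw [← wordSum_words_add, hn]
      _ ≤ _ := sqSum_wordSum_le _ _
      _ ≤ _ := by
          rw [card_words]
          gcongr
          simpa [h1] using hiter (n / l) (Set.indicator {y} 1)
  have h3 : ((S.card ^ (n % l) : ℕ) : ℝ≥0∞) ^ 2 *
      (ENNReal.ofReal (θ * (S.card : ℝ) ^ (2 * l)) ^ (n / l)) =
      ENNReal.ofReal (θ ^ (n / l) * (S.card : ℝ) ^ (2 * n)) := by
    rw [← ENNReal.ofReal_natCast, ← ENNReal.ofReal_pow (by positivity),
      ← ENNReal.ofReal_pow (by positivity), ← ENNReal.ofReal_mul (by positivity)]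
    congr 1
    conv_rhs => rw [← hn]
    rw [mul_pow, ← pow_mul, Nat.cast_pow, ← pow_mul, mul_left_comm, ← pow_add, hn]
    congr 2
    linarith [hn]
  rw [h3, ← ENNReal.ofReal_natCast, ← ENNReal.ofReal_pow (by positivity)] at h2
  exact (ENNReal.ofReal_le_ofReal_iff (by positivity)).1 h2

end Words

lemma exists_coe_pow_eq (h : SL2Z) (ht : 3 ≤ |(h : Matrix (Fin 2) (Fin 2) ℤ).trace|) (d : ℕ) :
    ∃ u u' : ℤ, ((h ^ (d + 1) : SL2Z) : Matrix (Fin 2) (Fin 2) ℤ) =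
      u • (h : Matrix (Fin 2) (Fin 2) ℤ) - u' • 1 ∧ |u'| < |u| := by
  induction d with
  | zero => exact ⟨1, 0, by simp, by simp⟩
  | succ d ih =>
    obtain ⟨u, u', hu, hlt⟩ := ih
    refine ⟨u * (h : Matrix (Fin 2) (Fin 2) ℤ).trace - u', u, ?_, ?_⟩
    · rw [pow_succ, Matrix.SpecialLinearGroup.coe_mul, hu]
      have hd := h.det_coe
      obtain ⟨H, hH⟩ : ∃ H, H = (h : Matrix (Fin 2) (Fin 2) ℤ) := ⟨_, rfl⟩
      rw [← hH] at hd ⊢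
      rw [Matrix.det_fin_two] at hd
      ext i j
      fin_cases i <;> fin_cases j <;>
        simp [-zsmul_eq_mul, -zsmul_one, Matrix.mul_apply,
          Matrix.trace_fin_two] <;>
        first | linear_combination (-u) * hd | linear_combination
    · have h1 : |u * (h : Matrix (Fin 2) (Fin 2) ℤ).trace| - |u'| ≤
        |u * (h : Matrix (Fin 2) (Fin 2) ℤ).trace - u'| := abs_sub_abs_le_abs_sub _ _
      rw [abs_mul] at h1
      nlinarith [abs_nonneg u, abs_nonneg u']

/-- The determinant of the commutator `g m - m g`. -/
def commDet {R : Type*} [CommRing R] (g m : Matrix (Fin 2) (Fin 2) R) : R := (g * m - m * g).det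

lemma commDet_inv (g m : SL2Z) : commDet (g : Matrix (Fin 2) (Fin 2) ℤ) (m⁻¹ : SL2Z) =
    commDet (g : Matrix (Fin 2) (Fin 2) ℤ) m := by
  rw [commDet, commDet, coe_inv_eq_trace_sub]
  simp only [Matrix.det_fin_two, Matrix.sub_apply, Matrix.mul_apply, Fin.sum_univ_two,
    Matrix.smul_apply, smul_eq_mul]
  simp
  ring

lemma commDet_pow {g h : SL2Z} (ht : 3 ≤ |(h : Matrix (Fin 2) (Fin 2) ℤ).trace|)
    (hgh : commDet (g : Matrix (Fin 2) (Fin 2) ℤ) h ≠ 0) (d : ℕ) :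
    commDet (g : Matrix (Fin 2) (Fin 2) ℤ) (h ^ (d + 1) : SL2Z) ≠ 0 := by
  obtain ⟨u, u', hu, hlt⟩ := exists_coe_pow_eq h ht d
  have hu0 : u ≠ 0 := by
    rintro rfl
    simp at hlt
    exact absurd hlt (not_lt.2 (abs_nonneg _))
  have : commDet (g : Matrix (Fin 2) (Fin 2) ℤ) (h ^ (d + 1) : SL2Z) =
      u ^ 2 * commDet (g : Matrix (Fin 2) (Fin 2) ℤ) h := by
    rw [commDet, commDet, hu]
    have : (g : Matrix (Fin 2) (Fin 2) ℤ) * (u • (h : Matrix (Fin 2) (Fin 2) ℤ) - u' • 1) -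
      (u • (h : Matrix (Fin 2) (Fin 2) ℤ) - u' • 1) * (g : Matrix (Fin 2) (Fin 2) ℤ) =
      u • ((g : Matrix (Fin 2) (Fin 2) ℤ) * h - h * g) := by
      rw [mul_sub, sub_mul, smul_sub, Matrix.mul_smul, Matrix.smul_mul, Matrix.mul_smul,
        Matrix.smul_mul, mul_one, one_mul]
      abel
    rw [this, Matrix.det_smul]
    simp
  rw [this]
  exact mul_ne_zero (pow_ne_zero _ hu0) hgh

lemma commDet_inv_pow_mul_pow {g h : SL2Z} (ht : 3 ≤ |(h : Matrix (Fin 2) (Fin 2) ℤ).trace|)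
    (hgh : commDet (g : Matrix (Fin 2) (Fin 2) ℤ) h ≠ 0) {i j : ℕ} (hij : i ≠ j) :
    commDet (g : Matrix (Fin 2) (Fin 2) ℤ) ((h ^ j)⁻¹ * h ^ i : SL2Z) ≠ 0 := by
  rcases lt_or_gt_of_ne hij with hlt | hlt
  · obtain ⟨d, rfl⟩ := Nat.exists_eq_add_of_lt hlt
    have : (h ^ (i + d + 1))⁻¹ * h ^ i = (h ^ (d + 1))⁻¹ := by
      rw [show i + d + 1 = i + (d + 1) by ring, pow_add, _root_.mul_inv_rev, inv_mul_cancel_right]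
    rw [this, commDet_inv]
    exact commDet_pow ht hgh d
  · obtain ⟨d, rfl⟩ := Nat.exists_eq_add_of_lt hlt
    have : (h ^ j)⁻¹ * h ^ (j + d + 1) = h ^ (d + 1) := by
      rw [show j + d + 1 = j + (d + 1) by ring, pow_add, inv_mul_cancel_left]
    rw [this]
    exact commDet_pow ht hgh d

lemma exists_diagonalization {g : SL2Z} (ht : 3 ≤ (g : Matrix (Fin 2) (Fin 2) ℤ).trace) :
    ∃ (P : Matrix (Fin 2) (Fin 2) ℂ) (t : ℂ), P.det ≠ 0 ∧ 1 < ‖t‖ ∧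
      P * (g : Matrix (Fin 2) (Fin 2) ℤ).map (Int.cast : ℤ → ℂ) = !![t, 0; 0, t⁻¹] * P := by
  have hdet := g.det_coe
  rw [Matrix.det_fin_two] at hdet
  rw [Matrix.trace_fin_two] at ht
  obtain ⟨a, ha⟩ : ∃ a, a = g 0 0 := ⟨_, rfl⟩
  obtain ⟨b, hb⟩ : ∃ b, b = g 0 1 := ⟨_, rfl⟩
  obtain ⟨c, hc⟩ : ∃ c, c = g 1 0 := ⟨_, rfl⟩
  obtain ⟨d, hd⟩ : ∃ d, d = g 1 1 := ⟨_, rfl⟩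
  rw [← ha, ← hb, ← hc, ← hd] at hdet
  rw [← ha, ← hd] at ht
  have hc0 : c ≠ 0 := by
    rintro rfl
    have : a * d = 1 := by linarith
    rcases Int.mul_eq_one_iff_eq_one_or_neg_one.1 this with ⟨h1, h2⟩ | ⟨h1, h2⟩ <;> omega
  have ht' : (3 : ℝ) ≤ a + d := by exact_mod_cast ht
  obtain ⟨s, hs⟩ : ∃ s, s = √(((a : ℝ) + d) ^ 2 - 4) := ⟨_, rfl⟩
  have hs2 : s ^ 2 = ((a : ℝ) + d) ^ 2 - 4 := by rw [hs, Real.sq_sqrt]; nlinarith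
  have hs0 : 0 ≤ s := hs ▸ Real.sqrt_nonneg _
  obtain ⟨t, htt⟩ : ∃ t : ℝ, t = (a + d + s) / 2 := ⟨_, rfl⟩
  have ht1 : 1 < t := by rw [htt]; linarith
  have htq : t * t = (a + d) * t - 1 := by rw [htt]; nlinarith only [hs2]
  have ht0 : (t : ℂ) ≠ 0 := by exact_mod_cast (by linarith : t ≠ 0)
  have hti : (t : ℂ)⁻¹ = a + d - t := by
    rw [inv_eq_iff_eq_inv, ← mul_eq_one_iff_eq_inv₀]
    · have : t * (a + d - t) = 1 := by linarith
      exact_mod_cast this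
    · intro h0
      have : (a : ℝ) + d - t = 0 := by exact_mod_cast h0
      nlinarith
  have hdet' : (a : ℂ) * d - b * c = 1 := by exact_mod_cast hdet
  have htq' : (t : ℂ) * t = (a + d) * t - 1 := by exact_mod_cast htq
  refine ⟨!![(c : ℂ), t - a; c, (t : ℂ)⁻¹ - a], t, ?_, ?_, ?_⟩
  · rw [Matrix.det_fin_two_of, hti]
    have : (c : ℂ) * (a + d - t - a) - (t - a) * c = c * (a + d - 2 * t) := by ring
    rw [this]
    refine mul_ne_zero (by exact_mod_cast hc0) ?_
    intro h0
    have h1 : (a : ℝ) + d - 2 * t = 0 := by exact_mod_cast h0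
    nlinarith
  · rw [Complex.norm_real, Real.norm_eq_abs, abs_of_pos (by linarith)]
    exact ht1
  · rw [hti]
    ext i j
    fin_cases i <;> fin_cases j <;>
      simp [Matrix.mul_apply, ← ha, ← hb, ← hc, ← hd]
    · ring
    · linear_combination -hdet' - htq'
    · ring
    · linear_combination -hdet' - htq'

lemma cone_disjoint {p q r s : ℂ} (hq : q ≠ 0) : ∃ ε₀ : ℝ, 0 < ε₀ ∧ ∀ ε : ℝ, 0 < ε → ε ≤ ε₀ →
    ∀ x y : ℂ, (x ≠ 0 ∨ y ≠ 0) → ‖x‖ ≤ ε * ‖y‖ → ε * ‖r * x + s * y‖ < ‖p * x + q * y‖ := by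
  obtain ⟨C, hC⟩ : ∃ C : ℝ, C = ‖p‖ + ‖r‖ + ‖s‖ + 1 := ⟨_, rfl⟩
  have hC1 : 1 ≤ C := by rw [hC]; linarith [norm_nonneg p, norm_nonneg r, norm_nonneg s]
  have hq0 : 0 < ‖q‖ := norm_pos_iff.2 hq
  refine ⟨min 1 (‖q‖ / (4 * C)), lt_min one_pos (by positivity), fun ε hε hle x y hxy hx => ?_⟩
  have hε1 : ε ≤ 1 := hle.trans (min_le_left _ _)
  have hε2 : ε * (4 * C) ≤ ‖q‖ := (le_div_iff₀ (by positivity)).1 (hle.trans (min_le_right _ _))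
  have hy : 0 < ‖y‖ := by
    rw [norm_pos_iff]
    rintro rfl
    rw [norm_zero, mul_zero] at hx
    rcases hxy with h | h
    · exact h (norm_le_zero_iff.1 hx)
    · exact h rfl
  have h1 : ‖q‖ * ‖y‖ - ‖p‖ * ‖x‖ ≤ ‖p * x + q * y‖ := by
    rw [← norm_mul, ← norm_mul, add_comm, ← sub_neg_eq_add, ← norm_neg (p * x)]
    exact norm_sub_norm_le _ _
  have h2 : ‖r * x + s * y‖ ≤ ‖r‖ * ‖x‖ + ‖s‖ * ‖y‖ := by
    rw [← norm_mul, ← norm_mul]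
    exact norm_add_le _ _
  have h3 : ‖x‖ ≤ ‖y‖ := hx.trans (by nlinarith)
  have h4 : ‖r * x + s * y‖ ≤ C * ‖y‖ := by
    refine h2.trans ?_
    have : ‖r‖ * ‖x‖ ≤ ‖r‖ * ‖y‖ := by gcongr
    nlinarith [norm_nonneg p]
  have h5 : ‖p‖ * ‖x‖ ≤ C * (ε * ‖y‖) := by
    have : ‖p‖ ≤ C := by rw [hC]; linarith [norm_nonneg r, norm_nonneg s]
    gcongr
  have h6 : ε * ‖r * x + s * y‖ ≤ ε * (C * ‖y‖) := by gcongr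
  have h7 : ε * (4 * C) * ‖y‖ ≤ ‖q‖ * ‖y‖ := by gcongr
  nlinarith [mul_pos hq0 hy]

/-- The inclusion of `SL₂(ℤ)` in `SL₂(ℂ)`. -/
def toSL2C : SL2Z →* SL2C := Matrix.SpecialLinearGroup.map (Int.castRingHom ℂ)

lemma coe_toSL2C (g : SL2Z) : (toSL2C g : Matrix (Fin 2) (Fin 2) ℂ) =
    (g : Matrix (Fin 2) (Fin 2) ℤ).map (Int.cast : ℤ → ℂ) := rfl

lemma commDet_toSL2C (g m : SL2Z) :
    commDet (toSL2C g : Matrix (Fin 2) (Fin 2) ℂ) (toSL2C m : Matrix (Fin 2) (Fin 2) ℂ) =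
      (commDet (g : Matrix (Fin 2) (Fin 2) ℤ) m : ℤ) := by
  simp only [commDet, Matrix.det_fin_two, Matrix.sub_apply, Matrix.mul_apply, Fin.sum_univ_two,
    coe_toSL2C, Matrix.map_apply]
  push_cast
  ring

lemma offDiag_ne_zero {P : Matrix (Fin 2) (Fin 2) ℂ} (hP : P.det ≠ 0) {t : ℂ} {g m : SL2Z}
    (hg : P * (toSL2C g : Matrix (Fin 2) (Fin 2) ℂ) = !![t, 0; 0, t⁻¹] * P)
    (hgm : commDet (g : Matrix (Fin 2) (Fin 2) ℤ) m ≠ 0) {M : Matrix (Fin 2) (Fin 2) ℂ}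
    (hM : P * (toSL2C m : Matrix (Fin 2) (Fin 2) ℂ) = M * P) : M 0 1 ≠ 0 ∧ M 1 0 ≠ 0 := by
  have h1 : commDet (!![t, 0; 0, t⁻¹]) M ≠ 0 := by
    intro h0
    have h2 : P * ((toSL2C g : Matrix (Fin 2) (Fin 2) ℂ) * (toSL2C m : Matrix (Fin 2) (Fin 2) ℂ) -
        (toSL2C m : Matrix (Fin 2) (Fin 2) ℂ) * (toSL2C g : Matrix (Fin 2) (Fin 2) ℂ)) =
        (!![t, 0; 0, t⁻¹] * M - M * !![t, 0; 0, t⁻¹]) * P := by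
      rw [mul_sub, ← mul_assoc, ← mul_assoc, hg, hM, sub_mul, mul_assoc, hM, mul_assoc, hg,
        mul_assoc, mul_assoc]
    have h3 := congrArg Matrix.det h2
    rw [Matrix.det_mul, Matrix.det_mul] at h3
    change P.det * commDet _ _ = commDet _ _ * P.det at h3
    rw [h0, zero_mul, commDet_toSL2C, mul_eq_zero] at h3
    rcases h3 with h3 | h3
    · exact hP h3
    · exact hgm (by exact_mod_cast h3)
  have h4 : commDet (!![t, 0; 0, t⁻¹]) M = (t - t⁻¹) ^ 2 * (M 0 1 * M 1 0) := by
    simp only [commDet, Matrix.det_fin_two, Matrix.mul_apply, Matrix.sub_apply, Fin.sum_univ_two,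
      Matrix.of_apply, Matrix.cons_val', Matrix.cons_val_zero, Matrix.cons_val_one,
      Matrix.cons_val_fin_one]
    ring
  rw [h4] at h1
  exact ⟨left_ne_zero_of_mul (right_ne_zero_of_mul h1),
    right_ne_zero_of_mul (right_ne_zero_of_mul h1)⟩

/-- The cone of lines close to the second coordinate axis, in the coordinates given by `P`. -/
def lineCone (P : Matrix (Fin 2) (Fin 2) ℂ) (ε : ℝ) : Set (Projectivization ℂ (Fin 2 → ℂ)) :=
  {x | ‖(P *ᵥ x.rep) 0‖ ≤ ε * ‖(P *ᵥ x.rep) 1‖}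

lemma mk_mem_lineCone {P : Matrix (Fin 2) (Fin 2) ℂ} {ε : ℝ} {v : Fin 2 → ℂ} (hv : v ≠ 0) :
    Projectivization.mk ℂ v hv ∈ lineCone P ε ↔ ‖(P *ᵥ v) 0‖ ≤ ε * ‖(P *ᵥ v) 1‖ := by
  obtain ⟨c, hc⟩ := Projectivization.exists_smul_eq_mk_rep ℂ v hv
  have hc0 : 0 < ‖(c : ℂ)‖ := norm_pos_iff.2 c.ne_zero
  rw [lineCone, Set.mem_ofPred_eq, ← hc]
  change ‖(P *ᵥ ((c : ℂ) • v)) 0‖ ≤ ε * ‖(P *ᵥ ((c : ℂ) • v)) 1‖ ↔ _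
  rw [Matrix.mulVec_smul, Pi.smul_apply, Pi.smul_apply, norm_smul, norm_smul, mul_left_comm,
    mul_le_mul_iff_right₀ hc0]

/-- Two hyperbolic elements without common eigenline play ping-pong on the projective line. -/
theorem exists_pingpong {g h : SL2Z} (hg : 3 ≤ (g : Matrix (Fin 2) (Fin 2) ℤ).trace)
    (hh : 3 ≤ |(h : Matrix (Fin 2) (Fin 2) ℤ).trace|)
    (hgh : commDet (g : Matrix (Fin 2) (Fin 2) ℤ) h ≠ 0) :
    ∃ (N : ℕ) (E : Set (Projectivization ℂ (Fin 2 → ℂ))),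
      (∀ i j : Fin 6, i ≠ j → ∀ x, toSL2C (h ^ (i : ℕ))⁻¹ • x ∈ E →
        toSL2C (h ^ (j : ℕ))⁻¹ • x ∉ E) ∧
      (∀ i j : Fin 6, i ≠ j → ∀ x, toSL2C (h ^ (i : ℕ) * g ^ N)⁻¹ • x ∉ E →
        toSL2C (h ^ (j : ℕ) * g ^ N)⁻¹ • x ∈ E) := by
  obtain ⟨P, t, hP, ht, hPg⟩ := exists_diagonalization hg
  rw [← coe_toSL2C] at hPg
  have hPu : IsUnit P.det := isUnit_iff_ne_zero.2 hP
  have hconj : ∀ m : SL2Z, ∃ M, P * (toSL2C m : Matrix (Fin 2) (Fin 2) ℂ) = M * P := fun m =>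
    ⟨P * (toSL2C m : Matrix (Fin 2) (Fin 2) ℂ) * P⁻¹, by
      rw [mul_assoc _ P⁻¹, Matrix.nonsing_inv_mul P hPu, mul_one]⟩
  choose Q hQ using hconj
  have hco : ∀ (m : SL2Z) (v : Fin 2 → ℂ) (i : Fin 2), (P *ᵥ (toSL2C m • v)) i =
      Q m i 0 * (P *ᵥ v) 0 + Q m i 1 * (P *ᵥ v) 1 := by
    intro m v i
    change (P *ᵥ ((toSL2C m : Matrix (Fin 2) (Fin 2) ℂ) *ᵥ v)) i = _
    rw [Matrix.mulVec_mulVec, hQ, ← Matrix.mulVec_mulVec]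
    simp [Matrix.mulVec, dotProduct]
  have hne : ∀ v : Fin 2 → ℂ, v ≠ 0 → (P *ᵥ v) 0 ≠ 0 ∨ (P *ᵥ v) 1 ≠ 0 := by
    intro v hv
    by_contra hcon
    push Not at hcon
    refine hv (Matrix.eq_zero_of_mulVec_eq_zero hP ?_)
    ext i
    fin_cases i
    exacts [hcon.1, hcon.2]
  have hev : ∀ᶠ ε in nhdsWithin (0 : ℝ) (Set.Ioi 0), ∀ i j : Fin 6, i ≠ j → ∀ v : Fin 2 → ℂ, v ≠ 0 →
      (‖(P *ᵥ v) 0‖ ≤ ε * ‖(P *ᵥ v) 1‖ →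
        ε * ‖(P *ᵥ (toSL2C ((h ^ (j : ℕ))⁻¹ * h ^ (i : ℕ)) • v)) 1‖ <
          ‖(P *ᵥ (toSL2C ((h ^ (j : ℕ))⁻¹ * h ^ (i : ℕ)) • v)) 0‖) ∧
      (‖(P *ᵥ v) 1‖ ≤ ε * ‖(P *ᵥ v) 0‖ →
        ε * ‖(P *ᵥ (toSL2C ((h ^ (j : ℕ))⁻¹ * h ^ (i : ℕ)) • v)) 0‖ <
          ‖(P *ᵥ (toSL2C ((h ^ (j : ℕ))⁻¹ * h ^ (i : ℕ)) • v)) 1‖) := by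
    refine Filter.eventually_all.2 fun i => Filter.eventually_all.2 fun j => ?_
    by_cases hij : i = j
    · exact Filter.Eventually.of_forall fun ε hne => absurd hij hne
    have hij' : (i : ℕ) ≠ j := fun h => hij (Fin.ext h)
    have hcd := commDet_inv_pow_mul_pow hh hgh hij'
    obtain ⟨m, hm⟩ : ∃ m, m = (h ^ (j : ℕ))⁻¹ * h ^ (i : ℕ) := ⟨_, rfl⟩
    rw [← hm] at hcd ⊢
    obtain ⟨h01, h10⟩ := offDiag_ne_zero hP hPg hcd (hQ m)
    obtain ⟨ε₁, hε₁, H1⟩ := cone_disjoint (p := Q m 0 0) (r := Q m 1 0) (s := Q m 1 1) h01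
    obtain ⟨ε₂, hε₂, H2⟩ := cone_disjoint (p := Q m 1 1) (r := Q m 0 1) (s := Q m 0 0) h10
    filter_upwards [Ioc_mem_nhdsGT (lt_min hε₁ hε₂)] with ε hε _ v hv
    refine ⟨fun hx => ?_, fun hx => ?_⟩
    · rw [hco, hco]
      exact H1 ε hε.1 (hε.2.trans (min_le_left _ _)) _ _ (hne v hv) hx
    · rw [hco, hco, add_comm, add_comm (Q m 1 0 * _)]
      exact H2 ε hε.1 (hε.2.trans (min_le_right _ _)) _ _ (hne v hv).symm hx
  obtain ⟨ε, hε, hε0⟩ := (hev.and self_mem_nhdsWithin).exists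
  replace hε0 : 0 < ε := hε0
  have ht0 : t ≠ 0 := norm_pos_iff.1 (by linarith)
  obtain ⟨N, hN⟩ : ∃ N : ℕ, (ε ^ 2)⁻¹ < ‖t‖ ^ N := pow_unbounded_of_one_lt _ ht
  have hpow : ∀ n : ℕ, P * (toSL2C (g ^ n) : Matrix (Fin 2) (Fin 2) ℂ) =
      !![t ^ n, 0; 0, (t⁻¹) ^ n] * P := by
    intro n
    induction n with
    | zero => simp [← Matrix.one_fin_two]
    | succ n ih =>
      rw [pow_succ, map_mul, Matrix.SpecialLinearGroup.coe_mul, ← mul_assoc, ih, mul_assoc, hPg,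
        ← mul_assoc]
      congr 1
      ext i j
      fin_cases i <;> fin_cases j <;> simp [Matrix.mul_apply, pow_succ]
  have hcog : ∀ v : Fin 2 → ℂ, (P *ᵥ (toSL2C (g ^ N) • v)) 0 = t ^ N * (P *ᵥ v) 0 ∧
      (P *ᵥ (toSL2C (g ^ N) • v)) 1 = (t⁻¹) ^ N * (P *ᵥ v) 1 := by
    intro v
    change (P *ᵥ ((toSL2C (g ^ N) : Matrix (Fin 2) (Fin 2) ℂ) *ᵥ v)) 0 = _ ∧
      (P *ᵥ ((toSL2C (g ^ N) : Matrix (Fin 2) (Fin 2) ℂ) *ᵥ v)) 1 = _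
    rw [Matrix.mulVec_mulVec, hpow, ← Matrix.mulVec_mulVec]
    simp [Matrix.mulVec, dotProduct]
  have hcontr : ∀ v : Fin 2 → ℂ, ¬ ‖(P *ᵥ v) 0‖ ≤ ε * ‖(P *ᵥ v) 1‖ →
      ‖(P *ᵥ (toSL2C (g ^ N) • v)) 1‖ ≤ ε * ‖(P *ᵥ (toSL2C (g ^ N) • v)) 0‖ := by
    intro v hv
    rw [not_le] at hv
    rw [(hcog v).1, (hcog v).2, norm_mul, norm_mul, norm_pow, norm_pow, norm_inv]
    have h1 : (‖t‖⁻¹) ^ N ≤ 1 := pow_le_one₀ (by positivity) (inv_le_one_of_one_le₀ ht.le)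
    have h2 : 1 ≤ ε ^ 2 * ‖t‖ ^ N := by
      rw [inv_lt_iff_one_lt_mul₀ (by positivity)] at hN
      linarith
    have h3 : (‖t‖⁻¹) ^ N * ‖(P *ᵥ v) 1‖ ≤ 1 * ‖(P *ᵥ v) 1‖ := by gcongr
    have h4 : ε * ‖(P *ᵥ v) 1‖ * (ε * ‖t‖ ^ N) ≤ ‖(P *ᵥ v) 0‖ * (ε * ‖t‖ ^ N) := by gcongr
    have h5 : 1 * ‖(P *ᵥ v) 1‖ ≤ ε ^ 2 * ‖t‖ ^ N * ‖(P *ᵥ v) 1‖ := by gcongr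
    nlinarith only [h3, h4, h5]
  refine ⟨N, lineCone P ε, fun i j hij x => ?_, fun i j hij x => ?_⟩
  · induction x using Projectivization.ind with
    | h v hv =>
      have hu : toSL2C (h ^ (i : ℕ))⁻¹ • v ≠ 0 := (smul_ne_zero_iff_ne _).2 hv
      rw [Projectivization.smul_mk, Projectivization.smul_mk, mk_mem_lineCone, mk_mem_lineCone]
      intro h1 h2
      have h3 := (hε i j hij _ hu).1 h1
      rw [smul_smul, ← map_mul, mul_assoc, mul_inv_cancel, mul_one] at h3
      linarith
  · induction x using Projectivization.ind with
    | h v hv =>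
      obtain ⟨u, hu⟩ : ∃ u, u = toSL2C (h ^ (i : ℕ) * g ^ N)⁻¹ • v := ⟨_, rfl⟩
      obtain ⟨w, hw⟩ : ∃ w, w = toSL2C (h ^ (j : ℕ) * g ^ N)⁻¹ • v := ⟨_, rfl⟩
      have hu0 : toSL2C (g ^ N) • u ≠ 0 := by
        rw [smul_ne_zero_iff_ne, hu, smul_ne_zero_iff_ne]
        exact hv
      rw [Projectivization.smul_mk, Projectivization.smul_mk, mk_mem_lineCone, mk_mem_lineCone,
        ← hu, ← hw]
      intro h1
      by_contra h2
      have h3 := (hε i j hij _ hu0).2 (hcontr u h1)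
      have h4 : toSL2C ((h ^ (j : ℕ))⁻¹ * h ^ (i : ℕ)) • toSL2C (g ^ N) • u =
          toSL2C (g ^ N) • w := by
        rw [hu, hw, smul_smul, smul_smul, smul_smul, ← map_mul, ← map_mul, ← map_mul]
        congr 2
        group
      rw [h4] at h3
      have h5 := hcontr w h2
      linarith

/-- The projection of `Γ` onto its `i`-th factor. -/
def factorHom (i : Fin 3) : GammaSL →* SL2Z :=
  ![MonoidHom.fst _ _, (MonoidHom.fst _ _).comp (MonoidHom.snd _ _),
    (MonoidHom.snd _ _).comp (MonoidHom.snd _ _)] i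

lemma entryZ_eq (g : GammaSL) (i : Fin 3) (a b : Fin 2) :
    entryZ g (i, a, b) = (factorHom i g : Matrix (Fin 2) (Fin 2) ℤ) a b := by
  fin_cases i <;> rfl

lemma ZariskiDense.exists_aeval_ne_zero {G : Subgroup GammaSL} (hG : ZariskiDense G) (i : Fin 3)
    (P : MvPolynomial (Fin 2 × Fin 2) ℚ) (h : SL2C)
    (hP : MvPolynomial.aeval (fun x => (h : Matrix (Fin 2) (Fin 2) ℂ) x.1 x.2) P ≠ 0) :
    ∃ g ∈ G, MvPolynomial.aeval
      (fun x => ((factorHom i g : Matrix (Fin 2) (Fin 2) ℤ) x.1 x.2 : ℂ)) P ≠ 0 := by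
  by_contra! hcon
  refine hP ?_
  have h1 := hG (MvPolynomial.rename (fun x : Fin 2 × Fin 2 => (i, x.1, x.2)) P) (fun g hg => ?_)
    (h, h, h)
  · rw [MvPolynomial.aeval_rename] at h1
    rw [← h1]
    congr 2
    ext x
    fin_cases i <;> rfl
  · rw [MvPolynomial.aeval_rename, ← hcon g hg]
    congr 2
    ext x
    simp only [Function.comp, entryZ_eq]

lemma ZariskiDense.exists_hyperbolic {G : Subgroup GammaSL} (hG : ZariskiDense G) (i : Fin 3) :
    ∃ g ∈ G, 7 ≤ (factorHom i g : Matrix (Fin 2) (Fin 2) ℤ).trace := by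
  obtain ⟨h, hh⟩ : ∃ h : SL2C, (h : Matrix (Fin 2) (Fin 2) ℂ) = !![3, 0; 0, 3⁻¹] :=
    ⟨⟨!![3, 0; 0, 3⁻¹], by simp [Matrix.det_fin_two]⟩, rfl⟩
  obtain ⟨g, hg, hne⟩ := hG.exists_aeval_ne_zero i
    (∏ k ∈ Finset.Icc (-2 : ℤ) 2, (MvPolynomial.X (0, 0) + MvPolynomial.X (1, 1) -
      MvPolynomial.C (k : ℚ))) h (by
    rw [map_prod, Finset.prod_ne_zero_iff]
    intro k hk h0
    simp only [map_sub, map_add, MvPolynomial.aeval_X, MvPolynomial.algHom_C, hh] at h0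
    simp only [Matrix.of_apply, Matrix.cons_val', Matrix.cons_val_zero, Matrix.cons_val_one,
      Matrix.cons_val_fin_one, eq_ratCast, Rat.cast_intCast] at h0
    have h1 : (10 : ℂ) = ((3 * k : ℤ) : ℂ) := by
      push_cast
      field_simp at h0
      linear_combination h0
    have h2 : (10 : ℤ) = 3 * k := by exact_mod_cast h1
    omega)
  refine ⟨g ^ 2, pow_mem hg 2, ?_⟩
  obtain ⟨m, hm⟩ : ∃ m, m = factorHom i g := ⟨_, rfl⟩
  rw [map_pow, ← hm]
  rw [← hm, map_prod, Finset.prod_ne_zero_iff] at hne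
  have htr : (m : Matrix (Fin 2) (Fin 2) ℤ).trace ∉ Finset.Icc (-2 : ℤ) 2 := by
    intro hmem
    refine hne _ hmem ?_
    simp [Matrix.trace_fin_two]
  have hdet := m.det_coe
  rw [Finset.mem_Icc] at htr
  rw [pow_two, Matrix.SpecialLinearGroup.coe_mul]
  rw [Matrix.det_fin_two] at hdet
  rw [Matrix.trace_fin_two] at htr ⊢
  rw [Matrix.mul_apply, Matrix.mul_apply, Fin.sum_univ_two, Fin.sum_univ_two]
  have h3 : 3 ≤ m 0 0 + m 1 1 ∨ m 0 0 + m 1 1 ≤ -3 := by omega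
  rcases h3 with h3 | h3 <;> nlinarith

lemma commDet_map {R R' : Type*} [CommRing R] [CommRing R'] (f : R →+* R')
    (g m : Matrix (Fin 2) (Fin 2) R) : f (commDet g m) = commDet (g.map f) (m.map f) := by
  simp only [commDet, Matrix.det_fin_two, Matrix.sub_apply, Matrix.mul_apply, Fin.sum_univ_two,
    Matrix.map_apply, map_sub, map_mul, map_add]

lemma commDet_conj_unipotent {R : Type*} [CommRing R] (a b c d : R) :
    commDet !![a, b; c, d] (!![1, 1; 0, 1] * !![a, b; c, d] * Matrix.adjugate !![1, 1; 0, 1]) =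
      c ^ 2 * ((a + d) ^ 2 - 4 * (a * d - b * c) - c ^ 2) := by
  simp only [commDet, Matrix.adjugate_fin_two_of, Matrix.det_fin_two, Matrix.sub_apply,
    Matrix.mul_apply, Fin.sum_univ_two, Matrix.of_apply, Matrix.cons_val', Matrix.cons_val_zero,
    Matrix.cons_val_one, Matrix.cons_val_fin_one]
  ring

lemma ZariskiDense.exists_transverse {G : Subgroup GammaSL} (hG : ZariskiDense G) (i : Fin 3)
    {g : SL2Z} (hg : 7 ≤ (g : Matrix (Fin 2) (Fin 2) ℤ).trace) :
    ∃ s ∈ G, commDet (g : Matrix (Fin 2) (Fin 2) ℤ)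
      (factorHom i s * g * (factorHom i s)⁻¹ : SL2Z) ≠ 0 := by
  obtain ⟨X, hX⟩ : ∃ X : Matrix (Fin 2) (Fin 2) (MvPolynomial (Fin 2 × Fin 2) ℚ),
      X = Matrix.of fun a b => MvPolynomial.X (a, b) := ⟨_, rfl⟩
  obtain ⟨Y, hY⟩ : ∃ Y : Matrix (Fin 2) (Fin 2) (MvPolynomial (Fin 2 × Fin 2) ℚ),
      Y = (g : Matrix (Fin 2) (Fin 2) ℤ).map (Int.castRingHom _) := ⟨_, rfl⟩
  have hval : ∀ f : Fin 2 × Fin 2 → ℂ, MvPolynomial.aeval f (commDet Y (X * Y * X.adjugate)) =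
      commDet ((g : Matrix (Fin 2) (Fin 2) ℤ).map (Int.castRingHom ℂ))
        (Matrix.of (fun a b => f (a, b)) * (g : Matrix (Fin 2) (Fin 2) ℤ).map (Int.castRingHom ℂ) *
          Matrix.adjugate (Matrix.of (fun a b => f (a, b)))) := by
    intro f
    have h1 : X.map (MvPolynomial.aeval f : _ →ₐ[ℚ] ℂ) = Matrix.of (fun a b => f (a, b)) := by
      ext a b
      simp [hX]
    have h2 : Y.map (MvPolynomial.aeval f : _ →ₐ[ℚ] ℂ) =
        (g : Matrix (Fin 2) (Fin 2) ℤ).map (Int.castRingHom ℂ) := by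
      ext a b
      simp [hY]
    have h3 := commDet_map (MvPolynomial.aeval f : _ →ₐ[ℚ] ℂ).toRingHom Y (X * Y * X.adjugate)
    rw [Matrix.map_mul, Matrix.map_mul] at h3
    have h4 := (MvPolynomial.aeval f : _ →ₐ[ℚ] ℂ).toRingHom.map_adjugate X
    change (X.adjugate).map _ = Matrix.adjugate (X.map _) at h4
    rw [h4] at h3
    change X.map (MvPolynomial.aeval f : _ →ₐ[ℚ] ℂ).toRingHom = _ at h1
    change Y.map (MvPolynomial.aeval f : _ →ₐ[ℚ] ℂ).toRingHom = _ at h2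
    rw [h1, h2] at h3
    exact h3
  obtain ⟨h, hh⟩ : ∃ h : SL2C, (h : Matrix (Fin 2) (Fin 2) ℂ) = !![1, 1; 0, 1] :=
    ⟨⟨!![1, 1; 0, 1], by simp [Matrix.det_fin_two]⟩, rfl⟩
  obtain ⟨s, hs, hne⟩ := hG.exists_aeval_ne_zero i (commDet Y (X * Y * X.adjugate)) h (by
    rw [hval]
    have h1 : (Matrix.of fun a b => (h : Matrix (Fin 2) (Fin 2) ℂ) (a, b).1 (a, b).2) =
        (!![1, 1; 0, 1] : Matrix (Fin 2) (Fin 2) ℤ).map (Int.castRingHom ℂ) := by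
      rw [hh]
      ext a b
      fin_cases a <;> fin_cases b <;> simp
    rw [h1]
    have h4 := (Int.castRingHom ℂ).map_adjugate (!![1, 1; 0, 1] : Matrix (Fin 2) (Fin 2) ℤ)
    change (Matrix.adjugate _).map _ = Matrix.adjugate (Matrix.map _ _) at h4
    rw [← h4, ← Matrix.map_mul, ← Matrix.map_mul, ← commDet_map]
    rw [Matrix.eta_fin_two (g : Matrix (Fin 2) (Fin 2) ℤ), commDet_conj_unipotent]
    have hdet := g.det_coe
    rw [Matrix.det_fin_two] at hdet
    rw [Matrix.trace_fin_two] at hg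
    rw [hdet]
    obtain ⟨a, ha⟩ : ∃ a, a = g 0 0 := ⟨_, rfl⟩
    obtain ⟨b, hb⟩ : ∃ b, b = g 0 1 := ⟨_, rfl⟩
    obtain ⟨c, hc⟩ : ∃ c, c = g 1 0 := ⟨_, rfl⟩
    obtain ⟨d, hd⟩ : ∃ d, d = g 1 1 := ⟨_, rfl⟩
    rw [← ha, ← hb, ← hc, ← hd] at hdet
    rw [← ha, ← hd] at hg
    rw [← ha, ← hd, ← hc]
    have hc0 : c ≠ 0 := by
      rintro rfl
      have h5 : a * d = 1 := by linarith
      rcases Int.mul_eq_one_iff_eq_one_or_neg_one.1 h5 with h6 | h6 <;> omega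
    have hc1 : (a + d) ^ 2 - 4 * 1 - c ^ 2 ≠ 0 := by
      intro h5
      have h6 : c ^ 2 < (a + d) ^ 2 := by linarith
      have h7 : |c| < a + d := by
        rw [sq_lt_sq] at h6
        rwa [abs_of_nonneg (by omega : 0 ≤ a + d)] at h6
      have h8 : |c| ≤ a + d - 1 := by omega
      have h9 : |c| ^ 2 ≤ (a + d - 1) ^ 2 := pow_le_pow_left₀ (abs_nonneg _) h8 2
      rw [sq_abs] at h9
      nlinarith
    have h10 := mul_ne_zero (pow_ne_zero 2 hc0) hc1
    intro h11
    rw [eq_intCast] at h11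
    exact h10 (by exact_mod_cast h11))
  refine ⟨s, hs, fun h0 => hne ?_⟩
  rw [hval]
  obtain ⟨m, hm⟩ : ∃ m, m = factorHom i s := ⟨_, rfl⟩
  rw [← hm] at h0 ⊢
  have h1 : (Matrix.of fun a b => (((m : Matrix (Fin 2) (Fin 2) ℤ) (a, b).1 (a, b).2 : ℤ) : ℂ)) =
      (m : Matrix (Fin 2) (Fin 2) ℤ).map (Int.castRingHom ℂ) := by
    ext a b
    simp
  rw [h1]
  have h4 := (Int.castRingHom ℂ).map_adjugate (m : Matrix (Fin 2) (Fin 2) ℤ)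
  change (Matrix.adjugate _).map _ = Matrix.adjugate (Matrix.map _ _) at h4
  rw [← h4, ← Matrix.map_mul, ← Matrix.map_mul, ← commDet_map]
  rw [Matrix.SpecialLinearGroup.coe_mul, Matrix.SpecialLinearGroup.coe_mul,
    Matrix.SpecialLinearGroup.coe_inv] at h0
  rw [h0, map_zero]

section Words

variable {G : Type*} [Group G] {S : Multiset G}

lemma inv_mem_words (hS : ∀ s ∈ S, s⁻¹ ∈ S) {n : ℕ} {w : G} (hw : w ∈ words S n) :
    w⁻¹ ∈ words S n := by
  induction n generalizing w with
  | zero =>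
    simp only [words, Multiset.mem_singleton] at hw ⊢
    simp [hw]
  | succ n ih =>
    simp only [words, Multiset.mem_bind, Multiset.mem_map] at hw
    obtain ⟨s, hs, v, hv, rfl⟩ := hw
    rw [_root_.mul_inv_rev, add_comm]
    exact mul_mem_words (mem_words_one (hS s hs)) (ih hv)

lemma exists_mem_words_of_mem_closure (hS : ∀ s ∈ S, s⁻¹ ∈ S) {w : G}
    (hw : w ∈ Subgroup.closure {s | s ∈ S}) : ∃ n, w ∈ words S n := by
  induction hw using Subgroup.closure_induction with
  | mem x hx => exact ⟨1, mem_words_one hx⟩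
  | one => exact ⟨0, by simp [words]⟩
  | mul x y _ _ hx hy =>
    obtain ⟨n, hn⟩ := hx
    obtain ⟨m, hm⟩ := hy
    exact ⟨n + m, mul_mem_words hn hm⟩
  | inv x _ hx =>
    obtain ⟨n, hn⟩ := hx
    exact ⟨n, inv_mem_words hS hn⟩

lemma one_mem_words_two_mul (hS : ∀ s ∈ S, s⁻¹ ∈ S) {s : G} (hs : s ∈ S) (k : ℕ) :
    1 ∈ words S (2 * k) := by
  induction k with
  | zero => simp [words]
  | succ k ih =>
    have h1 : (1 : G) = 1 * (s * s⁻¹) := by simp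
    have h2 : 2 * (k + 1) = 2 * k + (1 + 1) := by ring
    rw [h1, h2]
    exact mul_mem_words ih (mul_mem_words (mem_words_one hs) (mem_words_one (hS s hs)))

lemma mem_words_two_mul_of_le (hS : ∀ s ∈ S, s⁻¹ ∈ S) {s : G} (hs : s ∈ S) {m n : ℕ} (hmn : m ≤ n)
    {w : G} (hw : w ∈ words S (2 * m)) : w ∈ words S (2 * n) := by
  obtain ⟨k, rfl⟩ := Nat.exists_eq_add_of_le hmn
  rw [mul_add, ← mul_one w]
  exact mul_mem_words hw (one_mem_words_two_mul hS hs k)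

/-- The elements represented by words of even length. -/
def evenWords (S : Multiset G) (hS : ∀ s ∈ S, s⁻¹ ∈ S) : Subgroup G where
  carrier := {w | ∃ n, w ∈ words S (2 * n)}
  one_mem' := ⟨0, by simp [words]⟩
  mul_mem' := by
    rintro v w ⟨n, hn⟩ ⟨m, hm⟩
    exact ⟨n + m, by rw [mul_add]; exact mul_mem_words hn hm⟩
  inv_mem' := by
    rintro v ⟨n, hn⟩
    exact ⟨n, inv_mem_words hS hn⟩

end Words

/-- Spectral gap for the action of each factor on the projective line. -/
theorem exists_factor_gap {S : Set GammaSL} (hfin : S.Finite) (hsym : S⁻¹ = S)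
    (hdense : ZariskiDense (Subgroup.closure S)) (i : Fin 3) :
    ∃ (θ : ℝ) (l : ℕ), 0 < θ ∧ θ < 1 ∧ 0 < l ∧ ∀ (n : ℕ) (x y : Projectivization ℂ (Fin 2 → ℂ))
      [DecidablePred fun w : GammaSL => toSL2C (factorHom i w) • x = y],
      ((words hfin.toFinset.val n).countP
        (fun w : GammaSL => toSL2C (factorHom i w) • x = y) : ℝ) ^ 2 ≤
        θ ^ (n / l) * (S.ncard : ℝ) ^ (2 * n) := by
  obtain ⟨W, hW⟩ : ∃ W, W = hfin.toFinset.val := ⟨_, rfl⟩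
  have hmemW : ∀ s, s ∈ W ↔ s ∈ S := fun s => by rw [hW]; simp
  have hS : ∀ s ∈ W, s⁻¹ ∈ W := by
    intro s hs
    rw [hmemW] at hs ⊢
    rw [← hsym]
    simpa using hs
  have hcl : Subgroup.closure {s | s ∈ W} = Subgroup.closure S := by
    congr 1
    ext s
    exact hmemW s
  have hcard : W.card = S.ncard := by
    rw [hW, Set.ncard_eq_toFinset_card S hfin]
    rfl
  obtain ⟨g₀, hg₀, htr⟩ := hdense.exists_hyperbolic i
  obtain ⟨g, hg⟩ : ∃ g, g = g₀ ^ 2 := ⟨_, rfl⟩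
  have htr' : 7 ≤ (factorHom i g : Matrix (Fin 2) (Fin 2) ℤ).trace := by
    rw [hg, map_pow, pow_two, Matrix.SpecialLinearGroup.coe_mul]
    obtain ⟨m, hm⟩ : ∃ m, m = factorHom i g₀ := ⟨_, rfl⟩
    rw [← hm] at htr ⊢
    have hdet := m.det_coe
    rw [Matrix.det_fin_two] at hdet
    rw [Matrix.trace_fin_two] at htr ⊢
    rw [Matrix.mul_apply, Matrix.mul_apply, Fin.sum_univ_two, Fin.sum_univ_two]
    nlinarith
  obtain ⟨s, hs, hcd⟩ := hdense.exists_transverse i htr'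
  obtain ⟨h, hh⟩ : ∃ h, h = s * g * s⁻¹ := ⟨_, rfl⟩
  have hgE : g ∈ evenWords W hS := by
    obtain ⟨n, hn⟩ := exists_mem_words_of_mem_closure hS (hcl ▸ hg₀)
    refine ⟨n, ?_⟩
    rw [hg, pow_two, two_mul]
    exact mul_mem_words hn hn
  have hhE : h ∈ evenWords W hS := by
    obtain ⟨n, hn⟩ := exists_mem_words_of_mem_closure hS (hcl ▸ hs)
    obtain ⟨m, hm⟩ := hgE
    refine ⟨n + m, ?_⟩
    have h1 : 2 * (n + m) = n + 2 * m + n := by ring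
    rw [hh, h1]
    exact mul_mem_words (mul_mem_words hn hm) (inv_mem_words hS hn)
  have hhi : factorHom i h = factorHom i s * factorHom i g * (factorHom i s)⁻¹ := by
    rw [hh, map_mul, map_mul, map_inv]
  have htrh : (factorHom i h : Matrix (Fin 2) (Fin 2) ℤ).trace =
      (factorHom i g : Matrix (Fin 2) (Fin 2) ℤ).trace := by
    rw [hhi, Matrix.SpecialLinearGroup.coe_mul, Matrix.trace_mul_comm,
      ← Matrix.SpecialLinearGroup.coe_mul, ← mul_assoc, inv_mul_cancel, one_mul]
  rw [← hhi] at hcd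
  obtain ⟨N, E, ha, hb⟩ := exists_pingpong (by omega)
    (by rw [htrh, abs_of_nonneg (by omega)]; omega) hcd
  obtain ⟨s₀, hs₀⟩ : ∃ s₀, s₀ ∈ W := by
    by_contra! hcon
    have h1 : S = ∅ := Set.eq_empty_of_forall_notMem fun s hs => hcon s ((hmemW s).2 hs)
    rw [h1, Subgroup.closure_empty, Subgroup.mem_bot] at hg₀
    rw [hg₀, map_one, Matrix.SpecialLinearGroup.coe_one, Matrix.trace_one] at htr
    norm_num at htr
  have ha' : ∀ j : Fin 6, ∃ n, (h ^ (j : ℕ))⁻¹ ∈ words W (2 * n) := fun j =>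
    inv_mem (pow_mem hhE _)
  have hb' : ∀ j : Fin 6, ∃ n, (h ^ (j : ℕ) * g ^ N)⁻¹ ∈ words W (2 * n) := fun j =>
    inv_mem (mul_mem (pow_mem hhE _) (pow_mem hgE _))
  choose na hna using ha'
  choose nb hnb using hb'
  obtain ⟨l, hl⟩ : ∃ l, l = 1 + ∑ j, (na j + nb j) := ⟨_, rfl⟩
  have hle : ∀ j, na j ≤ l ∧ nb j ≤ l := by
    intro j
    have := Finset.single_le_sum (f := fun j => na j + nb j) (fun _ _ => Nat.zero_le _)
      (Finset.mem_univ j)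
    omega
  obtain ⟨θ, hθ0, hθ1, hθ⟩ := exists_word_gap (S := W.map (toSL2C.comp (factorHom i)))
    (a := fun j => toSL2C (factorHom i (h ^ (j : ℕ))⁻¹))
    (b := fun j => toSL2C (factorHom i (h ^ (j : ℕ) * g ^ N)⁻¹)) (E := E) (l := 2 * l)
    (by simpa only [map_mul, map_inv, map_pow] using ha)
    (by simpa only [map_mul, map_inv, map_pow] using hb)
    (fun j => by
      rw [words_map]
      exact Multiset.mem_map_of_mem (toSL2C.comp (factorHom i))
        (mem_words_two_mul_of_le hS hs₀ (hle j).1 (hna j)))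
    (fun j => by
      rw [words_map]
      exact Multiset.mem_map_of_mem (toSL2C.comp (factorHom i))
        (mem_words_two_mul_of_le hS hs₀ (hle j).2 (hnb j)))
  refine ⟨θ, 2 * l, hθ0, hθ1, by omega, fun n x y _ => ?_⟩
  classical
  have h1 := hθ n x y
  rw [words_map, Multiset.countP_map, Multiset.card_map, hcard] at h1
  rw [← hW, Multiset.countP_eq_card_filter]
  convert h1 using 4
  congr

lemma card_SL_zmod_le (q : ℕ) [NeZero q] :
    Nat.card (Matrix.SpecialLinearGroup (Fin 2) (ZMod q)) ≤ q ^ 4 := by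
  have h1 : Nat.card (Fin 2 → Fin 2 → ZMod q) = q ^ 4 := by
    rw [Nat.card_pi]
    simp only [Nat.card_pi, Nat.card_zmod, Finset.prod_const, Finset.card_univ, Fintype.card_fin]
    ring
  rw [← h1]
  exact Nat.card_le_card_of_injective
    (fun g : Matrix.SpecialLinearGroup (Fin 2) (ZMod q) => (g : Matrix (Fin 2) (Fin 2) (ZMod q)))
    Subtype.val_injective

lemma card_gammaMod_le (q : ℕ) [NeZero q] : Nat.card (GammaMod q) ≤ q ^ 12 := by
  rw [Nat.card_prod, Nat.card_prod]
  have h := card_SL_zmod_le q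
  calc _ ≤ q ^ 4 * (q ^ 4 * q ^ 4) := by gcongr
    _ = q ^ 12 := by ring

section Words

variable {G : Type*}

lemma count_words_succ [Group G] [DecidableEq G] (S : Multiset G) (n : ℕ) (x : G) :
    (words S (n + 1)).count x = (S.map fun s => (words S n).count (x * s⁻¹)).sum := by
  simp only [words]
  rw [Multiset.count_bind]
  congr 1
  refine Multiset.map_congr rfl fun s _ => ?_
  have h := Multiset.count_map_eq_count' (fun w => w * s) (words S n) (mul_left_injective s)
    (x * s⁻¹)
  simpa only [inv_mul_cancel_right] using h

lemma card_le_card_image_mul {β : Type*} [DecidableEq β] (F : Multiset G) (f : G → β) {M : ℝ}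
    (h : ∀ y, ((F.filter (f · = y)).card : ℝ) ≤ M) :
    (F.card : ℝ) ≤ (F.map f).toFinset.card * M := by
  have h1 := Multiset.toFinset_sum_count_eq (F.map f)
  rw [Multiset.card_map] at h1
  rw [← h1]
  push_cast
  rw [← nsmul_eq_mul]
  refine Finset.sum_le_card_nsmul _ _ _ fun y _ => ?_
  refine le_trans (le_of_eq ?_) (h y)
  rw [Multiset.count_map]
  simp only [eq_comm]

lemma exists_translate_filter [Monoid G] {S : Multiset G} {A : Set G} [DecidablePred (· ∈ A)]
    {n m : ℕ} {c : ℝ}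
    (h : c * (S.card : ℝ) ^ (n + m) < ((words S (n + m)).filter (· ∈ A)).card) :
    ∃ u, c * (S.card : ℝ) ^ n < ((words S n).filter (· * u ∈ A)).card := by
  by_contra! hcon
  refine h.not_ge ?_
  rw [words_add, Multiset.filter_bind, Multiset.card_bind, Nat.cast_multiset_sum, Multiset.map_map]
  refine (Multiset.sum_le_card_nsmul _ (c * (S.card : ℝ) ^ n) ?_).trans_eq ?_
  · intro x hx
    obtain ⟨u, _, rfl⟩ := Multiset.mem_map.1 hx
    refine le_trans (le_of_eq ?_) (hcon u)
    simp only [Function.comp, Multiset.filter_map, Multiset.card_map]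
  · rw [Multiset.card_map, card_words, nsmul_eq_mul]
    push_cast
    ring

end Words

lemma chiIter_eq {S : Set GammaSL} [DecidableEq GammaSL] (hfin : S.Finite) (n : ℕ) (x : GammaSL) :
    chiIter S n x = ((words hfin.toFinset.val n).count x : ℝ) / (S.ncard : ℝ) ^ n := by
  induction n generalizing x with
  | zero =>
    simp only [chiIter, words, pow_zero, div_one, Multiset.count_singleton]
    split_ifs <;> simp
  | succ n ih =>
    rw [chiIter, count_words_succ, convG]
    rw [finsum_eq_sum_of_support_subset (s := hfin.toFinset)]
    · change _ = ((∑ s ∈ hfin.toFinset, (words hfin.toFinset.val n).count (x * s⁻¹) : ℕ) : ℝ) / _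
      push_cast
      rw [Finset.sum_div]
      refine Finset.sum_congr rfl fun s hs => ?_
      rw [ih, chiS, Set.indicator_of_mem (hfin.mem_toFinset.1 hs), pow_succ, div_mul_eq_div_div]
      ring
    · intro y hy
      rw [Function.mem_support] at hy
      rw [Set.Finite.coe_toFinset]
      by_contra hyS
      exact hy (by rw [chiS, Set.indicator_of_notMem hyS, zero_mul])

lemma finsum_mem_chiIter {S : Set GammaSL} (hfin : S.Finite) (n : ℕ) (A : Set GammaSL)
    [DecidablePred (· ∈ A)] :
    ∑ᶠ x ∈ A, chiIter S n x =
      (((words hfin.toFinset.val n).filter (· ∈ A)).card : ℝ) / (S.ncard : ℝ) ^ n := by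
  classical
  obtain ⟨W, hW⟩ : ∃ W, W = words hfin.toFinset.val n := ⟨_, rfl⟩
  rw [finsum_mem_eq_sum_of_inter_support_eq (t := (W.filter (· ∈ A)).toFinset)]
  · rw [← hW, ← Multiset.toFinset_sum_count_eq]
    push_cast
    rw [Finset.sum_div]
    refine Finset.sum_congr rfl fun x hx => ?_
    rw [Multiset.mem_toFinset, Multiset.mem_filter] at hx
    rw [chiIter_eq hfin, ← hW, Multiset.count_filter_of_pos hx.2]
  · ext x
    simp only [Set.mem_inter_iff, Function.mem_support, Finset.mem_coe, Multiset.mem_toFinset,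
      Multiset.mem_filter]
    refine and_congr_left fun hx => ⟨fun hA => ⟨?_, hA⟩, fun h => h.2⟩
    by_contra hxW
    refine hx ?_
    rw [chiIter_eq hfin, ← hW, Multiset.count_eq_zero_of_notMem hxW]
    simp

lemma abs_entry_mul_le {g h : SL2Z} {a b : ℝ} (hg : ∀ i j, |(g i j : ℝ)| ≤ a)
    (hh : ∀ i j, |(h i j : ℝ)| ≤ b) (i j : Fin 2) : |((g * h) i j : ℝ)| ≤ 2 * (a * b) := by
  have ha : 0 ≤ a := (abs_nonneg _).trans (hg 0 0)
  rw [Matrix.SpecialLinearGroup.coe_mul, Matrix.mul_apply, Fin.sum_univ_two]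
  push_cast
  refine (abs_add_le _ _).trans ?_
  rw [abs_mul, abs_mul, two_mul]
  exact add_le_add (mul_le_mul (hg _ _) (hh _ _) (abs_nonneg _) ha)
    (mul_le_mul (hg _ _) (hh _ _) (abs_nonneg _) ha)

lemma abs_entry_inv_le {g : SL2Z} {a : ℝ} (hg : ∀ i j, |(g i j : ℝ)| ≤ a) (i j : Fin 2) :
    |((g⁻¹) i j : ℝ)| ≤ a := by
  rw [Matrix.SpecialLinearGroup.coe_inv, Matrix.adjugate_fin_two]
  fin_cases i <;> fin_cases j <;> simpa using hg _ _

lemma exists_entry_bound {S : Set GammaSL} (hfin : S.Finite) : ∃ B : ℝ, 1 ≤ B ∧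
    ∀ k n, ∀ w ∈ words hfin.toFinset.val n, ∀ i j, |((factorHom k w) i j : ℝ)| ≤ (2 * B) ^ n := by
  classical
  obtain ⟨B₀, hB₀⟩ := ((hfin.toFinset ×ˢ (Finset.univ : Finset (Fin 3 × Fin 2 × Fin 2))).image
    fun x => |((factorHom x.2.1 x.1) x.2.2.1 x.2.2.2 : ℝ)|).exists_le
  obtain ⟨B, hB⟩ : ∃ B, B = max 1 B₀ := ⟨_, rfl⟩
  have hB1 : 1 ≤ B := hB ▸ le_max_left _ _
  have hBs : ∀ s ∈ hfin.toFinset, ∀ k i j, |((factorHom k s) i j : ℝ)| ≤ B := by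
    intro s hs k i j
    rw [hB]
    refine (hB₀ _ (Finset.mem_image.2 ⟨(s, k, i, j), ?_, rfl⟩)).trans (le_max_right _ _)
    exact Finset.mem_product.2 ⟨hs, Finset.mem_univ _⟩
  refine ⟨B, hB1, fun k n => ?_⟩
  induction n with
  | zero =>
    intro w hw i j
    simp only [words, Multiset.mem_singleton] at hw
    rw [hw, map_one]
    fin_cases i <;> fin_cases j <;> simp
  | succ n ih =>
    intro w hw i j
    simp only [words, Multiset.mem_bind, Multiset.mem_map] at hw
    obtain ⟨s, hs, v, hv, rfl⟩ := hw
    rw [map_mul]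
    refine (abs_entry_mul_le (ih v hv) (hBs s hs k) i j).trans_eq ?_
    ring

theorem exists_expanding_sets {S : Set GammaSL} (hfin : S.Finite) (hsym : S⁻¹ = S)
    (hdense : ZariskiDense (Subgroup.closure S)) : ∃ C₀ κ : ℝ, 1 ≤ C₀ ∧ 0 < κ ∧
    ∀ η Λ : ℝ, 0 < η → 0 < Λ → ∃ δ₀ : ℝ, 0 < δ₀ ∧ ∃ Q₀ : ℕ, ∀ δ : ℝ, 0 < δ → δ ≤ δ₀ →
      ∀ q : ℕ, Q₀ ≤ q →
      ∀ q₀ : ℕ, 0 < q₀ → (q₀ : ℝ) ^ 18 ≤ (q : ℝ) ^ δ → ∀ A : Set GammaSL, A⁻¹ = A →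
      ∀ l : ℕ, δ⁻¹ * Real.log q < l → (q : ℝ) ^ (-δ) < ∑ᶠ x ∈ A, chiIter S l x →
      ∀ (i : Fin 3) (n : ℕ), η * Real.log q ≤ n → n ≤ Λ * Real.log q →
      ∃ V : Finset SL2Z,
        ↑V ⊆ factorHom i '' ((A * A) ∩ ((piq q₀).ker : Set GammaSL)) ∧
        (∀ w ∈ V, ∀ a b, |(w a b : ℝ)| ≤ Real.exp (C₀ * n)) ∧
        ∀ (ℓ : Projectivization ℂ (Fin 2 → ℂ)) [DecidableEq (Projectivization ℂ (Fin 2 → ℂ))],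
          Real.exp (κ * n) ≤ (V.image fun w => toSL2C w • ℓ).card := by
  classical
  choose θ l₀ hθ0 hθ1 hl₀ hθ using exists_factor_gap hfin hsym hdense
  obtain ⟨B, hB1, hB⟩ := exists_entry_bound hfin
  obtain ⟨i₀, hi₀⟩ := Finite.exists_min fun i => -Real.log (θ i) / (8 * l₀ i)
  obtain ⟨κ, hκ⟩ : ∃ κ, κ = -Real.log (θ i₀) / (8 * l₀ i₀) := ⟨_, rfl⟩
  obtain ⟨i₁, hi₁⟩ := Finite.exists_max l₀
  have hκ0 : 0 < κ := by
    rw [hκ]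
    have := Real.log_neg (hθ0 i₀) (hθ1 i₀)
    have := hl₀ i₀
    have : (0 : ℝ) < l₀ i₀ := by exact_mod_cast this
    apply div_pos <;> linarith
  have hlogB : 0 < Real.log (2 * B) := Real.log_pos (by linarith)
  refine ⟨1 + 3 * Real.log (2 * B), κ, by linarith, hκ0, fun η Λ hη hΛ => ?_⟩
  obtain ⟨δ₀, hδ₀⟩ : ∃ δ₀, δ₀ = min (κ * η / 2) Λ⁻¹ := ⟨_, rfl⟩
  have hδ₀0 : 0 < δ₀ := by rw [hδ₀]; positivity
  have hδ₀κ : δ₀ ≤ κ * η / 2 := hδ₀.trans_le (min_le_left _ _)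
  have hδ₀Λ : Λ ≤ δ₀⁻¹ := by
    rw [← inv_inv Λ]; exact inv_anti₀ hδ₀0 (hδ₀.trans_le (min_le_right _ _))
  obtain ⟨Q₀, hQ₀⟩ := exists_nat_ge (Real.exp ((2 * l₀ i₁ + 1) / η))
  refine ⟨δ₀, hδ₀0, Q₀, fun δ hδ hδδ q hq q₀ hq₀ hq₀q A hA l hl hmass i n hηn hnδ => ?_⟩
  have hqpos : (0 : ℝ) < q := (Real.exp_pos _).trans_le (hQ₀.trans (by exact_mod_cast hq))
  have hlogq : (2 * l₀ i₁ + 1) / η ≤ Real.log q :=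
    (Real.le_log_iff_exp_le hqpos).2 (hQ₀.trans (by exact_mod_cast hq))
  have hlogq' : 2 * (l₀ i₁ : ℝ) + 1 ≤ η * Real.log q := by
    rwa [div_le_iff₀ hη, mul_comm (Real.log _)] at hlogq
  have hlogq0 : 0 < Real.log q := lt_of_lt_of_le (by positivity) hlogq
  have hl₀i : (l₀ i : ℝ) ≤ l₀ i₁ := by exact_mod_cast hi₁ i
  have hl₀i' : (1 : ℝ) ≤ l₀ i := by exact_mod_cast hl₀ i
  have hn1 : (1 : ℝ) ≤ n := by linarith
  have hnl : n ≤ l := by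
    have h1 : Λ ≤ δ⁻¹ := hδ₀Λ.trans (inv_anti₀ hδ hδδ)
    have h2 : Λ * Real.log q ≤ δ⁻¹ * Real.log q := by gcongr
    have h3 : (n : ℝ) ≤ l := by linarith
    exact_mod_cast h3
  obtain ⟨m, rfl⟩ := Nat.exists_eq_add_of_le hnl
  obtain ⟨W, hW⟩ : ∃ W, W = hfin.toFinset.val := ⟨_, rfl⟩
  have hcard : W.card = S.ncard := by
    rw [hW, Set.ncard_eq_toFinset_card S hfin]
    rfl
  have hqδ : (0 : ℝ) < (q : ℝ) ^ (-δ) := Real.rpow_pos_of_pos hqpos _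
  rw [finsum_mem_chiIter hfin, ← hW, ← hcard] at hmass
  have hkpos : 0 < (W.card : ℝ) := by
    rcases Nat.eq_zero_or_pos W.card with h0 | h0
    · rw [h0] at hmass
      have h1 : n + m ≠ 0 := by
        have : (0 : ℝ) < n := by linarith
        have : 0 < n := by exact_mod_cast this
        omega
      rw [Nat.cast_zero, zero_pow h1, div_zero] at hmass
      linarith
    · exact_mod_cast h0
  rw [lt_div_iff₀ (by positivity)] at hmass
  obtain ⟨u, hu⟩ := exists_translate_filter hmass
  obtain ⟨F, hF⟩ : ∃ F, F = (words W n).filter (· * u ∈ A) := ⟨_, rfl⟩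
  rw [← hF] at hu
  have : NeZero q₀ := ⟨hq₀.ne'⟩
  have : Finite (GammaMod q₀) := by unfold GammaMod; infer_instance
  have : Fintype (GammaMod q₀) := Fintype.ofFinite _
  have hGpos : (0 : ℝ) < Nat.card (GammaMod q₀) := by exact_mod_cast Nat.card_pos
  obtain ⟨c, hc⟩ : ∃ c, (W.card : ℝ) ^ n * (q : ℝ) ^ (-δ) / Nat.card (GammaMod q₀) <
      ((F.filter (fun v => piq q₀ v = c)).card : ℝ) := by
    by_contra! hcon
    refine hu.not_ge ?_
    refine (card_le_card_image_mul F (piq q₀) hcon).trans ?_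
    have h1 : (((F.map (piq q₀)).toFinset.card : ℕ) : ℝ) ≤ Nat.card (GammaMod q₀) := by
      rw [Nat.card_eq_fintype_card]
      exact_mod_cast Finset.card_le_univ _
    calc _ ≤ (Nat.card (GammaMod q₀) : ℝ) *
          ((W.card : ℝ) ^ n * (q : ℝ) ^ (-δ) / Nat.card (GammaMod q₀)) := by gcongr
      _ = _ := by field_simp
  obtain ⟨F', hF'⟩ : ∃ F', F' = F.filter (fun v => piq q₀ v = c) := ⟨_, rfl⟩
  rw [← hF'] at hc
  have hF'mem : ∀ v ∈ F', v ∈ words W n ∧ v * u ∈ A ∧ piq q₀ v = c := by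
    intro v hv
    rw [hF', Multiset.mem_filter, hF, Multiset.mem_filter] at hv
    exact ⟨hv.1.1, hv.1.2, hv.2⟩
  obtain ⟨v₀, hv₀⟩ : ∃ v₀, v₀ ∈ F' := by
    refine Multiset.card_pos_iff_exists_mem.1 ?_
    have h1 : (0 : ℝ) < F'.card := lt_of_le_of_lt (by positivity) hc
    exact_mod_cast h1
  obtain ⟨hv₀W, hv₀A, hv₀c⟩ := hF'mem v₀ hv₀
  refine ⟨(F'.map fun v => factorHom i (v * v₀⁻¹)).toFinset, ?_, ?_, ?_⟩
  · intro w hw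
    rw [Finset.mem_coe, Multiset.mem_toFinset, Multiset.mem_map] at hw
    obtain ⟨v, hv, rfl⟩ := hw
    obtain ⟨hvW, hvA, hvc⟩ := hF'mem v hv
    refine ⟨v * v₀⁻¹, ⟨?_, ?_⟩, rfl⟩
    · have h1 : v * v₀⁻¹ = v * u * (v₀ * u)⁻¹ := by group
      rw [h1]
      refine Set.mul_mem_mul hvA ?_
      rw [← hA]
      exact Set.inv_mem_inv.2 hv₀A
    · rw [SetLike.mem_coe, MonoidHom.mem_ker, map_mul, map_inv, hvc, hv₀c, mul_inv_cancel]
  · intro w hw a b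
    rw [Multiset.mem_toFinset, Multiset.mem_map] at hw
    obtain ⟨v, hv, rfl⟩ := hw
    obtain ⟨hvW, -, -⟩ := hF'mem v hv
    rw [map_mul, map_inv]
    refine (abs_entry_mul_le (hB i n v (hW ▸ hvW))
      (abs_entry_inv_le (hB i n v₀ (hW ▸ hv₀W))) a b).trans ?_
    have h1 : (2 * B) ^ n = Real.exp (Real.log (2 * B) * n) := by
      rw [mul_comm (Real.log (2 * B)), Real.exp_nat_mul, Real.exp_log (by linarith)]
    have h2 : (2 : ℝ) ≤ Real.exp 1 := by
      have := Real.add_one_le_exp (1 : ℝ)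
      linarith
    rw [h1]
    calc _ ≤ Real.exp 1 * (Real.exp (Real.log (2 * B) * n) * Real.exp (Real.log (2 * B) * n)) := by
          gcongr
      _ = Real.exp (1 + (Real.log (2 * B) * n + Real.log (2 * B) * n)) := by
          rw [Real.exp_add, Real.exp_add]
      _ ≤ _ := by
          refine Real.exp_le_exp.2 ?_
          nlinarith
  · intro ℓ _
    obtain ⟨x, hx⟩ : ∃ x, x = (toSL2C (factorHom i v₀))⁻¹ • ℓ := ⟨_, rfl⟩
    have himg : (F'.map fun v => factorHom i (v * v₀⁻¹)).toFinset.image (fun w => toSL2C w • ℓ) =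
        (F'.map fun v => toSL2C (factorHom i v) • x).toFinset := by
      ext y
      simp only [Finset.mem_image, Multiset.mem_toFinset, Multiset.mem_map, hx]
      constructor
      · rintro ⟨_, ⟨v, hv, rfl⟩, rfl⟩
        exact ⟨v, hv, by rw [map_mul, map_mul, map_inv, map_inv, mul_smul]⟩
      · rintro ⟨v, hv, rfl⟩
        exact ⟨_, ⟨v, hv, rfl⟩, by rw [map_mul, map_mul, map_inv, map_inv, mul_smul]⟩
    rw [himg]
    obtain ⟨s, hs⟩ : ∃ s : ℕ, s = n / l₀ i := ⟨_, rfl⟩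
    obtain ⟨r, hr⟩ : ∃ r, r = Real.exp (Real.log (θ i) * s / 2) := ⟨_, rfl⟩
    have hr2 : r ^ 2 = θ i ^ s := by
      rw [hr, ← Real.exp_nat_mul]
      push_cast
      rw [mul_div_cancel₀ _ two_ne_zero, mul_comm, Real.exp_nat_mul, Real.exp_log (hθ0 i)]
    have hr0 : 0 < r := hr ▸ Real.exp_pos _
    have hfib : ∀ y, ((F'.filter fun v => toSL2C (factorHom i v) • x = y).card : ℝ) ≤
        r * (W.card : ℝ) ^ n := by
      intro y
      refine (pow_le_pow_iff_left₀ (by positivity) (by positivity) two_ne_zero).1 ?_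
      have h1 := hθ i n x y
      rw [← hW, ← hs, ← hr2, ← hcard, Multiset.countP_eq_card_filter] at h1
      have h2 : ((F'.filter fun v => toSL2C (factorHom i v) • x = y).card : ℝ) ≤
          ((words W n).filter fun v => toSL2C (factorHom i v) • x = y).card := by
        refine Nat.cast_le.2 (Multiset.card_le_card (Multiset.filter_le_filter _ ?_))
        rw [hF', hF]
        exact (Multiset.filter_le _ _).trans (Multiset.filter_le _ _)
      calc _ ≤ (((words W n).filter fun v => toSL2C (factorHom i v) • x = y).card : ℝ) ^ 2 := by
            gcongr
        _ ≤ _ := h1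
        _ = _ := by ring
    have h1 := card_le_card_image_mul F' (fun v => toSL2C (factorHom i v) • x) hfib
    obtain ⟨I, hI⟩ : ∃ I : ℝ,
        I = ((F'.map fun v => toSL2C (factorHom i v) • x).toFinset.card : ℝ) :=
      ⟨_, rfl⟩
    rw [← hI] at h1
    have hG18 : (Nat.card (GammaMod q₀) : ℝ) ≤ (q : ℝ) ^ δ := by
      have h2 : ((Nat.card (GammaMod q₀) : ℕ) : ℝ) ≤ (q₀ : ℝ) ^ 12 := by
        exact_mod_cast card_gammaMod_le q₀
      have h3 : (q₀ : ℝ) ^ 12 ≤ (q₀ : ℝ) ^ 18 :=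
        pow_le_pow_right₀ (by exact_mod_cast hq₀) (by norm_num)
      linarith
    have h2 : (q : ℝ) ^ (-δ) * (q : ℝ) ^ (-δ) < I * r := by
      have h3 : (W.card : ℝ) ^ n * (q : ℝ) ^ (-δ) / Nat.card (GammaMod q₀) <
          I * (r * (W.card : ℝ) ^ n) := hc.trans_le h1
      have h4 : (W.card : ℝ) ^ n * (q : ℝ) ^ (-δ) / (q : ℝ) ^ δ ≤
          (W.card : ℝ) ^ n * (q : ℝ) ^ (-δ) / Nat.card (GammaMod q₀) := by gcongr
      have h5 : (W.card : ℝ) ^ n * (q : ℝ) ^ (-δ) / (q : ℝ) ^ δ =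
          ((q : ℝ) ^ (-δ) * (q : ℝ) ^ (-δ)) * (W.card : ℝ) ^ n := by
        nth_rewrite 3 [Real.rpow_neg hqpos.le]
        rw [div_eq_mul_inv]
        ring
      rw [h5] at h4
      have h6 := h4.trans_lt h3
      rw [← mul_assoc] at h6
      exact lt_of_mul_lt_mul_right h6 (by positivity)
    have h3 : (q : ℝ) ^ (-δ) = Real.exp (-δ * Real.log q) := by
      rw [Real.rpow_def_of_pos hqpos, mul_comm]
    rw [← hI]
    have h4 : Real.exp (-δ * Real.log q) * Real.exp (-δ * Real.log q) *
        Real.exp (-(Real.log (θ i) * s / 2)) ≤ I := by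
      rw [h3] at h2
      calc _ ≤ I * r * Real.exp (-(Real.log (θ i) * s / 2)) := by gcongr
        _ = I := by rw [hr, mul_assoc, ← Real.exp_add, add_neg_cancel, Real.exp_zero, mul_one]
    refine le_trans ?_ h4
    rw [← Real.exp_add, ← Real.exp_add]
    refine Real.exp_le_exp.2 ?_
    have h5 : (n : ℝ) ≤ l₀ i * s + l₀ i := by
      have h6 := Nat.div_add_mod n (l₀ i)
      have h7 := Nat.mod_lt n (hl₀ i)
      rw [← hs] at h6
      have h8 : n ≤ l₀ i * s + l₀ i := by omega
      exact_mod_cast h8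
    have h6 : (n : ℝ) ≤ 2 * (l₀ i * s) := by linarith
    have h7 : 8 * l₀ i * κ ≤ -Real.log (θ i) := by
      have h8 := hi₀ i
      rw [← hκ, le_div_iff₀ (by positivity)] at h8
      linarith
    have h8 : 8 * l₀ i * κ * s ≤ -Real.log (θ i) * s := by gcongr
    have h9 : κ * n ≤ κ * (2 * (l₀ i * s)) := by gcongr
    have h10 : δ * Real.log q ≤ δ₀ * Real.log q := by gcongr
    have h11 : κ * (η * Real.log q) ≤ κ * n := by gcongr
    have h12 : δ₀ * Real.log q ≤ κ * (η * Real.log q) / 2 := by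
      have : δ₀ * Real.log q ≤ κ * η / 2 * Real.log q := by gcongr
      linarith
    linarith

/-- The binary quadratic form vanishing on the eigenlines of `n`. -/
def eigForm (n : Matrix (Fin 2) (Fin 2) ℤ) (v : Fin 2 → ℂ) : ℂ :=
  n 1 0 * v 0 ^ 2 + (n 1 1 - n 0 0) * (v 0 * v 1) - n 0 1 * v 1 ^ 2

lemma eigForm_smul (n : Matrix (Fin 2) (Fin 2) ℤ) (w : SL2Z) (v : Fin 2 → ℂ) :
    eigForm n (toSL2C w • v) = eigForm ((w⁻¹ : SL2Z) * n * w) v := by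
  have h : ∀ i, (toSL2C w • v) i = (w i 0 : ℂ) * v 0 + w i 1 * v 1 := by
    intro i
    change ((toSL2C w : Matrix (Fin 2) (Fin 2) ℂ) *ᵥ v) i = _
    simp [coe_toSL2C, Matrix.mulVec, dotProduct]
  rw [eigForm, eigForm, h, h, Matrix.SpecialLinearGroup.coe_inv, Matrix.adjugate_fin_two]
  simp only [Matrix.mul_apply, Fin.sum_univ_two, Matrix.of_apply, Matrix.cons_val',
    Matrix.cons_val_zero, Matrix.cons_val_one, Matrix.cons_val_fin_one]
  push_cast
  ring

lemma exists_eigForm_eq_zero {n : Matrix (Fin 2) (Fin 2) ℤ} (hn : n.trace = 0) :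
    ∃ v : Fin 2 → ℂ, v ≠ 0 ∧ eigForm n v = 0 := by
  obtain ⟨a, b, c, rfl⟩ := exists_traceless n hn
  by_cases hc : c = 0
  · refine ⟨![1, 0], fun h => by simpa using congrFun h 0, ?_⟩
    simp [eigForm, hc]
  · obtain ⟨s, hs⟩ := IsAlgClosed.exists_pow_nat_eq ((a : ℂ) ^ 2 + b * c) two_pos
    refine ⟨![a + s, c], fun h => hc (by simpa using congrFun h 1), ?_⟩
    simp only [eigForm, Matrix.of_apply, Matrix.cons_val', Matrix.cons_val_zero,
      Matrix.cons_val_one, Matrix.cons_val_fin_one]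
    push_cast
    linear_combination (c : ℂ) * hs

lemma eigForm_eq_zero_of_commute {n m : Matrix (Fin 2) (Fin 2) ℤ} (hn : n.trace = 0)
    (hm : m.trace = 0) (hn0 : n ≠ 0) (hnm : m * n = n * m) {v : Fin 2 → ℂ} (hv : eigForm n v = 0) :
    eigForm m v = 0 := by
  obtain ⟨a, b, c, rfl⟩ := exists_traceless n hn
  obtain ⟨a', b', c', rfl⟩ := exists_traceless m hm
  have h00 := congrFun (congrFun hnm 0) 0
  have h01 := congrFun (congrFun hnm 0) 1
  have h10 := congrFun (congrFun hnm 1) 0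
  simp only [Matrix.mul_apply, Fin.sum_univ_two, Matrix.of_apply, Matrix.cons_val',
    Matrix.cons_val_zero, Matrix.cons_val_one, Matrix.cons_val_fin_one] at h00 h01 h10
  have e1 : (b' : ℂ) * c = b * c' := by
    have : b' * c = b * c' := by linarith
    exact_mod_cast this
  have e2 : (a' : ℂ) * b = a * b' := by
    have : a' * b = a * b' := by linarith
    exact_mod_cast this
  have e3 : (a' : ℂ) * c = a * c' := by
    have : a' * c = a * c' := by linarith
    exact_mod_cast this
  simp only [eigForm, Matrix.of_apply, Matrix.cons_val', Matrix.cons_val_zero,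
    Matrix.cons_val_one, Matrix.cons_val_fin_one] at hv ⊢
  push_cast at hv ⊢
  have h : a ≠ 0 ∨ b ≠ 0 ∨ c ≠ 0 := by
    by_contra! hcon
    obtain ⟨rfl, rfl, rfl⟩ := hcon
    refine hn0 ?_
    ext i j
    fin_cases i <;> fin_cases j <;> simp
  rcases h with h | h | h
  · refine (mul_eq_zero.1 ?_).resolve_left (Int.cast_ne_zero.2 h : (a : ℂ) ≠ 0)
    linear_combination a' * hv - v 0 ^ 2 * e3 + v 1 ^ 2 * e2
  · refine (mul_eq_zero.1 ?_).resolve_left (Int.cast_ne_zero.2 h : (b : ℂ) ≠ 0)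
    linear_combination b' * hv - v 0 ^ 2 * e1 - 2 * v 0 * v 1 * e2
  · refine (mul_eq_zero.1 ?_).resolve_left (Int.cast_ne_zero.2 h : (c : ℂ) ≠ 0)
    linear_combination c' * hv - 2 * v 0 * v 1 * e3 - v 1 ^ 2 * e1

lemma mk_eq_mk_of_wedge_eq_zero {v w : Fin 2 → ℂ} (hv : v ≠ 0) (hw : w ≠ 0)
    (h : v 0 * w 1 - v 1 * w 0 = 0) :
    Projectivization.mk ℂ v hv = Projectivization.mk ℂ w hw := by
  rw [Projectivization.mk_eq_mk_iff']
  by_cases h0 : w 0 = 0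
  · have h1 : w 1 ≠ 0 := by
      intro h1
      refine hw ?_
      ext i
      fin_cases i
      exacts [h0, h1]
    refine ⟨v 1 / w 1, ?_⟩
    rw [h0, mul_zero, sub_zero] at h
    have h2 := (mul_eq_zero.1 h).resolve_right h1
    ext i
    fin_cases i
    · simp [h0, h2]
    · simp [h1]
  · refine ⟨v 0 / w 0, ?_⟩
    ext i
    fin_cases i
    · simp [h0]
    · simp only [Pi.smul_apply, smul_eq_mul, Fin.mk_one]
      field_simp
      linear_combination h

lemma eq_zero_of_three_eigForm {n : Matrix (Fin 2) (Fin 2) ℤ} (hn : n.trace = 0)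
    {x y z : Fin 2 → ℂ} (hx : eigForm n x = 0) (hy : eigForm n y = 0) (hz : eigForm n z = 0)
    (hxy : x 0 * y 1 - x 1 * y 0 ≠ 0) (hxz : x 0 * z 1 - x 1 * z 0 ≠ 0)
    (hyz : y 0 * z 1 - y 1 * z 0 ≠ 0) : n = 0 := by
  obtain ⟨a, b, c, rfl⟩ := exists_traceless n hn
  simp only [eigForm, Matrix.of_apply, Matrix.cons_val', Matrix.cons_val_zero,
    Matrix.cons_val_one, Matrix.cons_val_fin_one] at hx hy hz
  push_cast at hx hy hz
  have hD := mul_ne_zero (mul_ne_zero hxy hxz) hyz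
  have hc : (c : ℂ) = 0 := by
    refine (mul_eq_zero.1 ?_).resolve_right hD
    linear_combination hx * (y 1 * z 1 * (y 0 * z 1 - y 1 * z 0)) -
      hy * (x 1 * z 1 * (x 0 * z 1 - x 1 * z 0)) + hz * (x 1 * y 1 * (x 0 * y 1 - x 1 * y 0))
  have hb : (b : ℂ) = 0 := by
    refine (mul_eq_zero.1 ?_).resolve_right hD
    linear_combination -hx * (y 0 * z 0 * (y 0 * z 1 - y 1 * z 0)) +
      hy * (x 0 * z 0 * (x 0 * z 1 - x 1 * z 0)) - hz * (x 0 * y 0 * (x 0 * y 1 - x 1 * y 0))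
  have ha : (a : ℂ) = 0 := by
    refine (mul_eq_zero.1 ?_).resolve_right (mul_ne_zero two_ne_zero hD)
    linear_combination hx * (y 0 ^ 2 * z 1 ^ 2 - y 1 ^ 2 * z 0 ^ 2) -
      hy * (x 0 ^ 2 * z 1 ^ 2 - x 1 ^ 2 * z 0 ^ 2) + hz * (x 0 ^ 2 * y 1 ^ 2 - x 1 ^ 2 * y 0 ^ 2)
  rw [Int.cast_eq_zero] at ha hb hc
  ext i j
  fin_cases i <;> fin_cases j <;> simp [ha, hb, hc]

open Classical in
lemma exists_conj_not_commute {n : Matrix (Fin 2) (Fin 2) ℤ} (hn : n.trace = 0) (hn0 : n ≠ 0)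
    {V : Finset SL2Z} (hV : ∀ ℓ : Projectivization ℂ (Fin 2 → ℂ),
      2 < (V.image fun w => toSL2C w • ℓ).card) :
    ∃ w ∈ V, (w * n * (w⁻¹ : SL2Z)) * n ≠ n * (w * n * (w⁻¹ : SL2Z)) := by
  by_contra! hcon
  obtain ⟨v, hv0, hv⟩ := exists_eigForm_eq_zero hn
  have key : ∀ w ∈ V, eigForm n (toSL2C w • v) = 0 := by
    intro w hw
    have h1 := hcon w hw
    rw [eigForm_smul]
    have hwi : ((w⁻¹ : SL2Z) : Matrix (Fin 2) (Fin 2) ℤ) * w = 1 := by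
      rw [← Matrix.SpecialLinearGroup.coe_mul, inv_mul_cancel, Matrix.SpecialLinearGroup.coe_one]
    obtain ⟨I, hI⟩ : ∃ I : Matrix (Fin 2) (Fin 2) ℤ, I = (w⁻¹ : SL2Z) := ⟨_, rfl⟩
    rw [← hI] at h1 hwi ⊢
    obtain ⟨M, hM⟩ : ∃ M : Matrix (Fin 2) (Fin 2) ℤ, M = w := ⟨_, rfl⟩
    rw [← hM] at h1 hwi ⊢
    refine eigForm_eq_zero_of_commute hn ?_ hn0 ?_ hv
    · rw [Matrix.trace_mul_comm, ← mul_assoc]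
      have hwi' : M * I = 1 := mul_eq_one_comm.1 hwi
      rw [hwi', one_mul, hn]
    · have h2 := congrArg (fun X => I * X * M) h1
      simp only [← mul_assoc] at h2
      rw [hwi, one_mul] at h2
      have h3 : n * I * n * M = I * n * M * n * I * M := h2
      rw [mul_assoc _ I M, hwi, mul_one] at h3
      rw [← h3]
      simp only [mul_assoc]
  obtain ⟨a, ha, b, hb, c, hc, hab, hac, hbc⟩ :=
    Finset.two_lt_card.1 (hV (Projectivization.mk ℂ v hv0))
  obtain ⟨w₁, hw₁, rfl⟩ := Finset.mem_image.1 ha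
  obtain ⟨w₂, hw₂, rfl⟩ := Finset.mem_image.1 hb
  obtain ⟨w₃, hw₃, rfl⟩ := Finset.mem_image.1 hc
  rw [Projectivization.smul_mk, Projectivization.smul_mk] at hab hac hbc
  exact hn0 (eq_zero_of_three_eigForm hn (key _ hw₁) (key _ hw₂) (key _ hw₃)
    (fun h => hab (mk_eq_mk_of_wedge_eq_zero _ _ h))
    (fun h => hac (mk_eq_mk_of_wedge_eq_zero _ _ h))
    (fun h => hbc (mk_eq_mk_of_wedge_eq_zero _ _ h)))

open Classical in
lemma exists_nonscalar {V : Finset SL2Z} (hV : ∀ ℓ : Projectivization ℂ (Fin 2 → ℂ),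
      2 < (V.image fun w => toSL2C w • ℓ).card) :
    ∃ a ∈ V, 2 • (a : Matrix (Fin 2) (Fin 2) ℤ) -
      (a : Matrix (Fin 2) (Fin 2) ℤ).trace • (1 : Matrix (Fin 2) (Fin 2) ℤ) ≠ 0 := by
  by_contra! hcon
  have hv0 : (![1, 0] : Fin 2 → ℂ) ≠ 0 := fun h => by simpa using congrFun h 0
  have key : ∀ a ∈ V, toSL2C a • Projectivization.mk ℂ (![1, 0] : Fin 2 → ℂ) hv0 =
      Projectivization.mk ℂ (![1, 0] : Fin 2 → ℂ) hv0 := by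
    intro a ha
    rw [Projectivization.smul_mk]
    refine mk_eq_mk_of_wedge_eq_zero _ _ ?_
    have h1 : 2 * a 1 0 = 0 := by
      have h2 := congrFun (congrFun (hcon a ha) 1) 0
      rw [Matrix.sub_apply, Matrix.smul_apply, Matrix.smul_apply, Matrix.one_apply_ne (by decide),
        smul_zero, sub_zero] at h2
      simpa using h2
    have h2 : (a 1 0 : ℂ) = 0 := by
      have : a 1 0 = 0 := by omega
      exact_mod_cast this
    have h3 : (toSL2C a • (![1, 0] : Fin 2 → ℂ)) 1 = 0 := by
      change ((toSL2C a : Matrix (Fin 2) (Fin 2) ℂ) *ᵥ ![1, 0]) 1 = _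
      simp [coe_toSL2C, Matrix.mulVec, dotProduct, h2]
    rw [h3]
    simp
  obtain ⟨a, ha, b, hb, c, hc, hab, -, -⟩ :=
    Finset.two_lt_card.1 (hV (Projectivization.mk ℂ (![1, 0] : Fin 2 → ℂ) hv0))
  obtain ⟨w₁, hw₁, rfl⟩ := Finset.mem_image.1 ha
  obtain ⟨w₂, hw₂, rfl⟩ := Finset.mem_image.1 hb
  exact hab (by rw [key _ hw₁, key _ hw₂])

open Classical in
/-- Three conjugates of the axis of some element of `V` are linearly independent. -/
theorem exists_sl2Vol_ne_zero {V : Finset SL2Z} (hV : ∀ ℓ : Projectivization ℂ (Fin 2 → ℂ),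
      2 < (V.image fun w => toSL2C w • ℓ).card) :
    ∃ a ∈ V, ∃ v ∈ V, ∃ w ∈ V, ∃ b : Fin 3 → SL2Z,
      (∀ i, b i = 1 ∨ b i = v⁻¹ ∨ b i = w⁻¹ ∨ b i = v⁻¹ * w⁻¹) ∧ sl2Vol (axisOf a b) ≠ 0 := by
  obtain ⟨a, ha, ha0⟩ := exists_nonscalar hV
  obtain ⟨x, hx⟩ : ∃ x, x = 2 • (a : Matrix (Fin 2) (Fin 2) ℤ) -
      (a : Matrix (Fin 2) (Fin 2) ℤ).trace • (1 : Matrix (Fin 2) (Fin 2) ℤ) := ⟨_, rfl⟩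
  rw [← hx] at ha0
  have haxis : ∀ (b : Fin 3 → SL2Z) i, axisOf a b i =
      ((b i)⁻¹ : SL2Z) * x * (b i : Matrix (Fin 2) (Fin 2) ℤ) := by
    intro b i
    rw [hx, axisOf, mul_sub, sub_mul, mul_smul_comm, smul_mul_assoc, mul_smul_comm, smul_mul_assoc,
      mul_one, ← Matrix.SpecialLinearGroup.coe_mul, ← Matrix.SpecialLinearGroup.coe_mul,
      ← Matrix.SpecialLinearGroup.coe_mul, inv_mul_cancel, Matrix.SpecialLinearGroup.coe_one]
  have htrc : ∀ b : SL2Z, ((b⁻¹ : SL2Z) * x * (b : Matrix (Fin 2) (Fin 2) ℤ)).trace = 0 := by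
    intro b
    rw [← haxis (fun _ => b) 0]
    exact trace_axisOf a _ 0
  have hxt : x.trace = 0 := by simpa using htrc 1
  obtain ⟨v, hv, hvx⟩ := exists_conj_not_commute hxt ha0 hV
  obtain ⟨y, hy⟩ : ∃ y, y = (v * x * (v⁻¹ : SL2Z) : Matrix (Fin 2) (Fin 2) ℤ) := ⟨_, rfl⟩
  obtain ⟨n, hn⟩ : ∃ n, n = x * y - y * x := ⟨_, rfl⟩
  have hyt : y.trace = 0 := by
    rw [hy]
    simpa using htrc v⁻¹
  have hn0 : n ≠ 0 := by
    rw [hn, sub_ne_zero, hy]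
    exact hvx.symm
  have hnt : n.trace = 0 := by rw [hn, Matrix.trace_sub, Matrix.trace_mul_comm, sub_self]
  obtain ⟨w, hw, hwn⟩ := exists_conj_not_commute hnt hn0 hV
  obtain ⟨x', hx'⟩ : ∃ x', x' = (w * x * (w⁻¹ : SL2Z) : Matrix (Fin 2) (Fin 2) ℤ) := ⟨_, rfl⟩
  obtain ⟨y', hy'⟩ : ∃ y', y' = (w * y * (w⁻¹ : SL2Z) : Matrix (Fin 2) (Fin 2) ℤ) := ⟨_, rfl⟩
  have hxt' : x'.trace = 0 := by
    rw [hx']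
    simpa using htrc w⁻¹
  have hwi : ((w⁻¹ : SL2Z) : Matrix (Fin 2) (Fin 2) ℤ) * w = 1 := by
    rw [← Matrix.SpecialLinearGroup.coe_mul, inv_mul_cancel, Matrix.SpecialLinearGroup.coe_one]
  have hyt' : y'.trace = 0 := by
    rw [hy', Matrix.trace_mul_comm, ← mul_assoc, hwi, one_mul, hyt]
  have hcomm : (w * n * (w⁻¹ : SL2Z) : Matrix (Fin 2) (Fin 2) ℤ) = x' * y' - y' * x' := by
    have h1 : ∀ p r : Matrix (Fin 2) (Fin 2) ℤ, (w * p * (w⁻¹ : SL2Z)) * (w * r * (w⁻¹ : SL2Z)) =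
        w * (p * r) * ((w⁻¹ : SL2Z) : Matrix (Fin 2) (Fin 2) ℤ) := by
      intro p r
      calc _ = w * p * (((w⁻¹ : SL2Z) : Matrix (Fin 2) (Fin 2) ℤ) * w) * r *
            ((w⁻¹ : SL2Z) : Matrix (Fin 2) (Fin 2) ℤ) := by simp only [mul_assoc]
        _ = _ := by rw [hwi, mul_one]; simp only [mul_assoc]
    rw [hx', hy', h1, h1, hn, mul_sub, sub_mul]
  have hz : (n * x').trace ≠ 0 ∨ (n * y').trace ≠ 0 := by
    by_contra! hcon
    have h1 := comm_comm_traceless hnt hxt' hyt'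
    rw [hcon.1, hcon.2, ← hcomm] at h1
    simp only [mul_zero, zero_smul, sub_zero] at h1
    exact hwn (sub_eq_zero.1 h1).symm
  have hvol : ∀ b₂ : SL2Z, (n * ((b₂⁻¹ : SL2Z) * x * (b₂ : Matrix (Fin 2) (Fin 2) ℤ))).trace ≠ 0 →
      sl2Vol (axisOf a ![1, v⁻¹, b₂]) ≠ 0 := by
    intro b₂ hb₂
    have e0 : axisOf a ![1, v⁻¹, b₂] 0 = x := by
      rw [haxis]
      change ((1⁻¹ : SL2Z) : Matrix (Fin 2) (Fin 2) ℤ) * x * ((1 : SL2Z) : Matrix _ _ ℤ) = x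
      rw [inv_one, Matrix.SpecialLinearGroup.coe_one, one_mul, mul_one]
    have e1 : axisOf a ![1, v⁻¹, b₂] 1 = y := by
      rw [haxis, hy]
      change ((v⁻¹⁻¹ : SL2Z) : Matrix (Fin 2) (Fin 2) ℤ) * x * ((v⁻¹ : SL2Z) : Matrix _ _ ℤ) = _
      rw [inv_inv]
    have e2 : axisOf a ![1, v⁻¹, b₂] 2 = (b₂⁻¹ : SL2Z) * x * (b₂ : Matrix (Fin 2) (Fin 2) ℤ) :=
      haxis _ 2
    rw [sl2Vol, e0, e1, e2]
    obtain ⟨z, hz⟩ : ∃ z, z = ((b₂⁻¹ : SL2Z) * x * (b₂ : Matrix (Fin 2) (Fin 2) ℤ)) := ⟨_, rfl⟩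
    rw [← hz] at hb₂ ⊢
    have h1 : (x * (y * z - z * y)).trace = (n * z).trace := by
      rw [hn, sub_mul, mul_sub, Matrix.trace_sub, Matrix.trace_sub, ← mul_assoc, ← mul_assoc,
        Matrix.trace_mul_cycle y x z, Matrix.trace_mul_cycle z y x]
    rwa [h1]
  rcases hz with hz | hz
  · refine ⟨a, ha, v, hv, w, hw, ![1, v⁻¹, w⁻¹], ?_, hvol w⁻¹ (by rw [inv_inv, ← hx']; exact hz)⟩
    intro i
    fin_cases i <;> simp
  · refine ⟨a, ha, v, hv, w, hw, ![1, v⁻¹, v⁻¹ * w⁻¹], ?_, hvol (v⁻¹ * w⁻¹) ?_⟩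
    · intro i
      fin_cases i <;> simp
    · rw [_root_.mul_inv_rev, inv_inv, inv_inv, Matrix.SpecialLinearGroup.coe_mul,
        Matrix.SpecialLinearGroup.coe_mul]
      have h1 : (w * v * x * ((v⁻¹ : SL2Z) * (w⁻¹ : SL2Z)) : Matrix (Fin 2) (Fin 2) ℤ) = y' := by
        rw [hy', hy]
        simp only [mul_assoc]
      rw [h1]
      exact hz

lemma abs_matMul_entry_le {x y : Matrix (Fin 2) (Fin 2) ℤ} {α β : ℝ} (hα : 0 ≤ α)
    (hx : ∀ i j, |(x i j : ℝ)| ≤ α) (hy : ∀ i j, |(y i j : ℝ)| ≤ β) (i j : Fin 2) :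
    |((x * y) i j : ℝ)| ≤ 2 * (α * β) := by
  rw [Matrix.mul_apply, Fin.sum_univ_two]
  push_cast
  have h : ∀ k, |(x i k : ℝ) * y k j| ≤ α * β := fun k => by
    rw [abs_mul]; exact mul_le_mul (hx i k) (hy k j) (abs_nonneg _) hα
  have := abs_add_le ((x i 0 : ℝ) * y 0 j) (x i 1 * y 1 j)
  linarith [h 0, h 1]

lemma abs_trace_le {x : Matrix (Fin 2) (Fin 2) ℤ} {α : ℝ} (hx : ∀ i j, |(x i j : ℝ)| ≤ α) :
    |(x.trace : ℝ)| ≤ 2 * α := by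
  rw [Matrix.trace_fin_two]
  push_cast
  have := abs_add_le (x 0 0 : ℝ) (x 1 1)
  linarith [hx 0 0, hx 1 1]

lemma abs_axisOf_le {a : SL2Z} {b : Fin 3 → SL2Z} {E : ℝ} (hE : 1 ≤ E)
    (ha : ∀ i j, |(a i j : ℝ)| ≤ E) (hb : ∀ k i j, |(b k i j : ℝ)| ≤ 2 * E ^ 2) (k : Fin 3)
    (i j : Fin 2) : |(axisOf a b k i j : ℝ)| ≤ 34 * E ^ 5 := by
  have h0 : (0 : ℝ) ≤ E := by linarith
  have h1 := fun i j => abs_entry_mul_le (abs_entry_inv_le (hb k)) ha i j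
  have h2 := abs_entry_mul_le h1 (hb k) i j
  have h3 := abs_trace_le ha
  have h4 : E ≤ E ^ 5 := le_self_pow₀ hE (by norm_num)
  have h5 : |((1 : Matrix (Fin 2) (Fin 2) ℤ) i j : ℝ)| ≤ 1 := by
    rw [Matrix.one_apply]; split_ifs <;> simp
  have h6 : (axisOf a b k i j : ℝ) = 2 * (((b k)⁻¹ * a * b k) i j : ℝ) -
      ((a : Matrix (Fin 2) (Fin 2) ℤ).trace : ℝ) * ((1 : Matrix (Fin 2) (Fin 2) ℤ) i j : ℝ) := by
    rw [axisOf, Matrix.sub_apply, Matrix.smul_apply, Matrix.smul_apply]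
    push_cast [smul_eq_mul, nsmul_eq_mul]
    rfl
  have h7 : |((a : Matrix (Fin 2) (Fin 2) ℤ).trace : ℝ) *
      ((1 : Matrix (Fin 2) (Fin 2) ℤ) i j : ℝ)| ≤ 2 * E * 1 := by
    rw [abs_mul]; exact mul_le_mul h3 h5 (abs_nonneg _) (by linarith)
  rw [h6]
  refine (abs_sub _ _).trans ?_
  rw [abs_mul, abs_two]
  calc _ ≤ 2 * (2 * (2 * (2 * E ^ 2 * E) * (2 * E ^ 2))) + 2 * E * 1 := by linarith
    _ = 32 * E ^ 5 + 2 * E := by ring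
    _ ≤ _ := by linarith

lemma abs_sl2Vol_le {u : Fin 3 → Matrix (Fin 2) (Fin 2) ℤ} {U : ℝ} (hU : 0 ≤ U)
    (hu : ∀ k i j, |(u k i j : ℝ)| ≤ U) : |(sl2Vol u : ℝ)| ≤ 16 * U ^ 3 := by
  have h1 : ∀ i j, |((u 1 * u 2 - u 2 * u 1) i j : ℝ)| ≤ 4 * U ^ 2 := by
    intro i j
    rw [Matrix.sub_apply]
    push_cast
    refine (abs_sub _ _).trans ?_
    have h2 := abs_matMul_entry_le hU (hu 1) (hu 2) i j
    have h3 := abs_matMul_entry_le hU (hu 2) (hu 1) i j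
    linarith
  have h2 := abs_trace_le (abs_matMul_entry_le hU (hu 0) h1)
  rw [sl2Vol]
  refine h2.trans (le_of_eq ?_)
  ring

lemma abs_dScalar_conj_le {a w : SL2Z} {b : Fin 3 → SL2Z} {E F : ℝ} (hE : 1 ≤ E) (hF : 0 ≤ F)
    (ha : ∀ i j, |(a i j : ℝ)| ≤ E) (hb : ∀ k i j, |(b k i j : ℝ)| ≤ 2 * E ^ 2)
    (hw : ∀ i j, |(w i j : ℝ)| ≤ F) (k : Fin 3) :
    |(dScalar a (b k * w * (b k)⁻¹) : ℝ)| ≤ 544 * E ^ 6 * F ^ 2 := by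
  have h0 : (0 : ℝ) ≤ E := by linarith
  have h1 := abs_trace_le ha
  have h2 := abs_trace_le hw
  have h3 := abs_trace_le (abs_matMul_entry_le (by positivity) (abs_axisOf_le hE ha hb k) hw)
  rw [dScalar_conj]
  push_cast
  rw [abs_mul, abs_mul]
  calc _ ≤ (2 * E) * ((2 * F) * (2 * (2 * (34 * E ^ 5 * F)))) := by gcongr
    _ = _ := by ring

lemma abs_moveFactor_le {a : SL2Z} {b : Fin 3 → SL2Z} {E : ℝ} (hE : 1 ≤ E) (m₀ : ℤ)
    (ha : ∀ i j, |(a i j : ℝ)| ≤ E) (hb : ∀ k i j, |(b k i j : ℝ)| ≤ 2 * E ^ 2) :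
    |(moveFactor a b m₀ : ℝ)| ≤ (m₀ : ℝ) ^ 2 * (2048 * 34 ^ 6 * E ^ 32) := by
  have h0 : (0 : ℝ) ≤ E := by linarith
  have h1 := abs_trace_le ha
  have h2 := abs_sl2Vol_le (by positivity) (abs_axisOf_le hE ha hb)
  rw [moveFactor]
  push_cast
  rw [abs_mul, abs_mul, abs_mul, abs_two, abs_pow, abs_pow, abs_pow, sq_abs]
  calc _ ≤ (m₀ : ℝ) ^ 2 * (2 * (2 * E) ^ 2 * (16 * (34 * E ^ 5) ^ 3) ^ 2) := by gcongr
    _ = _ := by ring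

lemma mem_mul_self_of_conj {T : Set SL2Z} (hT : T⁻¹ = T) (h1 : (1 : SL2Z) ∈ T) {v w b : SL2Z}
    (hv : v ∈ T) (hw : w ∈ T) (hb : b = 1 ∨ b = v⁻¹ ∨ b = w⁻¹ ∨ b = v⁻¹ * w⁻¹) : b ∈ T * T := by
  have hi : ∀ {x}, x ∈ T → x⁻¹ ∈ T := fun {x} hx => by rw [← hT]; exact Set.inv_mem_inv.2 hx
  rcases hb with rfl | rfl | rfl | rfl
  · exact ⟨1, h1, 1, h1, mul_one _⟩
  · exact ⟨_, hi hv, 1, h1, mul_one _⟩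
  · exact ⟨_, hi hw, 1, h1, mul_one _⟩
  · exact ⟨_, hi hv, _, hi hw, rfl⟩

lemma abs_entry_conj_le {v w b : SL2Z} {E : ℝ} (hE : 1 ≤ E) (hv : ∀ i j, |(v i j : ℝ)| ≤ E)
    (hw : ∀ i j, |(w i j : ℝ)| ≤ E) (hb : b = 1 ∨ b = v⁻¹ ∨ b = w⁻¹ ∨ b = v⁻¹ * w⁻¹) (i j : Fin 2) :
    |(b i j : ℝ)| ≤ 2 * E ^ 2 := by
  have hE2 : E ≤ E ^ 2 := le_self_pow₀ hE (by norm_num)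
  rcases hb with rfl | rfl | rfl | rfl
  · have : |((1 : SL2Z) i j : ℝ)| ≤ 1 := by
      rw [Matrix.SpecialLinearGroup.coe_one, Matrix.one_apply]; split_ifs <;> simp
    linarith
  · linarith [abs_entry_inv_le hv i j]
  · linarith [abs_entry_inv_le hw i j]
  · have := abs_entry_mul_le (abs_entry_inv_le hv) (abs_entry_inv_le hw) i j
    linarith

/-- `T` has a finite subset with entries at most `exp (C₀ * n)` whose orbits on the projective line
all have at least `exp (κ * n)` points. -/
def Expands (T : Set SL2Z) (C₀ κ : ℝ) (n : ℕ) : Prop :=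
  ∃ V : Finset SL2Z, ↑V ⊆ T ∧ (∀ w ∈ V, ∀ i j, |(w i j : ℝ)| ≤ Real.exp (C₀ * n)) ∧
    ∀ (ℓ : Projectivization ℂ (Fin 2 → ℂ)) [DecidableEq (Projectivization ℂ (Fin 2 → ℂ))],
      Real.exp (κ * n) ≤ (V.image fun w => toSL2C w • ℓ).card

lemma exp_le_card {V : Finset SL2Z} {x : ℝ}
    (hV : ∀ (ℓ : Projectivization ℂ (Fin 2 → ℂ)) [DecidableEq (Projectivization ℂ (Fin 2 → ℂ))],
      x ≤ (V.image fun w => toSL2C w • ℓ).card) : x ≤ V.card := by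
  classical
  have h : (![1, 0] : Fin 2 → ℂ) ≠ 0 := fun h => by simpa using congrFun h 0
  exact (hV (Projectivization.mk ℂ _ h)).trans (by exact_mod_cast Finset.card_image_le)

lemma Expands.exists_basis {T : Set SL2Z} (hT : T⁻¹ = T) (h1 : (1 : SL2Z) ∈ T) {N : ℤ} (hN : 2 ≤ N)
    (hTN : ∀ w ∈ T, ∀ i j, N ∣ w i j - (1 : Matrix (Fin 2) (Fin 2) ℤ) i j) {C₀ κ : ℝ} {n : ℕ}
    (hC₀ : 0 ≤ C₀) (hκn : 2 ≤ κ * n) (h : Expands T C₀ κ n) :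
    ∃ a ∈ T, ∃ b : Fin 3 → SL2Z, (∀ i, b i ∈ T * T) ∧ (a : Matrix (Fin 2) (Fin 2) ℤ).trace ≠ 0 ∧
      sl2Vol (axisOf a b) ≠ 0 ∧ (∀ i j, |(a i j : ℝ)| ≤ Real.exp (C₀ * n)) ∧
      ∀ k i j, |(b k i j : ℝ)| ≤ 2 * Real.exp (C₀ * n) ^ 2 := by
  obtain ⟨V, hVT, hVe, hV⟩ := h
  have h2 : ∀ ℓ : Projectivization ℂ (Fin 2 → ℂ),
      open Classical in 2 < (V.image fun w => toSL2C w • ℓ).card := by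
    intro ℓ
    classical
    have h3 := hV ℓ
    have h4 := Real.add_one_le_exp (κ * n)
    have h5 : (2 : ℝ) < (V.image fun w => toSL2C w • ℓ).card := by linarith
    exact_mod_cast h5
  obtain ⟨a, ha, v, hv, w, hw, b, hb, hd⟩ := exists_sl2Vol_ne_zero h2
  have hE : 1 ≤ Real.exp (C₀ * n) := Real.one_le_exp (by positivity)
  exact ⟨a, hVT ha, b, fun i => mem_mul_self_of_conj hT h1 (hVT hv) (hVT hw) (hb i),
    trace_ne_zero_of_dvd hN (hTN a (hVT ha)), hd, hVe a ha,
    fun k => abs_entry_conj_le hE (hVe v hv) (hVe w hw) (hb k)⟩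

lemma RichAt.of_expands {T : Set SL2Z} {N : ℤ} (hN : 2 ≤ N)
    (hTN : ∀ w ∈ T, ∀ i j, N ∣ w i j - (1 : Matrix (Fin 2) (Fin 2) ℤ) i j) {C₀ κ : ℝ} {n₀ n : ℕ}
    (hC₀ : 1 ≤ C₀) {a : SL2Z} {b : Fin 3 → SL2Z} (ht : (a : Matrix (Fin 2) (Fin 2) ℤ).trace ≠ 0)
    (hd : sl2Vol (axisOf a b) ≠ 0) (ha : ∀ i j, |(a i j : ℝ)| ≤ Real.exp (C₀ * n₀))
    (hb : ∀ k i j, |(b k i j : ℝ)| ≤ 2 * Real.exp (C₀ * n₀) ^ 2) (hn₀ : n₀ ≤ n) (hn : 1 ≤ n)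
    (hκn : 2 ≤ κ * n) (h : Expands T C₀ κ n) {t : ℝ} (ht1 : t ≤ 15 * C₀ * n)
    (ht2 : 15 * C₀ * n ≤ 2 * t) : RichAt (scalarSet T a b) (κ / (90 * C₀)) 2 0 t := by
  classical
  obtain ⟨V, hVT, hVe, hV⟩ := h
  have hn1 : (1 : ℝ) ≤ n := by exact_mod_cast hn
  have hn₀' : (n₀ : ℝ) ≤ n := by exact_mod_cast hn₀
  obtain ⟨i, hi⟩ := exists_card_image_dScalar ht hd V
    fun w hw => trace_ne_zero_of_dvd hN (hTN w (hVT hw))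
  refine ⟨15 * C₀ * n, ht1, ht2, V.image fun w => dScalar a (b i * w * (b i)⁻¹), ?_, ?_, ?_⟩
  · intro z hz
    obtain ⟨w, hw, rfl⟩ := Finset.mem_image.1 hz
    exact Or.inl ⟨i, w, hVT hw, rfl⟩
  · intro z hz
    obtain ⟨w, hw, rfl⟩ := Finset.mem_image.1 hz
    refine (abs_dScalar_conj_le (Real.one_le_exp (by positivity)) (Real.exp_pos _).le ha hb
      (hVe w hw) i).trans ?_
    have h7 : (544 : ℝ) ≤ Real.exp 7 := by
      have h8 := Real.exp_one_gt_d9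
      rw [show (7 : ℝ) = (7 : ℕ) * 1 by norm_num, Real.exp_nat_mul]
      calc (544 : ℝ) ≤ 2.7 ^ 7 := by norm_num
        _ ≤ _ := by gcongr; linarith
    have hC0n : C₀ * n₀ ≤ C₀ * n := by gcongr
    have hCn : 1 ≤ C₀ * n := one_le_mul_of_one_le_of_one_le hC₀ hn1
    rw [← Real.exp_nat_mul, ← Real.exp_nat_mul]
    calc 544 * Real.exp ((6 : ℕ) * (C₀ * n₀)) * Real.exp ((2 : ℕ) * (C₀ * n))
        ≤ Real.exp 7 * Real.exp ((6 : ℕ) * (C₀ * n₀)) * Real.exp ((2 : ℕ) * (C₀ * n)) := by gcongr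
      _ = Real.exp (7 + 6 * (C₀ * n₀) + 2 * (C₀ * n)) := by
        rw [← Real.exp_add, ← Real.exp_add]; push_cast; rfl
      _ ≤ _ := Real.exp_le_exp.2 (by linarith)
  · have h3 := exp_le_card hV
    obtain ⟨m, hm⟩ : ∃ m, m = (V.image fun w => dScalar a (b i * w * (b i)⁻¹)).card := ⟨_, rfl⟩
    rw [← hm] at hi ⊢
    have h4 : Real.exp (κ * n) ≤ 2 * (m : ℝ) ^ 3 := h3.trans (by exact_mod_cast hi)
    have h5 : κ / (90 * C₀) * (15 * C₀ * n) = κ * n / 6 := by field_simp; ring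
    rw [h5]
    have h6 : (2 : ℝ) ≤ Real.exp (κ * n / 2) := by
      have := Real.add_one_le_exp (κ * n / 2); linarith
    have h7 : Real.exp (κ * n) = Real.exp (κ * n / 2) * Real.exp (κ * n / 6) ^ 3 := by
      rw [← Real.exp_nat_mul, ← Real.exp_add]; congr 1; push_cast; ring
    by_contra hcon
    push Not at hcon
    have h8 : (m : ℝ) ^ 3 < Real.exp (κ * n / 6) ^ 3 := by gcongr
    have h9 : 2 * Real.exp (κ * n / 6) ^ 3 ≤ Real.exp (κ * n / 2) * Real.exp (κ * n / 6) ^ 3 := by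
      gcongr
    linarith

/-- Two elements of a large set agree modulo a small number. -/
lemma Expands.exists_deep {T : Set SL2Z} (hT : T⁻¹ = T) {C₀ κ : ℝ} {n : ℕ} (hC₀ : 0 ≤ C₀)
    (h : Expands T C₀ κ n) {R : ℕ} (hR : 0 < R) (hRn : (R : ℝ) ^ 4 < Real.exp (κ * n)) :
    ∃ g ∈ T ^ 2, g ≠ 1 ∧ R ∣ depth g ∧ (depth g : ℝ) ≤ 3 * Real.exp (C₀ * n) ^ 2 := by
  classical
  obtain ⟨V, hVT, hVe, hV⟩ := h
  have h3 := exp_le_card hV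
  have : NeZero R := ⟨hR.ne'⟩
  have : Finite (Matrix.SpecialLinearGroup (Fin 2) (ZMod R)) := inferInstance
  have := Fintype.ofFinite (Matrix.SpecialLinearGroup (Fin 2) (ZMod R))
  have h4 : (Finset.univ : Finset (Matrix.SpecialLinearGroup (Fin 2) (ZMod R))).card < V.card := by
    rw [Finset.card_univ, ← Nat.card_eq_fintype_card]
    have := card_SL_zmod_le R
    have h5 : ((R ^ 4 : ℕ) : ℝ) < V.card := by push_cast; linarith
    have h6 : R ^ 4 < V.card := by exact_mod_cast h5
    omega
  obtain ⟨v, hv, w, hw, hvw, he⟩ := Finset.exists_ne_map_eq_of_card_lt_of_maps_to h4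
    (f := redSL R) fun _ _ => Finset.mem_univ _
  have hg1 : v⁻¹ * w ≠ 1 := fun h => hvw (inv_mul_eq_one.1 h)
  have hE : 1 ≤ Real.exp (C₀ * n) := Real.one_le_exp (by positivity)
  have hle := abs_entry_mul_le (abs_entry_inv_le (hVe v hv)) (hVe w hw)
  refine ⟨v⁻¹ * w, ?_, hg1, ?_, ?_⟩
  · rw [sq]
    exact ⟨v⁻¹, by rw [← hT]; exact Set.inv_mem_inv.2 (hVT hv), w, hVT hw, rfl⟩
  · rw [dvd_depth_iff]
    intro i j
    have h7 : redSL R (v⁻¹ * w) = 1 := by rw [map_mul, map_inv, he, inv_mul_cancel]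
    have h8 : (redSL R (v⁻¹ * w)) i j = (1 : Matrix (Fin 2) (Fin 2) (ZMod R)) i j := by
      rw [h7]; rfl
    rw [redSL_apply] at h8
    rw [← ZMod.intCast_zmod_eq_zero_iff_dvd, Int.cast_sub, h8, Matrix.one_apply, Matrix.one_apply]
    split_ifs <;> simp
  · obtain ⟨i, j, hij⟩ : ∃ i j, (v⁻¹ * w) i j - (1 : Matrix (Fin 2) (Fin 2) ℤ) i j ≠ 0 := by
      by_contra hcon
      push Not at hcon
      apply hg1
      ext i j
      exact sub_eq_zero.1 (hcon i j)
    have h9 : (depth (v⁻¹ * w) : ℤ) ∣ (v⁻¹ * w) i j - (1 : Matrix (Fin 2) (Fin 2) ℤ) i j :=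
      dvd_depth_iff.1 dvd_rfl i j
    have h10 : (depth (v⁻¹ * w) : ℤ) ≤ |(v⁻¹ * w) i j - (1 : Matrix (Fin 2) (Fin 2) ℤ) i j| :=
      Int.le_of_dvd (abs_pos.2 hij) ((dvd_abs _ _).2 h9)
    have h11 : (depth (v⁻¹ * w) : ℝ) ≤
        |((v⁻¹ * w) i j : ℝ) - ((1 : Matrix (Fin 2) (Fin 2) ℤ) i j : ℝ)| := by exact_mod_cast h10
    have h12 : |((1 : Matrix (Fin 2) (Fin 2) ℤ) i j : ℝ)| ≤ 1 := by
      rw [Matrix.one_apply]; split_ifs <;> simp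
    have h13 := abs_sub (((v⁻¹ * w) i j : ℤ) : ℝ) ((1 : Matrix (Fin 2) (Fin 2) ℤ) i j : ℝ)
    have h14 := hle i j
    nlinarith only [h11, h12, h13, h14, hE]

lemma exists_residues {𝒲 : Set ℤ} (h0 : (0 : ℤ) ∈ 𝒲) {k : ℕ} {τ x : ℝ}
    (hτ : τ ≤ 1 / 16) (hx : 28 ≤ x) {W : Finset ℤ} (hW : ∀ w ∈ W, w ∈ ringGen 𝒲 k)
    (hWx : ∀ w ∈ W, |(w : ℝ)| ≤ Real.exp x) (hWc : Real.exp ((1 - τ) * x) ≤ W.card) :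
    ∃ m₀ : ℕ, 1 ≤ m₀ ∧ (m₀ : ℝ) ≤ 625 * Real.exp (4 * τ * x) ∧
      ∀ R : ℕ, 1 ≤ R → (R : ℝ) ≤ Real.exp (x / 2) → ∀ z : ℤ,
        ∃ β ∈ ringGen 𝒲 (k + 18), (R : ℤ) ∣ (m₀ : ℤ) ^ 2 * z - β := by
  have hpos : (0 : ℝ) < W.card := (Real.exp_pos _).trans_le hWc
  have hne : W.Nonempty := Finset.card_pos.1 (by exact_mod_cast hpos)
  obtain ⟨Y, hY⟩ : ∃ Y, Y = ⌊Real.exp x⌋₊ := ⟨_, rfl⟩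
  have hYx : (Y : ℝ) ≤ Real.exp x := hY ▸ Nat.floor_le (Real.exp_pos _).le
  have hYx' : Real.exp x < Y + 1 := hY ▸ Nat.lt_floor_add_one _
  have hY1 : 1 ≤ Y := by
    rw [hY]; exact Nat.le_floor (by simpa using Real.one_le_exp (by linarith))
  have hbY : ∀ b ∈ W, |b| ≤ (Y : ℤ) := by
    intro b hb
    rw [hY, Int.natCast_floor_eq_floor (Real.exp_pos _).le, Int.le_floor]
    push_cast
    exact hWx b hb
  obtain ⟨m₀, hm1, hmY, hmc, b₀, hb₀, H⟩ := exists_dense_residues hne hY1 hbY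
  have hm : (m₀ : ℝ) ≤ 625 * Real.exp (4 * τ * x) := by
    have h1 : (m₀ : ℝ) * (W.card : ℝ) ^ 4 ≤ (5 * Y) ^ 4 := by exact_mod_cast hmc
    have h2 : (m₀ : ℝ) * Real.exp ((1 - τ) * x) ^ 4 ≤ (5 * Real.exp x) ^ 4 := by
      refine le_trans ?_ (h1.trans ?_)
      · gcongr
      · gcongr
    rw [mul_pow, ← Real.exp_nat_mul, ← Real.exp_nat_mul] at h2
    have h3 : Real.exp ((4 : ℕ) * x) =
        Real.exp (4 * τ * x) * Real.exp ((4 : ℕ) * ((1 - τ) * x)) := by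
      rw [← Real.exp_add]; congr 1; push_cast; ring
    rw [h3] at h2
    refine le_of_mul_le_mul_right (a := Real.exp ((4 : ℕ) * ((1 - τ) * x))) ?_ (Real.exp_pos _)
    linarith
  refine ⟨m₀, hm1, hm, fun R hR hRx z => ?_⟩
  have hmR : m₀ * R ≤ Y := by
    have h7 : (1000 : ℝ) ≤ Real.exp (x / 4) := by
      have h8 := Real.exp_one_gt_d9
      calc (1000 : ℝ) ≤ 2.7 ^ 7 := by norm_num
        _ ≤ Real.exp 1 ^ 7 := by gcongr; linarith
        _ = Real.exp ((7 : ℕ) * 1) := (Real.exp_nat_mul _ _).symm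
        _ ≤ _ := Real.exp_le_exp.2 (by push_cast; linarith)
    have h1 : (m₀ : ℝ) ≤ 625 * Real.exp (x / 4) := by
      refine hm.trans ?_
      gcongr
      nlinarith only [hτ, hx]
    have h2 : (m₀ : ℝ) * R ≤ 625 * Real.exp (x / 4) * Real.exp (x / 2) := by gcongr
    have h3 : Real.exp x = Real.exp (x / 4) * (Real.exp (x / 4) * Real.exp (x / 2)) := by
      rw [← Real.exp_add, ← Real.exp_add]; congr 1; ring
    have h4 : (1 : ℝ) ≤ Real.exp (x / 4) * Real.exp (x / 2) :=
      one_le_mul_of_one_le_of_one_le (by linarith) (Real.one_le_exp (by linarith))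
    have h5 : (m₀ : ℝ) * R < Y := by nlinarith only [h2, h3, h4, h7, hYx']
    have h6 : m₀ * R < Y := by exact_mod_cast h5
    exact h6.le
  obtain ⟨u, v, hu, hv, hd⟩ := H R hR hmR z
  refine ⟨_, ?_, hd⟩
  have h := ringGen.sum_mem (k := k + 2) h0 Finset.univ (fun i => (u i - b₀) * (v i - b₀))
    fun i _ => ringGen.mul_mem (ringGen.sub_mem (hW _ (hu i)) (hW _ hb₀))
      (ringGen.sub_mem (hW _ (hv i)) (hW _ hb₀))
  rwa [Finset.card_univ, Fintype.card_fin] at h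

lemma prod_pow_le_exp {P : Finset ℕ} (hP : ∀ p ∈ P, p.Prime) {N : ℕ} (hN : N ≠ 0) {n : ℕ → ℕ}
    {α : ℝ} (hα : 0 ≤ α) (h : ∀ p ∈ P, (n p : ℝ) ≤ α * N.factorization p) :
    ((∏ p ∈ P, p ^ n p : ℕ) : ℝ) ≤ Real.exp (α * Real.log N) := by
  have h1 : ((∏ p ∈ P, p ^ N.factorization p : ℕ) : ℝ) ≤ N := by
    exact_mod_cast Nat.le_of_dvd (Nat.pos_of_ne_zero hN)
      (prod_pow_dvd_of_forall hP fun p _ => Nat.ordProj_dvd N p)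
  have h2 : ∀ p ∈ P, (0 : ℝ) < p := fun p hp => by exact_mod_cast (hP p hp).pos
  have hpos : ∀ e : ℕ → ℕ, (0 : ℝ) < ((∏ p ∈ P, p ^ e p : ℕ) : ℝ) := fun e => by
    push_cast; exact Finset.prod_pos fun p hp => pow_pos (h2 p hp) _
  have hlog : ∀ e : ℕ → ℕ, Real.log ((∏ p ∈ P, p ^ e p : ℕ) : ℝ) =
      ∑ p ∈ P, (e p : ℝ) * Real.log p := fun e => by
    push_cast
    rw [Real.log_prod fun p hp => (pow_pos (h2 p hp) _).ne']
    simp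
  rw [← Real.log_le_iff_le_exp (hpos n), hlog]
  have h3 := Real.log_le_log (hpos _) h1
  rw [hlog] at h3
  calc ∑ p ∈ P, (n p : ℝ) * Real.log p
      ≤ ∑ p ∈ P, α * ((N.factorization p : ℝ) * Real.log p) := by
        refine Finset.sum_le_sum fun p hp => ?_
        rw [← mul_assoc]
        exact mul_le_mul_of_nonneg_right (h p hp) (Real.log_natCast_nonneg p)
    _ = α * ∑ p ∈ P, (N.factorization p : ℝ) * Real.log p := by rw [Finset.mul_sum]
    _ ≤ _ := by gcongr

/-- Away from few primes, a bounded power of `T` covers a congruence kernel. -/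
lemma exists_cover_of_residues (k j : ℕ) : ∃ K', ∀ T : Set SL2Z, T⁻¹ = T → (1 : SL2Z) ∈ T →
    ∀ a ∈ T, ∀ b : Fin 3 → SL2Z, (∀ i, b i ∈ T * T) → ∀ s : ℕ, s ≠ 0 →
    ∀ υ ρ : ℝ, 0 < υ → 0 < ρ → ρ ≤ 1 → υ ≤ 2 * ρ → 8 ≤ j * υ →
    (∀ p ∈ s.primeFactors, 20 ≤ υ * s.factorization p) → ∀ m₀ : ℤ, moveFactor a b m₀ ≠ 0 →
    ∀ R : ℕ, R = ∏ p ∈ s.primeFactors, p ^ ⌊υ * s.factorization p / 2⌋₊ →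
    (∀ z, ∃ β ∈ ringGen (scalarSet T a b) k, (R : ℤ) ∣ m₀ ^ 2 * z - β) →
    ∀ g ∈ T ^ 2, g ≠ 1 → R ∣ depth g →
    ∃ B ⊆ s.primeFactors, ((∏ p ∈ B, p ^ s.factorization p : ℕ) : ℝ) ≤
      Real.exp (16 / υ * Real.log (moveFactor a b m₀).natAbs + 2 / ρ * Real.log (depth g)) ∧
      ∀ G ⊆ s.primeFactors \ B, kerFloorPow (∏ p ∈ G, p ^ s.factorization p) ρ ⊆
        (redSL (∏ p ∈ G, p ^ s.factorization p) '' T) ^ K' := by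
  classical
  obtain ⟨K', hK'⟩ := exists_kernel_cover k 2 j
  refine ⟨K', fun T hT h1 a ha b hb s hs υ ρ hυ hρ hρ1 hυρ hj hsυ m₀ hm R hR hβ g hg hg1 hRg => ?_⟩
  obtain ⟨P, hP⟩ : ∃ P, P = s.primeFactors := ⟨_, rfl⟩
  obtain ⟨n, hn⟩ : ∃ n : ℕ → ℕ, n = fun p => s.factorization p := ⟨_, rfl⟩
  obtain ⟨r, hr⟩ : ∃ r : ℕ → ℕ, r = fun p => ⌊υ * n p / 2⌋₊ := ⟨_, rfl⟩
  obtain ⟨v, hv⟩ : ∃ v : ℕ → ℕ, v = fun p => (moveFactor a b m₀).natAbs.factorization p := ⟨_, rfl⟩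
  obtain ⟨e, he⟩ : ∃ e : ℕ → ℕ, e = fun p => (depth g).factorization p := ⟨_, rfl⟩
  have hPp : ∀ p ∈ P, p.Prime := fun p hp => Nat.prime_of_mem_primeFactors (hP ▸ hp)
  have hsυ' : ∀ p ∈ P, 20 ≤ υ * n p := fun p hp => by rw [hn]; exact hsυ p (hP ▸ hp)
  have hr1 : ∀ p, (r p : ℝ) ≤ υ * n p / 2 := fun p => by
    rw [hr]; exact Nat.floor_le (by positivity)
  have hr2 : ∀ p, υ * n p / 2 < r p + 1 := fun p => by
    rw [hr]; exact Nat.lt_floor_add_one _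
  have hRr : R = ∏ p ∈ P, p ^ r p := by rw [hR, hP, hr, hn]
  obtain ⟨B₁, hB₁⟩ : ∃ B₁, B₁ = P.filter fun p => r p < 4 * (v p + 1) := ⟨_, rfl⟩
  obtain ⟨B₂, hB₂⟩ : ∃ B₂, B₂ = (P \ B₁).filter fun p => ⌊(n p : ℝ) * ρ⌋₊ < v p + e p := ⟨_, rfl⟩
  have hB₁P : B₁ ⊆ P := hB₁ ▸ Finset.filter_subset _ _
  have hB₂P : B₂ ⊆ P := hB₂ ▸ (Finset.filter_subset _ _).trans Finset.sdiff_subset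
  refine ⟨B₁ ∪ B₂, hP ▸ Finset.union_subset hB₁P hB₂P, ?_, ?_⟩
  · have hdisj : Disjoint B₁ B₂ := by
      rw [hB₂]
      exact Finset.disjoint_of_subset_right (Finset.filter_subset _ _) Finset.disjoint_sdiff
    rw [Finset.prod_union hdisj, Nat.cast_mul, Real.exp_add]
    refine mul_le_mul ?_ ?_ (Nat.cast_nonneg _) (Real.exp_pos _).le
    · refine prod_pow_le_exp (fun p hp => hPp p (hB₁P hp)) (Int.natAbs_ne_zero.2 hm) (by positivity)
        fun p hp => ?_
      have h2 : r p < 4 * (v p + 1) := by rw [hB₁] at hp; exact (Finset.mem_filter.1 hp).2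
      have h3 : (r p : ℝ) + 1 ≤ 4 * (v p + 1) := by exact_mod_cast h2
      have h4 := hr2 p
      have h5 := hsυ' p (hB₁P hp)
      have h6 : υ * n p ≤ 16 * v p := by
        have : (1 : ℝ) ≤ v p := by
          by_contra hcon
          push Not at hcon
          have h7 : v p < 1 := by exact_mod_cast hcon
          have h8 : (v p : ℝ) = 0 := by exact_mod_cast Nat.lt_one_iff.1 h7
          linarith
        linarith
      have h7 : (n p : ℝ) ≤ 16 / υ * v p := by
        rw [div_mul_eq_mul_div, le_div_iff₀ hυ]; linarith
      rwa [hn, hv] at h7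
    · refine prod_pow_le_exp (fun p hp => hPp p (hB₂P hp)) (depth_ne_zero hg1) (by positivity)
        fun p hp => ?_
      rw [hB₂, Finset.mem_filter, Finset.mem_sdiff, hB₁, Finset.mem_filter] at hp
      obtain ⟨⟨hpP, hp1⟩, hp2⟩ := hp
      have h2 : 4 * (v p + 1) ≤ r p := by
        by_contra hcon
        exact hp1 ⟨hpP, not_le.1 hcon⟩
      have h3 : 4 * ((v p : ℝ) + 1) ≤ r p := by exact_mod_cast h2
      have h4 := hr1 p
      have h5 : υ * n p ≤ 2 * ρ * n p := by gcongr
      have h6 : (n p : ℝ) * ρ < ⌊(n p : ℝ) * ρ⌋₊ + 1 := Nat.lt_floor_add_one _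
      have h7 : ((⌊(n p : ℝ) * ρ⌋₊ : ℕ) : ℝ) + 1 ≤ v p + e p := by exact_mod_cast hp2
      have h8 : (n p : ℝ) ≤ 2 / ρ * e p := by
        rw [div_mul_eq_mul_div, le_div_iff₀ hρ]
        have : (0 : ℝ) ≤ e p := Nat.cast_nonneg _
        linarith
      rwa [hn, he] at h8
  · intro G hG
    rw [← hP] at hG
    have hGP : G ⊆ P := hG.trans Finset.sdiff_subset
    have hRG : ∏ p ∈ G, p ^ r p ∣ R := by
      rw [hRr]; exact Finset.prod_dvd_prod_of_subset _ _ _ hGP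
    have hgood : ∀ p ∈ G, 4 * (v p + 1) ≤ r p ∧ v p + e p ≤ ⌊(n p : ℝ) * ρ⌋₊ := by
      intro p hp
      have h2 := Finset.mem_sdiff.1 (hG hp)
      rw [Finset.mem_union, not_or] at h2
      obtain ⟨h3, h4, h5⟩ := h2
      refine ⟨?_, ?_⟩
      · by_contra hcon
        exact h4 (hB₁ ▸ Finset.mem_filter.2 ⟨h3, not_le.1 hcon⟩)
      · by_contra hcon
        exact h5 (hB₂ ▸ Finset.mem_filter.2 ⟨Finset.mem_sdiff.2 ⟨h3, h4⟩, not_le.1 hcon⟩)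
    have := hK' T hT h1 a ha b hb G (fun p hp => hPp p (hGP hp)) r n m₀ ρ hρ1 ?_ hm
      (fun p hp => by have := (hgood p hp).1; rwa [hv] at this) ?_ g hg hg1 (hRG.trans hRg)
      (fun p hp => by have := (hgood p hp).2; rwa [hv, he] at this) ?_
    · rwa [hn] at this
    · intro z
      obtain ⟨β, hβ1, hβ2⟩ := hβ z
      exact ⟨β, hβ1, (Int.natCast_dvd_natCast.2 hRG).trans hβ2⟩
    · intro p hp
      have h2 := hsυ' p (hGP hp)
      by_contra hcon
      have h3 : (n p : ℝ) = 0 := by exact_mod_cast Nat.lt_one_iff.1 (not_le.1 hcon)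
      rw [h3] at h2
      linarith
    · intro p hp
      have h2 := hsυ' p (hGP hp)
      have h3 := hr2 p
      have h4 : υ * n p ≤ 4 * r p := by linarith
      have h5 : 8 * (n p : ℝ) ≤ j * υ * n p := by gcongr
      have h6 : (j : ℝ) * (υ * n p) ≤ j * (4 * r p) := by gcongr
      have h7 : (2 : ℝ) * n p ≤ j * r p := by linarith
      exact_mod_cast h7

lemma exponent_le {C₀ κ ε ρ τ η₁ η₂ M x lq n₀ n lm ld : ℝ} (hC₀ : 1 ≤ C₀) (hκ : 0 < κ)
    (hρ : 0 < ρ) (hη₁ : 0 < η₁) (hl : 0 < lq) (hτ : 512 * τ ≤ ε)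
    (h1 : 9472 * C₀ * η₂ ≤ ε * η₁) (h2 : 48 * C₀ * M * η₁ ≤ ε * ρ * κ) (h3 : 32 * C₀ ≤ ε * ρ * lq)
    (hx1 : η₁ * lq ≤ x) (hx2 : x ≤ M * (η₁ * lq)) (hn₀ : 1 ≤ n₀) (hn₀' : n₀ ≤ 2 * (η₂ * lq))
    (hε : 0 < ε) (hn : n ≤ 3 * x / κ + 1) (hlm : lm ≤ 8 * τ * x + 42 + 32 * C₀ * n₀)
    (hld : ld ≤ 2 + 2 * C₀ * n) : 16 / (x / lq) * lm + 2 / ρ * ld ≤ ε * lq := by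
  have hx : 0 < x := (mul_pos hη₁ hl).trans_le hx1
  have h4 : 16 / (x / lq) * lm ≤ ε * lq / 2 := by
    rw [show 16 / (x / lq) * lm = lq * (16 * lm) / x by field_simp, div_le_iff₀ hx]
    have h5 : 512 * τ * x ≤ ε * x := by gcongr
    have h6 : 1 ≤ C₀ * n₀ := one_le_mul_of_one_le_of_one_le hC₀ hn₀
    have h7 : C₀ * n₀ ≤ C₀ * (2 * (η₂ * lq)) := by gcongr
    have h8 : 9472 * C₀ * η₂ * lq ≤ ε * η₁ * lq := by gcongr
    have h9 : ε * (η₁ * lq) ≤ ε * x := by gcongr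
    have h10 : 32 * lm ≤ ε * x := by linarith
    have h11 : lq * (32 * lm) ≤ lq * (ε * x) := by gcongr
    linarith
  have h5 : 2 / ρ * ld ≤ ε * lq / 2 := by
    rw [div_mul_eq_mul_div, div_le_iff₀ hρ]
    have h6 : 2 * C₀ * n ≤ 2 * C₀ * (3 * x / κ + 1) := by gcongr
    have h7 : 48 * C₀ * x / κ ≤ ε * ρ * lq := by
      rw [div_le_iff₀ hκ]
      calc 48 * C₀ * x ≤ 48 * C₀ * (M * (η₁ * lq)) := by gcongr
        _ = 48 * C₀ * M * η₁ * lq := by ring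
        _ ≤ ε * ρ * κ * lq := by gcongr
        _ = _ := by ring
    have h8 : 2 * C₀ * (3 * x / κ + 1) = 48 * C₀ * x / κ / 8 + 2 * C₀ := by ring
    linarith
  linarith

lemma log_moveFactor_le {a : SL2Z} {b : Fin 3 → SL2Z} {C₀ : ℝ} {n₀ : ℕ} (hC₀ : 0 ≤ C₀)
    (ha : ∀ i j, |(a i j : ℝ)| ≤ Real.exp (C₀ * n₀))
    (hb : ∀ k i j, |(b k i j : ℝ)| ≤ 2 * Real.exp (C₀ * n₀) ^ 2) {m₀ : ℕ} {y : ℝ}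
    (hm₀ : (m₀ : ℝ) ≤ 625 * Real.exp y) (hm : moveFactor a b m₀ ≠ 0) :
    Real.log (moveFactor a b m₀).natAbs ≤ 2 * y + 42 + 32 * C₀ * n₀ := by
  have h1 := abs_moveFactor_le (Real.one_le_exp (by positivity)) m₀ ha hb
  have h2 : ((moveFactor a b m₀).natAbs : ℝ) = |(moveFactor a b m₀ : ℝ)| := by
    rw [← Int.cast_abs, Int.abs_eq_natAbs, Int.cast_natCast]
  have h3 : (0 : ℝ) < (moveFactor a b m₀).natAbs := by
    exact_mod_cast Int.natAbs_pos.2 hm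
  rw [Real.log_le_iff_le_exp h3, h2]
  refine h1.trans ?_
  have h4 : (625 : ℝ) ^ 2 * (2048 * 34 ^ 6) ≤ Real.exp 42 := by
    have h8 := Real.exp_one_gt_d9
    rw [show (42 : ℝ) = (42 : ℕ) * 1 by norm_num, Real.exp_nat_mul]
    calc (625 : ℝ) ^ 2 * (2048 * 34 ^ 6) ≤ 2.71 ^ 42 := by norm_num
      _ ≤ _ := by gcongr; linarith
  calc (((m₀ : ℤ) : ℝ)) ^ 2 * (2048 * 34 ^ 6 * Real.exp (C₀ * n₀) ^ 32)
      ≤ (625 * Real.exp y) ^ 2 * (2048 * 34 ^ 6 * Real.exp (C₀ * n₀) ^ 32) := by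
        rw [Int.cast_natCast]; gcongr
    _ = 625 ^ 2 * (2048 * 34 ^ 6) * Real.exp y ^ 2 * Real.exp (C₀ * n₀) ^ 32 := by ring
    _ ≤ Real.exp 42 * Real.exp y ^ 2 * Real.exp (C₀ * n₀) ^ 32 := by gcongr
    _ = _ := by
      rw [← Real.exp_nat_mul, ← Real.exp_nat_mul, ← Real.exp_add, ← Real.exp_add]
      congr 1
      push_cast
      ring

lemma moveFactor_ne_zero {a : SL2Z} {b : Fin 3 → SL2Z} {m₀ : ℤ} (hm₀ : m₀ ≠ 0)
    (ha : (a : Matrix (Fin 2) (Fin 2) ℤ).trace ≠ 0) (hd : sl2Vol (axisOf a b) ≠ 0) :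
    moveFactor a b m₀ ≠ 0 := by
  rw [moveFactor]; positivity

theorem exists_factor_cover {C₀ κ ε ρ : ℝ} (hC₀ : 1 ≤ C₀) (hκ : 0 < κ) (hε : 0 < ε) (hρ : 0 < ρ)
    (hρ1 : ρ ≤ 1) : ∃ (K' : ℕ) (η Λ : ℝ) (Q₀ L₀ : ℕ), 0 < η ∧ 0 < Λ ∧ ∀ q : ℕ, Q₀ ≤ q →
      ∀ s : ℕ, s ∣ q → s ≠ 0 → (∀ p ∈ s.primeFactors, L₀ ≤ s.factorization p) →
      ∀ T : Set SL2Z, T⁻¹ = T → (1 : SL2Z) ∈ T → ∀ N : ℤ, 2 ≤ N →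
      (∀ w ∈ T, ∀ i j, N ∣ w i j - (1 : Matrix (Fin 2) (Fin 2) ℤ) i j) →
      (∀ n : ℕ, η * Real.log q ≤ n → n ≤ Λ * Real.log q → Expands T C₀ κ n) →
      ∃ B ⊆ s.primeFactors, ((∏ p ∈ B, p ^ s.factorization p : ℕ) : ℝ) ≤ (q : ℝ) ^ ε ∧
        ∀ G ⊆ s.primeFactors \ B, kerFloorPow (∏ p ∈ G, p ^ s.factorization p) ρ ⊆
          (redSL (∏ p ∈ G, p ^ s.factorization p) '' T) ^ K' := by
  obtain ⟨τ, hτ0, hτ1, hτ2⟩ : ∃ τ : ℝ, 0 < τ ∧ τ ≤ 1 / 16 ∧ 512 * τ ≤ ε :=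
    ⟨min (1 / 16) (ε / 512), by positivity, min_le_left _ _, by
      linarith [min_le_right (1 / 16) (ε / 512)]⟩
  obtain ⟨k', M, c, t₀, hM, hc, ht₀, hrich⟩ := richAt_near_one (σ := κ / (90 * C₀)) (M := 2) 0
    (by positivity) hτ0 one_le_two
  obtain ⟨η₁, hη₁, hη₁ρ, hη₁ε⟩ : ∃ η₁ : ℝ, 0 < η₁ ∧ M * η₁ ≤ 2 * ρ ∧
      48 * C₀ * M * η₁ ≤ ε * ρ * κ := by
    refine ⟨min (2 * ρ / M) (ε * ρ * κ / (48 * C₀ * M)), by positivity, ?_, ?_⟩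
    · rw [mul_comm, ← le_div_iff₀ (by positivity)]; exact min_le_left _ _
    · rw [mul_comm, ← le_div_iff₀ (by positivity)]; exact min_le_right _ _
  obtain ⟨η₂, hη₂, hη₂c, hη₂ε, hη₂κ⟩ : ∃ η₂ : ℝ, 0 < η₂ ∧ η₂ * (15 * C₀ * c) ≤ η₁ ∧
      9472 * C₀ * η₂ ≤ ε * η₁ ∧ η₂ * κ ≤ 3 * η₁ := by
    refine ⟨min (η₁ / (15 * C₀ * c)) (min (ε * η₁ / (9472 * C₀)) (3 * η₁ / κ)), by positivity,
      ?_, ?_, ?_⟩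
    · rw [← le_div_iff₀ (by positivity)]; exact min_le_left _ _
    · rw [mul_comm, ← le_div_iff₀ (by positivity)]
      exact (min_le_right _ _).trans (min_le_left _ _)
    · rw [← le_div_iff₀ (by positivity)]; exact (min_le_right _ _).trans (min_le_right _ _)
  obtain ⟨j, hj⟩ := exists_nat_ge (8 / η₁)
  rw [div_le_iff₀ hη₁] at hj
  obtain ⟨L₀, hL₀⟩ := exists_nat_ge (20 / η₁)
  rw [div_le_iff₀ hη₁] at hL₀
  obtain ⟨l₀, hl₀⟩ : ∃ l₀ : ℝ, ∀ l, l₀ ≤ l → 1 ≤ l ∧ t₀ ≤ l * η₁ ∧ 15 * C₀ * c ≤ l * η₁ ∧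
      2 ≤ l * (κ * η₂) ∧ 1 ≤ l * η₂ ∧ 28 ≤ l * η₁ ∧ 32 * C₀ ≤ l * (ε * ρ) := by
    refine ⟨max 1 (max (t₀ / η₁) (max (15 * C₀ * c / η₁) (max (2 / (κ * η₂)) (max (1 / η₂)
      (max (28 / η₁) (32 * C₀ / (ε * ρ))))))), fun l hl => ?_⟩
    simp only [max_le_iff] at hl
    obtain ⟨h1, h2, h3, h4, h5, h6, h7⟩ := hl
    refine ⟨h1, ?_, ?_, ?_, ?_, ?_, ?_⟩ <;> rw [← div_le_iff₀ (by positivity)] <;> assumption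
  obtain ⟨Q₀, hQ₀⟩ := exists_nat_ge (Real.exp l₀)
  have hM0 : 0 < M := by linarith
  obtain ⟨K', hK'⟩ := exists_cover_of_residues (k' + 18) j
  refine ⟨K', η₂, 2 * η₂ + η₁ + 3 * (M * η₁) / κ + 1, Q₀, L₀, hη₂, by positivity,
    fun q hq s hsq hs hL T hT h1 N hN hTN hexp => ?_⟩
  have hq0 : (0 : ℝ) < q := (Real.exp_pos _).trans_le (hQ₀.trans (by exact_mod_cast hq))
  obtain ⟨l, hl⟩ : ∃ l, l = Real.log q := ⟨_, rfl⟩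
  have hll : l₀ ≤ l := by
    rw [hl]; exact (Real.le_log_iff_exp_le hq0).2 (hQ₀.trans (by exact_mod_cast hq))
  rw [← hl] at hexp
  obtain ⟨g1, g2, g3, g4, g5, g6, g7⟩ := hl₀ l hll
  have hl0 : 0 < l := by linarith
  have hMη : 0 ≤ 3 * (M * η₁) / κ := by positivity
  obtain ⟨n₀, hn₀⟩ : ∃ n₀, n₀ = ⌈η₂ * l⌉₊ := ⟨_, rfl⟩
  have hn₀1 : η₂ * l ≤ n₀ := hn₀ ▸ Nat.le_ceil _
  have hn₀2 : (n₀ : ℝ) < η₂ * l + 1 := hn₀ ▸ Nat.ceil_lt_add_one (by positivity)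
  have hn₀3 : (1 : ℝ) ≤ n₀ := by linarith
  have hκ₀ : 2 ≤ κ * n₀ := by
    have : κ * (η₂ * l) ≤ κ * n₀ := by gcongr
    linarith
  have hC₀0 : 0 ≤ C₀ := by linarith
  obtain ⟨a, ha, b, hb, hta, hd, haE, hbE⟩ := Expands.exists_basis hT h1 hN hTN hC₀0 hκ₀
    (hexp n₀ hn₀1 (by nlinarith only [hn₀2, g5, g1, hMη, hη₁, hl0]))
  have hR : RichAt (scalarSet T a b) (1 - τ) M k' (η₁ * l) := by
    refine hrich _ (Or.inr (Or.inl rfl)) (Or.inr (Or.inr rfl)) _ (by linarith) fun t' ht1 ht2 => ?_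
    rw [div_le_iff₀ (by linarith)] at ht1
    have hc0 : 0 < c := by linarith
    have ht15 : 15 * C₀ ≤ t' := by
      have : 15 * C₀ * c ≤ t' * c := by linarith
      exact le_of_mul_le_mul_right this hc0
    obtain ⟨n, hn⟩ : ∃ n, n = ⌈t' / (15 * C₀)⌉₊ := ⟨_, rfl⟩
    have hnn1 : t' / (15 * C₀) ≤ n := hn ▸ Nat.le_ceil _
    have hnn2 : (n : ℝ) < t' / (15 * C₀) + 1 := hn ▸ Nat.ceil_lt_add_one
      (div_nonneg (by linarith) (by linarith))
    have hnn3 : η₂ * l ≤ t' / (15 * C₀) := by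
      rw [le_div_iff₀ (by positivity)]
      refine le_of_mul_le_mul_right (a := c) ?_ hc0
      have : η₂ * (15 * C₀ * c) * l ≤ η₁ * l := by gcongr
      linarith
    have hnn4 : n₀ ≤ n := by rw [hn₀, hn]; exact Nat.ceil_mono hnn3
    have hnn5 : (n₀ : ℝ) ≤ n := by exact_mod_cast hnn4
    have hnn6 : t' / (15 * C₀) ≤ η₁ * l := by
      rw [div_le_iff₀ (by positivity)]
      refine ht2.trans (le_mul_of_one_le_right (by positivity) (by linarith))
    have hn1 : (1 : ℝ) ≤ n := by linarith
    refine RichAt.of_expands hN hTN hC₀ hta hd haE hbE hnn4 (by exact_mod_cast hn1)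
      (hκ₀.trans (by gcongr)) (hexp n (by linarith)
        (by nlinarith only [hnn2, hnn6, hη₂, g1, hMη, hl0])) ?_ ?_
    · rw [div_le_iff₀ (by positivity)] at hnn1
      linarith
    · have : 15 * C₀ * n ≤ 15 * C₀ * (t' / (15 * C₀) + 1) := by gcongr
      have h5 : 15 * C₀ * (t' / (15 * C₀) + 1) = t' + 15 * C₀ := by field_simp
      linarith
  obtain ⟨x, hx1, hx2, W, hW, hWx, hWc⟩ := hR
  have hx0 : 0 < x := lt_of_lt_of_le (by positivity) hx1
  obtain ⟨m₀, hm1, hm, hres⟩ := exists_residues (Or.inr (Or.inl rfl)) hτ1 (by linarith) hW hWx hWc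
  obtain ⟨R, hRdef⟩ : ∃ R, R = ∏ p ∈ s.primeFactors, p ^ ⌊x / l * s.factorization p / 2⌋₊ :=
    ⟨_, rfl⟩
  have hR1 : 1 ≤ R := by
    rw [hRdef]
    exact Finset.prod_pos fun p hp => pow_pos (Nat.prime_of_mem_primeFactors hp).pos _
  have hRx : (R : ℝ) ≤ Real.exp (x / 2) := by
    rw [hRdef]
    refine (prod_pow_le_exp (fun p hp => Nat.prime_of_mem_primeFactors hp) hs (α := x / l / 2)
      (by positivity) fun p _ => ?_).trans (Real.exp_le_exp.2 ?_)
    · refine (Nat.floor_le (by positivity)).trans (le_of_eq ?_)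
      ring
    · have h5 : Real.log s ≤ l := by
        rw [hl]
        refine Real.log_le_log (by exact_mod_cast Nat.pos_of_ne_zero hs) ?_
        exact_mod_cast Nat.le_of_dvd (by exact_mod_cast hq0) hsq
      calc x / l / 2 * Real.log s ≤ x / l / 2 * l := by gcongr
        _ = x / 2 := by field_simp
  obtain ⟨n, hn⟩ : ∃ n, n = ⌈3 * x / κ⌉₊ := ⟨_, rfl⟩
  have hnn1 : 3 * x / κ ≤ n := hn ▸ Nat.le_ceil _
  have hnn2 : (n : ℝ) < 3 * x / κ + 1 := hn ▸ Nat.ceil_lt_add_one (by positivity)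
  have hnl : η₂ * l ≤ 3 * x / κ := by
    rw [le_div_iff₀ hκ]
    have : η₂ * κ * l ≤ 3 * η₁ * l := by gcongr
    linarith
  have hnu : 3 * x / κ ≤ 3 * (M * η₁) / κ * l := by
    rw [div_mul_eq_mul_div]
    refine div_le_div_of_nonneg_right ?_ hκ.le
    linarith
  obtain ⟨g, hg, hg1, hRg, hgd⟩ := Expands.exists_deep hT hC₀0 (hexp n (by linarith)
    (by nlinarith only [hnn2, hnu, hη₂, hη₁, g1, hl0])) hR1 (by
      rw [div_le_iff₀ hκ] at hnn1
      calc (R : ℝ) ^ 4 ≤ Real.exp (x / 2) ^ 4 := by gcongr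
        _ = Real.exp ((4 : ℕ) * (x / 2)) := (Real.exp_nat_mul _ _).symm
        _ < _ := Real.exp_lt_exp.2 (by push_cast; linarith))
  have hmf := moveFactor_ne_zero (m₀ := m₀) (by exact_mod_cast (by omega : m₀ ≠ 0)) hta hd
  obtain ⟨B, hBs, hBq, hB⟩ := hK' T hT h1 a ha b hb s hs (x / l) ρ (by positivity) hρ hρ1
    (by rw [div_le_iff₀ hl0]; nlinarith only [hx2, hη₁ρ, hl0])
    (by
      have : η₁ ≤ x / l := by rw [le_div_iff₀ hl0]; exact hx1
      calc (8 : ℝ) ≤ j * η₁ := hj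
        _ ≤ _ := by gcongr)
    (fun p hp => by
      have h5 : η₁ ≤ x / l := by rw [le_div_iff₀ hl0]; exact hx1
      have h6 : (L₀ : ℝ) ≤ s.factorization p := by exact_mod_cast hL p hp
      calc (20 : ℝ) ≤ η₁ * L₀ := by linarith
        _ ≤ _ := by gcongr)
    m₀ hmf R hRdef (hres R hR1 hRx) g hg hg1 hRg
  refine ⟨B, hBs, hBq.trans ?_, hB⟩
  rw [Real.rpow_def_of_pos hq0, ← hl, mul_comm l ε]
  refine Real.exp_le_exp.2 ?_
  refine exponent_le (n := n) hC₀ hκ hρ hη₁ hl0 hτ2 hη₂ε hη₁ε (by linarith) hx1 hx2 hn₀3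
    (by linarith) hε hnn2.le
    ((log_moveFactor_le hC₀0 haE hbE hm hmf).trans (by linarith)) ?_
  have hdep : (0 : ℝ) < depth g := by exact_mod_cast Nat.pos_of_ne_zero (depth_ne_zero hg1)
  rw [Real.log_le_iff_le_exp hdep]
  refine hgd.trans ?_
  have h5 : (3 : ℝ) ≤ Real.exp 2 := by linarith [Real.add_one_le_exp 2]
  calc 3 * Real.exp (C₀ * n) ^ 2 ≤ Real.exp 2 * Real.exp (C₀ * n) ^ 2 := by gcongr
    _ = _ := by rw [← Real.exp_nat_mul, ← Real.exp_add]; push_cast; congr 1; ring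

lemma div_smallPart {q : ℕ} (hq : q ≠ 0) (L : ℕ) : q / smallPart q L =
    ∏ p ∈ q.primeFactors with L < q.factorization p, p ^ q.factorization p := by
  have h1 : smallPart q L =
      ∏ p ∈ q.primeFactors with ¬ L < q.factorization p, p ^ q.factorization p := by
    rw [smallPart, Finset.prod_filter]
    simp only [not_lt]
  have h2 : 0 < smallPart q L := by
    rw [h1]
    exact Finset.prod_pos fun p hp =>
      pow_pos (Nat.prime_of_mem_primeFactors (Finset.mem_filter.1 hp).1).pos _
  refine Nat.div_eq_of_eq_mul_left h2 ?_
  rw [h1, Finset.prod_filter_mul_prod_filter_not]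
  exact (Nat.prod_factorization_pow_eq_self hq).symm

lemma exactDivisor_prod_pow {s : ℕ} (hs : s ≠ 0) {G : Finset ℕ} (hG : G ⊆ s.primeFactors) :
    ExactDivisor (∏ p ∈ G, p ^ s.factorization p) s := by
  have hGp : ∀ p ∈ G, p.Prime := fun p hp => Nat.prime_of_mem_primeFactors (hG hp)
  have h0 : ∏ p ∈ G, p ^ s.factorization p ≠ 0 :=
    Finset.prod_ne_zero_iff.2 fun p hp => pow_ne_zero _ (hGp p hp).ne_zero
  have he : ∀ p ∈ G, 1 ≤ s.factorization p := fun p hp =>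
    (hGp p hp).factorization_pos_of_dvd hs (Nat.dvd_of_mem_primeFactors (hG hp))
  intro p n hp hn h1 h2
  have hpG : p ∈ G := by
    rw [← primeFactors_prod_pow hGp he, Nat.mem_primeFactors_of_ne_zero h0]
    exact ⟨hp, (dvd_pow_self p (by omega)).trans h1⟩
  rw [hp.pow_dvd_iff_le_factorization h0, factorization_prod_pow hGp _ hpG] at h1 h2
  rw [hp.pow_dvd_iff_le_factorization hs, hp.pow_dvd_iff_le_factorization hs]
  exact ⟨h1, h2⟩

lemma exactDivisor_self (s : ℕ) : ExactDivisor s s := fun _ _ _ _ h1 h2 => ⟨h1, h2⟩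

lemma kerFloorPow_one (q : ℕ) (hq : q ≠ 0) : kerFloorPow q 1 = {1} := by
  have h1 : floorPow q 1 = q := by
    rw [floorPow]
    simp only [mul_one, Nat.floor_natCast]
    exact Nat.prod_factorization_pow_eq_self hq
  ext g
  simp only [kerFloorPow, h1, ZMod.natCast_self, zero_dvd_iff, Set.mem_ofPred_eq,
    Set.mem_singleton_iff, sub_eq_zero]
  exact ⟨fun h => Subtype.ext (Matrix.ext h), fun h i j => by rw [h]; rfl⟩

lemma dvd_entry_sub_of_mem_ker {q : ℕ} {g : GammaSL} (hg : g ∈ (piq q).ker) (i : Fin 3)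
    (a b : Fin 2) : (q : ℤ) ∣ factorHom i g a b - (1 : Matrix (Fin 2) (Fin 2) ℤ) a b := by
  rw [MonoidHom.mem_ker] at hg
  have h1 : redSL q (factorHom i g) = 1 := by
    fin_cases i
    · exact congrArg Prod.fst hg
    · exact congrArg (fun x => x.2.1) hg
    · exact congrArg (fun x => x.2.2) hg
  rw [← ZMod.intCast_zmod_eq_zero_iff_dvd, Int.cast_sub, sub_eq_zero, ← redSL_apply, h1]
  by_cases h : a = b
  · subst h; simp
  · simp [h]

lemma radical_pow_dvd {s m : ℕ} (hs : s ≠ 0) (h : ∀ p ∈ s.primeFactors, m ≤ s.factorization p) :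
    radical s ^ m ∣ s := by
  rw [radical, ← Finset.prod_pow]
  exact prod_pow_dvd_of_forall (fun p hp => Nat.prime_of_mem_primeFactors hp) fun p hp =>
    ((Nat.prime_of_mem_primeFactors hp).pow_dvd_iff_le_factorization hs).2 (h p hp)

lemma two_le_radical {s : ℕ} (hs : 2 ≤ s) : 2 ≤ radical s := by
  obtain ⟨p, hp⟩ := Nat.nonempty_primeFactors.2 hs
  exact (Nat.prime_of_mem_primeFactors hp).two_le.trans (Nat.le_of_dvd
    (Finset.prod_pos fun p hp => (Nat.prime_of_mem_primeFactors hp).pos)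
    (Finset.dvd_prod_of_mem _ hp))

lemma one_mem_mul_self_inter_ker {A : Set GammaSL} (hA : A⁻¹ = A) {q δ : ℝ} (hq : 0 < q)
    {f : GammaSL → ℝ} (h : q ^ (-δ) < ∑ᶠ x ∈ A, f x) (r : ℕ) :
    (1 : GammaSL) ∈ (A * A) ∩ ((piq r).ker : Set GammaSL) := by
  obtain ⟨a, ha⟩ : A.Nonempty := by
    rw [Set.nonempty_iff_ne_empty]
    rintro rfl
    simp only [Set.mem_empty_iff_false, finsum_false, finsum_zero] at h
    exact (Real.rpow_pos_of_pos hq _).not_gt h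
  refine ⟨⟨a, ha, a⁻¹, ?_, mul_inv_cancel a⟩, one_mem _⟩
  rw [← hA]; simpa using ha

theorem exists_exactDivisor_cover {S : Set GammaSL} (hfin : S.Finite) (hsym : S⁻¹ = S)
    (hdense : ZariskiDense (Subgroup.closure S)) {ε ρ : ℝ} (hε : 0 < ε) (hρ : 0 < ρ)
    (hρ1 : ρ ≤ 1) : ∃ (δ₀ : ℝ) (K Q₀ : ℕ), 0 < δ₀ ∧ 1 ≤ K ∧ ∀ δ : ℝ, 0 < δ → δ ≤ δ₀ →
      ∀ q : ℕ, Q₀ ≤ q → ∀ L : ℕ, 18 / δ < (L : ℝ) →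
        (q : ℝ) ^ (ε / 2) < ((q / smallPart q L : ℕ) : ℝ) →
        ∀ A : Set GammaSL, A⁻¹ = A → ∀ l : ℕ, δ⁻¹ * Real.log q < (l : ℝ) →
        (q : ℝ) ^ (-δ) < ∑ᶠ x ∈ A, chiIter S l x →
        ∃ q' : ℕ, ExactDivisor q' (q / smallPart q L) ∧
          ((q / smallPart q L : ℕ) : ℝ) ^ (1 / 2 : ℝ) ≤ (q' : ℝ) ∧
          ∀ i, kerFloorPow q' ρ ⊆ (redSL q' '' (factorHom i ''
            ((A * A) ∩ ((piq (radical (q / smallPart q L))).ker : Set GammaSL)))) ^ K := by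
  obtain ⟨C₀, κ, hC₀, hκ, hexp⟩ := exists_expanding_sets hfin hsym hdense
  obtain ⟨K, η, Λ, Q₁, L₀, hη, hΛ, hcov⟩ :=
    exists_factor_cover (ε := ε / 12) hC₀ hκ (by positivity) hρ hρ1
  obtain ⟨δ₁, hδ₁, Q₂, hexp⟩ := hexp η Λ hη hΛ
  refine ⟨min δ₁ (18 / (L₀ + 1)), K + 1, max 1 (max Q₁ Q₂), by positivity, by omega,
    fun δ hδ hδ₀ q hq L hL hlarge A hA l hl hχ => ?_⟩
  obtain ⟨hq1, hq2, hq3⟩ : 1 ≤ q ∧ Q₁ ≤ q ∧ Q₂ ≤ q := by simpa using hq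
  have hq0 : (1 : ℝ) ≤ q := by exact_mod_cast hq1
  have hLL : L₀ ≤ L := by
    have h1 : δ * (L₀ + 1) ≤ 18 := by
      rw [← le_div_iff₀ (by positivity)]; exact hδ₀.trans (min_le_right _ _)
    rw [div_lt_iff₀ hδ] at hL
    have h2 : (L₀ : ℝ) < L := by
      refine lt_of_mul_lt_mul_left ?_ hδ.le
      linarith
    exact_mod_cast h2.le
  obtain ⟨P, hP⟩ : ∃ P, P = q.primeFactors.filter fun p => L < q.factorization p := ⟨_, rfl⟩
  have hP' : ∀ p ∈ P, p ∈ q.primeFactors ∧ L < q.factorization p := fun p hp => by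
    rw [hP] at hp; exact Finset.mem_filter.1 hp
  have hPp : ∀ p ∈ P, p.Prime := fun p hp =>
    Nat.prime_of_mem_primeFactors (hP' p hp).1
  have hPL : ∀ p ∈ P, L < q.factorization p := fun p hp => (hP' p hp).2
  obtain ⟨s, hs⟩ : ∃ s, s = q / smallPart q L := ⟨_, rfl⟩
  rw [← hs] at hlarge ⊢
  rw [div_smallPart (by omega), ← hP] at hs
  have hsP : s.primeFactors = P := by
    rw [hs]; exact primeFactors_prod_pow hPp fun p hp => by have := hPL p hp; omega
  have hsf : ∀ p ∈ P, s.factorization p = q.factorization p := fun p hp => by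
    rw [hs]; exact factorization_prod_pow hPp _ hp
  have hsL : ∀ p ∈ s.primeFactors, L + 1 ≤ s.factorization p := by
    rw [hsP]; intro p hp; rw [hsf p hp]; exact hPL p hp
  have hs1 : (1 : ℝ) < s := (Real.one_le_rpow hq0 (by positivity)).trans_lt hlarge
  have hs2 : 2 ≤ s := by exact_mod_cast hs1
  have hs0 : s ≠ 0 := by omega
  have hsq : s ∣ q := by
    rw [hs]
    exact prod_pow_dvd_of_forall hPp fun p _ => Nat.ordProj_dvd q p
  obtain ⟨r, hr⟩ : ∃ r, r = radical s := ⟨_, rfl⟩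
  have hr2 : 2 ≤ r := hr ▸ two_le_radical hs2
  have hr18 : (r : ℝ) ^ 18 ≤ (q : ℝ) ^ δ := by
    have hr1 : (1 : ℝ) ≤ r := by exact_mod_cast (by omega : 1 ≤ r)
    have h1 : (r : ℝ) ^ (L + 1) ≤ q := by
      exact_mod_cast Nat.le_of_dvd (by omega) ((hr ▸ radical_pow_dvd hs0 hsL).trans hsq)
    rw [div_lt_iff₀ hδ] at hL
    calc (r : ℝ) ^ 18 = (r : ℝ) ^ (18 : ℝ) := by norm_cast
      _ ≤ (r : ℝ) ^ (((L + 1 : ℕ) : ℝ) * δ) :=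
        Real.rpow_le_rpow_of_exponent_le hr1 (by push_cast; linarith)
      _ = ((r : ℝ) ^ (L + 1)) ^ δ := by
        rw [Real.rpow_mul (by positivity), Real.rpow_natCast]
      _ ≤ _ := by gcongr
  rw [← hr]
  obtain ⟨T₀, hT₀⟩ : ∃ T₀, T₀ = (A * A) ∩ ((piq r).ker : Set GammaSL) := ⟨_, rfl⟩
  have h1 : (1 : GammaSL) ∈ T₀ := hT₀ ▸ one_mem_mul_self_inter_ker hA (by linarith) hχ r
  have hTinv : T₀⁻¹ = T₀ := by
    rw [hT₀, Set.inter_inv, _root_.mul_inv_rev, hA, inv_coe_set]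
  rw [← hT₀]
  have key : ∀ i, ∃ B ⊆ s.primeFactors,
      ((∏ p ∈ B, p ^ s.factorization p : ℕ) : ℝ) ≤ (q : ℝ) ^ (ε / 12) ∧
      ∀ G ⊆ s.primeFactors \ B, kerFloorPow (∏ p ∈ G, p ^ s.factorization p) ρ ⊆
        (redSL (∏ p ∈ G, p ^ s.factorization p) '' (factorHom i '' T₀)) ^ K := by
    intro i
    refine hcov q hq2 s hsq hs0 (fun p hp => by have := hsL p hp; omega) _ ?_ ⟨1, h1, map_one _⟩
      r (by exact_mod_cast hr2) ?_ fun n hn1 hn2 => ?_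
    · rw [← Set.image_inv, hTinv]
    · rintro _ ⟨g, hg, rfl⟩ a b
      exact dvd_entry_sub_of_mem_ker (hT₀ ▸ hg).2 i a b
    · rw [hT₀]
      exact hexp δ hδ (hδ₀.trans (min_le_left _ _)) q hq3 r (by omega) hr18 A hA l hl hχ i n hn1 hn2
  choose B hBs hBq hB using key
  obtain ⟨U, hU⟩ : ∃ U, U = Finset.univ.biUnion B := ⟨_, rfl⟩
  have hUs : U ⊆ s.primeFactors := by
    rw [hU]; exact Finset.biUnion_subset.2 fun i _ => hBs i
  refine ⟨∏ p ∈ s.primeFactors \ U, p ^ s.factorization p,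
    exactDivisor_prod_pow hs0 Finset.sdiff_subset, ?_, fun i => ?_⟩
  · have hUq : ((∏ p ∈ U, p ^ s.factorization p : ℕ) : ℝ) ≤ (q : ℝ) ^ (ε / 4) := by
      have h2 : ∏ p ∈ U, p ^ s.factorization p ≤ ∏ i, ∏ p ∈ B i, p ^ s.factorization p := by
        have hp : ∀ i, 0 < ∏ p ∈ B i, p ^ s.factorization p := fun i =>
          Finset.prod_pos fun p hp => pow_pos (Nat.prime_of_mem_primeFactors (hBs i hp)).pos _
        refine Nat.le_of_dvd (Finset.prod_pos fun i _ => hp i) ?_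
        refine prod_pow_dvd_of_forall (fun p hp => Nat.prime_of_mem_primeFactors (hUs hp))
          fun p hp => ?_
        rw [hU, Finset.mem_biUnion] at hp
        obtain ⟨i, hi, hpi⟩ := hp
        exact (Finset.dvd_prod_of_mem _ hpi).trans
          (Finset.dvd_prod_of_mem (fun i => ∏ p ∈ B i, p ^ s.factorization p) hi)
      calc ((∏ p ∈ U, p ^ s.factorization p : ℕ) : ℝ)
          ≤ ((∏ i, ∏ p ∈ B i, p ^ s.factorization p : ℕ) : ℝ) := by exact_mod_cast h2
        _ = ∏ i, ((∏ p ∈ B i, p ^ s.factorization p : ℕ) : ℝ) := Nat.cast_prod _ _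
        _ ≤ ∏ _i : Fin 3, (q : ℝ) ^ (ε / 12) :=
          Finset.prod_le_prod (fun i _ => Nat.cast_nonneg _) fun i _ => hBq i
        _ = _ := by
          rw [Finset.prod_const, Finset.card_univ, Fintype.card_fin, ← Real.rpow_mul_natCast
            (by positivity)]
          congr 1; push_cast; ring
    have hprod : ((∏ p ∈ s.primeFactors \ U, p ^ s.factorization p : ℕ) : ℝ) *
        ((∏ p ∈ U, p ^ s.factorization p : ℕ) : ℝ) = s := by
      rw [← Nat.cast_mul, Finset.prod_sdiff hUs]
      exact congrArg _ (Nat.prod_factorization_pow_eq_self hs0)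
    have hsh : (q : ℝ) ^ (ε / 4) ≤ (s : ℝ) ^ (1 / 2 : ℝ) := by
      calc (q : ℝ) ^ (ε / 4) = ((q : ℝ) ^ (ε / 2)) ^ (1 / 2 : ℝ) := by
            rw [← Real.rpow_mul (by positivity)]; congr 1; ring
        _ ≤ _ := by gcongr
    refine le_of_mul_le_mul_right (a := (s : ℝ) ^ (1 / 2 : ℝ)) ?_ (by positivity)
    rw [← Real.rpow_add (by positivity), add_halves, Real.rpow_one]
    calc (s : ℝ) = _ := hprod.symm
      _ ≤ _ := by gcongr; exact hUq.trans hsh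
  · refine (hB i _ (Finset.sdiff_subset_sdiff subset_rfl ?_)).trans
      (Set.pow_subset_pow_right ⟨1, ⟨1, h1, map_one _⟩, map_one _⟩ K.le_succ)
    rw [hU]
    exact Finset.subset_biUnion_of_mem B (Finset.mem_univ i)

/-- If `A` satisfies the hypotheses of Proposition 2.2 but fails its
conclusion, then a bounded product set of a projection of `A₀ = A·A ∩ Γ(q₀)` contains a large
congruence kernel mod a large exact divisor of `q_l`. -/
theorem statement13 (S : Set GammaSL) (hfin : S.Finite) (hsym : S⁻¹ = S)
    (hdense : ZariskiDense (Subgroup.closure S)) (ε : ℝ) (hε : 0 < ε) :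
    ∃ c : ℝ, 0 < c ∧ ∃ (ρ : ℝ → ℝ) (C : ℝ → ℕ),
      (∀ δ : ℝ, 0 < δ → 0 < ρ δ ∧ 0 < C δ) ∧
      Filter.Tendsto ρ (nhdsWithin 0 (Set.Ioi 0)) (nhds 0) ∧
      ∀ δ : ℝ, 0 < δ → ∃ Q₀ : ℕ, ∀ q : ℕ, Q₀ ≤ q →
        ∀ L : ℕ, (18 / δ < (L : ℝ)) →
        (q : ℝ) ^ (ε / 2) < ((q / smallPart q L : ℕ) : ℝ) →
        ∀ A : Set GammaSL, A⁻¹ = A →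
        ∀ l : ℕ, δ⁻¹ * Real.log q < (l : ℝ) →
        ((q : ℝ) ^ (-δ) < ∑ᶠ x ∈ A, chiIter S l x) →
        ((⇑(piq q) '' A).ncard : ℝ) < (Nat.card (GammaMod q) : ℝ) ^ ((1 : ℝ) - ε) →
        ((⇑(piq q) '' (A * A * A)).ncard : ℝ) ≤ ((⇑(piq q) '' A).ncard : ℝ) ^ ((1 : ℝ) + δ) →
        ∃ q' : ℕ, ExactDivisor q' (q / smallPart q L) ∧
          ((q / smallPart q L : ℕ) : ℝ) ^ c ≤ (q' : ℝ) ∧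
          (kerFloorPow q' (ρ δ) ⊆
            (⇑(redSL q') '' ((fun g : GammaSL => g.1) ''
              ((A * A) ∩ ((piq (radical (q / smallPart q L))).ker : Set GammaSL)))) ^ (C δ)) ∧
          (kerFloorPow q' (ρ δ) ⊆
            (⇑(redSL q') '' ((fun g : GammaSL => g.2.1) ''
              ((A * A) ∩ ((piq (radical (q / smallPart q L))).ker : Set GammaSL)))) ^ (C δ)) ∧
          (kerFloorPow q' (ρ δ) ⊆
            (⇑(redSL q') '' ((fun g : GammaSL => g.2.2) ''
              ((A * A) ∩ ((piq (radical (q / smallPart q L))).ker : Set GammaSL)))) ^ (C δ)) := by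
  have hk : ∀ k : ℕ, 0 < 1 / ((k : ℝ) + 1) ∧ 1 / ((k : ℝ) + 1) ≤ 1 := fun k =>
    ⟨by positivity, (div_le_one (by positivity)).2 (by linarith [k.cast_nonneg (α := ℝ)])⟩
  choose d K Q hd hK hcov using fun k =>
    exists_exactDivisor_cover hfin hsym hdense hε (hk k).1 (hk k).2
  classical
  obtain ⟨m, hm⟩ : ∃ m : ℝ → ℕ, m = fun δ => Nat.findGreatest (fun k => δ ≤ d k) ⌊1 / δ⌋₊ :=
    ⟨_, rfl⟩
  refine ⟨1 / 2, by positivity, fun δ => 1 / ((m δ : ℝ) + 1), fun δ => K (m δ),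
    fun δ _ => ⟨(hk _).1, hK _⟩, ?_, fun δ hδ => ⟨max 1 (Q (m δ)), fun q hq L hL hlarge A hA l hl
      hχ _ _ => ?_⟩⟩
  · refine tendsto_one_div_add_atTop_nhds_zero_nat.comp (Filter.tendsto_atTop.2 fun k => ?_)
    have hk' : 0 < min (d k) (1 / ((k : ℝ) + 1)) := lt_min (hd k) (hk k).1
    filter_upwards [Ioo_mem_nhdsGT hk'] with δ hδ
    rw [hm]
    refine Nat.le_findGreatest (Nat.le_floor ?_) (hδ.2.le.trans (min_le_left _ _))
    have h1 : δ ≤ 1 / ((k : ℝ) + 1) := hδ.2.le.trans (min_le_right _ _)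
    rw [le_div_iff₀ (by positivity)] at h1
    rw [le_div_iff₀ hδ.1]
    linarith [hδ.1]
  · have hq1 : 1 ≤ q := (le_max_left _ _).trans hq
    have hq0 : (0 : ℝ) < q := by exact_mod_cast hq1
    by_cases hδd : δ ≤ d (m δ)
    · obtain ⟨q', h1, h2, h3⟩ := hcov (m δ) δ hδ hδd q ((le_max_right _ _).trans hq) L hL hlarge
        A hA l hl hχ
      exact ⟨q', h1, h2, h3 0, h3 1, h3 2⟩
    · have hm0 : m δ = 0 := by
        by_contra h
        rw [hm] at h hδd
        exact hδd (Nat.findGreatest_of_ne_zero rfl h)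
      obtain ⟨s, hs⟩ : ∃ s, s = q / smallPart q L := ⟨_, rfl⟩
      rw [← hs] at hlarge ⊢
      have hs0 : s ≠ 0 := by
        rintro rfl
        exact (Real.rpow_pos_of_pos hq0 _).not_gt (by simpa using hlarge)
      have hs1 : (1 : ℝ) ≤ s := by exact_mod_cast Nat.one_le_iff_ne_zero.2 hs0
      have h1 := one_mem_mul_self_inter_ker hA hq0 hχ (radical s)
      simp only [hm0, Nat.cast_zero, zero_add, div_one]
      refine ⟨s, exactDivisor_self s, ?_, ?_⟩
      · exact (Real.rpow_le_rpow_of_exponent_le hs1 (by norm_num)).trans_eq (Real.rpow_one _)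
      · simp only [kerFloorPow_one s hs0, Set.singleton_subset_iff]
        exact ⟨Set.one_mem_pow ⟨1, ⟨1, h1, rfl⟩, map_one _⟩,
          Set.one_mem_pow ⟨1, ⟨1, h1, rfl⟩, map_one _⟩,
          Set.one_mem_pow ⟨1, ⟨1, h1, rfl⟩, map_one _⟩⟩
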